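/- Let n ≥ 2, σ ∈ (0,1), α > −2σ and (n+α)/(n−2σ) < p < (n+2σ)/(n−2σ). Let u ∈ C²({|x|>1}) ∩ L_σ(ℝⁿ) be a nonnegative solution of (−Δ)^σ u = |x|^α u^p in {x ∈ ℝⁿ : |x| > 1}. Then either the singularity at ∞ is removable, i.e., there exist C > 0 and R > 1 such that u(x) ≤ C |x|^{−(n−2σ)} for all |x| > R, or there exist positive constants C₁, C₂ and R > 1 such that C₁ |x|^{−(2σ+α)/(p−1)} ≤ u(x) ≤ C₂ |x|^{−(2σ+α)/(p−1)} for all |x| > R. -/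

import Mathlib

open MeasureTheory Filter Metric Set
open scoped Topology

noncomputable section

/-- The normalization constant `c_{n,σ}` of the fractional Laplacian. -/
def cns (n : ℕ) (σ : ℝ) : ℝ :=
  2 ^ (2 * σ) * σ * Real.Gamma (((n : ℝ) + 2 * σ) / 2) /
    (Real.pi ^ ((n : ℝ) / 2) * Real.Gamma (1 - σ))

/-- Membership in `L_σ(ℝⁿ)`: locally integrable with finite weighted integral. -/
def MemLsigma (n : ℕ) (σ : ℝ) (u : EuclideanSpace ℝ (Fin n) → ℝ) : Prop :=
  LocallyIntegrable u volume ∧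
    Integrable (fun x => |u x| / (1 + ‖x‖) ^ ((n : ℝ) + 2 * σ)) volume

/-- `(−Δ)^σ u = f` pointwise on `Ω`, in the principal value sense. -/
def FracLapEq (n : ℕ) (σ : ℝ) (u : EuclideanSpace ℝ (Fin n) → ℝ)
    (Ω : Set (EuclideanSpace ℝ (Fin n))) (f : EuclideanSpace ℝ (Fin n) → ℝ) : Prop :=
  ∀ x ∈ Ω, Tendsto (fun ε : ℝ =>
      cns n σ * ∫ ξ in {ξ : EuclideanSpace ℝ (Fin n) | ε < dist x ξ},
        (u x - u ξ) / dist x ξ ^ ((n : ℝ) + 2 * σ))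
    (𝓝[>] (0 : ℝ)) (𝓝 (f x))

/-- The function `Λ(τ)`. -/
def Lam (n : ℕ) (σ τ : ℝ) : ℝ :=
  2 ^ (2 * σ) *
    (Real.Gamma (((n : ℝ) + 2 * σ + 2 * τ) / 4) * Real.Gamma (((n : ℝ) + 2 * σ - 2 * τ) / 4)) /
    (Real.Gamma (((n : ℝ) - 2 * σ - 2 * τ) / 4) * Real.Gamma (((n : ℝ) - 2 * σ + 2 * τ) / 4))

/-- The constant `C_{p,σ,α} = Λ((n−2σ)/2 − (2σ+α)/(p−1))^{1/(p−1)}`. -/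
def Cpsa (n : ℕ) (σ p α : ℝ) : ℝ :=
  Lam n σ (((n : ℝ) - 2 * σ) / 2 - (2 * σ + α) / (p - 1)) ^ (1 / (p - 1))


section
open Real
open scoped Pointwise

open Real

/-- Euclidean `n`-space. -/
abbrev E (n : ℕ) := EuclideanSpace ℝ (Fin n)

/-- Standing assumptions on the parameters: `d = n - 2σ`, `N = n + 2σ`. -/
structure Par (n : ℕ) (σ d N : ℝ) : Prop where
  hn : 2 ≤ n
  hσ0 : 0 < σ
  hσ1 : σ < 1
  hd : d = n - 2 * σ
  hN : N = n + 2 * σ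

notation "pos!" => by positivity
notation "lin!" => by linarith
notation "num!" => by norm_num

lemma named {α : Sort*} (v : α) : ∃ w, w = v := ⟨v, rfl⟩

lemma mul_le_l {a b c : ℝ} (h : b ≤ c) (ha : 0 ≤ a := by positivity) : a * b ≤ a * c :=
  mul_le_mul_of_nonneg_left h ha

lemma mul_le_r {a b c : ℝ} (h : b ≤ c) (ha : 0 ≤ a := by positivity) : b * a ≤ c * a :=
  mul_le_mul_of_nonneg_right h ha

lemma rpow_anti {x y z : ℝ} (hx : 0 < x) (hxy : x ≤ y) (hz : z ≤ 0 := by linarith) :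
    y ^ z ≤ x ^ z := rpow_le_rpow_of_nonpos hx hxy hz

namespace Par
variable {n : ℕ} {σ d N : ℝ}
lemma n2 (P : Par n σ d N) : (2 : ℝ) ≤ n := by exact_mod_cast P.hn
lemma n0 (P : Par n σ d N) : (0 : ℝ) < n := by linarith [P.n2]
lemma d0 (P : Par n σ d N) : 0 < d := by linarith [P.n2, P.hσ1, P.hd]
lemma dn (P : Par n σ d N) : d < n := by linarith [P.hσ0, P.hd]
lemma nN (P : Par n σ d N) : (n : ℝ) < N := by linarith [P.hσ0, P.hN]
lemma N0 (P : Par n σ d N) : 0 < N := by linarith [P.n0, P.nN]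
lemma N2 (P : Par n σ d N) : N - 2 < n := by linarith [P.hσ1, P.hN]
lemma nd (P : Par n σ d N) : (n : ℝ) - d = 2 * σ := by linarith [P.hd]
lemma n1 (P : Par n σ d N) : 1 ≤ n := by linarith [P.hn]
lemma nontriv (P : Par n σ d N) : Nontrivial (E n) := by
  apply Module.nontrivial_of_finrank_pos (R := ℝ)
  rw [finrank_euclideanSpace_fin]; exact P.n1
end Par

section kernel
variable {n : ℕ}

lemma ker_measurable (a : ℝ) : Measurable (fun x : E n => ‖x‖ ^ a) := by fun_prop

lemma ker_integrable_ball (hn : 1 ≤ n) {a : ℝ} (ha : a < n) (r : ℝ) :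
    IntegrableOn (fun x : E n => ‖x‖ ^ (-a)) (ball 0 r) := by
  apply integrableOn_ball_of_norm_le_rpow (C := 1) (α := a)
  · rwa [finrank_euclideanSpace_fin]
  · refine .of_forall fun x => ?_
    rw [norm_of_nonneg pos!, one_mul]
  · exact (ker_measurable _).aestronglyMeasurable
  · rwa [finrank_euclideanSpace_fin]

lemma ker_integrable_compl {a : ℝ} (ha : n < a) {r : ℝ} (hr : 0 < r) :
    IntegrableOn (fun x : E n => ‖x‖ ^ (-a)) (ball 0 r)ᶜ := by
  have h1 : Integrable (fun x : E n => (1 + ‖x‖) ^ (-a)) := by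
    apply integrable_one_add_norm
    rwa [finrank_euclideanSpace_fin]
  refine Integrable.mono' ((h1.const_mul ((r / (1 + r)) ^ (-a))).integrableOn)
    (ker_measurable _).aestronglyMeasurable ?_
  refine (ae_restrict_iff' measurableSet_ball.compl).2 (.of_forall fun x hx => ?_)
  simp only [mem_compl_iff, mem_ball_zero_iff, not_lt] at hx
  rw [norm_of_nonneg pos!, ← mul_rpow pos! pos!]
  refine rpow_anti pos! ?_
  rw [div_mul_eq_mul_div, div_le_iff₀ pos!]; nlinarith

lemma smul_set_ball {r : ℝ} (hr : 0 < r) : (r • ball (0 : E n) 1) = ball 0 r := by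
  rw [_root_.smul_ball hr.ne']; simp [abs_of_pos hr]

lemma smul_compl_pos {r : ℝ} (hr : 0 < r) (s : Set (E n)) : r • sᶜ = (r • s)ᶜ :=
  smul_set_compl (a := Units.mk0 r hr.ne')

lemma setIntegral_scale (f : E n → ℝ) (s : Set (E n)) {r : ℝ} (hr : 0 < r) :
    ∫ x in r • s, f x = r ^ (n : ℝ) * ∫ x in s, f (r • x) := by
  rw [Measure.setIntegral_comp_smul_of_pos volume f s hr, finrank_euclideanSpace_fin, smul_eq_mul,
    ← mul_assoc, rpow_natCast, mul_inv_cancel₀ pos!, one_mul]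

lemma integral_scale (f : E n → ℝ) {r : ℝ} (hr : 0 < r) :
    ∫ x, f x = r ^ (n : ℝ) * ∫ x, f (r • x) := by
  have := setIntegral_scale f univ hr
  rwa [smul_set_univ₀ hr.ne', setIntegral_univ, setIntegral_univ] at this

lemma norm_smul_pos_rpow {r : ℝ} (hr : 0 < r) (x : E n) (a : ℝ) :
    ‖r • x‖ ^ a = r ^ a * ‖x‖ ^ a := by
  rw [norm_smul, norm_of_nonneg hr.le, mul_rpow hr.le (norm_nonneg _)]

lemma ker_scale (s : Set (E n)) {r : ℝ} (hr : 0 < r) (a : ℝ) :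
    ∫ x in r • s, ‖x‖ ^ (-a) = r ^ ((n : ℝ) - a) * ∫ x in s, ‖x‖ ^ (-a) := by
  rw [setIntegral_scale _ _ hr, sub_eq_add_neg, rpow_add hr, mul_assoc]
  simp_rw [norm_smul_pos_rpow hr]
  rw [integral_const_mul]

lemma ker_ball_eq {r : ℝ} (hr : 0 < r) (a : ℝ) :
    ∫ x in ball (0 : E n) r, ‖x‖ ^ (-a) = r ^ ((n : ℝ) - a) * ∫ x in ball (0 : E n) 1, ‖x‖ ^ (-a) := by
  rw [← ker_scale _ hr, smul_set_ball hr]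

lemma ker_compl_eq {r : ℝ} (hr : 0 < r) (a : ℝ) :
    ∫ x in (ball (0 : E n) r)ᶜ, ‖x‖ ^ (-a)
      = r ^ ((n : ℝ) - a) * ∫ x in (ball (0 : E n) 1)ᶜ, ‖x‖ ^ (-a) := by
  rw [← ker_scale _ hr, smul_compl_pos hr, smul_set_ball hr]

lemma integrableOn_comp_sub_left {f : E n → ℝ} {s : Set (E n)} (hf : IntegrableOn f s) (x : E n) :
    IntegrableOn (fun z => f (x - z)) ((fun z => x - z) ⁻¹' s) :=
  ((Measure.measurePreserving_sub_left volume x).integrableOn_comp_preimage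
    (MeasurableEquiv.subLeft x).measurableEmbedding).2 hf

lemma setIntegral_comp_sub_left (f : E n → ℝ) (s : Set (E n)) (x : E n) :
    ∫ z in (fun z => x - z) ⁻¹' s, f (x - z) = ∫ z in s, f z :=
  (Measure.measurePreserving_sub_left volume x).setIntegral_preimage_emb
    (MeasurableEquiv.subLeft x).measurableEmbedding f s

lemma preimage_sub_left_ball (x : E n) (r : ℝ) :
    (fun z => x - z) ⁻¹' (ball (0 : E n) r) = ball x r := by
  ext z; simp [dist_eq_norm, norm_sub_rev]

end kernel

open Real

section secondDifference
variable {V W : Type*} [NormedAddCommGroup V] [NormedSpace ℝ V] [NormedAddCommGroup W]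
  [NormedSpace ℝ W]

/-- The (negative) symmetric second difference. -/
def D2 (φ : V → W) (x y : V) : W := (2 : ℝ) • φ x - φ (x + y) - φ (x - y)

lemma norm_D2_le_of_lipschitz {F : V → W} {s : Set V} (hs : Convex ℝ s) {C : ℝ}
    (hd : ∀ z ∈ s, DifferentiableAt ℝ F z)
    (hC : ∀ a ∈ s, ∀ b ∈ s, ‖fderiv ℝ F a - fderiv ℝ F b‖ ≤ C * ‖a - b‖) {x y : V}
    (hx : x ∈ s) (hxy : x + y ∈ s) (hxy' : x - y ∈ s) :
    ‖D2 F x y‖ ≤ C * ‖y‖ ^ 2 := by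
  have hseg := hs.segment_subset hxy' hx
  have hseg' : ∀ z ∈ segment ℝ (x - y) x, z + y ∈ s := by
    intro z hz
    have : z + y ∈ segment ℝ (x - y + y) (x + y) := by
      rw [add_comm z, add_comm _ y, add_comm x]
      exact (mem_segment_translate ℝ y).2 hz
    rw [sub_add_cancel] at this
    exact hs.segment_subset hx hxy this
  have key := Convex.norm_image_sub_le_of_norm_hasFDerivWithin_le
    (f := fun z => F (z + y) - F z) (f' := fun z => fderiv ℝ F (z + y) - fderiv ℝ F z)
    (s := segment ℝ (x - y) x) (C := C * ‖y‖) (x := x - y) (y := x) ?_ ?_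
    (convex_segment _ _) (left_mem_segment _ _ _) (right_mem_segment _ _ _)
  · have e : D2 F x y = -((F (x + y) - F x) - (F (x - y + y) - F (x - y))) := by
      rw [D2, sub_add_cancel, two_smul]; abel
    rw [e, norm_neg]
    refine key.trans (le_of_eq ?_)
    rw [sub_sub_cancel]; ring
  · intro z hz
    exact (((hasFDerivAt_comp_add_right y).2 (hd _ (hseg' z hz)).hasFDerivAt).sub (hd _
        (hseg hz)).hasFDerivAt).hasFDerivWithinAt
  · intro z hz
    refine (hC _ (hseg' z hz) _ (hseg hz)).trans (le_of_eq ?_)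
    rw [add_sub_cancel_left]

lemma exists_D2_bound_on_compact [FiniteDimensional ℝ V] {F : V → W} {U K : Set V}
    (hU : IsOpen U) (hF : ContDiffOn ℝ 2 F U) (hK : IsCompact K) (hKU : K ⊆ U) :
    ∃ C ≥ 0, ∃ ρ > 0, ∀ x ∈ K, ∀ y, ‖y‖ ≤ ρ → ‖D2 F x y‖ ≤ C * ‖y‖ ^ 2 := by
  obtain ⟨ρ, hρ, hsub⟩ := hK.exists_cthickening_subset_open hU hKU
  have : ProperSpace V := FiniteDimensional.proper ℝ V
  have h1 : ContDiffOn ℝ 1 (fderiv ℝ F) U := hF.fderiv_of_isOpen hU num!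
  have h3 : ContinuousOn (fun z => ‖fderiv ℝ (fderiv ℝ F) z‖) (cthickening ρ K) :=
    by
    intro z hz
    exact Filter.Tendsto.norm (E := V →L[ℝ] V →L[ℝ] W) (((h1.continuousOn_fderiv_of_isOpen hU
        num!).mono hsub) z hz)
  obtain ⟨C, hC'⟩ := hK.cthickening.bddAbove_image h3
  refine ⟨max C 0, le_max_right _ _, ρ, hρ, fun x hx y hy => ?_⟩
  have hball := closedBall_subset_cthickening hx ρ
  apply norm_D2_le_of_lipschitz (convex_closedBall x ρ)
  · intro z hz
    exact (hF.differentiableOn num!).differentiableAt (hU.mem_nhds (hsub (hball hz)))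
  · intro a ha b hb
    refine Convex.norm_image_sub_le_of_norm_fderiv_le (𝕜 := ℝ) (s := closedBall x ρ) ?_ ?_
      (convex_closedBall x ρ) hb ha
    · intro z hz
      exact (h1.differentiableOn num!).differentiableAt (hU.mem_nhds (hsub (hball hz)))
    · intro z hz
      exact ((fun z hz => hC' (mem_image_of_mem _ hz)) z (hball hz)).trans (le_max_left _ _)
  · simpa using hρ.le
  · simpa using hy
  · simpa using hy

lemma exists_D2_bound_of_hasCompactSupport {F : V → W} (hF : ContDiff ℝ 2 F)
    (hc : HasCompactSupport F) : ∃ C ≥ 0, (∀ x, ‖F x‖ ≤ C) ∧ ∀ x y, ‖D2 F x y‖ ≤ C * ‖y‖ ^ 2 := by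
  obtain ⟨L, hL⟩ := ContDiff.lipschitzWith_of_hasCompactSupport (𝕂 := ℝ) (n := 1) (hc.fderiv ℝ)
    (hF.fderiv_right num!) num!
  obtain ⟨C, hC⟩ := hF.continuous.bounded_above_of_compact_support hc
  refine ⟨max L C, le_max_of_le_left L.2, fun x => (hC x).trans (le_max_right _ _), fun x y => ?_⟩
  refine (norm_D2_le_of_lipschitz convex_univ (C := L) ?_ ?_ trivial trivial trivial).trans ?_
  · exact fun z _ => (hF.differentiable num!) z
  · intro a _ b _
    simpa [dist_eq_norm] using hL.dist_le_mul a b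
  · gcongr; exact le_max_left _ _

lemma norm_D2_le_four {F : V → W} {C : ℝ} (hC : ∀ x, ‖F x‖ ≤ C) (x y : V) :
    ‖D2 F x y‖ ≤ 4 * C := by
  have h1 := norm_sub_le ((2 : ℝ) • F x - F (x + y)) (F (x - y))
  have h2 := norm_sub_le ((2 : ℝ) • F x) (F (x + y))
  rw [norm_smul, norm_of_nonneg (num! : (0 : ℝ) ≤ 2)] at h2
  have := hC x; have := hC (x + y); have := hC (x - y)
  rw [D2]; linarith

end secondDifference

section Lop
variable {n : ℕ}

/-- The integrand of the (unnormalized) fractional Laplacian. -/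
def Lint (N : ℝ) (φ : E n → ℝ) (x y : E n) : ℝ := D2 φ x y * ‖y‖ ^ (-N)

/-- The unnormalized fractional Laplacian in second difference form. -/
def Lop (N : ℝ) (φ : E n → ℝ) (x : E n) : ℝ := ∫ y, Lint N φ x y

lemma D2_measurable {φ : E n → ℝ} (hφ : Measurable φ) :
    Measurable (fun z : E n × E n => D2 φ z.1 z.2) := by
  unfold D2; fun_prop

lemma Lint_measurable {N : ℝ} {φ : E n → ℝ} (hφ : Measurable φ) :
    Measurable (fun z : E n × E n => Lint N φ z.1 z.2) := by
  have := D2_measurable hφ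
  unfold Lint; fun_prop

lemma Lint_measurable_right {N : ℝ} {φ : E n → ℝ} (hφ : Measurable φ) (x : E n) :
    Measurable (fun y : E n => Lint N φ x y) :=
  (Lint_measurable (N := N) hφ).comp measurable_prodMk_left

variable {σ d N : ℝ}

lemma sq_mul_ker (P : Par n σ d N) (y : E n) : ‖y‖ ^ 2 * ‖y‖ ^ (-N) = ‖y‖ ^ (-(N - 2)) := by
  rcases eq_or_ne y 0 with rfl | hy
  · have : -(N - 2) ≠ 0 ∨ -(N - 2) = 0 := ne_or_eq _ _
    simp only [norm_zero]
    rw [zero_pow num!, zero_mul, zero_rpow]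
    have := P.n2; have := P.nN; intro h; linarith
  · rw [← rpow_natCast, ← rpow_add (norm_pos_iff.2 hy)]
    congr 1; push_cast; ring

/-- The truncated kernel `min(|y|²,1)|y|^{-N}`. -/
def mker (N : ℝ) (y : E n) : ℝ := min (‖y‖ ^ 2) 1 * ‖y‖ ^ (-N)

lemma mker_nonneg (y : E n) : 0 ≤ mker N y := by unfold mker; positivity

lemma mker_measurable : Measurable (mker (n := n) N) := by unfold mker; fun_prop

lemma mker_integrable (P : Par n σ d N) : Integrable (mker (n := n) N) := by
  rw [← integrableOn_univ, ← union_compl_self (ball (0 : E n) 1)]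
  apply IntegrableOn.union
  · refine Integrable.mono' (ker_integrable_ball P.n1 P.N2 1)
      mker_measurable.aestronglyMeasurable (.of_forall fun y => ?_)
    rw [norm_of_nonneg (mker_nonneg y), ← sq_mul_ker P, mker]
    gcongr; exact min_le_left _ _
  · refine Integrable.mono' (ker_integrable_compl P.nN one_pos)
      mker_measurable.aestronglyMeasurable (.of_forall fun y => ?_)
    rw [norm_of_nonneg (mker_nonneg y), mker]
    exact mul_le_of_le_one_left pos! (min_le_right _ _)

lemma norm_Lint_le_mker {φ : E n → ℝ} {M : ℝ} (hM : 0 ≤ M) (h1 : ∀ x, ‖φ x‖ ≤ M)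
    (h2 : ∀ x y, ‖D2 φ x y‖ ≤ M * ‖y‖ ^ 2) (x y : E n) :
    ‖Lint N φ x y‖ ≤ 4 * M * mker N y := by
  rw [Lint, norm_mul, norm_of_nonneg (pos! : 0 ≤ ‖y‖ ^ (-N)), mker, ← mul_assoc]
  gcongr
  rcases le_total (‖y‖ ^ 2) 1 with h | h
  · rw [min_eq_left h]; refine (h2 x y).trans ?_
    nlinarith [mul_nonneg hM (sq_nonneg ‖y‖)]
  · rw [min_eq_right h]; simpa using norm_D2_le_four h1 x y

lemma Lint_integrable_test (P : Par n σ d N) {φ : E n → ℝ} (hφ : Measurable φ) {M : ℝ}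
    (hM : 0 ≤ M) (h1 : ∀ x, ‖φ x‖ ≤ M) (h2 : ∀ x y, ‖D2 φ x y‖ ≤ M * ‖y‖ ^ 2) (x : E n) :
    Integrable (Lint N φ x) :=
  ((mker_integrable P).const_mul (4 * M)).mono' (Lint_measurable_right hφ x).aestronglyMeasurable
    (.of_forall fun y => norm_Lint_le_mker hM h1 h2 x y)

/-- Decay of the fractional Laplacian of test functions, uniform in the function. -/
lemma exists_Lint_decay (P : Par n σ d N) (r : ℝ) (hr : 0 < r) :
    ∃ C > 0, ∀ (φ : E n → ℝ) (M : ℝ), Measurable φ → 0 ≤ M → (∀ x, ‖φ x‖ ≤ M) →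
      (∀ x y, ‖D2 φ x y‖ ≤ M * ‖y‖ ^ 2) → (∀ x, r ≤ ‖x‖ → φ x = 0) →
      ∀ x, ∫ y, ‖Lint N φ x y‖ ≤ C * M * (1 + ‖x‖) ^ (-N) := by
  set I := ∫ y : E n, mker N y
  have hI : 0 ≤ I := integral_nonneg mker_nonneg
  set v := volume.real (ball (0 : E n) r)
  have hN := P.N0
  set C1 := 4 * I * (1 + 2 * r) ^ N
  set C2 := 2 * v * ((1 + 2 * r) / (2 * r) * 2) ^ N
  have hC1 : 0 ≤ C1 := pos!
  have hC2 : 0 ≤ C2 := pos!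
  refine ⟨C1 + C2 + 1, pos!, fun φ M hφ hM h1 h2 hs x => ?_⟩
  have hint := Lint_integrable_test P hφ hM h1 h2 x
  rcases le_total ‖x‖ (2 * r) with hx | hx
  · have : ∫ y, ‖Lint N φ x y‖ ≤ 4 * M * I := by
      rw [← integral_const_mul]
      exact integral_mono hint.norm ((mker_integrable P).const_mul _)
        (norm_Lint_le_mker hM h1 h2 x)
    refine this.trans ?_
    have hb : 1 ≤ (1 + 2 * r) ^ N * (1 + ‖x‖) ^ (-N) := by
      rw [rpow_neg pos!, ← div_eq_mul_inv, one_le_div pos!]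
      gcongr
    calc 4 * M * I ≤ 4 * M * I * ((1 + 2 * r) ^ N * (1 + ‖x‖) ^ (-N)) :=
          le_mul_of_one_le_right pos! hb
      _ = C1 * M * (1 + ‖x‖) ^ (-N) := by ring
      _ ≤ _ := by gcongr; linarith
  · have hx0 : 0 < ‖x‖ := lin!
    have hφx := hs x lin!
    have hball : ∀ z y : E n, (z = y ∨ z = -y) → ‖φ (x + z)‖ * ‖y‖ ^ (-N) ≤
        (ball (-x) r).indicator (fun _ => M * (‖x‖ / 2) ^ (-N)) z := by
      intro z y hzy
      have hz : ‖z‖ = ‖y‖ := by rcases hzy with h | h <;> simp [h]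
      by_cases hz' : z ∈ ball (-x) r
      · rw [indicator_of_mem hz']
        have : ‖x‖ / 2 ≤ ‖y‖ := by
          rw [mem_ball, dist_eq_norm, sub_neg_eq_add] at hz'
          have : ‖x‖ ≤ ‖z + x‖ + ‖z‖ := by
            calc ‖x‖ = ‖(z + x) - z‖ := by simp
              _ ≤ _ := norm_sub_le _ _
          linarith
        have := rpow_anti pos! this (lin! : -N ≤ 0)
        have := h1 (x + z)
        gcongr
      · rw [indicator_of_notMem hz', hs, norm_zero, zero_mul]
        rw [mem_ball, dist_eq_norm, sub_neg_eq_add, not_lt, add_comm] at hz'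
        exact hz'
    set g : E n → ℝ := (ball (-x) r).indicator (fun _ => M * (‖x‖ / 2) ^ (-N)) with hg
    have hgi : Integrable g := (integrable_indicator_iff measurableSet_ball).2
      (integrableOn_const measure_ball_lt_top.ne)
    have hgI : ∫ y, g y = v * (M * (‖x‖ / 2) ^ (-N)) := by
      rw [hg, integral_indicator measurableSet_ball, setIntegral_const, smul_eq_mul, Measure.real,
        Measure.addHaar_ball_center]
      rfl
    have hb : ∫ y, ‖Lint N φ x y‖ ≤ ∫ y, (g y + g (-y)) := by
      refine integral_mono hint.norm (hgi.add hgi.comp_neg) fun y => ?_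
      have e1 := hball y y (Or.inl rfl)
      have e2 := hball (-y) y (Or.inr rfl)
      simp only [Lint, D2, hφx, smul_zero, zero_sub, norm_mul,
        norm_of_nonneg (pos! : 0 ≤ ‖y‖ ^ (-N))]
      rw [← sub_eq_add_neg] at e2
      have : ‖-φ (x + y) - φ (x - y)‖ ≤ ‖φ (x + y)‖ + ‖φ (x - y)‖ := by
        rw [← norm_neg (φ (x + y))]; exact norm_sub_le _ _
      calc _ ≤ (‖φ (x + y)‖ + ‖φ (x - y)‖) * ‖y‖ ^ (-N) := by gcongr
        _ ≤ _ := by rw [add_mul]; exact add_le_add e1 e2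
    rw [integral_add hgi hgi.comp_neg, integral_neg_eq_self (f := g), hgI] at hb
    refine hb.trans ?_
    have : (‖x‖ / 2) ^ (-N) ≤ ((1 + 2 * r) / (2 * r) * 2) ^ N * (1 + ‖x‖) ^ (-N) := by
      rw [rpow_neg pos!, rpow_neg pos!, ← div_eq_mul_inv,
        ← div_rpow pos! pos!, ← inv_rpow pos!]
      apply rpow_le_rpow pos! _ hN.le
      rw [le_div_iff₀ pos!, div_mul_eq_mul_div, le_div_iff₀ pos!, inv_div]
      rw [div_mul_eq_mul_div, div_mul_eq_mul_div, div_le_iff₀ hx0]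
      nlinarith
    calc _ = 2 * v * M * (‖x‖ / 2) ^ (-N) := by ring
      _ ≤ 2 * v * M * (((1 + 2 * r) / (2 * r) * 2) ^ N * (1 + ‖x‖) ^ (-N)) := by gcongr
      _ = C2 * M * (1 + ‖x‖) ^ (-N) := by ring
      _ ≤ _ := by gcongr; linarith

end Lop

open Real

section duality
variable {n : ℕ} {σ d N : ℝ}

/-- Measurable functions in `L_σ` that are `C²` on an open set `U`. -/
structure Adm (N : ℝ) (u : E n → ℝ) (U : Set (E n)) : Prop where
  meas : Measurable u
  int : Integrable (fun x => |u x| * (1 + ‖x‖) ^ (-N))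
  op : IsOpen U
  smooth : ContDiffOn ℝ 2 u U

lemma integrableOn_of_weighted {N : ℝ} (hN : 0 < N) {u : E n → ℝ} (hu : Measurable u)
    (hw : Integrable (fun x => |u x| * (1 + ‖x‖) ^ (-N))) (r : ℝ) :
    IntegrableOn u (ball 0 r) := by
  refine Integrable.mono' (hw.const_mul ((1 + r) ^ N)).integrableOn hu.aestronglyMeasurable ?_
  refine (ae_restrict_iff' measurableSet_ball).2 (.of_forall fun x hx => ?_)
  rw [mem_ball_zero_iff] at hx
  have : 1 ≤ (1 + r) ^ N * (1 + ‖x‖) ^ (-N) := by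
    rw [rpow_neg pos!, ← div_eq_mul_inv, one_le_div pos!]
    gcongr
  calc ‖u x‖ = |u x| := rfl
    _ ≤ |u x| * ((1 + r) ^ N * (1 + ‖x‖) ^ (-N)) := le_mul_of_one_le_right (abs_nonneg _) this
    _ = _ := by ring

lemma integrable_mul_test {u φ : E n → ℝ} (hu : ∀ r, IntegrableOn u (ball 0 r))
    (hφ : Measurable φ) {M r : ℝ} (h1 : ∀ x, ‖φ x‖ ≤ M) (hs : ∀ x, r ≤ ‖x‖ → φ x = 0) :
    Integrable (fun x => u x * φ x) := by
  have : Integrable (fun x => φ x * (ball (0 : E n) r).indicator u x) :=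
    ((integrable_indicator_iff measurableSet_ball).2 (hu r)).bdd_mul hφ.aestronglyMeasurable
      (.of_forall h1)
  refine this.congr (.of_forall fun x => ?_)
  by_cases hx : x ∈ ball (0 : E n) r
  · simp [indicator_of_mem hx, mul_comm]
  · simp only [mem_ball_zero_iff, not_lt] at hx
    simp [hs x hx]

lemma Adm.exists_Lint_bound (P : Par n σ d N) {u : E n → ℝ} {U K : Set (E n)} (hu : Adm N u U)
    (hK : IsCompact K) (hKU : K ⊆ U) :
    ∃ A ≥ 0, ∃ B ≥ 0, ∀ x ∈ K, ∀ y, ‖Lint N u x y‖ ≤ A * mker N y +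
      B * (|u (x + y)| * (1 + ‖x + y‖) ^ (-N) + |u (x - y)| * (1 + ‖x - y‖) ^ (-N)) := by
  obtain ⟨C, hC, ρ', hρ', h⟩ := exists_D2_bound_on_compact hu.op hu.smooth hK hKU
  obtain ⟨M', hM'⟩ := hK.exists_bound_of_continuousOn (hu.smooth.continuousOn.mono hKU)
  obtain ⟨R', hR'⟩ := hK.isBounded.exists_norm_le
  set M := max M' 0
  set R := max R' 0
  have hR0 : 0 ≤ R := le_max_right _ _
  set ρ := min ρ' 1
  have hρ : 0 < ρ := lt_min hρ' one_pos
  have hN := P.N0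
  set c := (1 + R) / ρ + 1
  refine ⟨C + 2 * M / ρ ^ 2, pos!, c ^ N, pos!, fun x hx y => ?_⟩
  have hux : |u x| ≤ M := (hM' x hx).trans (le_max_left _ _)
  have hxR : ‖x‖ ≤ R := (hR' x hx).trans (le_max_left _ _)
  have hk : 0 ≤ ‖y‖ ^ (-N) := pos!
  rw [Lint, norm_mul, norm_of_nonneg hk]
  rcases le_total ‖y‖ ρ with hy | hy
  · have h1 : ‖y‖ ≤ 1 := hy.trans (min_le_right _ _)
    have h2 := h x hx y (hy.trans (min_le_left _ _))
    have hm : mker N y = ‖y‖ ^ 2 * ‖y‖ ^ (-N) := by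
      rw [mker, min_eq_left (pow_le_one₀ (norm_nonneg _) h1)]
    have hm0 := mker_nonneg (N := N) y
    calc ‖D2 u x y‖ * ‖y‖ ^ (-N) ≤ C * ‖y‖ ^ 2 * ‖y‖ ^ (-N) := by gcongr
      _ = C * mker N y := by rw [hm]; ring
      _ ≤ (C + 2 * M / ρ ^ 2) * mker N y := by
          gcongr; linarith [show 0 ≤ 2 * M / ρ ^ 2 by positivity]
      _ ≤ _ := le_add_of_nonneg_right pos!
  · have hm : ρ ^ 2 * ‖y‖ ^ (-N) ≤ mker N y := by
      rw [mker]; gcongr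
      exact le_min (by gcongr) (pow_le_one₀ hρ.le (min_le_right _ _))
    have hm0 := mker_nonneg (N := N) y
    have e1 : 2 * M * ‖y‖ ^ (-N) ≤ 2 * M / ρ ^ 2 * mker N y := by
      calc 2 * M * ‖y‖ ^ (-N) = 2 * M / ρ ^ 2 * (ρ ^ 2 * ‖y‖ ^ (-N)) := by field_simp
        _ ≤ _ := by gcongr
    have e2 : ∀ z : E n, ‖z‖ ≤ ‖x‖ + ‖y‖ → ‖y‖ ^ (-N) ≤ c ^ N * (1 + ‖z‖) ^ (-N) := by
      intro z hz
      have hy0 : 0 < ‖y‖ := lin!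
      rw [rpow_neg pos!, rpow_neg pos!,
        ← inv_rpow pos!, ← inv_rpow pos!,
        ← mul_rpow pos! pos!]
      apply rpow_le_rpow pos! _ hN.le
      rw [← div_eq_mul_inv, inv_le_comm₀ hy0 pos!, inv_div, div_le_iff₀ pos!]
      have : (1 + R) / ρ * ρ = 1 + R := by field_simp
      have : (1 + R) / ρ * ρ ≤ (1 + R) / ρ * ‖y‖ := by gcongr
      simp only [c]; nlinarith
    have hD : ‖D2 u x y‖ ≤ 2 * M + |u (x + y)| + |u (x - y)| := by
      rw [D2, smul_eq_mul, norm_eq_abs]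
      have h1 := abs_sub (2 * u x - u (x + y)) (u (x - y))
      have h2 := abs_sub (2 * u x) (u (x + y))
      rw [abs_mul, abs_of_pos (num! : (0 : ℝ) < 2)] at h2
      linarith
    calc ‖D2 u x y‖ * ‖y‖ ^ (-N) ≤ (2 * M + |u (x + y)| + |u (x - y)|) * ‖y‖ ^ (-N) := by gcongr
      _ = 2 * M * ‖y‖ ^ (-N) + (|u (x + y)| * ‖y‖ ^ (-N) + |u (x - y)| * ‖y‖ ^ (-N)) := by ring
      _ ≤ 2 * M / ρ ^ 2 * mker N y + (|u (x + y)| * (c ^ N * (1 + ‖x + y‖) ^ (-N)) +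
          |u (x - y)| * (c ^ N * (1 + ‖x - y‖) ^ (-N))) := by
          gcongr
          · exact e2 _ (norm_add_le _ _)
          · exact e2 _ (norm_sub_le _ _)
      _ ≤ (C + 2 * M / ρ ^ 2) * mker N y + (|u (x + y)| * (c ^ N * (1 + ‖x + y‖) ^ (-N)) +
          |u (x - y)| * (c ^ N * (1 + ‖x - y‖) ^ (-N))) := by
          gcongr; linarith
      _ = _ := by ring

lemma Adm.bound_integrable (P : Par n σ d N) {u : E n → ℝ} {U : Set (E n)} (hu : Adm N u U)
    (A B : ℝ) (x : E n) : Integrable (fun y => A * mker N y +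
      B * (|u (x + y)| * (1 + ‖x + y‖) ^ (-N) + |u (x - y)| * (1 + ‖x - y‖) ^ (-N))) :=
  ((mker_integrable P).const_mul A).add
    (((hu.int.comp_add_left x).add (hu.int.comp_sub_left x)).const_mul B)

lemma Adm.Lint_integrable (P : Par n σ d N) {u : E n → ℝ} {U : Set (E n)} (hu : Adm N u U)
    {x : E n} (hx : x ∈ U) : Integrable (Lint N u x) := by
  obtain ⟨A, -, B, -, h⟩ := hu.exists_Lint_bound P (isCompact_singleton (x := x)) (by simpa using hx)
  exact (hu.bound_integrable P A B x).mono'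
    (Lint_measurable_right hu.meas x).aestronglyMeasurable (.of_forall (h x rfl))

/-- Bounded test functions with quadratic second differences, supported in a compact `K`. -/
structure Test (φ : E n → ℝ) (M : ℝ) (K : Set (E n)) : Prop where
  meas : Measurable φ
  cpt : IsCompact K
  bd : ∀ x, ‖φ x‖ ≤ M
  bd2 : ∀ x y, ‖D2 φ x y‖ ≤ M * ‖y‖ ^ 2
  supp : ∀ x, x ∉ K → φ x = 0

lemma Test.M0 {φ : E n → ℝ} {M : ℝ} {K : Set (E n)} (h : Test φ M K) : 0 ≤ M :=
  (norm_nonneg _).trans (h.bd 0)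

lemma Test.radius {φ : E n → ℝ} {M : ℝ} {K : Set (E n)} (h : Test φ M K) :
    ∃ r > 0, ∀ x, r ≤ ‖x‖ → φ x = 0 := by
  obtain ⟨R, hR⟩ := h.cpt.isBounded.exists_norm_le
  refine ⟨max R 0 + 1, pos!, fun x hx => h.supp x fun hxK => ?_⟩
  have := hR x hxK
  linarith [le_max_left R 0]

lemma test_of_contDiff {φ : E n → ℝ} (h : ContDiff ℝ 2 φ) (hc : HasCompactSupport φ) :
    ∃ M, Test φ M (tsupport φ) := by
  obtain ⟨C, -, h1, h2⟩ := exists_D2_bound_of_hasCompactSupport h hc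
  exact ⟨C, h.continuous.measurable, hc, h1, h2, fun x hx => image_eq_zero_of_notMem_tsupport hx⟩

lemma duality (P : Par n σ d N) {u φ : E n → ℝ} {U K : Set (E n)} {M : ℝ} (hu : Adm N u U)
    (hφ : Test φ M K) (hKU : K ⊆ U) :
    Integrable (fun x => u x * Lop N φ x) ∧ Integrable (fun x => φ x * Lop N u x) ∧
    ∫ x, u x * Lop N φ x = ∫ x, φ x * Lop N u x := by
  obtain ⟨r, hr, hsr⟩ := hφ.radius
  have hM := hφ.M0
  obtain ⟨C, hC, hdec⟩ := exists_Lint_decay (n := n) P r hr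
  have hul := integrableOn_of_weighted P.N0 hu.meas hu.int
  have hI1 : Integrable (fun z : E n × E n => u z.1 * Lint N φ z.1 z.2)
      (volume.prod volume) := by
    have hm : Measurable (fun z : E n × E n => u z.1 * Lint N φ z.1 z.2) :=
      (hu.meas.comp measurable_fst).mul (Lint_measurable hφ.meas)
    refine (integrable_prod_iff hm.aestronglyMeasurable).2
      ⟨.of_forall fun x => ((Lint_integrable_test P hφ.meas hM hφ.bd hφ.bd2) x).const_mul (u x), ?_⟩
    refine (hu.int.const_mul (C * M)).mono' ?_ (.of_forall fun x => ?_)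
    · exact (hm.norm.stronglyMeasurable.integral_prod_right).aestronglyMeasurable
    · rw [norm_of_nonneg (integral_nonneg fun _ => norm_nonneg _)]
      simp_rw [norm_mul]
      rw [integral_const_mul]
      calc ‖u x‖ * ∫ y, ‖Lint N φ x y‖ ≤ ‖u x‖ * (C * M * (1 + ‖x‖) ^ (-N)) := by
            gcongr; exact (hdec φ M hφ.meas hM hφ.bd hφ.bd2 hsr) x
        _ = _ := by rw [norm_eq_abs]; ring
  obtain ⟨A, hA, B, hB, hub⟩ := hu.exists_Lint_bound P hφ.cpt hKU
  have hI2 : Integrable (fun z : E n × E n => φ z.1 * Lint N u z.1 z.2)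
      (volume.prod volume) := by
    have hm : Measurable (fun z : E n × E n => φ z.1 * Lint N u z.1 z.2) :=
      (hφ.meas.comp measurable_fst).mul (Lint_measurable hu.meas)
    set W := ∫ x, |u x| * (1 + ‖x‖) ^ (-N)
    set I := ∫ y : E n, mker N y
    refine (integrable_prod_iff hm.aestronglyMeasurable).2 ⟨.of_forall fun x => ?_, ?_⟩
    · by_cases hx : x ∈ K
      · exact (hu.Lint_integrable P (hKU hx)).const_mul (φ x)
      · simp [hφ.supp x hx]
    · have : Integrable (K.indicator fun _ => M * (A * I + B * (W + W)) : E n → ℝ) :=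
        (integrable_indicator_iff hφ.cpt.measurableSet).2
          (integrableOn_const hφ.cpt.measure_lt_top.ne)
      refine this.mono' ?_ (.of_forall fun x => ?_)
      · exact (hm.norm.stronglyMeasurable.integral_prod_right).aestronglyMeasurable
      · rw [norm_of_nonneg (integral_nonneg fun _ => norm_nonneg _)]
        by_cases hx : x ∈ K
        · rw [indicator_of_mem hx]
          simp_rw [norm_mul]
          rw [integral_const_mul]
          have h1 : ∫ y, ‖Lint N u x y‖ ≤ A * I + B * (W + W) := by
            refine (integral_mono (hu.Lint_integrable P (hKU hx)).norm
              (hu.bound_integrable P A B x) (hub x hx)).trans (le_of_eq ?_)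
            have j : Integrable fun y => |u (x + y)| * (1 + ‖x + y‖) ^ (-N) +
                |u (x - y)| * (1 + ‖x - y‖) ^ (-N) :=
              (hu.int.comp_add_left x).add (hu.int.comp_sub_left x)
            rw [integral_add ((mker_integrable P).const_mul A) (j.const_mul B),
              integral_const_mul, integral_const_mul,
              integral_add (hu.int.comp_add_left x) (hu.int.comp_sub_left x),
              integral_add_left_eq_self (fun z : E n => |u z| * (1 + ‖z‖) ^ (-N)) x,
              integral_sub_left_eq_self (fun z : E n => |u z| * (1 + ‖z‖) ^ (-N))]
          gcongr
          exact hφ.bd x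
        · simp [indicator_of_notMem hx, hφ.supp x hx]
  have e1 : (fun x => u x * Lop N φ x) = fun x => ∫ y, u x * Lint N φ x y := by
    ext x; rw [integral_const_mul]; rfl
  have e2 : (fun x => φ x * Lop N u x) = fun x => ∫ y, φ x * Lint N u x y := by
    ext x; rw [integral_const_mul]; rfl
  refine ⟨?_, ?_, ?_⟩
  · rw [e1]; exact hI1.integral_prod_left
  · rw [e2]; exact hI2.integral_prod_left
  · rw [e1, e2]
    refine (integral_integral_swap hI1).trans (Eq.trans ?_ (integral_integral_swap hI2).symm)
    congr 1; ext y
    simp only [Lint, ← mul_assoc]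
    rw [integral_mul_const, integral_mul_const]
    congr 1
    have i1 : ∀ y, Integrable (fun x => u x * φ (x + y)) := fun y => by
      refine integrable_mul_test hul (hφ.meas.comp (measurable_add_const y)) (r := r + ‖y‖)
        (fun x => hφ.bd _) fun x hx => hsr _ ?_
      have : ‖x‖ ≤ ‖x + y‖ + ‖y‖ := by simpa using norm_sub_le (x + y) y
      linarith
    have i2 : ∀ y, Integrable (fun x => φ x * u (x + y)) := fun y => by
      have := (i1 (-y)).comp_add_right y
      simpa [mul_comm] using this
    have t : ∀ y, ∫ x, u x * φ (x + y) = ∫ x, φ x * u (x + -y) := fun y => by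
      rw [← integral_sub_right_eq_self _ y]
      congr 1; ext x; simp [sub_eq_add_neg, mul_comm]
    have j1 := ((integrable_mul_test hul hφ.meas hφ.bd hsr).const_mul 2)
    have j1' : Integrable (fun x => u x * (2 * φ x)) := j1.congr (.of_forall fun x => by ring)
    have j2' : Integrable (fun x => φ x * (2 * u x)) := j1.congr (.of_forall fun x => by ring)
    have k1 : ∀ x, u x * D2 φ x y = u x * (2 * φ x) - u x * φ (x + y) - u x * φ (x + -y) :=
      fun x => by simp only [D2, smul_eq_mul, sub_eq_add_neg]; ring
    have k2 : ∀ x, φ x * D2 u x y = φ x * (2 * u x) - φ x * u (x + y) - φ x * u (x + -y) :=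
      fun x => by simp only [D2, smul_eq_mul, sub_eq_add_neg]; ring
    simp_rw [k1, k2]
    rw [integral_sub (by exact j1'.sub (i1 y)) (i1 (-y)), integral_sub j1' (i1 y),
      integral_sub (by exact j2'.sub (i2 y)) (i2 (-y)), integral_sub j2' (i2 y), t y, t (-y),
      neg_neg]
    have : ∫ x, u x * (2 * φ x) = ∫ x, φ x * (2 * u x) := by congr 1; ext x; ring
    rw [this]; ring

end duality

open Real

section gamma
variable {n : ℕ} {σ d N : ℝ}

/-- The (unnormalized) fundamental solution. -/
def Gam (d : ℝ) (x : E n) : ℝ := ‖x‖ ^ (-d)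

lemma Gam_nonneg (x : E n) : 0 ≤ Gam d x := by unfold Gam; positivity
lemma Gam_pos {x : E n} (hx : x ≠ 0) : 0 < Gam d x :=
  rpow_pos_of_pos (norm_pos_iff.2 hx) _
lemma Gam_neg (x : E n) : Gam d (-x) = Gam d x := by simp [Gam]
lemma Gam_sub_comm (x y : E n) : Gam d (x - y) = Gam d (y - x) := by simp [Gam, norm_sub_rev]
lemma Gam_measurable : Measurable (Gam (n := n) d) := by unfold Gam; fun_prop
lemma Gam_smul {r : ℝ} (hr : 0 < r) (x : E n) : Gam d (r • x) = r ^ (-d) * Gam d x :=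
  norm_smul_pos_rpow hr x _
lemma Gam_contDiffAt {x : E n} (hx : x ≠ 0) {m : WithTop ℕ∞} : ContDiffAt ℝ m (Gam d) x :=
  (contDiffAt_norm ℝ hx).rpow_const_of_ne (norm_ne_zero_iff.2 hx)

lemma Gam_adm (P : Par n σ d N) : Adm N (Gam (n := n) d) {0}ᶜ where
  meas := Gam_measurable
  op := isOpen_compl_singleton
  smooth := fun x hx => (Gam_contDiffAt hx).contDiffWithinAt
  int := by
    have hm : Measurable fun x : E n => |Gam d x| * (1 + ‖x‖) ^ (-N) :=
      (Gam_measurable.abs).mul (by fun_prop)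
    have hN := P.N0
    rw [← integrableOn_univ, ← union_compl_self (ball (0 : E n) 1)]
    apply IntegrableOn.union
    · refine Integrable.mono' (ker_integrable_ball P.n1 P.dn 1)
        hm.aestronglyMeasurable (.of_forall fun y => ?_)
      rw [norm_of_nonneg pos!, abs_of_nonneg (Gam_nonneg y)]
      refine mul_le_of_le_one_right (Gam_nonneg y) ?_
      exact rpow_le_one_of_one_le_of_nonpos (by linarith [norm_nonneg y]) lin!
    · refine Integrable.mono' (ker_integrable_compl P.nN one_pos)
        hm.aestronglyMeasurable ?_
      refine (ae_restrict_iff' measurableSet_ball.compl).2 (.of_forall fun x hx => ?_)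
      simp only [mem_compl_iff, mem_ball_zero_iff, not_lt] at hx
      rw [norm_of_nonneg pos!, abs_of_nonneg (Gam_nonneg x)]
      refine (mul_le_of_le_one_left pos!
          (rpow_le_one_of_one_le_of_nonpos hx (by linarith [P.d0]))).trans ?_
      exact rpow_anti lin! lin!

lemma Lop_const_mul (c : ℝ) (φ : E n → ℝ) (x : E n) :
    Lop N (fun z => c * φ z) x = c * Lop N φ x := by
  simp only [Lop, ← integral_const_mul]
  congr 1; ext y; simp only [Lint, D2, smul_eq_mul]; ring

lemma Lop_scale (P : Par n σ d N) (φ : E n → ℝ) {r : ℝ} (hr : 0 < r) (x : E n) :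
    Lop N (fun z => φ (r • z)) x = r ^ (2 * σ) * Lop N φ (r • x) := by
  rw [Lop, Lop, integral_scale (Lint N φ (r • x)) hr, ← mul_assoc, ← rpow_add hr,
    ← integral_const_mul]
  congr 1; ext y
  simp only [Lint, D2, norm_smul_pos_rpow hr, smul_add, smul_sub]
  have : r ^ (2 * σ + n) * r ^ (-N) = 1 := by
    rw [← rpow_add hr, P.hN]; ring_nf; exact rpow_zero r
  linear_combination (-((2 : ℝ) • φ (r • x) - φ (r • x + r • y) - φ (r • x - r • y)) * ‖y‖ ^ (-N)) * this

lemma Lop_translate (φ : E n → ℝ) (a x : E n) :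
    Lop N (fun z => φ (z - a)) x = Lop N φ (x - a) := by
  simp only [Lop, Lint, D2]
  congr 1; ext y
  rw [add_sub_right_comm, sub_right_comm x y a]

lemma Lop_isometry (A : E n ≃ₗᵢ[ℝ] E n) (φ : E n → ℝ) (x : E n) :
    Lop N (fun z => φ (A z)) x = Lop N φ (A x) := by
  rw [Lop, Lop, ← A.measurePreserving.integral_comp A.toMeasurableEquiv.measurableEmbedding
    (Lint N φ (A x))]
  congr 1; ext y
  simp [Lint, D2]

lemma Lop_sub {φ ψ : E n → ℝ} {x : E n} (h1 : Integrable (Lint N φ x))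
    (h2 : Integrable (Lint N ψ x)) :
    Lop N (fun z => φ z - ψ z) x = Lop N φ x - Lop N ψ x := by
  rw [Lop, Lop, Lop, ← integral_sub h1 h2]
  congr 1; ext y; simp only [Lint, D2, smul_eq_mul]; ring

lemma Test.Lint_integrable (P : Par n σ d N) {φ : E n → ℝ} {M : ℝ} {K : Set (E n)}
    (h : Test φ M K) (x : E n) : Integrable (Lint N φ x) :=
  Lint_integrable_test P h.meas h.M0 h.bd h.bd2 x

lemma norm_Lop_le (φ : E n → ℝ) (x : E n) : ‖Lop N φ x‖ ≤ ∫ y, ‖Lint N φ x y‖ :=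
  norm_integral_le_integral_norm _

lemma Lop_measurable {φ : E n → ℝ} (h : Measurable φ) : Measurable (Lop N φ) :=
  ((Lint_measurable h).stronglyMeasurable.integral_prod_right).measurable

lemma Test.mul_Lop_integrable (P : Par n σ d N) {u φ : E n → ℝ} {M : ℝ} {K : Set (E n)}
    (h : Test φ M K) (hum : Measurable u)
    (hu : Integrable (fun x => |u x| * (1 + ‖x‖) ^ (-N))) :
    Integrable (fun x => u x * Lop N φ x) := by
  obtain ⟨r, hr, hs⟩ := h.radius
  obtain ⟨C, hC, hdec⟩ := exists_Lint_decay (n := n) P r hr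
  refine (hu.const_mul (C * M)).mono' (hum.mul (Lop_measurable h.meas)).aestronglyMeasurable
    (.of_forall fun x => ?_)
  have := (norm_Lop_le φ x).trans (hdec φ M h.meas h.M0 h.bd h.bd2 hs x)
  rw [norm_mul, norm_eq_abs (u x)]
  nlinarith [abs_nonneg (u x)]

lemma exists_isometry {x y : E n} (h : ‖x‖ = ‖y‖) : ∃ A : E n ≃ₗᵢ[ℝ] E n, A x = y :=
  ⟨_, Submodule.reflection_sub h⟩

lemma Lop_Gam_eq (P : Par n σ d N) (e x : E n) (he : ‖e‖ = 1) (hx : x ≠ 0) :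
    Lop N (Gam d) x = ‖x‖ ^ (-(n : ℝ)) * Lop N (Gam d) e := by
  have hx0 := norm_pos_iff.2 hx
  obtain ⟨A, hA⟩ := exists_isometry (x := ‖x‖ • e) (y := x) (by
    rw [norm_smul, he, mul_one, norm_norm])
  have h1 : Lop N (Gam d) x = Lop N (Gam d) (‖x‖ • e) := by
    rw [← hA, ← Lop_isometry, hA]
    congr 1; ext z; simp [Gam]
  have h2 := Lop_scale P (Gam d) hx0 e
  simp_rw [Gam_smul hx0] at h2
  rw [Lop_const_mul] at h2
  rw [h1]
  have : ‖x‖ ^ (-(n : ℝ)) = ‖x‖ ^ (-d) * ‖x‖ ^ (-(2 * σ)) := by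
    rw [← rpow_add hx0, P.hd]; ring_nf
  rw [this, mul_right_comm, h2, mul_right_comm, ← rpow_add hx0]
  simp

lemma Test.mono {φ : E n → ℝ} {M : ℝ} {K K' : Set (E n)} (h : Test φ M K) (hK' : IsCompact K')
    (hs : ∀ x, x ∉ K' → φ x = 0) : Test φ M K' :=
  ⟨h.meas, hK', h.bd, h.bd2, hs⟩

/-- The fundamental solution is `σ`-harmonic off the origin. -/
lemma Lop_Gam (P : Par n σ d N) {x : E n} (hx : x ≠ 0) : Lop N (Gam d) x = 0 := by
  have := P.nontriv
  obtain ⟨e, he⟩ := exists_norm_eq (E n) zero_le_one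
  suffices h0 : Lop N (Gam d) e = 0 by rw [Lop_Gam_eq P e x he hx, h0, mul_zero]
  let ξ : ContDiffBump (0 : E n) := ⟨1, 3 / 2, one_pos, num!⟩
  have hξ1 : ∀ z : E n, ‖z‖ ≤ 1 → ξ z = 1 := fun z hz => ξ.one_of_mem_closedBall (by simpa [ξ])
  have hξ0 : ∀ z : E n, 3 / 2 ≤ ‖z‖ → ξ z = 0 := fun z hz => ξ.zero_of_le_dist (by simpa [ξ])
  have n2 : ∀ z : E n, ‖(2 : ℝ) • z‖ = 2 * ‖z‖ := fun z => by rw [norm_smul]; norm_num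
  have hsm : ContDiff ℝ 2 ξ := ξ.contDiff
  have hsm2 : ContDiff ℝ 2 fun z => ξ ((2 : ℝ) • z) := hsm.comp (contDiff_const_smul _)
  have hcp : ∀ φ : E n → ℝ, (∀ z, 3 / 2 ≤ ‖z‖ → φ z = 0) → HasCompactSupport φ := fun φ h =>
    HasCompactSupport.intro (isCompact_closedBall 0 (3 / 2)) fun z hz => h z (by
      simp only [mem_closedBall_zero_iff, not_le] at hz; exact hz.le)
  have hz2 : ∀ z : E n, 3 / 2 ≤ ‖z‖ → ξ ((2 : ℝ) • z) = 0 := fun z hz => hξ0 _ (by rw [n2]; linarith)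
  obtain ⟨M1, T1⟩ := test_of_contDiff hsm (hcp _ hξ0)
  obtain ⟨M2, T2⟩ := test_of_contDiff hsm2 (hcp _ hz2)
  set ζ : E n → ℝ := fun z => ξ z - ξ ((2 : ℝ) • z) with hζ
  obtain ⟨M, T⟩ := test_of_contDiff (hsm.sub hsm2) (hcp ζ fun z hz => by
    simp [hζ, hξ0 z hz, hz2 z hz])
  have hζin : ∀ z : E n, ‖z‖ ≤ 1 / 2 → ζ z = 0 := fun z hz => by
    simp only [hζ]; rw [hξ1 z lin!, hξ1 _ (by rw [n2]; linarith), sub_self]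
  have hζ0 : ∀ z, 0 ≤ ζ z := fun z => by
    simp only [hζ]
    rcases le_total ‖z‖ 1 with h | h
    · rw [hξ1 z h]; linarith [ξ.le_one (x := (2 : ℝ) • z)]
    · rw [hξ0 ((2 : ℝ) • z) (by rw [n2]; linarith)]; linarith [ξ.nonneg (x := z)]
  set K : Set (E n) := closedBall 0 (3 / 2) \ ball 0 (1 / 4)
  have TK : Test ζ M K := by
    refine T.mono ((isCompact_closedBall 0 (3 / 2)).diff isOpen_ball) fun z hz => ?_
    simp only [K, Set.mem_sdiff, mem_closedBall_zero_iff, mem_ball_zero_iff, not_and, not_not] at hz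
    rcases le_or_gt ‖z‖ (3 / 2) with h | h
    · exact hζin z (by linarith [hz h])
    · simp [hξ0 z h.le, hz2 z h.le]
  have hKU : K ⊆ {0}ᶜ := by
    rintro z hz rfl
    simp [K] at hz
  obtain ⟨-, hint, hd⟩ := duality P (Gam_adm P) TK hKU
  have hL : ∀ z, Gam d z * Lop N ζ z
      = Gam d z * Lop N ξ z - Gam d z * Lop N (fun z => ξ ((2 : ℝ) • z)) z := fun z => by
    rw [hζ, Lop_sub (T1.Lint_integrable P z) (T2.Lint_integrable P z), mul_sub]
  have hz : ∫ z, Gam d z * Lop N ζ z = 0 := by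
    simp_rw [hL]
    rw [integral_sub (T1.mul_Lop_integrable P (Gam_adm P).meas
        (Gam_adm P).int) (T2.mul_Lop_integrable P (Gam_adm P).meas
            (Gam_adm P).int), sub_eq_zero, integral_scale _ two_pos, ← integral_const_mul]
    congr 1; ext z
    rw [Lop_scale P _ two_pos, Gam_smul two_pos]
    have : (2 : ℝ) ^ (n : ℝ) * 2 ^ (-d) = 2 ^ (2 * σ) := by
      rw [← rpow_add two_pos, ← P.nd]; ring_nf
    rw [← this]; ring
  have hc : ∀ z, ζ z * Lop N (Gam d) z = Lop N (Gam d) e * (ζ z * ‖z‖ ^ (-(n : ℝ))) := fun z => by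
    rcases eq_or_ne z 0 with rfl | h
    · rw [hζin 0 (by simp)]; ring
    · rw [Lop_Gam_eq P e z he h]; ring
  rw [hz] at hd
  simp_rw [hc] at hd
  rw [integral_const_mul] at hd
  rcases mul_eq_zero.1 hd.symm with h | h
  · exact h
  exfalso
  have hcont : Continuous fun z : E n => ζ z * ‖z‖ ^ (-(n : ℝ)) := by
    rw [continuous_iff_continuousAt]
    intro z
    rcases eq_or_ne z 0 with rfl | h
    · have : (fun z : E n => ζ z * ‖z‖ ^ (-(n : ℝ))) =ᶠ[𝓝 0] fun _ => 0 := by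
        filter_upwards [ball_mem_nhds (0 : E n) (num! : (0 : ℝ) < 1 / 2)] with w hw
        rw [hζin w (by simpa using (mem_ball.1 hw).le), zero_mul]
      exact continuousAt_const.congr this.symm
    · exact ((hsm.sub hsm2).continuous.continuousAt).mul
        (continuousAt_id.norm.rpow_const (Or.inl (norm_ne_zero_iff.2 h)))
  have := hcont.integral_pos_of_hasCompactSupport_nonneg_nonzero (μ := volume)
      (hcp _ fun z hz => by simp [hζ, hξ0 z hz, hz2 z hz])
    (fun z => by have := hζ0 z; positivity) (x := e) (by
      simp only [he, hζ, hξ1 e he.le, hξ0 ((2 : ℝ) • e) (by rw [n2, he]; norm_num)]; simp)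
  rw [h] at this
  exact lt_irrefl _ this

end gamma

open Real

section profile

/-- A smooth nonincreasing cutoff, `1` on `(-∞,1]` and `0` on `[2,∞)`. -/
def cutSlope (t : ℝ) : ℝ := 1 - smoothTransition (t - 1)

lemma cutSlope_contDiff_three : ContDiff ℝ 3 cutSlope :=
  contDiff_const.sub (smoothTransition.contDiff.comp (contDiff_id.sub contDiff_const))
lemma cutSlope_contDiff : ContDiff ℝ 2 cutSlope := cutSlope_contDiff_three.of_le num!
lemma cutSlope_continuous : Continuous cutSlope := cutSlope_contDiff.continuous
lemma cutSlope_eq_one {t : ℝ} (h : t ≤ 1) : cutSlope t = 1 := by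
  rw [cutSlope, smoothTransition.zero_of_nonpos lin!, sub_zero]
lemma cutSlope_eq_zero {t : ℝ} (h : 2 ≤ t) : cutSlope t = 0 := by
  rw [cutSlope, smoothTransition.one_of_one_le lin!, sub_self]
lemma cutSlope_nonneg (t : ℝ) : 0 ≤ cutSlope t := by
  have := smoothTransition.le_one (t - 1); unfold cutSlope; linarith
lemma cutSlope_le_one (t : ℝ) : cutSlope t ≤ 1 := by
  have := smoothTransition.nonneg (t - 1); unfold cutSlope; linarith
lemma cutSlope_lt_one {t : ℝ} (h : 1 < t) : cutSlope t < 1 := by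
  have := smoothTransition.pos_of_pos (x := t - 1) lin!; unfold cutSlope; linarith
lemma cutSlope_antitone : Antitone cutSlope := fun a b h => by
  have : smoothTransition (a - 1) ≤ smoothTransition (b - 1) :=
    smoothTransition.monotone lin!
  unfold cutSlope; linarith

/-- A smooth concave profile: the identity on `[0,1]`, constant on `[2,∞)`. -/
def Phi (s : ℝ) : ℝ := ∫ t in (0 : ℝ)..s, cutSlope t

lemma cutSlope_ii (a b : ℝ) : IntervalIntegrable cutSlope volume a b :=
  cutSlope_continuous.intervalIntegrable a b
lemma Phi_sub (a b : ℝ) : Phi b - Phi a = ∫ t in a..b, cutSlope t :=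
  intervalIntegral.integral_interval_sub_left (cutSlope_ii _ _) (cutSlope_ii _ _)
lemma Phi_hasDerivAt (s : ℝ) : HasDerivAt Phi (cutSlope s) s :=
  intervalIntegral.integral_hasDerivAt_right (cutSlope_ii _ _)
    (cutSlope_continuous.stronglyMeasurableAtFilter _ _) cutSlope_continuous.continuousAt
lemma Phi_contDiff_three : ContDiff ℝ 3 Phi := by
  rw [show (3 : WithTop ℕ∞) = 2 + 1 by norm_num, contDiff_succ_iff_deriv]
  refine ⟨fun s => (Phi_hasDerivAt s).differentiableAt, by simp, ?_⟩
  rw [show deriv Phi = cutSlope from funext fun s => (Phi_hasDerivAt s).deriv]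
  exact cutSlope_contDiff
lemma Phi_contDiff : ContDiff ℝ 2 Phi := Phi_contDiff_three.of_le num!
lemma Phi_zero : Phi 0 = 0 := intervalIntegral.integral_same
lemma Phi_tangent (a b : ℝ) : Phi b ≤ Phi a + cutSlope a * (b - a) := by
  have h := Phi_sub a b
  rcases le_total a b with hab | hab
  · have : ∫ t in a..b, cutSlope t ≤ ∫ t in a..b, cutSlope a :=
      intervalIntegral.integral_mono_on hab (cutSlope_ii _ _) (by simp)
        fun t ht => cutSlope_antitone ht.1
    rw [intervalIntegral.integral_const, smul_eq_mul] at this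
    linarith [mul_comm (cutSlope a) (b - a)]
  · have : ∫ t in b..a, cutSlope a ≤ ∫ t in b..a, cutSlope t :=
      intervalIntegral.integral_mono_on hab (by simp) (cutSlope_ii _ _)
        fun t ht => cutSlope_antitone ht.2
    rw [intervalIntegral.integral_const, smul_eq_mul] at this
    rw [intervalIntegral.integral_symm] at h
    linarith [mul_comm (cutSlope a) (b - a)]
lemma Phi_eq {s : ℝ} (h : s ≤ 1) : Phi s = s := by
  have h1 := Phi_tangent 0 s
  have h2 := Phi_tangent s 0
  rw [cutSlope_eq_one h] at h2
  rw [cutSlope_eq_one num!] at h1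
  rw [Phi_zero] at *; linarith
lemma Phi_le {s : ℝ} : Phi s ≤ s := by
  have h1 := Phi_tangent 0 s
  rw [cutSlope_eq_one num!, Phi_zero] at h1; linarith
lemma Phi_mono : Monotone Phi := fun a b h => by
  have := Phi_tangent b a
  nlinarith [cutSlope_nonneg b]
lemma Phi_eq_two {s : ℝ} (h : 2 ≤ s) : Phi s = Phi 2 := by
  have h1 := Phi_tangent 2 s
  rw [cutSlope_eq_zero le_rfl] at h1
  linarith [Phi_mono h]
lemma Phi_le_two (s : ℝ) : Phi s ≤ Phi 2 := by
  have h1 := Phi_tangent 2 s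
  rw [cutSlope_eq_zero le_rfl] at h1
  linarith
lemma Phi_nonneg {s : ℝ} (h : 0 ≤ s) : 0 ≤ Phi s := Phi_zero ▸ Phi_mono h
lemma one_le_Phi_two : 1 ≤ Phi 2 := by
  have := Phi_mono (show (1 : ℝ) ≤ 2 by norm_num)
  rwa [Phi_eq le_rfl] at this
lemma Phi_tangent_strict {a b : ℝ} (ha : 1 < a) (hb : b < 1) :
    Phi b < Phi a + cutSlope a * (b - a) := by
  have h1 := Phi_tangent a 1
  rw [Phi_eq le_rfl] at h1
  rw [Phi_eq hb.le]
  nlinarith [cutSlope_lt_one ha]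
/-- `s ↦ Phi (s) / s` is nonincreasing. -/
lemma Phi_star {a b : ℝ} (ha : 0 < a) (hab : a ≤ b) : a * Phi b ≤ b * Phi a := by
  have h1 := Phi_tangent a b
  have h2 := Phi_tangent a 0
  rw [Phi_zero] at h2
  have : a * cutSlope a ≤ Phi a := lin!
  nlinarith

end profile

section regularized
variable {n : ℕ} {σ d N : ℝ}

/-- The regularized fundamental solution. -/
def G1 (d : ℝ) (x : E n) : ℝ := if x = 0 then Phi 2 else Phi (Gam d x)

lemma G1_of_ne {x : E n} (h : x ≠ 0) : G1 d x = Phi (Gam d x) := if_neg h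
lemma G1_zero : G1 d (0 : E n) = Phi 2 := if_pos rfl
lemma G1_neg (x : E n) : G1 d (-x) = G1 d x := by simp [G1, Gam_neg]

lemma Gam_le_one (hd : 0 < d) {x : E n} (h : 1 ≤ ‖x‖) : Gam d x ≤ 1 :=
  rpow_le_one_of_one_le_of_nonpos h lin!
lemma Gam_lt_one (hd : 0 < d) {x : E n} (h : 1 < ‖x‖) : Gam d x < 1 :=
  rpow_lt_one_of_one_lt_of_neg h lin!

lemma G1_eq (hd : 0 < d) {x : E n} (h : 1 ≤ ‖x‖) : G1 d x = Gam d x := by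
  rw [G1_of_ne (norm_pos_iff.1 lin!), Phi_eq (Gam_le_one hd h)]
lemma G1_le {x : E n} (h : x ≠ 0) : G1 d x ≤ Gam d x := by rw [G1_of_ne h]; exact Phi_le
lemma G1_nonneg (x : E n) : 0 ≤ G1 d x := by
  unfold G1; split_ifs
  · exact Phi_nonneg num!
  · exact Phi_nonneg (Gam_nonneg x)
lemma G1_le_two (x : E n) : G1 d x ≤ Phi 2 := by
  unfold G1; split_ifs
  · exact le_rfl
  · exact Phi_le_two _

lemma G1_contDiff_three (hd : 0 < d) : ContDiff ℝ 3 (G1 (n := n) d) := by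
  rw [contDiff_iff_contDiffAt]
  intro x
  rcases eq_or_ne x 0 with rfl | hx
  · have : G1 (n := n) d =ᶠ[𝓝 0] fun _ => Phi 2 := by
      have hr : (0 : ℝ) < (2 : ℝ) ^ (-(1 / d)) := pos!
      filter_upwards [ball_mem_nhds (0 : E n) hr] with y hy
      unfold G1; split_ifs with h
      · rfl
      · apply Phi_eq_two
        rw [mem_ball_zero_iff] at hy
        have h2 := rpow_anti (norm_pos_iff.2 h) hy.le (lin! : -d ≤ 0)
        rw [← rpow_mul num!] at h2
        rw [show -(1 / d) * -d = 1 by field_simp, rpow_one] at h2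
        exact h2
    exact contDiffAt_const.congr_of_eventuallyEq this
  · have : G1 (n := n) d =ᶠ[𝓝 x] fun y => Phi (Gam d y) := by
      filter_upwards [isOpen_compl_singleton.mem_nhds hx] with y hy using G1_of_ne hy
    exact ((Phi_contDiff_three.contDiffAt).comp x (Gam_contDiffAt hx)).congr_of_eventuallyEq this
lemma G1_contDiff (hd : 0 < d) : ContDiff ℝ 2 (G1 (n := n) d) :=
  (G1_contDiff_three hd).of_le num!

lemma G1_measurable (hd : 0 < d) : Measurable (G1 (n := n) d) := (G1_contDiff hd).continuous.measurable

lemma weighted_integrable_const (P : Par n σ d N) :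
    Integrable (fun x : E n => (1 + ‖x‖) ^ (-N)) := by
  apply integrable_one_add_norm
  rw [finrank_euclideanSpace_fin]; exact P.nN

lemma adm_of_bounded (P : Par n σ d N) {φ : E n → ℝ} (h : ContDiff ℝ 2 φ) {M : ℝ}
    (hM : ∀ x, |φ x| ≤ M) : Adm N φ univ where
  meas := h.continuous.measurable
  op := isOpen_univ
  smooth := h.contDiffOn
  int := ((weighted_integrable_const P).const_mul M).mono'
    ((h.continuous.measurable.abs.mul (by fun_prop)).aestronglyMeasurable)
    (.of_forall fun x => by
      rw [norm_of_nonneg pos!]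
      have := hM x
      gcongr)

lemma G1_abs_le (x : E n) : |G1 d x| ≤ Phi 2 := by
  rw [abs_of_nonneg (G1_nonneg x)]; exact G1_le_two x

lemma G1_adm (P : Par n σ d N) : Adm N (G1 (n := n) d) univ :=
  adm_of_bounded P (G1_contDiff P.d0) G1_abs_le

/-- The gap between the fundamental solution and its regularization. -/
def Psi1 (d : ℝ) (x : E n) : ℝ := if x = 0 then 0 else Gam d x - G1 d x

lemma Psi1_of_ne {x : E n} (h : x ≠ 0) : Psi1 d x = Gam d x - G1 d x := if_neg h
lemma Psi1_neg (x : E n) : Psi1 d (-x) = Psi1 d x := by simp [Psi1, Gam_neg, G1_neg]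
lemma Psi1_nonneg (x : E n) : 0 ≤ Psi1 d x := by
  unfold Psi1; split_ifs with h
  · exact le_rfl
  · linarith [G1_le (d := d) h]
lemma Psi1_le (x : E n) : Psi1 d x ≤ Gam d x := by
  unfold Psi1; split_ifs with h
  · exact Gam_nonneg x
  · linarith [G1_nonneg (d := d) x]
lemma Psi1_eq_zero (hd : 0 < d) {x : E n} (h : 1 ≤ ‖x‖) : Psi1 d x = 0 := by
  unfold Psi1; split_ifs
  · rfl
  · rw [G1_eq hd h, sub_self]
lemma Psi1_measurable (hd : 0 < d) : Measurable (Psi1 (n := n) d) :=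
  Measurable.ite (measurableSet_singleton 0) measurable_const (Gam_measurable.sub (G1_measurable hd))
lemma Psi1_integrable (P : Par n σ d N) : Integrable (Psi1 (n := n) d) := by
  have : Integrable ((ball (0 : E n) 1).indicator (Gam d)) :=
    (integrable_indicator_iff measurableSet_ball).2 (ker_integrable_ball P.n1 P.dn 1)
  refine this.mono' (Psi1_measurable P.d0).aestronglyMeasurable (.of_forall fun x => ?_)
  rw [norm_of_nonneg (Psi1_nonneg x)]
  by_cases hx : x ∈ ball (0 : E n) 1
  · rw [indicator_of_mem hx]; exact Psi1_le x
  · rw [indicator_of_notMem hx, Psi1_eq_zero P.d0 (by simpa using hx)]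

/-- The fractional Laplacian of the regularized fundamental solution. -/
def gam (d N : ℝ) (x : E n) : ℝ := Lop N (G1 d) x

lemma gam_neg (x : E n) : gam d N (-x) = gam d N x := by
  have := Lop_isometry (N := N) (LinearIsometryEquiv.neg ℝ) (G1 (n := n) d) x
  simp only [LinearIsometryEquiv.coe_neg, G1_neg] at this
  exact this.symm

lemma Lop_continuous (P : Par n σ d N) {φ : E n → ℝ} (h : ContDiff ℝ 2 φ) {M : ℝ}
    (hM : ∀ x, |φ x| ≤ M) : Continuous (Lop N φ) := by
  rw [continuous_iff_continuousAt]
  intro x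
  obtain ⟨C, hC, ρ', hρ', hb⟩ := exists_D2_bound_on_compact isOpen_univ h.contDiffOn
    (isCompact_closedBall x 1) (subset_univ _)
  have hM0 := (abs_nonneg _).trans (hM 0)
  set ρ := min ρ' 1
  refine continuousAt_of_dominated (bound := fun y => (C + 4 * M / ρ ^ 2) * mker N y)
    (.of_forall fun z =>
      (Lint_measurable_right h.continuous.measurable z).aestronglyMeasurable) ?_
    ((mker_integrable P).const_mul _) ?_
  · filter_upwards [closedBall_mem_nhds x one_pos] with z hz
    refine .of_forall fun y => ?_
    have hk : 0 ≤ ‖y‖ ^ (-N) := pos!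
    rw [Lint, norm_mul, norm_of_nonneg hk, mker, ← mul_assoc]
    gcongr
    have e : 0 ≤ 4 * M / ρ ^ 2 := pos!
    rcases le_total ‖y‖ ρ with hy | hy
    · rw [min_eq_left (pow_le_one₀ (norm_nonneg _) (hy.trans (min_le_right _ _)))]
      refine (hb z hz y (hy.trans (min_le_left _ _))).trans ?_
      gcongr; linarith
    · have h4 := norm_D2_le_four (F := φ) hM z y
      have : ρ ^ 2 ≤ min (‖y‖ ^ 2) 1 :=
        le_min (by gcongr) (pow_le_one₀ (lt_min hρ' one_pos).le (min_le_right _ _))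
      calc ‖D2 φ z y‖ ≤ 4 * M / ρ ^ 2 * ρ ^ 2 := by rw [div_mul_cancel₀ _ pos!]; exact h4
        _ ≤ (C + 4 * M / ρ ^ 2) * min (‖y‖ ^ 2) 1 := by gcongr; linarith
  · refine .of_forall fun y => ?_
    have := h.continuous
    unfold Lint D2
    fun_prop

lemma gam_continuous (P : Par n σ d N) : Continuous (gam (n := n) d N) :=
  Lop_continuous P (G1_contDiff P.d0) G1_abs_le

lemma Lint_G1_integrable (P : Par n σ d N) (x : E n) : Integrable (Lint N (G1 d) x) :=
  (G1_adm P).Lint_integrable P (mem_univ x)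

lemma gam_formula (P : Par n σ d N) {x : E n} (hx : 1 ≤ ‖x‖) :
    Integrable (fun z => Psi1 d z * ‖x - z‖ ^ (-N)) ∧
      gam d N x = 2 * ∫ z, Psi1 d z * ‖x - z‖ ^ (-N) := by
  have hx0 := norm_pos_iff.1 lin!
  have := P.nontriv
  have i1 := Lint_G1_integrable P x
  have i2 := (Gam_adm P).Lint_integrable P (x := x) hx0
  have hae : ∀ᵐ y : E n, Lint N (G1 d) x y - Lint N (Gam d) x y
      = Psi1 d (x + y) * ‖y‖ ^ (-N) + Psi1 d (x - y) * ‖y‖ ^ (-N) := by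
    have a1 : ∀ᵐ y : E n, y ≠ x := compl_mem_ae_iff.2 (measure_singleton x)
    filter_upwards [a1, compl_mem_ae_iff.2 (measure_singleton (-x))] with y h1 h2
    have e1 := sub_ne_zero.2 h1.symm
    rw [Psi1_of_ne e1, Psi1_of_ne
        (fun h => h2 (eq_neg_of_add_eq_zero_right h)), Lint, Lint, D2, D2, G1_eq P.d0 hx]
    ring
  have hN : ∀ y : E n, 0 ≤ ‖y‖ ^ (-N) := fun y => pos!
  have i4 : Integrable (fun y => Psi1 d (x - y) * ‖y‖ ^ (-N)) := by
    refine ((i1.sub i2).congr hae).mono' ?_ (.of_forall fun y => ?_)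
    · exact (((Psi1_measurable P.d0).comp (measurable_const.sub measurable_id)).mul
        (ker_measurable _)).aestronglyMeasurable
    · have := mul_nonneg (Psi1_nonneg (d := d) (x - y)) (hN y)
      have := mul_nonneg (Psi1_nonneg (d := d) (x + y)) (hN y)
      rw [norm_of_nonneg (by assumption)]
      linarith
  have i5 : Integrable (fun y => Psi1 d (x + y) * ‖y‖ ^ (-N)) := by
    have := i4.comp_neg
    simpa using this
  have i6 : Integrable (fun z => Psi1 d z * ‖x - z‖ ^ (-N)) := by
    have := i4.comp_sub_left x
    simpa using this
  refine ⟨i6, ?_⟩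
  have h1 : gam d N x = ∫ y, (Lint N (G1 d) x y - Lint N (Gam d) x y) := by
    rw [integral_sub i1 i2]
    have := Lop_Gam P hx0
    rw [Lop] at this
    rw [this, sub_zero]; rfl
  rw [h1, integral_congr_ae hae, integral_add i5 i4]
  have e1 : ∫ y, Psi1 d (x + y) * ‖y‖ ^ (-N) = ∫ y, Psi1 d (x - y) * ‖y‖ ^ (-N) := by
    rw [← integral_neg_eq_self]; simp [sub_eq_add_neg]
  have e2 : ∫ y, Psi1 d (x - y) * ‖y‖ ^ (-N) = ∫ z, Psi1 d z * ‖x - z‖ ^ (-N) := by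
    rw [← integral_sub_left_eq_self _ _ x]; simp
  rw [e1, e2]; ring

end regularized

open Real

section gamma
variable {n : ℕ} {σ d N : ℝ}

lemma Phi_lt {s : ℝ} (h : 1 < s) : Phi s < s := by
  have h1 := Phi_tangent ((1 + s) / 2) s
  have h2 := @Phi_le ((1 + s) / 2)
  have h3 := cutSlope_lt_one (t := (1 + s) / 2) lin!
  nlinarith

lemma Phi_lip {a b : ℝ} (h : a ≤ b) : Phi b - Phi a ≤ b - a := by
  have h1 := Phi_tangent a b
  nlinarith [cutSlope_le_one a]

lemma one_lt_Gam (hd : 0 < d) {x : E n} (h0 : x ≠ 0) (h : ‖x‖ < 1) : 1 < Gam d x :=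
  one_lt_rpow_of_pos_of_lt_one_of_neg (norm_pos_iff.2 h0) h lin!

lemma Psi1_pos (hd : 0 < d) {x : E n} (h0 : x ≠ 0) (h : ‖x‖ < 1) : 0 < Psi1 d x := by
  rw [Psi1_of_ne h0, G1_of_ne h0]
  linarith [Phi_lt (one_lt_Gam hd h0 h)]

lemma Psi1_integral_pos (P : Par n σ d N) : 0 < ∫ x : E n, Psi1 d x := by
  rw [integral_pos_iff_support_of_nonneg Psi1_nonneg (Psi1_integrable P)]
  have h : ball (0 : E n) 1 \ {0} ⊆ Function.support (Psi1 (n := n) d) := fun x hx =>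
    (Psi1_pos P.d0 (by simpa using hx.2) (by simpa using hx.1)).ne'
  refine lt_of_lt_of_le ?_ (measure_mono h)
  have := P.nontriv
  rw [measure_sdiff_null (measure_singleton _)]
  exact measure_ball_pos _ _ one_pos

lemma lt_norm_of_two_lt {x y : E n} (hx : ‖x‖ < 1) (hy : 2 < ‖y‖) : 1 < ‖x + y‖ := by
  have := norm_sub_norm_le y (-x)
  rw [norm_neg, sub_neg_eq_add, add_comm y x] at this; linarith

lemma gam_pos_of_lt (P : Par n σ d N) {x : E n} (hx : ‖x‖ < 1) : 0 < gam d N x := by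
  have := P.nontriv
  have a1 : ∀ᵐ y : E n, y ≠ x := compl_mem_ae_iff.2 (measure_singleton x)
  have i1 := Lint_G1_integrable P x
  obtain ⟨m, i2, h2, hm, hm'⟩ : ∃ m : ℝ, Integrable (fun y => m * Lint N (Gam d) x y) ∧
      (∫ y, m * Lint N (Gam d) x y) = 0 ∧
      (∀ z : E n, z ≠ 0 → G1 d z ≤ G1 d x + m * (Gam d z - Gam d x)) ∧
      (∀ z : E n, 1 < ‖z‖ → G1 d z < G1 d x + m * (Gam d z - Gam d x)) := by
    rcases eq_or_ne x 0 with rfl | h0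
    · refine ⟨0, by simp, by simp, fun z _ => ?_, fun z hz => ?_⟩
      · rw [G1_zero, zero_mul, add_zero]; exact G1_le_two z
      · rw [G1_zero, G1_eq P.d0 hz.le, zero_mul, add_zero]
        exact (Gam_lt_one P.d0 hz).trans_le one_le_Phi_two
    · refine ⟨cutSlope (Gam d x), ((Gam_adm P).Lint_integrable P h0).const_mul _, ?_,
        fun z hz => ?_, fun z hz => ?_⟩
      · have := Lop_Gam P h0
        rw [Lop] at this
        rw [integral_const_mul, this, mul_zero]
      · rw [G1_of_ne hz, G1_of_ne h0]; exact Phi_tangent _ _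
      · rw [G1_of_ne (norm_pos_iff.1 lin!), G1_of_ne h0]
        exact Phi_tangent_strict (one_lt_Gam P.d0 h0 hx) (Gam_lt_one P.d0 hz)
  have h1 : gam d N x = ∫ y, (Lint N (G1 d) x y - m * Lint N (Gam d) x y) := by
    rw [integral_sub i1 i2, h2, sub_zero]; rfl
  have i3 : Integrable (fun y => Lint N (G1 d) x y - m * Lint N (Gam d) x y) := i1.sub i2
  rw [h1, integral_pos_iff_support_of_nonneg_ae _ i3]
  · have h : (closedBall (0 : E n) 2)ᶜ ⊆
        Function.support (fun y => Lint N (G1 d) x y - m * Lint N (Gam d) x y) := by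
      intro y hy
      simp only [mem_compl_iff, mem_closedBall_zero_iff, not_le] at hy
      have e1 := hm' (x + y) (lt_norm_of_two_lt hx hy)
      have e2 := hm' (x - y) (by rw [sub_eq_add_neg]; exact lt_norm_of_two_lt hx (by rwa [norm_neg]))
      have hk : 0 < ‖y‖ ^ (-N) := rpow_pos_of_pos lin! _
      apply ne_of_gt
      simp only [Lint, D2, smul_eq_mul]
      nlinarith
    refine lt_of_lt_of_le ?_ (measure_mono h)
    refine isClosed_closedBall.isOpen_compl.measure_pos _ ?_
    obtain ⟨e, he⟩ := exists_norm_eq (E n) (c := 3) num!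
    exact ⟨e, by simp [he]; norm_num⟩
  · filter_upwards [a1, compl_mem_ae_iff.2 (measure_singleton (-x))] with y h1 h2
    have e1 := hm (x + y) fun h => h2 (eq_neg_of_add_eq_zero_right h)
    have e2 := hm (x - y) (sub_ne_zero.2 h1.symm)
    have hk : 0 ≤ ‖y‖ ^ (-N) := pos!
    simp only [Lint, D2, smul_eq_mul, Pi.zero_apply]
    nlinarith

lemma gam_lower (P : Par n σ d N) {x : E n} (hx : 1 ≤ ‖x‖) :
    2 * (2 * ‖x‖) ^ (-N) * (∫ z : E n, Psi1 d z) ≤ gam d N x := by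
  have := P.nontriv
  obtain ⟨hi, he⟩ := gam_formula P hx
  rw [he, mul_assoc, ← integral_const_mul]
  refine mul_le_l ?_
  refine integral_mono_ae ((Psi1_integrable P).const_mul _) hi ?_
  have a1 : ∀ᵐ y : E n, y ≠ x := compl_mem_ae_iff.2 (measure_singleton x)
  filter_upwards [a1] with z hzx
  change (2 * ‖x‖) ^ (-N) * Psi1 d z ≤ Psi1 d z * ‖x - z‖ ^ (-N)
  rw [mul_comm]
  rcases le_or_gt 1 ‖z‖ with hz | hz
  · rw [Psi1_eq_zero P.d0 hz]; simp
  · refine mul_le_l ?_ (Psi1_nonneg z)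
    refine rpow_anti (norm_pos_iff.2 (sub_ne_zero.2 hzx.symm)) ?_
      (by linarith [P.N0])
    linarith [norm_sub_le x z]

lemma gam_upper (P : Par n σ d N) {x : E n} (hx : 2 ≤ ‖x‖) :
    gam d N x ≤ 2 * (‖x‖ / 2) ^ (-N) * (∫ z : E n, Psi1 d z) := by
  obtain ⟨hi, he⟩ := gam_formula P (x := x) lin!
  rw [he, mul_assoc, ← integral_const_mul ((‖x‖ / 2) ^ (-N))]
  refine mul_le_l ?_
  refine integral_mono hi ((Psi1_integrable P).const_mul _) fun z => ?_
  change Psi1 d z * ‖x - z‖ ^ (-N) ≤ (‖x‖ / 2) ^ (-N) * Psi1 d z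
  rw [mul_comm]
  rcases le_or_gt 1 ‖z‖ with hz | hz
  · rw [Psi1_eq_zero P.d0 hz]; simp
  · refine mul_le_r ?_ (Psi1_nonneg z)
    refine rpow_anti lin! ?_ (by linarith [P.N0])
    linarith [norm_sub_norm_le x z]

lemma gam_pos (P : Par n σ d N) (x : E n) : 0 < gam d N x := by
  rcases lt_or_ge ‖x‖ 1 with h | h
  · exact gam_pos_of_lt P h
  · refine lt_of_lt_of_le ?_ (gam_lower P h)
    have := Psi1_integral_pos (n := n) P
    have : 0 < ‖x‖ := lin!
    positivity

lemma exists_gam_bounds (P : Par n σ d N) : ∃ c > 0, ∃ C > 0, ∀ x : E n,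
    c * (1 + ‖x‖) ^ (-N) ≤ gam d N x ∧ gam d N x ≤ C * (1 + ‖x‖) ^ (-N) := by
  have hI := Psi1_integral_pos (n := n) P
  set I := ∫ x : E n, Psi1 d x
  have hN := P.N0
  have hcpt := isCompact_closedBall (0 : E n) 2
  have hne : (closedBall (0 : E n) 2).Nonempty := ⟨0, by simp⟩
  obtain ⟨a, -, ha⟩ := hcpt.exists_isMinOn hne (gam_continuous P (d := d)).continuousOn
  obtain ⟨b, -, hb⟩ := hcpt.exists_isMaxOn hne (gam_continuous P (d := d)).continuousOn
  have hga := gam_pos P a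
  have hgb := gam_pos P b
  refine ⟨min (gam d N a) (2 * 2 ^ (-N) * I), pos!,
    max (gam d N b * 3 ^ N) (2 * 4 ^ N * I), pos!, fun x => ?_⟩
  rcases le_or_gt ‖x‖ 2 with h | h
  · have hxm : x ∈ closedBall (0 : E n) 2 := by simpa using h
    constructor
    · refine le_trans ?_ (ha hxm)
      have : (1 + ‖x‖) ^ (-N) ≤ 1 :=
        rpow_le_one_of_one_le_of_nonpos (by linarith [norm_nonneg x]) lin!
      calc _ ≤ gam d N a * 1 := by gcongr; exact min_le_left _ _
        _ = _ := mul_one _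
    · refine le_trans (hb hxm) ?_
      have : (3 : ℝ) ^ (-N) ≤ (1 + ‖x‖) ^ (-N) :=
        rpow_anti pos! lin!
      calc gam d N b = gam d N b * 3 ^ N * 3 ^ (-N) := by
            rw [mul_assoc, ← rpow_add num!]; simp
        _ ≤ _ := by gcongr; exact le_max_left _ _
  · have hx0 : 0 < ‖x‖ := lin!
    constructor
    · refine le_trans ?_ (gam_lower P lin!)
      rw [mul_rpow num! hx0.le]
      have : (1 + ‖x‖) ^ (-N) ≤ ‖x‖ ^ (-N) :=
        rpow_anti hx0 lin!
      calc _ ≤ (2 * 2 ^ (-N) * I) * ‖x‖ ^ (-N) := by gcongr; exact min_le_right _ _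
        _ = _ := by ring
    · refine le_trans (gam_upper P h.le) ?_
      have : (‖x‖ / 2) ^ (-N) ≤ ((1 + ‖x‖) / 4) ^ (-N) :=
        rpow_anti pos! lin!
      rw [div_rpow (x := 1 + ‖x‖) pos! num!,
        rpow_neg (num! : (0:ℝ) ≤ 4), div_inv_eq_mul] at this
      calc _ ≤ 2 * ((1 + ‖x‖) ^ (-N) * 4 ^ N) * I := by gcongr
        _ = 2 * 4 ^ N * I * (1 + ‖x‖) ^ (-N) := by ring
        _ ≤ _ := by gcongr; exact le_max_right _ _

lemma gam_integrable (P : Par n σ d N) : Integrable (gam (n := n) d N) := by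
  obtain ⟨c, -, C, -, h⟩ := exists_gam_bounds (n := n) P
  refine ((weighted_integrable_const P).const_mul C).mono' (gam_continuous P).aestronglyMeasurable
    (.of_forall fun x => ?_)
  rw [norm_of_nonneg (gam_pos P x).le]; exact (h x).2

/-- The total mass of the regularized Dirac mass. -/
def kap (n : ℕ) (d N : ℝ) : ℝ := ∫ x : E n, gam d N x

lemma kap_pos (P : Par n σ d N) : 0 < kap n d N := by
  rw [kap, integral_pos_iff_support_of_nonneg (fun x => (gam_pos P x).le) (gam_integrable P)]
  rw [show Function.support (gam (n := n) d N) = univ from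
    eq_univ_of_forall fun x => (gam_pos P x).ne']
  exact isOpen_univ.measure_pos _ ⟨0, trivial⟩

/-- `gam` is log-uniformly continuous. -/
lemma exists_gam_ratio (P : Par n σ d N) {η : ℝ} (hη : 0 < η) :
    ∃ δ > 0, ∀ x x' : E n, ‖x - x'‖ ≤ δ → gam d N x ≤ (1 + η) * gam d N x' := by
  have hN := P.N0
  have hcpt := isCompact_closedBall (0 : E n) 4
  obtain ⟨a, -, ha⟩ := hcpt.exists_isMinOn ⟨0, by simp⟩ (gam_continuous P (d := d)).continuousOn
  have hga := gam_pos P a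
  obtain ⟨δ₁, hδ₁, h1⟩ := Metric.uniformContinuousOn_iff.1
    (hcpt.uniformContinuousOn_of_continuous (gam_continuous P (d := d)).continuousOn)
    (η * gam d N a) pos!
  have hlim : Tendsto (fun t : ℝ => (1 - t) ^ (-N)) (𝓝[>] 0) (𝓝 1) := by
    have : ContinuousAt (fun t : ℝ => (1 - t) ^ (-N)) 0 :=
      ContinuousAt.rpow_const (by fun_prop) (Or.inl num!)
    have h2 := this.tendsto
    simp only [sub_zero, one_rpow] at h2
    exact h2.mono_left nhdsWithin_le_nhds
  obtain ⟨δ₂, h2, hδ₂0, hδ₂1⟩ := ((hlim.eventually_lt_const (show (1 : ℝ) < 1 + η by linarith)).and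
    (Ioo_mem_nhdsGT (show (0 : ℝ) < 1 by norm_num))).exists
  refine ⟨min (δ₁ / 2) δ₂, pos!, fun x x' hx => ?_⟩
  have hx1 : ‖x - x'‖ < δ₁ := by linarith [hx.trans (min_le_left _ _)]
  have hx2 := hx.trans (min_le_right _ _)
  rcases le_or_gt ‖x'‖ 3 with h | h
  · have hxm' : x' ∈ closedBall (0 : E n) 4 := by simp; linarith
    have hxm : x ∈ closedBall (0 : E n) 4 := by
      simp only [mem_closedBall_zero_iff]; linarith [norm_sub_norm_le x x']
    have h3 := h1 x hxm x' hxm' (by rwa [dist_eq_norm])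
    rw [dist_eq] at h3
    have h4 : gam d N a ≤ gam d N x' := ha hxm'
    have := (abs_lt.1 h3).2
    nlinarith
  · have hx3 : 2 ≤ ‖x‖ := by
      have := norm_sub_norm_le x' x; rw [norm_sub_rev] at this; linarith
    obtain ⟨hi, he⟩ := gam_formula P (x := x) lin!
    obtain ⟨hi', he'⟩ := gam_formula P (x := x') lin!
    rw [he, he', mul_left_comm, ← integral_const_mul (1 + η)]
    refine mul_le_l (integral_mono hi (hi'.const_mul _) fun z => ?_)
    change Psi1 d z * ‖x - z‖ ^ (-N) ≤ (1 + η) * (Psi1 d z * ‖x' - z‖ ^ (-N))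
    rcases le_or_gt 1 ‖z‖ with hz | hz
    · rw [Psi1_eq_zero P.d0 hz]; simp
    · rw [mul_left_comm]
      refine mul_le_l ?_ (Psi1_nonneg z)
      have e1 : 1 ≤ ‖x' - z‖ := by linarith [norm_sub_norm_le x' z]
      have e2 : (1 - δ₂) * ‖x' - z‖ ≤ ‖x - z‖ := by
        have := norm_sub_norm_le (x' - z) (x - z)
        rw [sub_sub_sub_cancel_right, norm_sub_rev x' x] at this
        nlinarith
      calc ‖x - z‖ ^ (-N) ≤ ((1 - δ₂) * ‖x' - z‖) ^ (-N) :=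
            rpow_anti (mul_pos lin! lin!) e2
        _ = (1 - δ₂) ^ (-N) * ‖x' - z‖ ^ (-N) :=
            mul_rpow lin! lin!
        _ ≤ _ := by gcongr

end gamma

section scaled
variable {n : ℕ} {σ d N : ℝ}

/-- Regularized fundamental solution at scale `r`. -/
def Gr (d r : ℝ) (x : E n) : ℝ := r ^ (-d) * G1 d (r⁻¹ • x)
/-- Gap at scale `r`. -/
def Psr (d r : ℝ) (x : E n) : ℝ := r ^ (-d) * Psi1 d (r⁻¹ • x)
/-- Regularized Dirac mass at scale `r`. -/
def gar (d N r : ℝ) (x : E n) : ℝ := r ^ (-(n : ℝ)) * gam d N (r⁻¹ • x)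

variable {r : ℝ}

lemma Gam_inv_smul (hr : 0 < r) (x : E n) : Gam d (r⁻¹ • x) = r ^ d * Gam d x := by
  rw [Gam_smul (inv_pos.2 hr), inv_rpow hr.le, rpow_neg hr.le, inv_inv]
lemma rpow_cancel (hr : 0 < r) : r ^ (-d) * r ^ d = 1 := by
  rw [← rpow_add hr]; simp
lemma smul_ne (hr : 0 < r) {x : E n} (hx : x ≠ 0) : r⁻¹ • x ≠ 0 :=
  smul_ne_zero (inv_ne_zero hr.ne') hx
lemma one_le_norm_inv_smul (hr : 0 < r) {x : E n} (h : r ≤ ‖x‖) : 1 ≤ ‖r⁻¹ • x‖ := by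
  rw [norm_smul, norm_inv, norm_of_nonneg hr.le, inv_mul_eq_div, one_le_div hr]; exact h

lemma Gr_of_ne (hr : 0 < r) {x : E n} (hx : x ≠ 0) :
    Gr d r x = r ^ (-d) * Phi (r ^ d * Gam d x) := by
  rw [Gr, G1_of_ne (smul_ne hr hx), Gam_inv_smul hr]
lemma Psr_neg (x : E n) : Psr d r (-x) = Psr d r x := by rw [Psr, Psr, smul_neg, Psi1_neg]
lemma Gr_eq (hd : 0 < d) (hr : 0 < r) {x : E n} (h : r ≤ ‖x‖) : Gr d r x = Gam d x := by
  rw [Gr, G1_eq hd (one_le_norm_inv_smul hr h), Gam_inv_smul hr, ← mul_assoc, rpow_cancel hr, one_mul]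
lemma Psr_of_ne (hr : 0 < r) {x : E n} (hx : x ≠ 0) : Psr d r x = Gam d x - Gr d r x := by
  rw [Psr, Psi1_of_ne (smul_ne hr hx), Gam_inv_smul hr, Gr, mul_sub, ← mul_assoc, rpow_cancel hr,
    one_mul]
lemma Gr_nonneg (hr : 0 < r) (x : E n) : 0 ≤ Gr d r x :=
  mul_nonneg pos! (G1_nonneg _)
lemma Gr_le_two (hr : 0 < r) (x : E n) : Gr d r x ≤ Phi 2 * r ^ (-d) := by
  rw [Gr, mul_comm]; gcongr; exact G1_le_two _
lemma Gr_abs_le (hr : 0 < r) (x : E n) : |Gr d r x| ≤ Phi 2 * r ^ (-d) := by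
  rw [abs_of_nonneg (Gr_nonneg hr x)]; exact Gr_le_two hr x
lemma Gr_contDiff_three (hd : 0 < d) : ContDiff ℝ 3 (Gr (n := n) d r) :=
  contDiff_const.mul ((G1_contDiff_three hd).comp (contDiff_const_smul _))
lemma Gr_contDiff (hd : 0 < d) : ContDiff ℝ 2 (Gr (n := n) d r) :=
  (Gr_contDiff_three hd).of_le num!
lemma Psr_nonneg (hr : 0 < r) (x : E n) : 0 ≤ Psr d r x :=
  mul_nonneg pos! (Psi1_nonneg _)
lemma Psr_le (hr : 0 < r) (x : E n) : Psr d r x ≤ Gam d x := by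
  rcases eq_or_ne x 0 with rfl | hx
  · simpa [Psr, Psi1] using Gam_nonneg 0
  · rw [Psr_of_ne hr hx]; linarith [Gr_nonneg (d := d) hr x]
lemma Psr_eq_zero (hd : 0 < d) (hr : 0 < r) {x : E n} (h : r ≤ ‖x‖) : Psr d r x = 0 := by
  rw [Psr, Psi1_eq_zero hd (one_le_norm_inv_smul hr h), mul_zero]
lemma Psr_measurable (hd : 0 < d) : Measurable (Psr (n := n) d r) :=
  ((Psi1_measurable hd).comp (measurable_const_smul _)).const_mul _
lemma Psr_integrable (P : Par n σ d N) (hr : 0 < r) : Integrable (Psr (n := n) d r) :=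
  ((Psi1_integrable P).comp_smul (inv_ne_zero hr.ne')).const_mul _
lemma integral_comp_inv_smul (hr : 0 < r) (f : E n → ℝ) :
    ∫ x, f (r⁻¹ • x) = r ^ (n : ℝ) * ∫ x, f x := by
  rw [integral_scale f (inv_pos.2 hr), ← mul_assoc, ← mul_rpow hr.le pos!,
    mul_inv_cancel₀ hr.ne', one_rpow, one_mul]
lemma Psr_integral (P : Par n σ d N) (hr : 0 < r) :
    ∫ x : E n, Psr d r x = r ^ (2 * σ) * ∫ x : E n, Psi1 d x := by
  simp only [Psr]
  rw [integral_const_mul, integral_comp_inv_smul hr, ← mul_assoc, ← rpow_add hr,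
    show -d + (n : ℝ) = 2 * σ by linarith [P.nd]]

lemma Gr_antitone {s : ℝ} (hd : 0 < d) (hr : 0 < r) (hrs : r ≤ s) (x : E n) : Gr d s x ≤ Gr d r x := by
  have hs := hr.trans_le hrs
  rcases eq_or_ne x 0 with rfl | hx
  · rw [Gr, Gr, smul_zero, smul_zero]
    refine mul_le_r ?_ (G1_nonneg 0)
    exact rpow_anti hr hrs
  · have hg := Gam_pos (d := d) hx
    have h := Phi_star (a := r ^ d * Gam d x) (b := s ^ d * Gam d x) pos! (by gcongr)
    rw [Gr_of_ne hr hx, Gr_of_ne hs hx, rpow_neg hr.le, rpow_neg hs.le,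
      inv_mul_eq_div, inv_mul_eq_div, div_le_div_iff₀ pos! pos!]
    refine le_of_mul_le_mul_right ?_ hg
    linarith

lemma abs_Psr_sub_le (hr : 0 < r) {x y : E n} (hx : x ≠ 0) (hy : y ≠ 0) :
    |Psr d r x - Psr d r y| ≤ |Gam d x - Gam d y| := by
  wlog h : Gam d y ≤ Gam d x generalizing x y
  · rw [abs_sub_comm, abs_sub_comm (Gam d x)]; exact this hy hx (le_of_not_ge h)
  have h1 : r ^ d * Gam d y ≤ r ^ d * Gam d x := by gcongr
  have hk : 0 ≤ r ^ (-d) := pos!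
  have h5 := mul_le_l (Phi_lip h1) hk
  have h6 := mul_le_l (Phi_mono h1) hk
  have h7 : r ^ (-d) * (r ^ d * Gam d x - r ^ d * Gam d y) = Gam d x - Gam d y := by
    linear_combination (Gam d x - Gam d y) * (rpow_cancel (d := d) hr)
  rw [Psr_of_ne hr hx, Psr_of_ne hr hy, Gr_of_ne hr hx, Gr_of_ne hr hy,
    abs_of_nonneg (sub_nonneg.2 h), abs_le]
  constructor <;> linarith

lemma Lop_Gr (P : Par n σ d N) (hr : 0 < r) (x : E n) : Lop N (Gr d r) x = gar d N r x := by
  have h1 := Lop_const_mul (N := N) (r ^ (-d)) (fun z : E n => G1 d (r⁻¹ • z)) x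
  rw [Lop_scale P _ (inv_pos.2 hr), inv_rpow hr.le, ← rpow_neg hr.le, ← mul_assoc,
    ← rpow_add hr, show -d + -(2 * σ) = -(n : ℝ) by linarith [P.nd]] at h1
  exact h1

lemma gar_pos (P : Par n σ d N) (hr : 0 < r) (x : E n) : 0 < gar d N r x :=
  mul_pos pos! (gam_pos P _)
lemma gar_continuous (P : Par n σ d N) : Continuous (gar (n := n) d N r) :=
  continuous_const.mul ((gam_continuous P).comp (continuous_const_smul _))

lemma gar_scale_aux (P : Par n σ d N) (hr : 0 < r) (x : E n) :
    r ^ (-(n : ℝ)) * (1 + ‖r⁻¹ • x‖) ^ (-N) = r ^ (2 * σ) * (r + ‖x‖) ^ (-N) := by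
  rw [norm_smul, norm_inv, norm_of_nonneg hr.le, inv_mul_eq_div,
    show 1 + ‖x‖ / r = (r + ‖x‖) / r by field_simp,
    div_rpow pos! hr.le, rpow_neg hr.le N, div_inv_eq_mul, mul_comm _ (r ^ N),
    ← mul_assoc, ← rpow_add hr, show -(n : ℝ) + N = 2 * σ by linarith [P.hN]]

lemma exists_gar_bounds (P : Par n σ d N) : ∃ c > 0, ∃ C > 0, ∀ r > 0, ∀ x : E n,
    c * (r ^ (2 * σ) * (r + ‖x‖) ^ (-N)) ≤ gar d N r x ∧
    gar d N r x ≤ C * (r ^ (2 * σ) * (r + ‖x‖) ^ (-N)) := by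
  obtain ⟨c, hc, C, hC, h⟩ := exists_gam_bounds (n := n) P
  refine ⟨c, hc, C, hC, fun r hr x => ?_⟩
  have h1 := h (r⁻¹ • x)
  have hk : 0 ≤ r ^ (-(n : ℝ)) := pos!
  rw [← gar_scale_aux P hr, gar]
  constructor
  · rw [mul_left_comm]; exact mul_le_l h1.1 hk
  · rw [mul_left_comm]; exact mul_le_l h1.2 hk

lemma exists_gar_ratio (P : Par n σ d N) {η : ℝ} (hη : 0 < η) :
    ∃ δ > 0, ∀ r > 0, ∀ x x' : E n, ‖x - x'‖ ≤ δ * r → gar d N r x ≤ (1 + η) * gar d N r x' := by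
  obtain ⟨δ, hδ, h⟩ := exists_gam_ratio (n := n) P hη
  refine ⟨δ, hδ, fun r hr x x' hx => ?_⟩
  have := h (r⁻¹ • x) (r⁻¹ • x') (by
    rw [← smul_sub, norm_smul, norm_inv, norm_of_nonneg hr.le, inv_mul_eq_div, div_le_iff₀ hr]
    exact hx)
  rw [gar, gar, mul_left_comm]
  exact mul_le_l this

end scaled

open Real

section representation
variable {n : ℕ} {σ d N : ℝ}

/-- The weighted integrability class. -/
def Wt (N : ℝ) (u : E n → ℝ) : Prop :=
  Measurable u ∧ Integrable (fun x => |u x| * (1 + ‖x‖) ^ (-N))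

lemma Adm.wt {u : E n → ℝ} {U : Set (E n)} (h : Adm N u U) : Wt N u := ⟨h.meas, h.int⟩

lemma Wt.mul_decay {u g : E n → ℝ} (h : Wt N u) (hg : Measurable g) {C : ℝ}
    (hC : ∀ x, |g x| ≤ C * (1 + ‖x‖) ^ (-N)) : Integrable (fun x => u x * g x) := by
  refine (h.2.const_mul C).mono' (h.1.mul hg).aestronglyMeasurable (.of_forall fun x => ?_)
  rw [norm_mul, norm_eq_abs, norm_eq_abs, mul_left_comm]
  exact mul_le_l (hC x)

lemma shift_decay (hN : 0 < N) {r : ℝ} (hr : 0 < r) (x y : E n) :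
    (r + ‖x - y‖) ^ (-N) ≤ (1 + (1 + ‖y‖) / r) ^ N * (1 + ‖x‖) ^ (-N) := by
  have h : 1 + ‖x‖ ≤ (1 + (1 + ‖y‖) / r) * (r + ‖x - y‖) := by
    have h1 : ‖x‖ ≤ ‖x - y‖ + ‖y‖ := by simpa using norm_add_le (x - y) y
    have h2 : (1 + (1 + ‖y‖) / r) * (r + ‖x - y‖) =
      r + ‖x - y‖ + (1 + ‖y‖) + (1 + ‖y‖) / r * ‖x - y‖ := by field_simp; ring
    have h3 : 0 ≤ (1 + ‖y‖) / r * ‖x - y‖ := pos!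
    linarith
  have hK : 0 < 1 + (1 + ‖y‖) / r := pos!
  calc (r + ‖x - y‖) ^ (-N)
      = (1 + (1 + ‖y‖) / r) ^ N * ((1 + (1 + ‖y‖) / r) * (r + ‖x - y‖)) ^ (-N) := by
        rw [mul_rpow hK.le pos!, ← mul_assoc, ← rpow_add hK]; simp
    _ ≤ _ := by
        refine mul_le_l ?_
        exact rpow_anti pos! h

lemma Wt.mul_gar_integrable (P : Par n σ d N) {u : E n → ℝ} (h : Wt N u) {r : ℝ} (hr : 0 < r)
    (y : E n) : Integrable (fun x => u x * gar d N r (x - y)) := by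
  obtain ⟨c, hc, C, hC, hb⟩ := exists_gar_bounds (n := n) P
  refine h.mul_decay ((gar_continuous P).measurable.comp (measurable_id.sub_const y))
    (C := C * r ^ (2 * σ) * (1 + (1 + ‖y‖) / r) ^ N) fun x => ?_
  rw [abs_of_pos (gar_pos P hr _)]
  refine (hb r hr _).2.trans ?_
  have := shift_decay P.N0 hr x y
  calc _ = C * r ^ (2 * σ) * (r + ‖x - y‖) ^ (-N) := by ring
    _ ≤ C * r ^ (2 * σ) * ((1 + (1 + ‖y‖) / r) ^ N * (1 + ‖x‖) ^ (-N)) := by gcongr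
    _ = _ := by ring

lemma tendsto_integral_gar_near (P : Par n σ d N) {u : E n → ℝ} (h : Integrable u) {y : E n}
    (hy : ContinuousAt u y) :
    Tendsto (fun ε => ∫ x, u x * gar d N ε (x - y)) (𝓝[>] 0) (𝓝 (kap n d N * u y)) := by
  have hκ := kap_pos P
  obtain ⟨c, hc, C, hC, hb⟩ := exists_gam_bounds (n := n) P
  have h1 := tendsto_integral_comp_smul_smul_of_integrable' (μ := volume)
    (φ := fun x => (kap n d N)⁻¹ * gam d N x)
    (fun x => mul_nonneg (inv_nonneg.2 hκ.le) (gam_pos P x).le)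
    (by rw [integral_const_mul]; exact inv_mul_cancel₀ hκ.ne') ?_ h hy
  · have h2 := (h1.comp tendsto_inv_nhdsGT_zero).const_mul (kap n d N)
    refine Tendsto.congr' ?_ h2
    filter_upwards [self_mem_nhdsWithin] with ε (hε : 0 < ε)
    simp only [Function.comp, ← integral_const_mul]
    congr 1; ext x
    rw [finrank_euclideanSpace_fin, gar, ← neg_sub y x, smul_neg, gam_neg, smul_eq_mul,
      rpow_neg hε.le, rpow_natCast, inv_pow]
    field_simp
  · rw [finrank_euclideanSpace_fin]
    have hlim : Tendsto (fun x : E n => (kap n d N)⁻¹ * (C * ‖x‖ ^ (-(2 * σ))))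
        (Bornology.cobounded (E n)) (𝓝 0) := by
      have := ((tendsto_rpow_neg_atTop (y := 2 * σ) (by linarith [P.hσ0])).comp
        (tendsto_norm_cobounded_atTop (E := E n))).const_mul C |>.const_mul (kap n d N)⁻¹
      simpa using this
    refine tendsto_of_tendsto_of_tendsto_of_le_of_le' tendsto_const_nhds hlim
      (.of_forall fun x => mul_nonneg pos!
        (mul_nonneg (inv_nonneg.2 hκ.le) (gam_pos P x).le)) ?_
    filter_upwards [(tendsto_norm_cobounded_atTop (E := E n)).eventually_gt_atTop 0] with x hx
    rw [mul_left_comm]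
    refine mul_le_l ?_ (inv_nonneg.2 hκ.le)
    have h3 : (1 + ‖x‖) ^ (-N) ≤ ‖x‖ ^ (-N) :=
      rpow_anti hx lin! (by linarith [P.N0])
    calc ‖x‖ ^ n * gam d N x ≤ ‖x‖ ^ n * (C * ‖x‖ ^ (-N)) := by
          refine mul_le_l ((hb x).2.trans ?_)
          gcongr
      _ = C * ‖x‖ ^ (-(2 * σ)) := by
        rw [← rpow_natCast, mul_left_comm, ← rpow_add hx]
        congr 2; linarith [P.hN]

lemma tendsto_integral_gar (P : Par n σ d N) {u : E n → ℝ} (h : Wt N u) {y : E n}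
    (hy : ContinuousAt u y) :
    Tendsto (fun ε => ∫ x, u x * gar d N ε (x - y)) (𝓝[>] 0) (𝓝 (kap n d N * u y)) := by
  obtain ⟨c, hc, C, hC, hb⟩ := exists_gar_bounds (n := n) P
  have hN := P.N0
  set B := ball y 1
  have hmB : MeasurableSet B := measurableSet_ball
  have hBy := ball_mem_nhds y one_pos
  have hsub : B ⊆ ball 0 (1 + ‖y‖) := by
    intro x hx
    have : ‖x - y‖ < 1 := by simpa [B, dist_eq_norm] using hx
    rw [mem_ball_zero_iff]
    have h1 : ‖x‖ ≤ ‖x - y‖ + ‖y‖ := by simpa using norm_add_le (x - y) y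
    linarith
  have e : B.indicator u =ᶠ[𝓝 y] u := by filter_upwards [hBy] with x hx using indicator_of_mem hx u
  have t1 := tendsto_integral_gar_near P ((integrable_indicator_iff hmB).2
      ((integrableOn_of_weighted hN h.1 h.2 _).mono_set hsub)) (hy.congr_of_eventuallyEq e)
  rw [e.self_of_nhds] at t1
  have hw1 : Wt N (B.indicator u) := ⟨h.1.indicator hmB, h.2.mono'
    ((h.1.indicator hmB).abs.mul (by fun_prop)).aestronglyMeasurable (.of_forall fun x => by
      rw [norm_of_nonneg pos!]
      refine mul_le_r ?_
      exact (norm_indicator_le_norm_self u x))⟩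
  have hw2 : Wt N (Bᶜ.indicator u) := ⟨h.1.indicator hmB.compl, h.2.mono'
    ((h.1.indicator hmB.compl).abs.mul (by fun_prop)).aestronglyMeasurable
    (.of_forall fun x => by
      rw [norm_of_nonneg pos!]
      refine mul_le_r ?_
      exact (norm_indicator_le_norm_self u x))⟩
  set A := ∫ x, |u x| * (1 + ‖x‖) ^ (-N)
  have t2 : Tendsto (fun ε => ∫ x, Bᶜ.indicator u x * gar d N ε (x - y)) (𝓝[>] 0) (𝓝 0) := by
    have hlim : Tendsto (fun ε : ℝ => C * (1 + (1 + ‖y‖) / (1 / 2)) ^ N * 2 ^ N * A * ε ^ (2 * σ))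
        (𝓝[>] 0) (𝓝 0) := by
      have h0 : ContinuousAt (fun ε : ℝ => ε ^ (2 * σ)) 0 :=
        continuousAt_rpow_const _ _ (Or.inr (by linarith [P.hσ0]))
      have := (h0.tendsto.mono_left (nhdsWithin_le_nhds (s := Ioi 0))).const_mul
        (C * (1 + (1 + ‖y‖) / (1 / 2)) ^ N * 2 ^ N * A)
      rwa [zero_rpow (by linarith [P.hσ0]), mul_zero] at this
    refine squeeze_zero_norm' ?_ hlim
    filter_upwards [Ioo_mem_nhdsGT (show (0 : ℝ) < 1 by norm_num)] with ε hε
    have hε0 := hε.1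
    refine (norm_integral_le_of_norm_le (h.2.const_mul
      (C * (1 + (1 + ‖y‖) / (1 / 2)) ^ N * 2 ^ N * ε ^ (2 * σ)))
      (.of_forall fun x => ?_)).trans_eq (by rw [integral_const_mul]; ring)
    by_cases hx : x ∈ B
    · rw [indicator_of_notMem (by simpa using hx), zero_mul, norm_zero]; positivity
    · rw [indicator_of_mem (by simpa using hx), norm_mul, norm_eq_abs,
        norm_of_nonneg (gar_pos P hε0 _).le]
      have hx1 : 1 ≤ ‖x - y‖ := by simpa [B, dist_eq_norm] using hx
      have h1 := shift_decay hN (r := 1 / 2) num! x y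
      have h2 : (ε + ‖x - y‖) ^ (-N) ≤ (1 / 2 * (1 / 2 + ‖x - y‖)) ^ (-N) :=
        rpow_anti pos! lin!
      rw [mul_rpow num! pos!] at h2
      have h3 : ((1 : ℝ) / 2) ^ (-N) = 2 ^ N := by
        rw [one_div, inv_rpow num!, rpow_neg num!, inv_inv]
      rw [h3] at h2
      have h4 : (ε + ‖x - y‖) ^ (-N) ≤
          2 ^ N * ((1 + (1 + ‖y‖) / (1 / 2)) ^ N * (1 + ‖x‖) ^ (-N)) := by
        refine h2.trans ?_; gcongr
      calc |u x| * gar d N ε (x - y) ≤ |u x| * (C * (ε ^ (2 * σ) * (2 ^ N *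
            ((1 + (1 + ‖y‖) / (1 / 2)) ^ N * (1 + ‖x‖) ^ (-N))))) := by
            refine mul_le_l ((hb ε hε0 _).2.trans ?_)
            gcongr
        _ = _ := by ring
  have := t1.add t2
  rw [add_zero] at this
  refine Tendsto.congr' ?_ this
  filter_upwards [self_mem_nhdsWithin] with ε (hε : 0 < ε)
  rw [← integral_add (hw1.mul_gar_integrable P hε y) (hw2.mul_gar_integrable P hε y)]
  congr 1; ext x
  rw [← add_mul, ← Pi.add_apply (B.indicator u), indicator_self_add_compl]

lemma Psr_mul_integrable (P : Par n σ d N) {r : ℝ} (hr : 0 < r) {f : E n → ℝ} {y : E n} {M : ℝ}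
    (hf : Measurable f) (hM : ∀ x ∈ closedBall y r, |f x| ≤ M) :
    Integrable (fun x => Psr d r (x - y) * f x) ∧
    |∫ x, Psr d r (x - y) * f x| ≤ M * (r ^ (2 * σ) * ∫ x : E n, Psi1 d x) := by
  have hb : ∀ x, ‖Psr d r (x - y) * f x‖ ≤ M * Psr d r (x - y) := by
    intro x
    rw [norm_mul, norm_of_nonneg (Psr_nonneg hr _), mul_comm]
    rcases le_or_gt r ‖x - y‖ with hx | hx
    · rw [Psr_eq_zero P.d0 hr hx]; simp
    · refine mul_le_r (hM x ?_) (Psr_nonneg hr _)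
      rw [mem_closedBall, dist_eq_norm]; exact hx.le
  have i1 := ((Psr_integrable P hr).comp_sub_right y).const_mul M
  refine ⟨i1.mono' ?_ (.of_forall hb), ?_⟩
  · exact (((Psr_measurable P.d0).comp (measurable_id.sub_const y)).mul hf).aestronglyMeasurable
  · refine (norm_integral_le_of_norm_le i1 (.of_forall hb)).trans_eq ?_
    rw [integral_const_mul, integral_sub_right_eq_self (Psr d r) y, Psr_integral P hr]

/-- Green-type representation formula with a general smooth corrector. -/
lemma representation_general (P : Par n σ d N) {u w : E n → ℝ} {U K : Set (E n)} (hu : Adm N u U)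
    (hw : ContDiff ℝ 2 w) {M : ℝ} (hM : ∀ x, |w x| ≤ M) (hK : IsCompact K) (hKU : K ⊆ U) {y : E n}
    (hy : K ∈ 𝓝 y) (hwK : ∀ x ∉ K, Gam d (x - y) = w x) {Mf : ℝ}
    (hf : ∀ x ∈ K, |Lop N u x| ≤ Mf) :
    Integrable (fun x => u x * Lop N w x) ∧
    Integrable (fun x => (Gam d (x - y) - w x) * Lop N u x) ∧
    kap n d N * u y = (∫ x, u x * Lop N w x) + ∫ x, (Gam d (x - y) - w x) * Lop N u x := by
  have := P.nontriv
  obtain ⟨ε₀, hε₀, hball⟩ := nhds_basis_closedBall.mem_iff.1 hy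
  have hwint := fun x => (adm_of_bounded P hw hM).Lint_integrable P (mem_univ x)
  have key : ∀ ε ∈ Ioc 0 ε₀, Integrable (fun x => u x * Lop N w x) ∧
      Integrable (fun x => (Gam d (x - y) - w x) * Lop N u x) ∧
      (∫ x, u x * gar d N ε (x - y)) = (∫ x, u x * Lop N w x) +
        (∫ x, (Gam d (x - y) - w x) * Lop N u x) - ∫ x, Psr d ε (x - y) * Lop N u x := by
    intro ε hε
    have hε0 := hε.1
    set φ : E n → ℝ := fun x => Gr d ε (x - y) - w x with hφ
    have hφc : ContDiff ℝ 2 φ := ((Gr_contDiff P.d0).comp (contDiff_id.sub contDiff_const)).sub hw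
    have hφK : ∀ x, x ∉ K → φ x = 0 := by
      intro x hx
      have h1 : ε ≤ ‖x - y‖ := by
        by_contra h
        refine hx (hball ?_)
        rw [mem_closedBall, dist_eq_norm]; linarith [hε.2]
      simp only [hφ, Gr_eq P.d0 hε0 h1, hwK x hx, sub_self]
    obtain ⟨M', T⟩ := test_of_contDiff hφc (HasCompactSupport.intro hK hφK)
    obtain ⟨i1, i2, he⟩ := duality P hu (T.mono hK hφK) hKU
    have hL : ∀ x, Lop N φ x = gar d N ε (x - y) - Lop N w x := by
      intro x
      have h1 := (adm_of_bounded P (φ := fun z => Gr d ε (z - y))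
        ((Gr_contDiff P.d0).comp (contDiff_id.sub contDiff_const))
        (fun z => Gr_abs_le hε0 _)).Lint_integrable P (mem_univ x)
      rw [hφ, Lop_sub h1 (hwint x), Lop_translate (Gr d ε), Lop_Gr P hε0]
    have i3 := hu.wt.mul_gar_integrable P hε0 y
    simp only [hL] at i1 he
    have i4 : Integrable (fun x => u x * Lop N w x) := by
      refine (i3.sub i1).congr (.of_forall fun x => ?_)
      simp only [Pi.sub_apply]; ring
    have e4 : ∫ x, u x * (gar d N ε (x - y) - Lop N w x) =
        (∫ x, u x * gar d N ε (x - y)) - ∫ x, u x * Lop N w x := by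
      rw [← integral_sub i3 i4]; congr 1; ext x; ring
    obtain ⟨i5, -⟩ := Psr_mul_integrable P hε0 (f := Lop N u) (y := y) (M := Mf)
      (Lop_measurable hu.meas) fun x hx => hf x (hball (closedBall_subset_closedBall hε.2 hx))
    have hae' : ∀ᵐ x : E n, φ x * Lop N u x + Psr d ε (x - y) * Lop N u x =
        (Gam d (x - y) - w x) * Lop N u x := by
      filter_upwards [compl_mem_ae_iff.2 (measure_singleton y)] with x hx
      rw [Psr_of_ne hε0 (sub_ne_zero.2 hx), hφ]; ring
    have e6 := integral_congr_ae hae'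
    rw [integral_add i2 i5] at e6
    exact ⟨i4, (i2.add i5).congr hae', lin!⟩
  obtain ⟨i1, i2, -⟩ := key ε₀ ⟨hε₀, le_rfl⟩
  refine ⟨i1, i2, ?_⟩
  have t1 := tendsto_integral_gar P hu.wt
    ((hu.smooth.continuousOn y (hKU (mem_of_mem_nhds hy))).continuousAt (hu.op.mem_nhds
      (hKU (mem_of_mem_nhds hy))))
  have t2 : Tendsto (fun ε => ∫ x, Psr d ε (x - y) * Lop N u x) (𝓝[>] 0) (𝓝 0) := by
    have hlim : Tendsto (fun ε : ℝ => Mf * (ε ^ (2 * σ) * ∫ x : E n, Psi1 d x)) (𝓝[>] 0) (𝓝 0) := by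
      have h0 : ContinuousAt (fun ε : ℝ => ε ^ (2 * σ)) 0 :=
        continuousAt_rpow_const _ _ (Or.inr (by linarith [P.hσ0]))
      have := ((h0.tendsto.mono_left (nhdsWithin_le_nhds (s := Ioi 0))).mul_const
        (∫ x : E n, Psi1 d x)).const_mul Mf
      rwa [zero_rpow (by linarith [P.hσ0]), zero_mul, mul_zero] at this
    refine squeeze_zero_norm' ?_ hlim
    filter_upwards [Ioc_mem_nhdsGT hε₀] with ε hε
    exact (Psr_mul_integrable P hε.1 (Lop_measurable hu.meas)
      fun x hx => hf x (hball (closedBall_subset_closedBall hε.2 hx))).2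
  have t3 := t2.const_sub ((∫ x, u x * Lop N w x) + ∫ x, (Gam d (x - y) - w x) * Lop N u x)
  rw [sub_zero] at t3
  refine tendsto_nhds_unique t1 (t3.congr' ?_)
  filter_upwards [Ioc_mem_nhdsGT hε₀] with ε hε
  exact (key ε hε).2.2.symm

/-- Representation formula on a ball. -/
lemma representation_ball (P : Par n σ d N) {u : E n → ℝ} {U : Set (E n)} (hu : Adm N u U)
    {y : E n} {r : ℝ} (hr : 0 < r) (hU : closedBall y r ⊆ U) {Mf : ℝ}
    (hf : ∀ x ∈ closedBall y r, |Lop N u x| ≤ Mf) :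
    kap n d N * u y = (∫ x, u x * gar d N r (x - y)) + ∫ x, Psr d r (x - y) * Lop N u x := by
  have := P.nontriv
  obtain ⟨-, -, h⟩ := representation_general P hu (w := fun x => Gr d r (x - y))
    ((Gr_contDiff P.d0).comp (contDiff_id.sub contDiff_const)) (fun x => Gr_abs_le hr _)
    (isCompact_closedBall y r) hU (closedBall_mem_nhds y hr) (fun x hx => by
      rw [Gr_eq P.d0 hr]
      rw [mem_closedBall, dist_eq_norm] at hx; linarith) hf
  rw [h]
  congr 1
  · congr 1; ext x
    rw [Lop_translate (Gr d r), Lop_Gr P hr]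
  · have hae : ∀ᵐ x : E n, x ≠ y := compl_mem_ae_iff.2 (measure_singleton y)
    refine integral_congr_ae ?_
    filter_upwards [hae] with x hx
    rw [Psr_of_ne hr (sub_ne_zero.2 hx)]

end representation

open Real

section inversion
variable {n : ℕ} {σ d N l : ℝ}

/-- Inversion in the sphere of radius `l` centred at the origin. -/
def iv (l : ℝ) (z : E n) : E n := (l / ‖z‖) ^ 2 • z

lemma iv_eq (l : ℝ) : iv (n := n) l = EuclideanGeometry.inversion 0 l := by
  ext1 z; simp [iv, EuclideanGeometry.inversion]

lemma norm_iv (hl : 0 < l) {z : E n} (hz : z ≠ 0) : ‖iv l z‖ = l ^ 2 / ‖z‖ := by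
  have := norm_pos_iff.2 hz
  rw [iv, norm_smul, norm_of_nonneg pos!]; field_simp

lemma iv_ne_zero (hl : 0 < l) {z : E n} (hz : z ≠ 0) : iv l z ≠ 0 := by
  have := norm_pos_iff.2 hz
  rw [← norm_pos_iff, norm_iv hl hz]; positivity

lemma iv_iv (hl : 0 < l) (z : E n) : iv l (iv l z) = z := by
  rw [iv_eq]; exact EuclideanGeometry.inversion_inversion _ hl.ne' _

lemma norm_iv_sub (hl : 0 < l) {x z : E n} (hx : x ≠ 0) (hz : z ≠ 0) :
    ‖iv l x - iv l z‖ = l ^ 2 / (‖x‖ * ‖z‖) * ‖x - z‖ := by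
  have := EuclideanGeometry.dist_inversion_inversion hx hz l
  rw [iv_eq, ← dist_eq_norm, this]; simp [dist_eq_norm]

lemma sq_norm_iv_sub (hl : 0 < l) {x z : E n} (hx : x ≠ 0) :
    (‖x‖ * ‖iv l x - z‖) ^ 2 = l ^ 4 - 2 * l ^ 2 * inner ℝ x z + ‖x‖ ^ 2 * ‖z‖ ^ 2 := by
  have := norm_pos_iff.2 hx
  rw [mul_pow, norm_sub_sq_real, norm_iv hl hx, iv, real_inner_smul_left]
  field_simp

lemma norm_iv_sub_comm (hl : 0 < l) {x z : E n} (hx : x ≠ 0) (hz : z ≠ 0) :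
    ‖x‖ * ‖iv l x - z‖ = ‖z‖ * ‖x - iv l z‖ := by
  rw [← sq_eq_sq₀ pos! pos!, sq_norm_iv_sub hl hx, norm_sub_rev x,
    sq_norm_iv_sub hl hz, real_inner_comm]
  ring

/-- The reflected kernel. -/
def Gi (d l : ℝ) (x z : E n) : ℝ := (l / ‖z‖) ^ d * Gam d (x - iv l z)

lemma Gi_nonneg (hl : 0 < l) (x z : E n) : 0 ≤ Gi d l x z := by
  unfold Gi; have := Gam_nonneg (d := d) (x - iv l z); positivity

lemma Gi_eq (hl : 0 < l) {x z : E n} (hx : x ≠ 0) (hz : z ≠ 0) :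
    (l / ‖x‖) ^ d * Gam d (iv l x - z) = Gi d l x z := by
  have e : ∀ a b : ℝ, 0 < a → 0 ≤ b → (l / a) ^ d * b ^ (-d) = l ^ d * (a * b) ^ (-d) := by
    intro a b ha hb
    rw [div_rpow hl.le ha.le, mul_rpow ha.le hb, rpow_neg ha.le]
    field_simp
  unfold Gi Gam
  rw [e _ _ (norm_pos_iff.2 hx) (norm_nonneg _), e _ _ (norm_pos_iff.2 hz) (norm_nonneg _),
      norm_iv_sub_comm hl hx hz]

lemma Gi_iv (hl : 0 < l) {x z : E n} (hx : x ≠ 0) (hz : z ≠ 0) :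
    (l / ‖x‖) ^ d * Gi d l (iv l x) z = Gam d (x - z) := by
  unfold Gi Gam
  rw [norm_iv_sub hl hx hz, mul_rpow pos! (norm_nonneg _), ← mul_assoc, ← mul_assoc,
    ← mul_rpow pos! pos!]
  have : l / ‖x‖ * (l / ‖z‖) = l ^ 2 / (‖x‖ * ‖z‖) := by field_simp
  rw [this, ← rpow_add pos!]; simp

lemma Gi_lt (hd : 0 < d) (hl : 0 < l) {x z : E n} (hx : l < ‖x‖) (hz : l < ‖z‖) (hxz : x ≠ z) :
    Gi d l x z < Gam d (x - z) := by
  have h2 : ‖x - z‖ < ‖z‖ / l * ‖x - iv l z‖ := by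
    refine lt_of_pow_lt_pow_left₀ 2 pos! ?_
    have : (‖z‖ / l * ‖x - iv l z‖) ^ 2 = (‖z‖ * ‖iv l z - x‖) ^ 2 / l ^ 2 := by
      rw [norm_sub_rev (iv l z)]; field_simp
    rw [this, sq_norm_iv_sub hl
        (norm_pos_iff.1 (hl.trans hz)), norm_sub_sq_real, lt_div_iff₀ pos!,
      real_inner_comm]
    nlinarith [mul_pos (show 0 < ‖x‖ ^ 2 - l ^ 2 by nlinarith) (show 0 < ‖z‖ ^ 2 - l ^ 2 by nlinarith)]
  have h3 := rpow_lt_rpow_of_neg (norm_pos_iff.2 (sub_ne_zero.2 hxz)) h2 (neg_lt_zero.2 hd)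
  unfold Gi Gam
  rw [mul_rpow pos! pos!] at h3
  convert h3 using 2
  rw [rpow_neg pos!, ← inv_rpow pos!, inv_div]

lemma Gi_le (hd : 0 < d) (hl : 0 < l) {x z : E n} (hx : l < ‖x‖) (hz : l < ‖z‖) (hxz : x ≠ z) :
    Gi d l x z ≤ Gam d (x - z) := (Gi_lt hd hl hx hz hxz).le

lemma iv_image (hl : 0 < l) : iv l '' {z : E n | l < ‖z‖} = ball 0 l \ {0} := by
  ext y
  simp only [mem_image, mem_ofPred_eq, Set.mem_sdiff, mem_ball_zero_iff, mem_singleton_iff]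
  constructor
  · rintro ⟨z, hz, rfl⟩
    have hz' := hl.trans hz
    have hz0 := norm_pos_iff.1 hz'
    refine ⟨?_, iv_ne_zero hl hz0⟩
    rw [norm_iv hl hz0, div_lt_iff₀ hz']; nlinarith
  · rintro ⟨h1, h2⟩
    refine ⟨iv l y, ?_, iv_iv hl y⟩
    rw [norm_iv hl h2, lt_div_iff₀ (norm_pos_iff.2 h2)]; nlinarith

lemma meas_ext (l : ℝ) : MeasurableSet {z : E n | l < ‖z‖} :=
  measurableSet_lt measurable_const measurable_norm

/-- Folding an integral over the whole space onto the exterior of a ball. -/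
lemma integral_fold (hn : 1 ≤ n) (hl : 0 < l) {g : E n → ℝ} (hg : Integrable g) :
    IntegrableOn (fun z => (l / ‖z‖) ^ (2 * n : ℝ) * g (iv l z)) {z : E n | l < ‖z‖} ∧
    ∫ z, g z = ∫ z in {z : E n | l < ‖z‖}, (g z + (l / ‖z‖) ^ (2 * n : ℝ) * g (iv l z)) := by
  have : Nontrivial (E n) := by
    apply Module.nontrivial_of_finrank_pos (R := ℝ)
    rw [finrank_euclideanSpace_fin]; exact hn
  set s := {z : E n | l < ‖z‖} with hs
  have hsm : MeasurableSet s := meas_ext l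
  have hder : ∀ z ∈ s, HasFDerivWithinAt (iv l)
      ((l / dist z 0) ^ 2 • ((ℝ ∙ (z - 0))ᗮ.reflection : E n →L[ℝ] E n)) s z := by
    intro z hz
    rw [iv_eq]
    exact (EuclideanGeometry.hasFDerivAt_inversion (norm_pos_iff.1 (hl.trans hz))).hasFDerivWithinAt
  have hinj : InjOn (iv l) s := fun a _ b _ h => by
    rw [← iv_iv hl a, ← iv_iv hl b, h]
  have hdet : ∀ z ∈ s, |((l / dist z 0) ^ 2 • ((ℝ ∙ (z - 0))ᗮ.reflection : E n →L[ℝ] E n)).det|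
      = (l / ‖z‖) ^ (2 * n : ℝ) := by
    intro z hz
    have hz' := hl.trans hz
    rw [ContinuousLinearMap.det, ContinuousLinearMap.toLinearMap_smul, LinearMap.det_smul,
      finrank_euclideanSpace_fin]
    have : LinearMap.det (((ℝ ∙ (z - 0))ᗮ.reflection : E n →L[ℝ] E n) : E n →ₗ[ℝ] E n)
      = (-1) ^ (Module.finrank ℝ (ℝ ∙ (z - 0))ᗮᗮ) := Submodule.det_reflection _
    rw [this, abs_mul, abs_pow (-1 : ℝ), abs_neg, abs_one, one_pow, mul_one, dist_zero_right,
      abs_of_nonneg pos!, ← pow_mul, ← rpow_natCast]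
    push_cast; rfl
  have h1 := integrableOn_image_iff_integrableOn_abs_det_fderiv_smul volume hsm hder hinj g
  have h2 := integral_image_eq_integral_abs_det_fderiv_smul volume hsm hder hinj g
  rw [iv_image hl] at h1 h2
  have h3 : IntegrableOn (fun z => (l / ‖z‖) ^ (2 * n : ℝ) * g (iv l z)) s := by
    refine (h1.1 hg.integrableOn).congr_fun (fun z hz => ?_) hsm
    change _ • _ = _
    rw [hdet z hz, smul_eq_mul]
  refine ⟨h3, ?_⟩
  rw [integral_add hg.integrableOn h3, ← integral_add_compl hsm hg]
  congr 1
  have h4 : ∫ z in s, (l / ‖z‖) ^ (2 * n : ℝ) * g (iv l z) = ∫ z in ball 0 l \ {0}, g z := by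
    rw [h2]
    refine setIntegral_congr_fun hsm fun z hz => ?_
    change _ = _ • _
    rw [hdet z hz, smul_eq_mul]
  rw [h4]
  refine setIntegral_congr_set ?_
  have e1 : (sᶜ : Set (E n)) = closedBall 0 l := by
    ext z; simp [hs]
  rw [e1]
  refine (Filter.EventuallyEq.trans (sdiff_null_ae_eq_self (measure_singleton _)) ?_).symm
  have : (closedBall (0 : E n) l) \ sphere 0 l = ball 0 l := by
    ext z; simp [lt_iff_le_and_ne]
  rw [← this]
  exact sdiff_null_ae_eq_self (Measure.addHaar_sphere _ _ _)

end inversion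

open Real

section kernelest
variable {n : ℕ} {σ d N : ℝ}

lemma Gam_ball_integral (P : Par n σ d N) (x : E n) {r : ℝ} (hr : 0 < r) :
    IntegrableOn (fun z => Gam d (x - z)) (ball x r) ∧
    ∫ z in ball x r, Gam d (x - z) = r ^ (2 * σ) * ∫ z in ball (0 : E n) 1, ‖z‖ ^ (-d) := by
  have h1 := integrableOn_comp_sub_left (ker_integrable_ball P.n1 P.dn r) x
  have h2 := setIntegral_comp_sub_left (fun z : E n => ‖z‖ ^ (-d)) (ball 0 r) x
  rw [preimage_sub_left_ball] at h1 h2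
  refine ⟨h1, ?_⟩
  have e := ker_ball_eq (n := n) hr d
  rw [P.nd] at e
  rw [← e]; exact h2

lemma exists_T_bound (P : Par n σ d N) : ∃ C > 0, ∀ t : ℝ, 0 < t → t ≤ 1 / 2 → ∀ a > 0,
    ∀ x : E n, a ≤ ‖x‖ → ∀ S : Set (E n), MeasurableSet S → S ⊆ (ball 0 a)ᶜ →
    IntegrableOn (fun z => Gam d (x - z) * ‖z‖ ^ (-N)) S ∧
    ∫ z in S, Gam d (x - z) * ‖z‖ ^ (-N) ≤
      ‖x‖ ^ (-d) * (t ^ (-d) * (∫ z in S, ‖z‖ ^ (-N)) + C * t ^ (2 * σ) * a ^ (-(2 * σ))) := by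
  obtain ⟨I, hI⟩ := named (∫ z in ball (0 : E n) 1, ‖z‖ ^ (-d))
  have hI0 := hI ▸ integral_nonneg fun z => pos!
  refine ⟨2 ^ N * I + 1, pos!, fun t ht ht2 a ha x hx S hS hSa => ?_⟩
  have hx0 := ha.trans_le hx
  have hr : 0 < t * ‖x‖ := pos!
  obtain ⟨g1, g2⟩ := Gam_ball_integral P x hr
  rw [← hI] at g2
  have hd0 := P.d0
  have hN0 := P.N0
  have f1 : IntegrableOn (fun z : E n => (t * ‖x‖) ^ (-d) * ‖z‖ ^ (-N)) S :=
    ((ker_integrable_compl P.nN ha).mono_set hSa).const_mul _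
  have f2 : Integrable ((ball x (t * ‖x‖)).indicator
      (fun z => 2 ^ N * ‖x‖ ^ (-N) * Gam d (x - z))) :=
    (integrable_indicator_iff measurableSet_ball).2 (g1.const_mul _)
  have hle : ∀ z : E n, Gam d (x - z) * ‖z‖ ^ (-N) ≤ (t * ‖x‖) ^ (-d) * ‖z‖ ^ (-N) +
      (ball x (t * ‖x‖)).indicator (fun z => 2 ^ N * ‖x‖ ^ (-N) * Gam d (x - z)) z := by
    intro z
    have hG := Gam_nonneg (d := d) (x - z)
    by_cases hz : z ∈ ball x (t * ‖x‖)
    · rw [indicator_of_mem hz]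
      have h1 : ‖x‖ / 2 ≤ ‖z‖ := by
        rw [mem_ball, dist_eq_norm] at hz
        have := norm_sub_norm_le x z
        rw [norm_sub_rev] at hz
        nlinarith
      have h2 : ‖z‖ ^ (-N) ≤ 2 ^ N * ‖x‖ ^ (-N) := by
        calc ‖z‖ ^ (-N) ≤ (‖x‖ / 2) ^ (-N) :=
              rpow_anti pos! h1
          _ = _ := by
              rw [div_rpow hx0.le num!, rpow_neg zero_le_two]
              field_simp
      have h3 : 0 ≤ (t * ‖x‖) ^ (-d) * ‖z‖ ^ (-N) := pos!
      nlinarith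
    · rw [indicator_of_notMem hz, add_zero]
      refine mul_le_r ?_
      rw [mem_ball, dist_eq_norm, not_lt, norm_sub_rev] at hz
      exact rpow_anti hr hz
  have hint : IntegrableOn (fun z => Gam d (x - z) * ‖z‖ ^ (-N)) S := by
    refine Integrable.mono' (f1.add f2.integrableOn) ?_ (.of_forall fun z => ?_)
    · exact ((Gam_measurable.comp (measurable_const.sub measurable_id)).mul
        (ker_measurable _)).aestronglyMeasurable
    · rw [norm_of_nonneg (mul_nonneg (Gam_nonneg _) pos!)]; exact hle z
  refine ⟨hint, ?_⟩
  calc _ ≤ ∫ z in S, ((t * ‖x‖) ^ (-d) * ‖z‖ ^ (-N) +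
      (ball x (t * ‖x‖)).indicator (fun z => 2 ^ N * ‖x‖ ^ (-N) * Gam d (x - z)) z) :=
        setIntegral_mono hint (f1.add f2.integrableOn) hle
    _ = (∫ z in S, (t * ‖x‖) ^ (-d) * ‖z‖ ^ (-N)) + ∫ z in S,
      (ball x (t * ‖x‖)).indicator (fun z => 2 ^ N * ‖x‖ ^ (-N) * Gam d (x - z)) z :=
        integral_add f1 f2.integrableOn
    _ ≤ (t * ‖x‖) ^ (-d) * (∫ z in S, ‖z‖ ^ (-N)) + 2 ^ N * ‖x‖ ^ (-N) * ((t * ‖x‖) ^ (2 * σ) * I) := by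
        rw [integral_const_mul]
        gcongr
        rw [← g2, ← integral_const_mul (2 ^ N * ‖x‖ ^ (-N)), ← integral_indicator measurableSet_ball]
        exact setIntegral_le_integral f2 (.of_forall fun z =>
          indicator_nonneg (fun z _ => mul_nonneg pos! (Gam_nonneg _)) z)
    _ = ‖x‖ ^ (-d) * (t ^ (-d) * (∫ z in S, ‖z‖ ^ (-N)) +
          2 ^ N * I * t ^ (2 * σ) * ‖x‖ ^ (-(2 * σ))) := by
        have e1 : ‖x‖ ^ (-N) * ‖x‖ ^ (2 * σ) = ‖x‖ ^ (-d) * ‖x‖ ^ (-(2 * σ)) := by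
          rw [← rpow_add hx0, ← rpow_add hx0]
          congr 1; linarith [P.hN, P.hd]
        rw [mul_rpow ht.le hx0.le, mul_rpow ht.le hx0.le]
        generalize (∫ z in S, ‖z‖ ^ (-N)) = A
        linear_combination 2 ^ N * t ^ (2 * σ) * I * e1
    _ ≤ _ := by
        have e1 : ‖x‖ ^ (-(2 * σ)) ≤ a ^ (-(2 * σ)) :=
          rpow_anti ha hx (by linarith [P.hσ0])
        have e2 : 2 ^ N * I ≤ 2 ^ N * I + 1 := lin!
        generalize (∫ z in S, ‖z‖ ^ (-N)) = A
        gcongr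

end kernelest

open Real

/-- A positive bounded continuous solution of the integral equation `v = k Γ * v^p`. -/
structure EntSol (n : ℕ) (d p k C : ℝ) (v : E n → ℝ) : Prop where
  cont : Continuous v
  pos : ∀ x, 0 < v x
  le : ∀ x, v x ≤ C
  int : ∀ x, Integrable (fun y => Gam d (x - y) * v y ^ p)
  eq : ∀ x, v x = k * ∫ y, Gam d (x - y) * v y ^ p

/-- Kelvin transform. -/
def kel (d l : ℝ) (v : E n → ℝ) (z : E n) : ℝ := (l / ‖z‖) ^ d * v (iv l z)

/-- The reflected nonlinearity. -/
def kelN (N p l : ℝ) (v : E n → ℝ) (z : E n) : ℝ := (l / ‖z‖) ^ N * v (iv l z) ^ p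

section moving
variable {n : ℕ} {σ d N p k C l : ℝ} {v : E n → ℝ}

lemma div_rpow_le_one (hl : 0 < l) {z : E n} (hz : l < ‖z‖) {a : ℝ} (ha : 0 ≤ a) :
    (l / ‖z‖) ^ a ≤ 1 :=
  rpow_le_one pos! ((div_le_one (hl.trans hz)).2 hz.le) ha

lemma EntSol.fold (P : Par n σ d N) (h : EntSol n d p k C v) (hl : 0 < l) {x : E n} (hx : l < ‖x‖) :
    IntegrableOn (fun z => Gam d (x - z) * v z ^ p + Gi d l x z * kelN N p l v z) {z | l < ‖z‖} ∧
    IntegrableOn (fun z => Gi d l x z * v z ^ p + Gam d (x - z) * kelN N p l v z) {z | l < ‖z‖} ∧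
    v x = k * ∫ z in {z | l < ‖z‖}, (Gam d (x - z) * v z ^ p + Gi d l x z * kelN N p l v z) ∧
    kel d l v x
      = k * ∫ z in {z | l < ‖z‖}, (Gi d l x z * v z ^ p + Gam d (x - z) * kelN N p l v z) := by
  have hx0 := norm_pos_iff.1 (hl.trans hx)
  have hsm := meas_ext (n := n) l
  obtain ⟨a1, a2⟩ := integral_fold P.n1 hl (h.int x)
  obtain ⟨b1, b2⟩ := integral_fold P.n1 hl (h.int (iv l x))
  have e2 : ∀ z : E n, l < ‖z‖ → (l / ‖z‖) ^ (2 * n : ℝ) = (l / ‖z‖) ^ d * (l / ‖z‖) ^ N := by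
    intro z hz
    have : 0 < ‖z‖ := hl.trans hz
    rw [← rpow_add pos!]; congr 1; linarith [P.hd, P.hN]
  have ea : EqOn (fun z => Gam d (x - z) * v z ^ p +
      (l / ‖z‖) ^ (2 * n : ℝ) * (Gam d (x - iv l z) * v (iv l z) ^ p))
      (fun z => Gam d (x - z) * v z ^ p + Gi d l x z * kelN N p l v z) {z | l < ‖z‖} := by
    intro z hz
    simp only [Gi, kelN, e2 z hz]; ring
  have eb : EqOn (fun z => (l / ‖x‖) ^ d * (Gam d (iv l x - z) * v z ^ p +
      (l / ‖z‖) ^ (2 * n : ℝ) * (Gam d (iv l x - iv l z) * v (iv l z) ^ p)))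
      (fun z => Gi d l x z * v z ^ p + Gam d (x - z) * kelN N p l v z) {z | l < ‖z‖} := by
    intro z hz
    have hz0 := norm_pos_iff.1 (hl.trans hz)
    have g1 := Gi_eq (d := d) hl hx0 hz0
    have g2 : (l / ‖x‖) ^ d * ((l / ‖z‖) ^ d * Gam d (iv l x - iv l z)) = Gam d (x - z) :=
      Gi_iv hl hx0 hz0
    simp only [kelN, e2 z hz]
    linear_combination v z ^ p * g1 + (l / ‖z‖) ^ N * v (iv l z) ^ p * g2
  refine ⟨((h.int x).integrableOn.add a1).congr_fun ea hsm,
    IntegrableOn.congr_fun (Integrable.const_mul ((h.int (iv l x)).integrableOn.add b1) _) eb hsm,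
    ?_, ?_⟩
  · rw [h.eq x, a2, setIntegral_congr_fun hsm ea]
  · rw [kel, h.eq (iv l x), b2, ← setIntegral_congr_fun hsm eb, integral_const_mul]; ring

lemma EntSol.sub_eq (P : Par n σ d N) (h : EntSol n d p k C v) (hl : 0 < l) {x : E n}
    (hx : l < ‖x‖) :
    IntegrableOn (fun z => (Gam d (x - z) - Gi d l x z) * (v z ^ p - kelN N p l v z)) {z | l < ‖z‖} ∧
    v x - kel d l v x = k * ∫ z in {z | l < ‖z‖},
      (Gam d (x - z) - Gi d l x z) * (v z ^ p - kelN N p l v z) := by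
  obtain ⟨a, b, c, e⟩ := h.fold P hl hx
  have : (fun z => (Gam d (x - z) - Gi d l x z) * (v z ^ p - kelN N p l v z)) = fun z =>
      (Gam d (x - z) * v z ^ p + Gi d l x z * kelN N p l v z) -
      (Gi d l x z * v z ^ p + Gam d (x - z) * kelN N p l v z) := by
    ext z; ring
  rw [this]
  refine ⟨a.sub b, ?_⟩
  rw [integral_sub a b, mul_sub, ← c, ← e]

lemma kelN_eq (hl : 0 < l) (hv : ∀ x, 0 ≤ v x) {z : E n} (hz : l < ‖z‖) :
    kelN N p l v z = (l / ‖z‖) ^ (N - d * p) * kel d l v z ^ p := by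
  have hz' := hl.trans hz
  rw [kel, mul_rpow pos! (hv _), ← rpow_mul pos!, ← mul_assoc,
    ← rpow_add pos!, kelN]
  congr 2; ring

lemma kel_nonneg (hl : 0 < l) (hv : ∀ x, 0 ≤ v x) (z : E n) : 0 ≤ kel d l v z :=
  mul_nonneg pos! (hv _)

lemma rpow_sub_rpow_le {a b : ℝ} (ha : 0 ≤ a) (hab : a ≤ b) (hp : 1 ≤ p) :
    b ^ p - a ^ p ≤ p * b ^ (p - 1) * (b - a) := by
  rcases hab.eq_or_lt with rfl | hab
  · simp
  have hb := ha.trans_lt hab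
  have := one_add_mul_self_le_rpow_one_add (s := a / b - 1) (p := p)
    (by have : 0 ≤ a / b := pos!
        linarith) hp
  rw [show 1 + (a / b - 1) = a / b by ring, div_rpow ha hb.le, le_div_iff₀ pos!] at this
  have e : b ^ p = b ^ (p - 1) * b := by rw [← rpow_add_one hb.ne']; ring_nf
  rw [e] at this ⊢
  field_simp at this
  nlinarith

/-- The contraction step. -/
lemma EntSol.contract (P : Par n σ d N) (h : EntSol n d p k C v) (hk : 0 ≤ k) (hp : 1 ≤ p)
    (hdp : d * p ≤ N) (hl : 0 < l) {m : ℝ} (hm : 0 ≤ m) {S : Set (E n)} (hS : MeasurableSet S)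
    (hSl : S ⊆ {z | l < ‖z‖}) (hSc : ∀ z, l < ‖z‖ → z ∉ S → kel d l v z ≤ v z)
    (H : ∀ z, l < ‖z‖ → kel d l v z - v z ≤ m * (l / ‖z‖) ^ d) {x : E n} (hx : l < ‖x‖)
    (hint : IntegrableOn (fun z => Gam d (x - z) * ‖z‖ ^ (-N)) S) :
    kel d l v x - v x ≤
      k * p * C ^ (p - 1) * m * l ^ N * ∫ z in S, Gam d (x - z) * ‖z‖ ^ (-N) := by
  have hv0 : ∀ x, 0 ≤ v x := fun x => (h.pos x).le
  have hC := (hv0 0).trans (h.le 0)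
  obtain ⟨i1, i2⟩ := h.sub_eq P hl hx
  have hsm := meas_ext (n := n) l
  set D : ℝ := p * C ^ (p - 1) * m * l ^ N with hD
  have hD0 : 0 ≤ D := pos!
  have hmain : -(∫ z in {z | l < ‖z‖}, (Gam d (x - z) - Gi d l x z) * (v z ^ p - kelN N p l v z))
      ≤ ∫ z in {z | l < ‖z‖}, S.indicator (fun z => D * (Gam d (x - z) * ‖z‖ ^ (-N))) z := by
    rw [← integral_neg]
    refine setIntegral_mono_ae_restrict i1.neg
      ((integrable_indicator_iff hS).2 (hint.const_mul _)).integrableOn ?_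
    have := P.nontriv
    have hae : ∀ᵐ z : E n, z ≠ x := compl_mem_ae_iff.2 (measure_singleton x)
    refine (ae_restrict_iff' hsm).2 ?_
    filter_upwards [hae] with z hzx hz
    have hz' := hl.trans hz
    have g1 := Gi_le (d := d) P.d0 hl hx hz hzx.symm
    have g2 := Gi_nonneg (d := d) hl x z
    have hq : (l / ‖z‖) ^ (N - d * p) ≤ 1 := div_rpow_le_one hl hz lin!
    have hq0 : 0 ≤ (l / ‖z‖) ^ (N - d * p) := pos!
    have hkn := kel_nonneg (d := d) hl hv0 z
    have hvp := rpow_nonneg (hv0 z) p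
    have hRHS : 0 ≤ S.indicator (fun z => D * (Gam d (x - z) * ‖z‖ ^ (-N))) z :=
      indicator_nonneg (fun z _ => mul_nonneg hD0 (mul_nonneg (Gam_nonneg _) pos!)) z
    change -((Gam d (x - z) - Gi d l x z) * (v z ^ p - kelN N p l v z)) ≤ _
    rw [kelN_eq (d := d) hl hv0 hz]
    rcases le_or_gt (kel d l v z) (v z) with hle | hgt
    · refine le_trans ?_ hRHS
      have : kel d l v z ^ p ≤ v z ^ p := rpow_le_rpow hkn hle lin!
      have hkp := rpow_nonneg hkn p
      nlinarith [mul_nonneg (sub_nonneg.2 g1)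
        (show 0 ≤ v z ^ p - (l / ‖z‖) ^ (N - d * p) * kel d l v z ^ p by nlinarith)]
    · have hzS : z ∈ S := by
        by_contra hc; exact absurd (hSc z hz hc) (not_le.2 hgt)
      rw [indicator_of_mem hzS]
      have e1 := rpow_sub_rpow_le (p := p) (hv0 z) hgt.le hp
      have e2 : kel d l v z ≤ (l / ‖z‖) ^ d * C :=
        mul_le_l (h.le _)
      have e3 : kel d l v z ^ (p - 1) ≤ ((l / ‖z‖) ^ d * C) ^ (p - 1) :=
        rpow_le_rpow hkn e2 lin!
      have e4 : (l / ‖z‖) ^ (N - d * p) * (p * ((l / ‖z‖) ^ d * C) ^ (p - 1) * (m * (l / ‖z‖) ^ d))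
          = D * ‖z‖ ^ (-N) := by
        have hq' : 0 < l / ‖z‖ := pos!
        rw [mul_rpow pos! hC, ← rpow_mul hq'.le]
        have : (l / ‖z‖) ^ (N - d * p) * (l / ‖z‖) ^ (d * (p - 1)) * (l / ‖z‖) ^ d
            = l ^ N * ‖z‖ ^ (-N) := by
          rw [← rpow_add hq', ← rpow_add hq', show N - d * p + d * (p - 1) + d = N by ring,
            div_rpow hl.le hz'.le, rpow_neg hz'.le]; rfl
        rw [hD]
        linear_combination p * C ^ (p - 1) * m * this
      have e5 : (l / ‖z‖) ^ (N - d * p) * kel d l v z ^ p - v z ^ p ≤ D * ‖z‖ ^ (-N) := by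
        rw [← e4]
        calc _ ≤ (l / ‖z‖) ^ (N - d * p) * (kel d l v z ^ p - v z ^ p) := by nlinarith
          _ ≤ _ := by
            refine mul_le_l (e1.trans ?_) hq0
            have := sub_pos.2 hgt
            have := H z hz
            gcongr
      have hDz : 0 ≤ D * ‖z‖ ^ (-N) := pos!
      calc _ = (Gam d (x - z) - Gi d l x z) *
            ((l / ‖z‖) ^ (N - d * p) * kel d l v z ^ p - v z ^ p) := by ring
        _ ≤ (Gam d (x - z) - Gi d l x z) * (D * ‖z‖ ^ (-N)) := by gcongr
        _ ≤ _ := by nlinarith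
  have hS' : ∫ z in {z | l < ‖z‖}, S.indicator (fun z => D * (Gam d (x - z) * ‖z‖ ^ (-N))) z
      = D * ∫ z in S, Gam d (x - z) * ‖z‖ ^ (-N) := by
    rw [setIntegral_indicator hS, inter_eq_self_of_subset_right hSl, integral_const_mul]
  rw [hS'] at hmain
  calc _ = k * -(∫ z in {z | l < ‖z‖}, (Gam d (x - z) - Gi d l x z) * (v z ^ p - kelN N p l v z)) := by
        linarith
    _ ≤ k * (D * ∫ z in S, Gam d (x - z) * ‖z‖ ^ (-N)) := mul_le_l hmain hk
    _ = _ := by rw [hD]; ring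

end moving

open Real

/-- The moving sphere inequality at radius `l`. -/
def MS {n : ℕ} (d l : ℝ) (v : E n → ℝ) : Prop := ∀ x, l < ‖x‖ → kel d l v x ≤ v x

section moving
variable {n : ℕ} {σ d N p k C l : ℝ} {v : E n → ℝ}

lemma EntSol.MS_of_halving (h : EntSol n d p k C v) (hl : 0 < l)
    (H : ∀ m : ℝ, 0 ≤ m → (∀ z, l < ‖z‖ → kel d l v z - v z ≤ m * (l / ‖z‖) ^ d) →
      ∀ z, l < ‖z‖ → kel d l v z - v z ≤ (m / 2) * (l / ‖z‖) ^ d) : MS d l v := by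
  have hC := (h.pos 0).le.trans (h.le 0)
  have hj : ∀ j : ℕ, ∀ z, l < ‖z‖ → kel d l v z - v z ≤ (C * (1 / 2) ^ j) * (l / ‖z‖) ^ d := by
    intro j
    induction j with
    | zero =>
      intro z hz
      have h1 : kel d l v z ≤ (l / ‖z‖) ^ d * C := mul_le_l (h.le _)
      have := h.pos z
      rw [pow_zero, mul_one]; linarith
    | succ j ih =>
      have := H _ pos! ih
      intro z hz
      have := this z hz
      rw [pow_succ]
      convert this using 2; ring
  intro x hx
  have ht : Tendsto (fun j : ℕ => (C * (1 / 2 : ℝ) ^ j) * (l / ‖x‖) ^ d) atTop (𝓝 0) := by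
    have := ((tendsto_pow_atTop_nhds_zero_of_lt_one (r := (1 / 2 : ℝ)) num!
      num!).const_mul C).mul_const ((l / ‖x‖) ^ d)
    simpa using this
  have := ge_of_tendsto' ht fun j => hj j x hx
  linarith

lemma ext_subset (l : ℝ) : {z : E n | l < ‖z‖} ⊆ (ball 0 l)ᶜ := by
  intro z hz
  simp only [mem_ofPred_eq] at hz
  simp [hz.le]

lemma EntSol.exists_MS_criterion (P : Par n σ d N) (h : EntSol n d p k C v) (hk : 0 ≤ k) (hp : 1 ≤ p)
    (hdp : d * p ≤ N) : ∃ K > 0, ∀ t : ℝ, 0 < t → t ≤ 1 / 2 → ∀ l > 0, ∀ S : Set (E n),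
    MeasurableSet S → S ⊆ {z | l < ‖z‖} → (∀ z, l < ‖z‖ → z ∉ S → kel d l v z ≤ v z) →
    K * l ^ (4 * σ) * (t ^ (-d) * (∫ z in S, ‖z‖ ^ (-N)) + K * t ^ (2 * σ) * l ^ (-(2 * σ))) ≤ 1 / 2 →
    MS d l v := by
  obtain ⟨C', hC', HT⟩ := exists_T_bound P
  have hC := (h.pos 0).le.trans (h.le 0)
  set A := k * p * C ^ (p - 1) with hA
  have hA0 : 0 ≤ A := pos!
  refine ⟨A + C', pos!, fun t ht ht2 l hl S hS hSl hSc hle => ?_⟩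
  refine h.MS_of_halving hl fun m hm H x hx => ?_
  have hx' := hl.trans hx
  obtain ⟨t1, t2⟩ := HT t ht ht2 l hl x hx.le S hS (hSl.trans (ext_subset l))
  have hc := h.contract P hk hp hdp hl hm hS hSl hSc H hx t1
  rw [← hA] at hc
  have hJ : 0 ≤ ∫ z in S, ‖z‖ ^ (-N) := integral_nonneg fun z => pos!
  generalize (∫ z in S, ‖z‖ ^ (-N)) = J at *
  have e : l ^ N * ‖x‖ ^ (-d) = l ^ (4 * σ) * (l / ‖x‖) ^ d := by
    rw [div_rpow hl.le hx'.le, rpow_neg hx'.le, show N = 4 * σ + d by linarith [P.hN, P.hd],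
      rpow_add hl]
    ring
  have h1 : A * l ^ (4 * σ) * (t ^ (-d) * J + C' * t ^ (2 * σ) * l ^ (-(2 * σ))) ≤ 1 / 2 := by
    refine le_trans ?_ hle
    gcongr <;> linarith
  calc _ ≤ A * m * l ^ N * _ := hc
    _ ≤ A * m * l ^ N * (‖x‖ ^ (-d) * (t ^ (-d) * J + C' * t ^ (2 * σ) * l ^ (-(2 * σ)))) := by
        gcongr
    _ = m * (l / ‖x‖) ^ d *
        (A * l ^ (4 * σ) * (t ^ (-d) * J + C' * t ^ (2 * σ) * l ^ (-(2 * σ)))) := by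
        linear_combination A * m * (t ^ (-d) * J + C' * t ^ (2 * σ) * l ^ (-(2 * σ))) * e
    _ ≤ m * (l / ‖x‖) ^ d * (1 / 2) := by gcongr
    _ = _ := by ring

lemma kerN_compl (P : Par n σ d N) {r : ℝ} (hr : 0 < r) :
    ∫ x in (ball (0 : E n) r)ᶜ, ‖x‖ ^ (-N)
      = r ^ (-(2 * σ)) * ∫ x in (ball (0 : E n) 1)ᶜ, ‖x‖ ^ (-N) := by
  rw [ker_compl_eq hr, show (n : ℝ) - N = -(2 * σ) by linarith [P.hN]]

lemma EntSol.MS_small (P : Par n σ d N) (h : EntSol n d p k C v) (hk : 0 ≤ k) (hp : 1 ≤ p)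
    (hdp : d * p ≤ N) : ∀ᶠ l in 𝓝[>] (0 : ℝ), MS d l v := by
  obtain ⟨K, hK, H⟩ := h.exists_MS_criterion P hk hp hdp
  obtain ⟨J, hJ⟩ := named (∫ x in (ball (0 : E n) 1)ᶜ, ‖x‖ ^ (-N))
  have ht : Tendsto (fun l : ℝ => l ^ (2 * σ) *
      (K * ((1 / 2) ^ (-d) * J + K * (1 / 2) ^ (2 * σ)))) (𝓝[>] 0) (𝓝 0) := by
    have h0 : ContinuousAt (fun ε : ℝ => ε ^ (2 * σ)) 0 :=
      continuousAt_rpow_const _ _ (Or.inr (by linarith [P.hσ0]))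
    have := ((h0.tendsto.mono_left (nhdsWithin_le_nhds (s := Ioi 0))).mul_const
      (K * ((1 / 2) ^ (-d) * J + K * (1 / 2) ^ (2 * σ))))
    rwa [zero_rpow (by linarith [P.hσ0]), zero_mul] at this
  filter_upwards [ht.eventually_le_const (show (0 : ℝ) < 1 / 2 by norm_num),
    self_mem_nhdsWithin] with l hl1 hl0
  have hl0 : 0 < l := hl0
  refine H (1 / 2) num! le_rfl l hl0 _ (meas_ext l) subset_rfl
    (fun z hz hz' => absurd hz hz') (le_trans ?_ hl1)
  have e1 : ∫ z in {z : E n | l < ‖z‖}, ‖z‖ ^ (-N) ≤ l ^ (-(2 * σ)) * J := by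
    rw [hJ, ← kerN_compl P hl0]
    exact setIntegral_mono_set (ker_integrable_compl P.nN hl0)
      (.of_forall fun z => pos!) (ext_subset l).eventuallyLE
  have e2 : l ^ (4 * σ) * l ^ (-(2 * σ)) = l ^ (2 * σ) := by
    rw [← rpow_add hl0]; congr 1; ring
  calc _ ≤ K * l ^ (4 * σ) * ((1 / 2) ^ (-d) * (l ^ (-(2 * σ)) * J) +
        K * (1 / 2) ^ (2 * σ) * l ^ (-(2 * σ))) := by gcongr
    _ = _ := by linear_combination (K * ((1 / 2) ^ (-d) * J + K * (1 / 2) ^ (2 * σ))) * e2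

lemma EntSol.MS_strict (P : Par n σ d N) (h : EntSol n d p k C v) (hk : 0 < k) (hp : 1 < p)
    (hdp : d * p < N) (hl : 0 < l) (hM : MS d l v) {x : E n} (hx : l < ‖x‖) : kel d l v x < v x := by
  have hv0 : ∀ x, 0 ≤ v x := fun x => (h.pos x).le
  obtain ⟨i1, i2⟩ := h.sub_eq P hl hx
  have := P.nontriv
  have hae : ∀ᵐ z : E n, z ≠ x := compl_mem_ae_iff.2 (measure_singleton x)
  have hpos : ∀ᵐ z : E n, z ∈ {z : E n | l < ‖z‖} →
      0 < (Gam d (x - z) - Gi d l x z) * (v z ^ p - kelN N p l v z) := by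
    filter_upwards [hae] with z hzx hz
    have hz := hz
    have g1 := Gi_lt (d := d) P.d0 hl hx hz hzx.symm
    refine mul_pos (sub_pos.2 g1) (sub_pos.2 ?_)
    rw [kelN_eq (d := d) hl hv0 hz]
    have h1 : kel d l v z ^ p ≤ v z ^ p :=
      rpow_le_rpow (kel_nonneg hl hv0 z) (hM z hz) lin!
    have h2 : (l / ‖z‖) ^ (N - d * p) < 1 :=
      rpow_lt_one pos! ((div_lt_one (hl.trans hz)).2 hz) lin!
    have h3 := rpow_pos_of_pos (h.pos z) p
    have h4 : 0 ≤ (l / ‖z‖) ^ (N - d * p) := pos!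
    nlinarith
  have : 0 < ∫ z in {z : E n | l < ‖z‖}, (Gam d (x - z) - Gi d l x z) * (v z ^ p - kelN N p l v z) := by
    have hae2 := (ae_restrict_iff' (meas_ext (n := n) l)).2 hpos
    rw [integral_pos_iff_support_of_nonneg_ae (hae2.mono fun z hz => hz.le) i1]
    have : (volume.restrict {z : E n | l < ‖z‖}) univ ≠ 0 := by
      rw [Measure.restrict_apply_univ]
      exact (isOpen_lt continuous_const continuous_norm).measure_ne_zero _ ⟨x, hx⟩
    refine pos_iff_ne_zero.2 fun h0 => this ?_
    rw [← h0]
    refine measure_congr ?_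
    filter_upwards [hae2] with z hz
    have : z ∈ Function.support fun z =>
      (Gam d (x - z) - Gi d l x z) * (v z ^ p - kelN N p l v z) := hz.ne'
    exact propext ⟨fun _ => this, fun _ => trivial⟩
  have := mul_pos hk this
  linarith

lemma kel_continuousAt (hv : Continuous v) {l : ℝ} (hl : 0 < l) {z : E n} (hz : z ≠ 0) :
    ContinuousAt (fun q : ℝ × E n => kel d q.1 v q.2) (l, z) := by
  have h1 : ContinuousAt (fun q : ℝ × E n => q.1 / ‖q.2‖) (l, z) :=
    continuousAt_fst.div continuousAt_snd.norm (norm_pos_iff.2 hz).ne'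
  unfold kel iv
  refine ContinuousAt.mul (h1.rpow_const (Or.inl pos!)) ?_
  exact hv.continuousAt.comp ((h1.pow 2).smul continuousAt_snd)

lemma EntSol.MS_right (P : Par n σ d N) (h : EntSol n d p k C v) (hk : 0 < k) (hp : 1 < p)
    (hdp : d * p < N) {l₀ : ℝ} (hl : 0 < l₀) (hM : MS d l₀ v) : ∀ᶠ l in 𝓝[>] l₀, MS d l v := by
  obtain ⟨K, hK, H⟩ := h.exists_MS_criterion P hk.le hp.le hdp.le
  obtain ⟨J, hJ⟩ := named (∫ x in (ball (0 : E n) 1)ᶜ, ‖x‖ ^ (-N))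
  have hσ := P.hσ0
  -- choice of t
  obtain ⟨t, ht, ht2, htK⟩ : ∃ t : ℝ, 0 < t ∧ t ≤ 1 / 2 ∧
      K * (2 * l₀) ^ (4 * σ) * (K * t ^ (2 * σ) * l₀ ^ (-(2 * σ))) ≤ 1 / 4 := by
    have h0 : ContinuousAt (fun ε : ℝ =>
        K * (2 * l₀) ^ (4 * σ) * (K * ε ^ (2 * σ) * l₀ ^ (-(2 * σ)))) 0 :=
      continuousAt_const.mul ((continuousAt_const.mul
        (continuousAt_rpow_const _ _ (Or.inr lin!))).mul continuousAt_const)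
    have h1 := h0.tendsto.mono_left (nhdsWithin_le_nhds (s := Ioi 0))
    rw [zero_rpow lin!] at h1
    simp only [mul_zero, zero_mul] at h1
    obtain ⟨t, a, b⟩ := ((h1.eventually_le_const (show (0 : ℝ) < 1 / 4 by norm_num)).and
      (Ioc_mem_nhdsGT (show (0 : ℝ) < 1 / 2 by norm_num))).exists
    exact ⟨t, b.1, b.2, a⟩
  obtain ⟨η, hη, hηK⟩ : ∃ η > 0, K * (2 * l₀) ^ (4 * σ) * (t ^ (-d) * η) ≤ 1 / 4 := by
    refine ⟨1 / 4 / (K * (2 * l₀) ^ (4 * σ) * t ^ (-d)), pos!, le_of_eq ?_⟩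
    field_simp
  -- choice of the annulus
  obtain ⟨δ, hδ0, hδ⟩ : ∃ δ > 0, (l₀ ^ (-(2 * σ)) - (l₀ + δ) ^ (-(2 * σ))) * J ≤ η / 2 := by
    have h0 : ContinuousAt (fun δ : ℝ => (l₀ ^ (-(2 * σ)) - (l₀ + δ) ^ (-(2 * σ))) * J) 0 := by
      refine (continuousAt_const.sub ((continuousAt_const.add continuousAt_id).rpow_const
        (Or.inl ?_))).mul continuousAt_const
      simp [hl.ne']
    have h1 := h0.tendsto.mono_left (nhdsWithin_le_nhds (s := Ioi 0))
    simp only [add_zero, sub_self, zero_mul] at h1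
    obtain ⟨t, a, b⟩ := ((h1.eventually_le_const (half_pos hη)).and self_mem_nhdsWithin).exists
    exact ⟨t, b, a⟩
  obtain ⟨R, hRl, hR⟩ : ∃ R, l₀ + δ ≤ R ∧ R ^ (-(2 * σ)) * J ≤ η / 2 := by
    have h1 := (tendsto_rpow_neg_atTop (show 0 < 2 * σ by linarith)).mul_const J
    rw [zero_mul] at h1
    obtain ⟨R, a, b⟩ := ((h1.eventually_le_const (half_pos hη)).and
      (eventually_ge_atTop (l₀ + δ))).exists
    exact ⟨R, b, a⟩
  have hev : ∀ᶠ l in 𝓝 l₀, ∀ z ∈ closedBall (0 : E n) R \ ball 0 (l₀ + δ), kel d l v z < v z := by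
    refine ((isCompact_closedBall
        0 R).diff isOpen_ball).eventually_forall_of_forall_eventually fun z hz => ?_
    have hz1 : l₀ < ‖z‖ := by
      have := hz.2; simp only [mem_ball_zero_iff, not_lt] at this; linarith
    exact (kel_continuousAt (d := d) h.cont hl (norm_pos_iff.1 (hl.trans hz1))).eventually_lt
        (h.cont.comp continuous_snd).continuousAt
      (h.MS_strict P hk hp hdp hl hM hz1)
  filter_upwards [nhdsWithin_le_nhds hev, Ioo_mem_nhdsGT (show l₀ < 2 * l₀ by linarith)] with l h1 h2
  obtain ⟨h2, h3⟩ := h2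
  have hl' := hl.trans h2
  set S : Set (E n) := {z | l < ‖z‖} \ (closedBall (0 : E n) R \ ball 0 (l₀ + δ)) with hS
  refine H t ht ht2 l hl' S ((meas_ext l).diff (measurableSet_closedBall.diff measurableSet_ball))
      (fun z hz => hz.1) (fun z hz hzS => ?_) ?_
  · by_contra hc
    exact hzS ⟨hz, fun hh => hc (h1 z hh).le⟩
  have hR0 : 0 < R := lin!
  have i0 := ker_integrable_compl (n := n) P.nN hl
  have hJS : ∫ z in S, ‖z‖ ^ (-N) ≤ η := by
    have hsub : S ⊆ ((ball (0 : E n) l₀)ᶜ \ (ball 0 (l₀ + δ))ᶜ) ∪ (ball 0 R)ᶜ := by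
      intro z hz
      have hz1 : l < ‖z‖ := hz.1
      have hz2 := hz.2
      simp only [Set.mem_sdiff, mem_closedBall_zero_iff, mem_ball_zero_iff, not_and, not_not,
        mem_union, mem_compl_iff, not_lt] at hz2 ⊢
      rcases le_or_gt R ‖z‖ with h | h
      · exact Or.inr h
      · exact Or.inl ⟨lin!, hz2 h.le⟩
    have hsub2 : (ball (0 : E n) (l₀ + δ))ᶜ ⊆ (ball 0 l₀)ᶜ :=
      compl_subset_compl.2 (ball_subset_ball lin!)
    have hsub3 : (ball (0 : E n) R)ᶜ ⊆ (ball 0 l₀)ᶜ :=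
      compl_subset_compl.2 (ball_subset_ball lin!)
    calc ∫ z in S, ‖z‖ ^ (-N)
        ≤ ∫ z in ((ball (0 : E n) l₀)ᶜ \ (ball 0 (l₀ + δ))ᶜ) ∪ (ball 0 R)ᶜ, ‖z‖ ^ (-N) :=
          setIntegral_mono_set (i0.mono_set (union_subset sdiff_subset hsub3))
            (.of_forall fun z => pos!) hsub.eventuallyLE
      _ ≤ (∫ z in (ball (0 : E n) l₀)ᶜ \ (ball 0 (l₀ + δ))ᶜ, ‖z‖ ^ (-N)) +
          ∫ z in (ball (0 : E n) R)ᶜ, ‖z‖ ^ (-N) := by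
          rw [← integral_add_measure (i0.mono_set sdiff_subset) (i0.mono_set hsub3)]
          exact integral_mono_measure (Measure.restrict_union_le _ _)
            (.of_forall fun z => pos!)
            (Integrable.add_measure (i0.mono_set sdiff_subset) (i0.mono_set hsub3))
      _ = (l₀ ^ (-(2 * σ)) - (l₀ + δ) ^ (-(2 * σ))) * J + R ^ (-(2 * σ)) * J := by
          rw [setIntegral_sdiff measurableSet_ball.compl i0 hsub2, kerN_compl P hl,
            kerN_compl P (show 0 < l₀ + δ by linarith), kerN_compl P hR0, ← hJ]; ring
      _ ≤ η := lin!
  have hJ0 : 0 ≤ ∫ z in S, ‖z‖ ^ (-N) := integral_nonneg fun z => pos!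
  generalize (∫ z in S, ‖z‖ ^ (-N)) = JS at *
  have e1 : l ^ (-(2 * σ)) ≤ l₀ ^ (-(2 * σ)) :=
    rpow_anti hl h2.le
  calc K * l ^ (4 * σ) * (t ^ (-d) * JS + K * t ^ (2 * σ) * l ^ (-(2 * σ)))
      ≤ K * (2 * l₀) ^ (4 * σ) * (t ^ (-d) * η + K * t ^ (2 * σ) * l₀ ^ (-(2 * σ))) := by
        gcongr
    _ ≤ 1 / 2 := lin!

lemma EntSol.MS_all (P : Par n σ d N) (h : EntSol n d p k C v) (hk : 0 < k) (hp : 1 < p)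
    (hdp : d * p < N) {L : ℝ} (hL : 0 < L) : MS d L v := by
  obtain ⟨a, ha1, ha2, ha3⟩ := ((h.MS_small P hk.le hp.le hdp.le).and (Ioc_mem_nhdsGT hL)).exists
  have hcl : IsClosed ({l | MS d l v} ∩ Icc a L) := by
    refine IsSeqClosed.isClosed fun s l hs hsl => ?_
    have hl := isClosed_Icc.mem_of_tendsto hsl (.of_forall fun j => (hs j).2)
    have hl0 := ha2.trans_le hl.1
    refine ⟨fun x hx => ?_, hl⟩
    have hc : Tendsto (fun j => kel d (s j) v x) atTop (𝓝 (kel d l v x)) := by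
      exact (kel_continuousAt (d := d) h.cont hl0 (norm_pos_iff.1 (hl0.trans hx))).tendsto.comp
          (hsl.prodMk_nhds tendsto_const_nhds)
    refine le_of_tendsto hc ?_
    filter_upwards [hsl.eventually_lt_const hx] with j hj
    exact (hs j).1 x hj
  have := hcl.Icc_subset_of_forall_mem_nhdsWithin ha1 (fun l hl =>
    h.MS_right P hk hp hdp (ha2.trans_le hl.2.1) hl.1)
  exact this (right_mem_Icc.2 ha3)

end moving

open Real

section liouville
variable {n : ℕ} {σ d N p k C l : ℝ} {v : E n → ℝ}

/-- Radial comparison coming from the moving spheres. -/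
lemma EntSol.radial (P : Par n σ d N) (h : EntSol n d p k C v) (hk : 0 < k) (hp : 1 < p)
    (hdp : d * p < N) {x : E n} {r : ℝ} (hx : x ≠ 0) (hr : 1 < r) :
    r ^ (-(d / 2)) * v x ≤ v (r • x) := by
  have hr0 : 0 < r := lin!
  have hsq := sq_sqrt hr0.le
  have hs : 1 < √r := by rw [lt_sqrt zero_le_one]; simpa using hr
  have := h.MS_all P hk hp hdp (L := √r * ‖x‖) pos! (r • x) (by
    rw [norm_smul, norm_of_nonneg hr0.le]; gcongr; nlinarith)
  convert this using 1
  rw [kel]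
  have e1 : √r * ‖x‖ / ‖r • x‖ = (√r)⁻¹ := by
    rw [norm_smul, norm_of_nonneg hr0.le]
    field_simp; exact hsq
  have e2 : iv (√r * ‖x‖) (r • x) = x := by
    rw [iv, e1, inv_pow, hsq, smul_smul, inv_mul_cancel₀ hr0.ne', one_smul]
  rw [e2, e1, sqrt_eq_rpow, ← rpow_neg hr0.le, ← rpow_mul hr0.le]
  congr 2; ring

lemma EntSol.false (P : Par n σ d N) (h : EntSol n d p k C v) (hk : 0 < k) (hp : 1 < p)
    (hdp : d * p < N) : False := by
  have := P.nontriv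
  have hd0 := P.d0
  -- minimum on spheres
  have hmin : ∀ t : ℝ, 0 < t → ∃ x : E n, ‖x‖ = t ∧ ∀ y : E n, ‖y‖ = t → v x ≤ v y := by
    intro t ht
    obtain ⟨x, hx, hm⟩ := (isCompact_sphere (0 : E n) t).exists_isMinOn
      (NormedSpace.sphere_nonempty.2 ht.le) h.cont.continuousOn
    exact ⟨x, by simpa using hx, fun y hy => hm (by simpa using hy)⟩
  have hcomp : ∀ t : ℝ, 0 < t → ∀ m, (∀ y : E n, ‖y‖ = t → m ≤ v y) → ∀ z : E n, t < ‖z‖ →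
      (‖z‖ / t) ^ (-(d / 2)) * m ≤ v z := by
    intro t ht m hm z hz
    have hz' := ht.trans hz
    have hz0 := norm_pos_iff.1 hz'
    have e : (‖z‖ / t) • ((t / ‖z‖) • z) = z := by
      rw [smul_smul, div_mul_div_cancel₀ ht.ne', div_self hz'.ne', one_smul]
    have e3 : ‖(t / ‖z‖) • z‖ = t := by
      rw [norm_smul, norm_of_nonneg pos!]; field_simp
    have hne : (t / ‖z‖) • z ≠ 0 := by rw [← norm_pos_iff, e3]; exact ht
    have := h.radial P hk hp hdp hne ((one_lt_div ht).2 hz)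
    rw [e] at this
    refine le_trans ?_ this
    gcongr
    exact hm _ e3
  obtain ⟨V, hV⟩ := named ((volume : Measure (E n)).real (ball 0 2 \ closedBall 0 1))
  have hV0 : 0 < V := by
    rw [hV]
    refine ENNReal.toReal_pos (IsOpen.measure_pos volume (isOpen_ball.sdiff isClosed_closedBall) ?_).ne'
      ((measure_mono sdiff_subset).trans_lt measure_ball_lt_top).ne
    obtain ⟨x, hx⟩ := NormedSpace.sphere_nonempty (x := (0 : E n)) (r := 3 / 2) |>.2 num!
    have hx : ‖x‖ = 3 / 2 := by simpa using hx
    exact ⟨x, by simp [hx]; norm_num⟩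
  obtain ⟨x₁, hx₁, hm₁⟩ := hmin 1 one_pos
  have hv1 := h.pos x₁
  -- key inequality
  have key : ∀ t : ℝ, 1 < t → k * (3 : ℝ) ^ (-d) * ((2 : ℝ) ^ (-(d / 2))) ^ p * V * v x₁ ^ (p - 1)
      ≤ t ^ (d / 2 * (p - 1) - 2 * σ) := by
    intro t ht
    have ht0 : 0 < t := lin!
    obtain ⟨x, hx, hm⟩ := hmin t ht0
    obtain ⟨m, hmdef⟩ := named (v x)
    have hm0 := hmdef ▸ h.pos x
    have hm1 : t ^ (-(d / 2)) * v x₁ ≤ m := by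
      have := hcomp 1 one_pos (v x₁) hm₁ x (by rw [hx]; exact ht)
      rwa [hx, div_one, ← hmdef] at this
    set A : Set (E n) := t • (ball (0 : E n) 2 \ closedBall 0 1) with hA
    have hAz : ∀ z ∈ A, t < ‖z‖ ∧ ‖z‖ < 2 * t := by
      rintro _ ⟨w, hw, rfl⟩
      simp only [Set.mem_sdiff, mem_ball_zero_iff, mem_closedBall_zero_iff, not_le] at hw
      simp only [norm_smul, norm_of_nonneg ht0.le]
      constructor <;> nlinarith [hw.1, hw.2]
    have hAvol : (volume : Measure (E n)).real A = t ^ (n : ℝ) * V := by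
      rw [hA, Measure.real, Measure.addHaar_smul, finrank_euclideanSpace_fin, ENNReal.toReal_mul,
        abs_of_pos pos!, ENNReal.toReal_ofReal pos!, ← Measure.real, ← hV,
        rpow_natCast]
    have hlow : ∀ z ∈ A, z ≠ x → (3 * t) ^ (-d) * (2 ^ (-(d / 2)) * m) ^ p ≤ Gam d (x - z) * v z ^ p := by
      intro z hz hzx
      obtain ⟨z1, z2⟩ := hAz z hz
      have hz' := ht0.trans z1
      have h1 : (3 * t) ^ (-d) ≤ Gam d (x - z) := by
        refine rpow_anti (norm_pos_iff.2 (sub_ne_zero.2 hzx.symm)) ?_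
        have := norm_sub_le x z
        linarith
      have h2 : 2 ^ (-(d / 2)) * m ≤ v z := by
        refine le_trans ?_ (hcomp t ht0 m (fun y hy => hmdef ▸ hm y hy) z z1)
        gcongr ?_ * m
        refine rpow_anti pos! ?_
        rw [div_le_iff₀ ht0]; exact z2.le
      have := h.pos z
      exact mul_le_mul h1 (rpow_le_rpow pos! h2 lin!) pos!
        (Gam_nonneg _)
    have hint : (3 * t) ^ (-d) * (2 ^ (-(d / 2)) * m) ^ p * (t ^ (n : ℝ) * V) ≤
        ∫ y, Gam d (x - y) * v y ^ p := by
      have hfin : volume A ≠ ⊤ := by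
        have hb : A ⊆ ball 0 (2 * t) := fun z hz => by simpa using (hAz z hz).2
        exact ((measure_mono hb).trans_lt measure_ball_lt_top).ne
      calc _ = ∫ _ in A, (3 * t) ^ (-d) * (2 ^ (-(d / 2)) * m) ^ p := by
            rw [setIntegral_const, hAvol, smul_eq_mul]; ring
        _ ≤ ∫ y in A, Gam d (x - y) * v y ^ p := by
            refine setIntegral_mono_on (integrableOn_const hfin) (h.int x).integrableOn
                ((measurableSet_ball.diff measurableSet_closedBall).const_smul₀ t) ?_
            intro z hz
            refine hlow z hz ?_
            rintro rfl
            have := (hAz _ hz).1; linarith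
        _ ≤ _ := setIntegral_le_integral (h.int x) (.of_forall fun y =>
            mul_nonneg (Gam_nonneg _) (rpow_nonneg (h.pos y).le _))
    have h3 := mul_le_l hint hk.le
    rw [← h.eq x, ← hmdef] at h3
    have hmp : m ^ p = m ^ (p - 1) * m := by rw [← rpow_add_one hm0.ne']; ring_nf
    have h4 : k * 3 ^ (-d) * ((2 : ℝ) ^ (-(d / 2))) ^ p * V * (t ^ (n - d) * m ^ (p - 1)) ≤ 1 := by
      rw [mul_rpow pos! ht0.le, mul_rpow pos! hm0.le, hmp] at h3
      have e : t ^ (n - d) = t ^ (-d) * t ^ (n : ℝ) := by rw [← rpow_add ht0]; ring_nf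
      rw [e]
      refine le_of_mul_le_mul_right ?_ hm0
      rw [one_mul]
      refine le_trans (le_of_eq ?_) h3
      ring
    have h5 : (t ^ (-(d / 2)) * v x₁) ^ (p - 1) ≤ m ^ (p - 1) :=
      rpow_le_rpow pos! hm1 lin!
    rw [mul_rpow pos! hv1.le, ← rpow_mul ht0.le] at h5
    have h6 : k * 3 ^ (-d) * ((2 : ℝ) ^ (-(d / 2))) ^ p * V *
        (t ^ (n - d) * (t ^ (-(d / 2) * (p - 1)) * v x₁ ^ (p - 1))) ≤ 1 :=
      le_trans (by gcongr) h4
    have e7 : t ^ (d / 2 * (p - 1) - 2 * σ) * (t ^ (n - d) * t ^ (-(d / 2) * (p - 1))) = 1 := by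
      rw [← rpow_add ht0, ← rpow_add ht0, ← rpow_zero t]
      congr 1; rw [P.nd]; ring
    have h8 := mul_le_l h6 (show 0 ≤ t ^ (d / 2 * (p - 1) - 2 * σ) by positivity)
    rw [mul_one] at h8
    refine le_trans (le_of_eq ?_) h8
    linear_combination -(k * (3 : ℝ) ^ (-d) * ((2 : ℝ) ^ (-(d / 2))) ^ p * V * v x₁ ^ (p - 1)) * e7
  have hneg : 0 < 2 * σ - d / 2 * (p - 1) := by linarith [P.hN, P.hd]
  have hc : 0 < k * (3 : ℝ) ^ (-d) * ((2 : ℝ) ^ (-(d / 2))) ^ p * V * v x₁ ^ (p - 1) := pos!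
  obtain ⟨t, a, b⟩ := (((tendsto_rpow_neg_atTop hneg).eventually_lt_const hc).and
      (eventually_gt_atTop 1)).exists
  have := key t b
  rw [neg_sub] at a
  linarith

/-- Liouville theorem for bounded solutions of `v = b + k Γ * v^p` with `p` subcritical. -/
theorem liouville (P : Par n σ d N) (hk : 0 < k) (hp : 1 < p) (hdp : d * p < N) {b : ℝ} (hb : 0 ≤ b)
    (hc : Continuous v) (hv0 : ∀ x, 0 ≤ v x) (hvC : ∀ x, v x ≤ C) (h0 : 0 < v 0)
    (hint : ∀ x, Integrable (fun y => Gam d (x - y) * v y ^ p))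
    (heq : ∀ x, v x = b + k * ∫ y, Gam d (x - y) * v y ^ p) : False := by
  have := P.nontriv
  have hI0 : ∀ x, 0 ≤ ∫ y, Gam d (x - y) * v y ^ p := fun x => integral_nonneg fun y =>
    mul_nonneg (Gam_nonneg _) (rpow_nonneg (hv0 y) _)
  rcases hb.eq_or_lt with rfl | hb
  · refine EntSol.false (k := k) (p := p) (v := v) (C := C) P ⟨hc, fun x => ?_, hvC, hint, fun x => by
      rw [← zero_add (k * _)]; exact heq x⟩ hk hp hdp
    rw [heq x, zero_add]
    refine mul_pos hk ?_
    rw [integral_pos_iff_support_of_nonneg (fun y =>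
      mul_nonneg (Gam_nonneg _) (rpow_nonneg (hv0 y) _)) (hint x)]
    have ho : IsOpen {y | 0 < v y} := isOpen_lt continuous_const hc
    have h1 : 0 < volume ({y | 0 < v y} \ {x}) := by
      rw [measure_sdiff_null (measure_singleton x)]
      exact ho.measure_pos volume ⟨0, h0⟩
    refine h1.trans_le (measure_mono fun y hy => ?_)
    have h2 : 0 < v y := hy.1
    exact (mul_pos (Gam_pos (sub_ne_zero.2 fun h => hy.2 h.symm)) (rpow_pos_of_pos h2 p)).ne'
  · have hvb : ∀ x, b ≤ v x := fun x => by
      rw [heq x]; linarith [mul_nonneg hk.le (hI0 x)]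
    have hG : Integrable (Gam (n := n) d) := by
      have := (hint 0).const_mul ((b ^ p)⁻¹)
      refine this.mono' Gam_measurable.aestronglyMeasurable (.of_forall fun y => ?_)
      rw [norm_of_nonneg (Gam_nonneg _), zero_sub, Gam_neg]
      have h2 : 0 < b ^ p := pos!
      rw [inv_mul_eq_div, le_div_iff₀ h2]
      exact mul_le_l (rpow_le_rpow hb.le (hvb y) lin!) (Gam_nonneg _)
    have h1 := integral_scale (Gam (n := n) d) (zero_lt_two (α := ℝ))
    simp_rw [Gam_smul zero_lt_two] at h1
    rw [integral_const_mul, ← mul_assoc, ← rpow_add zero_lt_two] at h1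
    have h2 : 0 < ∫ x : E n, Gam d x := by
      rw [integral_pos_iff_support_of_nonneg (fun x => Gam_nonneg x) hG]
      have : 0 < volume (ball (0 : E n) 1 \ {0}) := by
        rw [measure_sdiff_null (measure_singleton 0)]
        exact measure_ball_pos _ _ one_pos
      exact this.trans_le (measure_mono fun x hx => (Gam_pos hx.2).ne')
    have h3 : (1 : ℝ) < 2 ^ ((n : ℝ) + -d) :=
      one_lt_rpow one_lt_two (by linarith [P.dn])
    nlinarith

end liouville

open Real

section kernelcont
variable {n : ℕ} {σ d N : ℝ}

/-- `L¹`-continuity of translations of the truncated kernel. -/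
lemma Psr_equicont (P : Par n σ d N) {F ε : ℝ} (hF : 0 ≤ F) (hε : 0 < ε) :
    ∃ δ > 0, δ ≤ 1 ∧ ∀ x y : E n, ‖x - y‖ ≤ δ → ∀ f : E n → ℝ, Measurable f →
      (∀ z ∈ ball x 3, |f z| ≤ F) →
      |(∫ z, Psr d 1 (z - x) * f z) - ∫ z, Psr d 1 (z - y) * f z| ≤ ε := by
  have := P.nontriv
  have hd0 := P.d0
  obtain ⟨I, hI⟩ := named (∫ x : E n, Psi1 d x)
  obtain ⟨ρ, hρ0, hρ1, hρ⟩ : ∃ ρ : ℝ, 0 < ρ ∧ ρ ≤ 1 ∧ F * (ρ ^ (2 * σ) * I) ≤ ε / 4 := by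
    have h0 : ContinuousAt (fun ε : ℝ => F * (ε ^ (2 * σ) * I)) 0 :=
      continuousAt_const.mul ((continuousAt_rpow_const _ _ (Or.inr
        (by linarith [P.hσ0]))).mul continuousAt_const)
    have h1 := h0.tendsto.mono_left (nhdsWithin_le_nhds (s := Ioi 0))
    rw [zero_rpow (by linarith [P.hσ0])] at h1
    simp only [mul_zero, zero_mul] at h1
    obtain ⟨t, a, b⟩ := ((h1.eventually_le_const (show (0 : ℝ) < ε / 4 by linarith)).and
      (Ioc_mem_nhdsGT one_pos)).exists
    exact ⟨t, b.1, b.2, a⟩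
  set K : E n → ℝ := fun z => Gr d ρ z - Gr d 1 z with hK
  have hKs : HasCompactSupport K := by
    refine HasCompactSupport.intro (isCompact_closedBall 0 1) fun z hz => ?_
    simp only [mem_closedBall_zero_iff, not_le] at hz
    simp only [hK]
    rw [Gr_eq hd0 hρ0 lin!, Gr_eq hd0 one_pos hz.le, sub_self]
  obtain ⟨L, hL⟩ : ∃ L, LipschitzWith L K :=
    (((Gr_contDiff hd0).sub (Gr_contDiff hd0)).of_le
        num!).lipschitzWith_of_hasCompactSupport hKs one_ne_zero
  obtain ⟨W, hW⟩ := named ((volume : Measure (E n)).real (ball 0 3))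
  have hW0 := hW ▸ measureReal_nonneg
  refine ⟨min 1 (ε / (2 * (L * F * W + 1))), pos!, min_le_left _ _,
    fun x y hxy f hf hfF => ?_⟩
  have hxy1 := hxy.trans (min_le_left _ _)
  have hxy2 : L * F * W * ‖x - y‖ ≤ ε / 2 := by
    have h1 := hxy.trans (min_le_right _ _)
    calc L * F * W * ‖x - y‖ ≤ (L * F * W + 1) * (ε / (2 * (L * F * W + 1))) := by
          gcongr; linarith
      _ = ε / 2 := by field_simp
  have hb : ∀ w : E n, ‖x - w‖ ≤ 1 → ∀ s ≤ (1 : ℝ), ∀ z ∈ closedBall w s, |f z| ≤ F := by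
    intro w hw s hs z hz
    refine hfF z ?_
    rw [mem_closedBall, dist_eq_norm] at hz
    rw [mem_ball, dist_eq_norm]
    have : z - x = (z - w) - (x - w) := by abel
    rw [this]
    linarith [norm_sub_le (z - w) (x - w)]
  have hx0 : ‖x - x‖ ≤ 1 := by simp
  obtain ⟨a1, -⟩ := Psr_mul_integrable P one_pos hf (hb x hx0 1 le_rfl)
  obtain ⟨a2, -⟩ := Psr_mul_integrable P one_pos hf (hb y hxy1 1 le_rfl)
  obtain ⟨b1, b2⟩ := Psr_mul_integrable P hρ0 hf (hb x hx0 ρ hρ1)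
  obtain ⟨c1, c2⟩ := Psr_mul_integrable P hρ0 hf (hb y hxy1 ρ hρ1)
  rw [← hI] at b2 c2
  have key : |∫ z, ((Psr d 1 (z - x) * f z - Psr d ρ (z - x) * f z) -
      (Psr d 1 (z - y) * f z - Psr d ρ (z - y) * f z))| ≤ ε / 2 := by
    refine le_trans ?_ hxy2
    have hae1 : ∀ᵐ z : E n, z ≠ x := compl_mem_ae_iff.2 (measure_singleton x)
    have hbd : ∀ᵐ z : E n, ‖(Psr d 1 (z - x) * f z - Psr d ρ (z - x) * f z) -
      (Psr d 1 (z - y) * f z - Psr d ρ (z - y) * f z)‖ ≤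
      (ball x 3).indicator (fun _ => L * ‖x - y‖ * F) z := by
      filter_upwards [hae1.and (compl_mem_ae_iff.2 (measure_singleton y))] with z hz
      have e : (Psr d 1 (z - x) * f z - Psr d ρ (z - x) * f z) -
        (Psr d 1 (z - y) * f z - Psr d ρ (z - y) * f z) = (K (z - x) - K (z - y)) * f z := by
        rw [Psr_of_ne one_pos (sub_ne_zero.2 hz.1), Psr_of_ne hρ0 (sub_ne_zero.2 hz.1),
          Psr_of_ne one_pos (sub_ne_zero.2 hz.2), Psr_of_ne hρ0 (sub_ne_zero.2 hz.2)]
        simp only [hK]; ring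
      rw [e, norm_mul]
      by_cases hzx : z ∈ ball x 3
      · rw [indicator_of_mem hzx]
        have h1 := hL.dist_le_mul (z - x) (z - y)
        rw [dist_eq_norm, dist_eq_norm, show z - x - (z - y) = -(x - y) by abel, norm_neg] at h1
        exact mul_le_mul h1 (hfF z hzx) (norm_nonneg _) pos!
      · rw [indicator_of_notMem hzx]
        rw [mem_ball, dist_eq_norm, not_lt] at hzx
        have hzy : 1 ≤ ‖z - y‖ := by
          have : z - x = (z - y) - (x - y) := by abel
          rw [this] at hzx
          linarith [norm_sub_le (z - y) (x - y)]
        simp only [hK]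
        rw [Gr_eq hd0 hρ0 (lin! : ρ ≤ ‖z - x‖), Gr_eq hd0 one_pos (lin! : 1 ≤ ‖z - x‖),
          Gr_eq hd0 hρ0 (lin! : ρ ≤ ‖z - y‖), Gr_eq hd0 one_pos hzy]
        simp
    have := norm_integral_le_of_norm_le ((integrable_indicator_iff measurableSet_ball).2
        (integrableOn_const measure_ball_lt_top.ne)) hbd
    rw [integral_indicator measurableSet_ball, setIntegral_const, smul_eq_mul] at this
    have hvol : (volume : Measure (E n)).real (ball x 3) = W := by
      rw [hW, Measure.real, Measure.real, Measure.addHaar_ball_center]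
    rw [hvol] at this
    refine this.trans (le_of_eq ?_); ring
  have i3 : ∫ z, ((Psr d 1 (z - x) * f z - Psr d ρ (z - x) * f z) -
      (Psr d 1 (z - y) * f z - Psr d ρ (z - y) * f z)) =
      (∫ z, (Psr d 1 (z - x) * f z - Psr d ρ (z - x) * f z)) -
      ∫ z, (Psr d 1 (z - y) * f z - Psr d ρ (z - y) * f z) := integral_sub (a1.sub b1) (a2.sub c1)
  rw [i3, integral_sub a1 b1, integral_sub a2 c1] at key
  have b3 := b2.trans hρ
  have c3 := c2.trans hρ
  rw [abs_le] at key b3 c3 ⊢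
  constructor <;> linarith [key.1, key.2, b3.1, b3.2, c3.1, c3.2]

lemma Gam_ratio {η : ℝ} (hη : 0 < η) : ∃ L > 0, ∀ x z : E n, L * ‖x‖ ≤ ‖z‖ → z ≠ 0 →
    |Gam d (x - z) - Gam d z| ≤ η * Gam d z := by
  obtain ⟨δ, hδ, h⟩ := Metric.continuousAt_iff.1
      (continuousAt_rpow_const _ _ (Or.inl one_ne_zero)) η hη
  refine ⟨2 / δ, pos!, fun x z hxz hz => ?_⟩
  have hz' := norm_pos_iff.2 hz
  have hx2 : ‖x‖ ≤ δ / 2 * ‖z‖ := by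
    rw [div_mul_eq_mul_div, div_le_iff₀ hδ] at hxz; nlinarith
  have h1 : dist (‖x - z‖ / ‖z‖) 1 < δ := by
    rw [dist_eq, div_sub_one hz'.ne', abs_div, abs_of_pos hz', div_lt_iff₀ hz']
    have := abs_norm_sub_norm_le (x - z) (-z)
    rw [norm_neg, sub_neg_eq_add, sub_add_cancel] at this
    nlinarith
  have h2 := h h1
  rw [dist_eq, one_rpow, div_rpow (norm_nonneg _) hz'.le] at h2
  have h3 : 0 < ‖z‖ ^ (-d) := pos!
  unfold Gam
  rw [div_sub_one h3.ne', abs_div, abs_of_pos h3, div_lt_iff₀ h3] at h2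
  exact h2.le

lemma exists_Gam_le_two_Psr (hd : 0 < d) : ∃ θ > 0, θ ≤ 1 / 8 ∧ ∀ S > 0, ∀ z : E n,
    ‖z‖ ≤ 4 * θ * S → Gam d z ≤ 2 * Psr d S z := by
  have hc : Tendsto (fun t : ℝ => 2 * Phi 2 * (4 * t) ^ d) (𝓝[>] 0) (𝓝 0) := by
    have h0 : ContinuousAt (fun t : ℝ => 2 * Phi 2 * (4 * t) ^ d) 0 :=
      continuousAt_const.mul ((continuousAt_const.mul continuousAt_id).rpow_const (Or.inr hd.le))
    have h1 := h0.tendsto.mono_left (nhdsWithin_le_nhds (s := Ioi 0))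
    rw [mul_zero, zero_rpow hd.ne', mul_zero] at h1
    exact h1
  obtain ⟨θ, a, b, b'⟩ := ((hc.eventually_le_const (show (0 : ℝ) < 1 by norm_num)).and
    (Ioc_mem_nhdsGT (show (0 : ℝ) < 1 / 8 by norm_num))).exists
  refine ⟨θ, b, b', fun S hS z hz => ?_⟩
  rcases eq_or_ne z 0 with rfl | hz0
  · have : Gam d (0 : E n) = 0 := by simp [Gam, hd.ne']
    rw [this]; linarith [Psr_nonneg (d := d) hS (0 : E n)]
  rw [Psr_of_ne hS hz0]
  have h1 := Gr_le_two (d := d) hS z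
  have h2 : (4 * θ * S) ^ (-d) ≤ Gam d z := rpow_anti
      (norm_pos_iff.2 hz0) hz
  have h3 : 2 * (Phi 2 * S ^ (-d)) ≤ (4 * θ * S) ^ (-d) := by
    rw [mul_rpow pos! hS.le, rpow_neg (x := 4 * θ) pos!]
    have h4 : 0 < (4 * θ) ^ d := pos!
    have h5 : 2 * Phi 2 ≤ ((4 * θ) ^ d)⁻¹ := by
      rw [← one_div, le_div_iff₀ h4]; exact a
    calc _ = 2 * Phi 2 * S ^ (-d) := by ring
      _ ≤ _ := by gcongr
  linarith

lemma Gam_integrableOn_ball (P : Par n σ d N) (x : E n) (R : ℝ) :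
    IntegrableOn (fun z => Gam d (x - z)) (ball 0 R) := by
  refine ((Gam_ball_integral P x (r := |R| + ‖x‖ + 1) pos!).1).mono_set fun z hz => ?_
  rw [mem_ball_zero_iff] at hz
  rw [mem_ball, dist_eq_norm]
  linarith [norm_sub_le z x, le_abs_self R]

lemma Gam_mul_integrableOn_ball (P : Par n σ d N) (x : E n) {R M : ℝ} {f : E n → ℝ} (hf : Measurable f)
    (hM : ∀ z ∈ ball 0 R, |f z| ≤ M) : IntegrableOn (fun z => Gam d (x - z) * f z) (ball 0 R) := by
  refine Integrable.mono' ((Gam_integrableOn_ball P x R).mul_const M)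
    ((Gam_measurable.comp (measurable_const.sub measurable_id)).mul hf).aestronglyMeasurable ?_
  refine (ae_restrict_iff' measurableSet_ball).2 (.of_forall fun z hz => ?_)
  change ‖Gam d (x - z) * f z‖ ≤ _
  rw [norm_mul, norm_of_nonneg (Gam_nonneg _)]
  exact mul_le_l (hM z hz) (Gam_nonneg _)

end kernelcont

open Real

/-- A rescaled family of approximate solutions on larger and larger balls, normalised at `0`,
with a nearly linear representation formula. -/
structure Blow {n : ℕ} (σ d N κ c C F p : ℝ) (v f : ℕ → E n → ℝ) (B : ℕ → ℝ → E n → ℝ)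
    (r ε : ℕ → ℝ) : Prop where
  par : Par n σ d N
  r_lim : Tendsto r atTop atTop
  ε_lim : Tendsto ε atTop (𝓝 0)
  meas : ∀ k, Measurable (f k)
  one : ∀ k, v k 0 = 1
  v0 : ∀ k x, ‖x‖ < r k → 0 ≤ v k x
  vC : ∀ k x, ‖x‖ < r k → v k x ≤ C
  f0 : ∀ k x, ‖x‖ < r k → 0 ≤ f k x
  fF : ∀ k x, ‖x‖ < r k → f k x ≤ F
  conv : ∀ x, Tendsto (fun k => f k x - c * v k x ^ p) atTop (𝓝 0)
  rep : ∀ k s y, 0 < s → ‖y‖ + s < r k →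
    |κ * v k y - B k s y - ∫ z, Psr d s (z - y) * f k z| ≤ ε k
  B0 : ∀ k s y, 0 < s → 0 ≤ B k s y
  ratio : ∀ η > 0, ∃ δ > 0, ∀ k s y y', 0 < s → ‖y - y'‖ ≤ δ * s → B k s y ≤ (1 + η) * B k s y'
  κ0 : 0 < κ
  c0 : 0 < c
  p1 : 1 < p
  dp : d * p < N
  C0 : 0 ≤ C
  F0 : 0 ≤ F

namespace Blow
variable {n : ℕ} {σ d N κ c C F p : ℝ} {v f : ℕ → E n → ℝ} {B : ℕ → ℝ → E n → ℝ} {r ε : ℕ → ℝ}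

lemma comp (H : Blow σ d N κ c C F p v f B r ε) {φ : ℕ → ℕ} (hφ : StrictMono φ) :
    Blow σ d N κ c C F p (v ∘ φ) (f ∘ φ) (B ∘ φ) (r ∘ φ) (ε ∘ φ) where
  par := H.par
  r_lim := H.r_lim.comp hφ.tendsto_atTop
  ε_lim := H.ε_lim.comp hφ.tendsto_atTop
  meas := fun k => H.meas _
  one := fun k => H.one _
  v0 := fun k => H.v0 _
  vC := fun k => H.vC _
  f0 := fun k => H.f0 _
  fF := fun k => H.fF _
  conv := fun x => (H.conv x).comp hφ.tendsto_atTop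
  rep := fun k => H.rep _
  B0 := fun k => H.B0 _
  ratio := fun η hη => by
    obtain ⟨δ, hδ, h⟩ := H.ratio η hη
    exact ⟨δ, hδ, fun k => h _⟩
  κ0 := H.κ0
  c0 := H.c0
  p1 := H.p1
  dp := H.dp
  C0 := H.C0
  F0 := H.F0

lemma abs_f_le (H : Blow σ d N κ c C F p v f B r ε) {k : ℕ} {x : E n} (hx : ‖x‖ < r k) :
    |f k x| ≤ F := by
  rw [abs_of_nonneg (H.f0 k x hx)]; exact H.fF k x hx

lemma norm_lt_of_mem {s R : ℝ} {y z : E n} (h : ‖y‖ + s < R) (hz : z ∈ closedBall y s) :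
    ‖z‖ < R := by
  rw [mem_closedBall, dist_eq_norm] at hz
  linarith [norm_sub_norm_le z y]

lemma Psr_int (H : Blow σ d N κ c C F p v f B r ε) {k : ℕ} {s : ℝ} {y : E n} (hs : 0 < s)
    (h : ‖y‖ + s < r k) : Integrable (fun z => Psr d s (z - y) * f k z) :=
  (Psr_mul_integrable H.par hs (H.meas k) fun _ hz => H.abs_f_le (norm_lt_of_mem h hz)).1

lemma Psr_mul_nonneg (H : Blow σ d N κ c C F p v f B r ε) {k : ℕ} {s : ℝ} {y : E n} (hs : 0 < s)
    (h : ‖y‖ + s < r k) (z : E n) : 0 ≤ Psr d s (z - y) * f k z := by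
  by_cases hz : z ∈ closedBall y s
  · exact mul_nonneg (Psr_nonneg hs _) (H.f0 k z (norm_lt_of_mem h hz))
  · rw [mem_closedBall, dist_eq_norm, not_le] at hz
    rw [Psr_eq_zero H.par.d0 hs hz.le, zero_mul]

lemma B_le (H : Blow σ d N κ c C F p v f B r ε) {k : ℕ} {s : ℝ} {y : E n} (hs : 0 < s)
    (h : ‖y‖ + s < r k) : B k s y ≤ κ * C + ε k := by
  have h1 := (abs_le.1 (H.rep k s y hs h)).1
  have h2 : 0 ≤ ∫ z, Psr d s (z - y) * f k z := integral_nonneg (H.Psr_mul_nonneg hs h)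
  have h3 := mul_le_l (H.vC k y lin!) H.κ0.le
  linarith

lemma Psr_int_le (H : Blow σ d N κ c C F p v f B r ε) {k : ℕ} {s : ℝ} {y : E n} (hs : 0 < s)
    (h : ‖y‖ + s < r k) : ∫ z, Psr d s (z - y) * f k z ≤ κ * v k y + ε k := by
  have h1 := (abs_le.1 (H.rep k s y hs h)).1
  linarith [H.B0 k s y hs]

lemma equicont (H : Blow σ d N κ c C F p v f B r ε) {η : ℝ} (hη : 0 < η) :
    ∃ δ > 0, ∀ R, ∀ᶠ k in atTop, ∀ x y : E n, ‖x‖ ≤ R → ‖y‖ ≤ R → ‖x - y‖ ≤ δ →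
      |v k x - v k y| ≤ η := by
  have hκ := H.κ0
  have hC := H.C0
  obtain ⟨δ1, hδ1, h1⟩ := H.ratio (κ * η / 4 / (κ * C + 1)) pos!
  obtain ⟨δ2, hδ2, -, h2⟩ := Psr_equicont H.par H.F0 (ε := κ * η / 4) pos!
  have key : ∀ R, ∀ᶠ k in atTop, ∀ x y : E n, ‖x‖ ≤ R → ‖y‖ ≤ R → ‖x - y‖ ≤ min δ1 δ2 →
      v k x - v k y ≤ η := by
    intro R
    filter_upwards [H.r_lim.eventually_ge_atTop (R + 4),
      H.ε_lim.eventually_le_const (show (0 : ℝ) < min 1 (κ * η / 4) by positivity)]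
      with k hk hε x y hx hy hxy
    have a1 := h1 k 1 x y one_pos (by rw [mul_one]; exact hxy.trans (min_le_left _ _))
    have a2 := h2 x y (hxy.trans (min_le_right _ _)) (f k) (H.meas k) fun z hz =>
      H.abs_f_le (norm_lt_of_mem (s := 3) lin! (ball_subset_closedBall hz))
    have a3 := H.B_le (k := k) (y := y) one_pos lin!
    have a4 := H.rep k 1 x one_pos lin!
    have a5 := H.rep k 1 y one_pos lin!
    have e1 := hε.trans (min_le_left _ _)
    have e2 := hε.trans (min_le_right _ _)
    have a6 : κ * η / 4 / (κ * C + 1) * B k 1 y ≤ κ * η / 4 := by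
      calc _ ≤ κ * η / 4 / (κ * C + 1) * (κ * C + 1) := by gcongr; linarith
        _ = _ := by field_simp
    rw [abs_le] at a2 a4 a5
    have : κ * (v k x - v k y) ≤ κ * η := by linarith [a2.2, a4.2, a5.1]
    exact le_of_mul_le_mul_left this hκ
  refine ⟨min δ1 δ2, pos!, fun R => ?_⟩
  filter_upwards [key R] with k hk x y hx hy hxy
  rw [abs_le]
  exact ⟨by linarith [hk y x hy hx (by rwa [norm_sub_rev])], hk x y hx hy hxy⟩

lemma exists_subseq (H : Blow σ d N κ c C F p v f B r ε) : ∃ φ : ℕ → ℕ, StrictMono φ ∧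
    ∃ V : E n → ℝ, Continuous V ∧ ∀ x, Tendsto (fun k => v (φ k) x) atTop (𝓝 (V x)) := by
  set q := TopologicalSpace.denseSeq (E n) with hq
  set g : ℕ → ℕ → ℝ := fun k j => max 0 (min C (v k (q j))) with hg
  obtain ⟨a, -, φ, hφ, hlim⟩ :=
      (isCompact_univ_pi fun _ => isCompact_Icc).tendsto_subseq (x := g) fun k j _ =>
    ⟨le_max_left _ _, max_le H.C0 (min_le_left _ _)⟩
  rw [tendsto_pi_nhds] at hlim
  have Hφ := H.comp hφ
  have hdense : ∀ j, Tendsto (fun k => v (φ k) (q j)) atTop (𝓝 (a j)) := fun j => by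
    refine (hlim j).congr' ?_
    filter_upwards [Hφ.r_lim.eventually_gt_atTop ‖q j‖] with k hk
    have h0 : 0 ≤ v (φ k) (q j) := Hφ.v0 k _ hk
    have h1 : v (φ k) (q j) ≤ C := Hφ.vC k _ hk
    simp only [hg, Function.comp]
    rw [min_eq_right h1, max_eq_right h0]
  have hex : ∀ x, ∃ l, Tendsto (fun k => v (φ k) x) atTop (𝓝 l) := fun x => by
    refine cauchySeq_tendsto_of_complete (Metric.cauchySeq_iff.2 fun η hη => ?_)
    obtain ⟨δ, hδ, h⟩ := Hφ.equicont (η := η / 4) lin!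
    obtain ⟨y, hy⟩ : ∃ y, q y ∈ ball x δ :=
      (TopologicalSpace.denseRange_denseSeq (E n)).exists_mem_open isOpen_ball
        ⟨x, mem_ball_self hδ⟩
    obtain ⟨K1, hK1⟩ := Metric.cauchySeq_iff.1 (hdense y).cauchySeq (η / 4) lin!
    obtain ⟨K2, hK2⟩ := eventually_atTop.1 (h (max ‖x‖ ‖q y‖))
    refine ⟨max K1 K2, fun m hm l hl => ?_⟩
    have hd : ‖x - q y‖ ≤ δ := by
      rw [← dist_eq_norm, dist_comm]; exact (mem_ball.1 hy).le
    have b1 := hK2 m ((le_max_right _ _).trans hm) x (q y) (le_max_left _ _) (le_max_right _ _) hd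
    have b2 := hK2 l ((le_max_right _ _).trans hl) x (q y) (le_max_left _ _) (le_max_right _ _) hd
    have b3 := hK1 m ((le_max_left _ _).trans hm) l ((le_max_left _ _).trans hl)
    rw [dist_eq] at b3 ⊢
    simp only [Function.comp] at b1 b2
    rw [abs_le] at b1 b2
    rw [abs_lt] at b3 ⊢
    constructor <;> linarith [b1.1, b1.2, b2.1, b2.2, b3.1, b3.2]
  choose V hV using hex
  refine ⟨φ, hφ, V, ?_, hV⟩
  refine Metric.continuous_iff.2 fun x η hη => ?_
  obtain ⟨δ, hδ, h⟩ := Hφ.equicont (η := η / 2) lin!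
  refine ⟨δ, hδ, fun y hy => ?_⟩
  have h2 : |V y - V x| ≤ η / 2 := by
    refine le_of_tendsto ((hV y).sub (hV x)).abs ((h (max ‖x‖ ‖y‖)).mono fun k hk => ?_)
    exact hk y x (le_max_right _ _) (le_max_left _ _) (by rw [← dist_eq_norm]; exact hy.le)
  rw [dist_eq]; linarith

end Blow

open Real

namespace Blow
variable {n : ℕ} {σ d N κ c C F p : ℝ} {v f : ℕ → E n → ℝ} {B : ℕ → ℝ → E n → ℝ} {r ε : ℕ → ℝ}
  {V : E n → ℝ}

lemma limit_bounds (H : Blow σ d N κ c C F p v f B r ε)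
    (hV : ∀ x, Tendsto (fun k => v k x) atTop (𝓝 (V x))) (x : E n) : 0 ≤ V x ∧ V x ≤ C :=
  ⟨ge_of_tendsto (hV x) ((H.r_lim.eventually_gt_atTop ‖x‖).mono fun k hk => H.v0 k x hk),
    le_of_tendsto (hV x) ((H.r_lim.eventually_gt_atTop ‖x‖).mono fun k hk => H.vC k x hk)⟩

lemma f_lim (H : Blow σ d N κ c C F p v f B r ε)
    (hV : ∀ x, Tendsto (fun k => v k x) atTop (𝓝 (V x))) (x : E n) :
    Tendsto (fun k => f k x) atTop (𝓝 (c * V x ^ p)) := by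
  have h1 := ((hV x).rpow_const (Or.inr (by linarith [H.p1]))).const_mul c
  simpa using (H.conv x).add h1

lemma int_lim (H : Blow σ d N κ c C F p v f B r ε)
    (hV : ∀ x, Tendsto (fun k => v k x) atTop (𝓝 (V x))) (x : E n) (R : ℝ) :
    Tendsto (fun k => ∫ z in ball 0 R, Gam d (x - z) * f k z) atTop
      (𝓝 (∫ z in ball 0 R, Gam d (x - z) * (c * V z ^ p))) := by
  refine tendsto_integral_filter_of_dominated_convergence (fun z => Gam d (x - z) * F)
    (.of_forall fun k =>
      ((Gam_measurable.comp (measurable_const.sub measurable_id)).mul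
        (H.meas k)).aestronglyMeasurable) ?_ ?_ ?_
  · filter_upwards [H.r_lim.eventually_gt_atTop R] with k hk
    refine (ae_restrict_iff' measurableSet_ball).2 (.of_forall fun z hz => ?_)
    rw [mem_ball_zero_iff] at hz
    rw [norm_mul, norm_of_nonneg (Gam_nonneg _)]
    exact mul_le_l (H.abs_f_le (hz.trans hk)) (Gam_nonneg _)
  · exact Integrable.mul_const (Gam_integrableOn_ball H.par x R) F
  · exact .of_forall fun z => (H.f_lim hV z).const_mul _

lemma ball_bound (H : Blow σ d N κ c C F p v f B r ε)
    (hV : ∀ x, Tendsto (fun k => v k x) atTop (𝓝 (V x))) (x : E n) (R : ℝ) :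
    ∫ z in ball 0 R, Gam d (x - z) * (c * V z ^ p) ≤ κ * V x := by
  have := H.par.nontriv
  obtain ⟨W, hW⟩ := named ((volume : Measure (E n)).real (ball 0 R))
  have hlim : Tendsto (fun k => κ * v k x + ε k + Phi 2 * (r k / 2) ^ (-d) * F * W) atTop
      (𝓝 (κ * V x)) := by
    have h2 := (((hV x).const_mul κ).add H.ε_lim).add
      (((((tendsto_rpow_neg_atTop H.par.d0).comp (H.r_lim.atTop_div_const two_pos)).const_mul
          (Phi 2)).mul_const F).mul_const W)
    simpa using h2
  refine le_of_tendsto_of_tendsto (H.int_lim hV x R) hlim ?_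
  filter_upwards [H.r_lim.eventually_gt_atTop (2 * ‖x‖), H.r_lim.eventually_gt_atTop R,
    H.r_lim.eventually_gt_atTop 0] with k h1 h2 h3
  have hS : 0 < r k / 2 := lin!
  have hlt : ‖x‖ + r k / 2 < r k := lin!
  have hI := H.Psr_int hS hlt
  have hf : ∀ z ∈ ball (0 : E n) R, ‖z‖ < r k := fun z hz => by
    rw [mem_ball_zero_iff] at hz; linarith
  have hconst : IntegrableOn (fun _ : E n => Phi 2 * (r k / 2) ^ (-d) * F) (ball 0 R) :=
    integrableOn_const measure_ball_lt_top.ne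
  have i1 : ∫ z in ball 0 R, Gam d (x - z) * f k z ≤
      ∫ z in ball 0 R, (Psr d (r k / 2) (z - x) * f k z + Phi 2 * (r k / 2) ^ (-d) * F) := by
    refine setIntegral_mono_on_ae (Gam_mul_integrableOn_ball H.par x (H.meas k)
      fun z hz => H.abs_f_le (hf z hz)) (hI.integrableOn.add hconst) measurableSet_ball ?_
    filter_upwards [compl_mem_ae_iff.2 (measure_singleton x)] with z hz hzR
    rw [Psr_of_ne hS (sub_ne_zero.2 hz), Gam_sub_comm]
    have a1 := Gr_le_two (d := d) hS (z - x)
    nlinarith [mul_le_mul a1 (H.fF k z (hf z hzR)) (H.f0 k z (hf z hzR)) ((Gr_nonneg (d := d) hS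
        (z - x)).trans a1)]
  have i2 := integral_add hI.integrableOn hconst
  rw [setIntegral_const, smul_eq_mul, ← hW] at i2
  have i3 : ∫ z in ball 0 R, Psr d (r k / 2) (z - x) * f k z ≤
      ∫ z, Psr d (r k / 2) (z - x) * f k z :=
    setIntegral_le_integral hI (.of_forall (H.Psr_mul_nonneg hS hlt))
  have i4 := H.Psr_int_le hS hlt
  linarith

lemma int_limit (H : Blow σ d N κ c C F p v f B r ε) (hc : Continuous V)
    (hV : ∀ x, Tendsto (fun k => v k x) atTop (𝓝 (V x))) (x : E n) :
    Integrable (fun z => Gam d (x - z) * (c * V z ^ p)) ∧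
    Tendsto (fun R : ℝ => ∫ z in ball 0 R, Gam d (x - z) * (c * V z ^ p)) atTop
      (𝓝 (∫ z, Gam d (x - z) * (c * V z ^ p))) := by
  have hcov : AECover volume atTop (fun R : ℝ => ball (0 : E n) R) := aecover_ball tendsto_id
  have hb := H.limit_bounds hV
  have hi : ∀ R : ℝ, IntegrableOn (fun z => Gam d (x - z) * (c * V z ^ p)) (ball 0 R) := fun R =>
    Gam_mul_integrableOn_ball H.par x
        ((hc.measurable.pow_const p).const_mul c) (M := c * C ^ p) fun z _ => by
      have := H.c0
      have h1 := (hb z).1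
      rw [abs_of_nonneg pos!]
      exact mul_le_l (rpow_le_rpow (hb z).1 (hb z).2 (by linarith [H.p1]))
        H.c0.le
  have hint := hcov.integrable_of_integral_bounded_of_nonneg_ae (κ * V x) hi
    (.of_forall (fun z => mul_nonneg (Gam_nonneg _) (mul_nonneg H.c0.le (rpow_nonneg (hb z).1 _))))
        (.of_forall fun R => H.ball_bound hV x R)
  exact ⟨hint, hcov.integral_tendsto_of_countably_generated hint⟩

lemma two_ball_bound (H : Blow σ d N κ c C F p v f B r ε) {θ : ℝ} (hθ8 : θ ≤ 1 / 8)
    (hG : ∀ S > 0, ∀ z : E n, ‖z‖ ≤ 4 * θ * S → Gam d z ≤ 2 * Psr d S z) {k : ℕ} (hr : 0 < r k) :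
    ∫ z in ball 0 (2 * (θ * r k)), Gam d (0 - z) * f k z ≤ 2 * (κ + ε k) := by
  have hS : 0 < r k / 2 := lin!
  have hlt : ‖(0 : E n)‖ + r k / 2 < r k := by rw [norm_zero]; linarith
  have hI := H.Psr_int hS hlt
  have hf : ∀ z ∈ ball (0 : E n) (2 * (θ * r k)), ‖z‖ < r k := fun z hz => by
    rw [mem_ball_zero_iff] at hz; nlinarith
  have i1 : ∫ z in ball 0 (2 * (θ * r k)), Gam d (0 - z) * f k z ≤
      ∫ z in ball 0 (2 * (θ * r k)), 2 * (Psr d (r k / 2) (z - 0) * f k z) := by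
    refine setIntegral_mono_on (Gam_mul_integrableOn_ball H.par 0 (H.meas k)
      fun z hz => H.abs_f_le (hf z hz)) (hI.integrableOn.const_mul 2) measurableSet_ball ?_
    intro z hz
    rw [Gam_sub_comm, ← mul_assoc]
    refine mul_le_r (hG _ hS _ ?_) (H.f0 k z (hf z hz))
    rw [mem_ball_zero_iff] at hz
    rw [sub_zero]; nlinarith
  have i3 : ∫ z in ball 0 (2 * (θ * r k)), 2 * (Psr d (r k / 2) (z - 0) * f k z) ≤
      ∫ z, 2 * (Psr d (r k / 2) (z - 0) * f k z) :=
    setIntegral_le_integral (hI.const_mul 2) (.of_forall fun z => by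
      have := H.Psr_mul_nonneg hS hlt z
      change (0 : ℝ) ≤ 2 * (Psr d (r k / 2) (z - 0) * f k z); linarith)
  have i5 : ∫ z, 2 * (Psr d (r k / 2) (z - 0) * f k z) = 2 * ∫ z, Psr d (r k / 2) (z - 0) * f k z :=
    integral_const_mul 2 _
  have i4 := H.Psr_int_le hS hlt
  rw [H.one, mul_one] at i4
  linarith

lemma diff_bound (H : Blow σ d N κ c C F p v f B r ε)
    (hV : ∀ x, Tendsto (fun k => v k x) atTop (𝓝 (V x))) (x : E n) {η : ℝ} (hη : 0 < η) :
    ∃ R₀, ∀ R ≥ R₀, |κ * V x - κ * V 0 - ((∫ z in ball 0 R, Gam d (x - z) * (c * V z ^ p)) -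
      ∫ z in ball 0 R, Gam d (0 - z) * (c * V z ^ p))| ≤ η * (κ * C) + 2 * η * κ := by
  have := H.par.nontriv
  have hd0 := H.par.d0
  obtain ⟨L, hL, hLG⟩ := Gam_ratio (n := n) (d := d) hη
  obtain ⟨θ, hθ, hθ8, hG⟩ := exists_Gam_le_two_Psr (n := n) hd0
  obtain ⟨δ, hδ, hratio⟩ := H.ratio η hη
  refine ⟨(L + 1) * ‖x‖ + 1, fun R hR => ?_⟩
  have hRx : L * ‖x‖ ≤ R := by nlinarith [norm_nonneg x]
  have hRx' : ‖x‖ < R := by nlinarith [norm_nonneg x, mul_nonneg hL.le (norm_nonneg x)]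
  obtain ⟨W, hW⟩ := named ((volume : Measure (E n)).real (ball 0 R))
  have hlim1 := ((((hV x).const_mul κ).sub ((hV 0).const_mul κ)).sub
      ((H.int_lim hV x R).sub (H.int_lim hV 0 R))).abs
  have hlim2 : Tendsto (fun k => η * (κ * C + ε k) + η * (2 * (κ + ε k)) +
      Phi 2 * (θ * r k) ^ (-d) * F * W + 2 * ε k) atTop (𝓝 (η * (κ * C) + 2 * η * κ)) := by
    have h2 := (((((H.ε_lim.const_add (κ * C)).const_mul η).add
      (((H.ε_lim.const_add κ).const_mul 2).const_mul η)).add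
      (((((tendsto_rpow_neg_atTop hd0).comp (H.r_lim.const_mul_atTop hθ)).const_mul
          (Phi 2)).mul_const F).mul_const W)).add (H.ε_lim.const_mul 2))
    simp only [add_zero, mul_zero, zero_mul] at h2
    rwa [show η * (κ * C) + η * (2 * κ) = η * (κ * C) + 2 * η * κ by ring] at h2
  refine le_of_tendsto_of_tendsto hlim1 hlim2 ?_
  have hθr := H.r_lim.const_mul_atTop hθ
  filter_upwards [H.r_lim.eventually_gt_atTop (2 * ‖x‖), H.r_lim.eventually_gt_atTop R,
    H.r_lim.eventually_gt_atTop 0, hθr.eventually_ge_atTop R,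
        (hθr.const_mul_atTop hδ).eventually_ge_atTop ‖x‖]
    with k h1 h2 h3 h4 h5
  obtain ⟨s, hs⟩ := named (θ * r k)
  rw [← hs] at h4 h5 ⊢
  have hs0 : 0 < s := hs ▸ pos!
  have hs8 : s ≤ r k / 8 := by rw [hs]; nlinarith
  have hxs : ‖x‖ + s < r k := lin!
  have h0s : ‖(0 : E n)‖ + s < r k := by rw [norm_zero]; linarith
  have hf : ∀ z ∈ ball (0 : E n) R, ‖z‖ < r k := fun z hz => by
    rw [mem_ball_zero_iff] at hz; linarith
  have hf2 : ∀ z ∈ ball (0 : E n) (2 * s), ‖z‖ < r k := fun z hz => by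
    rw [mem_ball_zero_iff] at hz; linarith
  have r1 := H.rep k s x hs0 hxs
  have r2 := H.rep k s 0 hs0 h0s
  have b1 := hratio k s x 0 hs0 (by rwa [sub_zero])
  have b2 := hratio k s 0 x hs0 (by rwa [zero_sub, norm_neg])
  have b3 := mul_le_l (H.B_le hs0 hxs) hη.le
  have b4 := mul_le_l (H.B_le hs0 h0s) hη.le
  have g1 := H.Psr_int hs0 hxs
  have g2 := H.Psr_int hs0 h0s
  have g3 := Gam_mul_integrableOn_ball H.par x (H.meas k) fun z hz => H.abs_f_le (hf z hz)
  have g4 := Gam_mul_integrableOn_ball H.par 0 (H.meas k) fun z hz => H.abs_f_le (hf z hz)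
  have g6 : IntegrableOn (fun _ : E n => Phi 2 * s ^ (-d) * F) (ball 0 R) :=
    integrableOn_const measure_ball_lt_top.ne
  have tb : ∫ z in ball 0 (2 * s), Gam d (0 - z) * f k z ≤ 2 * (κ + ε k) := by
    rw [hs]; exact H.two_ball_bound hθ8 hG h3
  have key : |((∫ z, Psr d s (z - x) * f k z) - ∫ z, Psr d s (z - 0) * f k z) -
      ((∫ z in ball 0 R, Gam d (x - z) * f k z) - ∫ z in ball 0 R, Gam d (0 - z) * f k z)| ≤
      η * (2 * (κ + ε k)) + Phi 2 * s ^ (-d) * F * W := by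
    have j1 : ∫ z, ((Psr d s (z - x) * f k z - Psr d s (z - 0) * f k z) -
        ((ball 0 R).indicator (fun z => Gam d (x - z) * f k z) z -
          (ball 0 R).indicator (fun z => Gam d (0 - z) * f k z) z)) =
        (∫ z, (Psr d s (z - x) * f k z - Psr d s (z - 0) * f k z)) -
        ∫ z, ((ball 0 R).indicator (fun z => Gam d (x - z) * f k z) z -
          (ball 0 R).indicator (fun z => Gam d (0 - z) * f k z) z) :=
      integral_sub (g1.sub g2) ((g3.integrable_indicator measurableSet_ball).sub
        (g4.integrable_indicator measurableSet_ball))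
    have j3 : ∫ z, ((ball 0 R).indicator (fun z => Gam d (x - z) * f k z) z -
          (ball 0 R).indicator (fun z => Gam d (0 - z) * f k z) z) =
        (∫ z, (ball 0 R).indicator (fun z => Gam d (x - z) * f k z) z) -
        ∫ z, (ball 0 R).indicator (fun z => Gam d (0 - z) * f k z) z :=
      integral_sub (g3.integrable_indicator measurableSet_ball)
        (g4.integrable_indicator measurableSet_ball)
    rw [integral_indicator measurableSet_ball, integral_indicator measurableSet_ball] at j3
    rw [← (integral_sub g1 g2), ← j3, ← j1]
    have g7 : IntegrableOn (fun z => η * (Gam d (0 - z) * f k z)) (ball 0 (2 * s)) :=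
      Integrable.const_mul
          (Gam_mul_integrableOn_ball H.par 0 (H.meas k) fun z hz => H.abs_f_le (hf2 z hz)) η
    have hhint : Integrable (fun z => (ball (0 : E n) (2 * s)).indicator
        (fun z => η * (Gam d (0 - z) * f k z)) z +
        (ball (0 : E n) R).indicator (fun _ => Phi 2 * s ^ (-d) * F) z) :=
      (g7.integrable_indicator measurableSet_ball).add
        (g6.integrable_indicator measurableSet_ball)
    have hI2 := integral_add (g7.integrable_indicator measurableSet_ball)
        (g6.integrable_indicator measurableSet_ball)
    rw [integral_indicator measurableSet_ball, integral_indicator measurableSet_ball,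
      setIntegral_const, integral_const_mul, smul_eq_mul, ← hW] at hI2
    have hle := norm_integral_le_of_norm_le (f := fun z =>
      ((Psr d s (z - x) * f k z - Psr d s (z - 0) * f k z) -
        ((ball 0 R).indicator (fun z => Gam d (x - z) * f k z) z -
          (ball 0 R).indicator (fun z => Gam d (0 - z) * f k z) z))) hhint ?_
    · rw [hI2, norm_eq_abs] at hle
      refine hle.trans ?_
      have := mul_le_l tb hη.le
      linarith
    filter_upwards [compl_mem_ae_iff.2 (measure_singleton x),
        compl_mem_ae_iff.2 (measure_singleton 0)] with z hzx hz0
    by_cases hzR : z ∈ ball (0 : E n) R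
    · have hz2 : z ∈ ball (0 : E n) (2 * s) := ball_subset_ball lin! hzR
      rw [indicator_of_mem hzR, indicator_of_mem hzR, indicator_of_mem hzR, indicator_of_mem hz2,
        Psr_of_ne hs0 (sub_ne_zero.2 hzx), Psr_of_ne hs0 (by rwa [sub_zero]), Gam_sub_comm x z,
        Gam_sub_comm 0 z]
      have f0 := H.f0 k z (hf z hzR)
      have q1 := Gr_le_two (d := d) hs0 (z - x)
      have q2 := Gr_le_two (d := d) hs0 (z - 0)
      have q3 := Gr_nonneg (d := d) hs0 (z - x)
      have q4 := Gr_nonneg (d := d) hs0 (z - 0)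
      have q5 : 0 ≤ η * (Gam d (z - 0) * f k z) :=
        mul_nonneg hη.le (mul_nonneg (Gam_nonneg _) f0)
      rw [norm_eq_abs, show (Gam d (z - x) - Gr d s (z - x)) * f k z -
        (Gam d (z - 0) - Gr d s (z - 0)) * f k z - (Gam d (z - x) * f k z - Gam d (z - 0) * f k z)
        = (Gr d s (z - 0) - Gr d s (z - x)) * f k z by ring, abs_mul, abs_of_nonneg f0]
      have q6 : |Gr d s (z - 0) - Gr d s (z - x)| ≤ Phi 2 * s ^ (-d) := by
        rw [abs_le]; constructor <;> linarith
      have q7 := mul_le_mul q6 (H.fF k z (hf z hzR)) f0 ((abs_nonneg _).trans q6)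
      linarith
    · rw [indicator_of_notMem hzR, indicator_of_notMem hzR, indicator_of_notMem hzR]
      simp only [sub_zero, add_zero]
      by_cases hz2 : z ∈ ball (0 : E n) (2 * s)
      · rw [indicator_of_mem hz2, ← sub_mul, norm_mul]
        have f0 := H.f0 k z (hf2 z hz2)
        rw [norm_of_nonneg f0, ← mul_assoc]
        refine mul_le_r ?_ f0
        rw [mem_ball_zero_iff, not_lt] at hzR
        have q2 := hLG x z (hRx.trans hzR) hz0
        rw [Gam_sub_comm] at q2
        rw [zero_sub, Gam_neg]
        exact (abs_Psr_sub_le (d := d) hs0 (sub_ne_zero.2 hzx) hz0).trans q2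
      · rw [indicator_of_notMem hz2]
        rw [mem_ball_zero_iff, not_lt] at hz2
        rw [Psr_eq_zero hd0 hs0 (lin! : s ≤ ‖z‖),
          Psr_eq_zero hd0 hs0 (by linarith [norm_sub_norm_le z x] : s ≤ ‖z - x‖)]
        simp
  rw [abs_le] at key r1 r2 ⊢
  constructor <;> linarith [key.1, key.2, r1.1, r1.2, r2.1, r2.2]

/-- No blow-up family exists. -/
theorem elim (H : Blow σ d N κ c C F p v f B r ε) : False := by
  obtain ⟨φ, hφ, V, hc, hV⟩ := H.exists_subseq
  have H' := H.comp hφ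
  have hκ := H.κ0
  have hC := H.C0
  obtain ⟨i0, l0⟩ := H'.int_limit hc hV 0
  have hV0 := tendsto_nhds_unique (hV 0) (by simp only [H.one]; exact tendsto_const_nhds)
  obtain ⟨J, hJ⟩ := named (∫ z, Gam d (0 - z) * (c * V z ^ p))
  have hJκ : J ≤ κ := by
    have := le_of_tendsto l0 (.of_forall fun R => H'.ball_bound hV 0 R)
    rw [hV0, ← hJ] at this; linarith
  have heq : ∀ x, κ * V x = (κ - J) + ∫ z, Gam d (x - z) * (c * V z ^ p) := by
    intro x
    obtain ⟨ix, lx⟩ := H'.int_limit hc hV x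
    have h1 : ∀ η > 0, |κ * V x - κ * V 0 - ((∫ z, Gam d (x - z) * (c * V z ^ p)) -
        ∫ z, Gam d (0 - z) * (c * V z ^ p))| ≤ η * (κ * C) + 2 * η * κ := by
      intro η hη
      obtain ⟨R₀, hR₀⟩ := H'.diff_bound hV x hη
      exact le_of_tendsto ((tendsto_const_nhds.sub (lx.sub l0)).abs)
        ((eventually_ge_atTop R₀).mono fun R hR => hR₀ R hR)
    have h2 : |κ * V x - κ * V 0 - ((∫ z, Gam d (x - z) * (c * V z ^ p)) -
        ∫ z, Gam d (0 - z) * (c * V z ^ p))| ≤ 0 := by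
      refine le_of_forall_pos_le_add fun ε hε => ?_
      have := h1 (ε / (κ * C + 2 * κ)) pos!
      rw [show ε / (κ * C + 2 * κ) * (κ * C) + 2 * (ε / (κ * C + 2 * κ)) * κ = 0 + ε by
        field_simp; ring] at this
      exact this
    have h3 := abs_eq_zero.1 (le_antisymm h2 (abs_nonneg _))
    rw [hV0, ← hJ] at h3
    linarith
  have hb := H'.limit_bounds hV
  have hmul : ∀ x, (fun z => Gam d (x - z) * (c * V z ^ p)) = fun z => c * (Gam d (x - z) * V z ^ p) :=
    fun x => by ext z; ring
  refine liouville H.par (k := c / κ) (div_pos H.c0 hκ) H.p1 H.dp (b := (κ - J) / κ)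
    (div_nonneg lin! hκ.le) hc (fun x => (hb x).1) (fun x => (hb x).2)
    (by rw [hV0]; exact one_pos) (fun x => ?_) fun x => ?_
  · have := (H'.int_limit hc hV x).1
    rw [hmul] at this
    refine (this.const_mul c⁻¹).congr (.of_forall fun z => ?_)
    change c⁻¹ * (c * (Gam d (x - z) * V z ^ p)) = _
    rw [← mul_assoc, inv_mul_cancel₀ H.c0.ne', one_mul]
  · have := heq x
    rw [hmul, integral_const_mul] at this
    field_simp
    linarith

end Blow

open Real

/-- Solutions of `Lop u = c|x|^α u^p` outside the unit ball, with the exponents in the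
subcritical, Serrin-supercritical range. -/
structure Sol {n : ℕ} (σ d N α p c : ℝ) (u : E n → ℝ) : Prop where
  par : Par n σ d N
  adm : Adm N u {x | 1 < ‖x‖}
  nonneg : ∀ x, 1 < ‖x‖ → 0 ≤ u x
  eq : ∀ x, 1 < ‖x‖ → Lop N u x = c * (‖x‖ ^ α * u x ^ p)
  c0 : 0 < c
  hα : -(2 * σ) < α
  dp : d * p < N
  αp : n + α < d * p

lemma rpow_two_bounds {t a : ℝ} (h1 : 1 / 2 ≤ t) (h2 : t ≤ 2) :
    (2 : ℝ) ^ (-|a|) ≤ t ^ a ∧ t ^ a ≤ 2 ^ |a| := by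
  have ht : 0 < t := lin!
  have hl : |log t| ≤ log 2 := by
    rw [abs_le]
    refine ⟨?_, log_le_log ht h2⟩
    rw [← log_inv]
    exact log_le_log num! (by rw [inv_eq_one_div]; exact h1)
  have h : |log t * a| ≤ log 2 * |a| := by
    rw [abs_mul]; exact mul_le_r hl
  rw [abs_le] at h
  rw [rpow_def_of_pos ht, rpow_def_of_pos two_pos, rpow_def_of_pos two_pos]
  exact ⟨exp_le_exp.2 (by linarith [h.1]), exp_le_exp.2 h.2⟩

namespace Sol
variable {n : ℕ} {σ d N α p c : ℝ} {u : E n → ℝ}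

lemma p1 (S : Sol σ d N α p c u) : 1 < p := by
  have := S.par.d0
  have h1 := S.αp
  have h2 := S.hα
  have h3 := S.par.hd
  by_contra h
  push Not at h
  nlinarith

/-- The decay rate of the singular solutions. -/
lemma beta_pos (S : Sol σ d N α p c u) : 0 < (2 * σ + α) / (p - 1) :=
  div_pos (by linarith [S.hα]) (by linarith [S.p1])
lemma beta_lt (S : Sol σ d N α p c u) : (2 * σ + α) / (p - 1) < d := by
  rw [div_lt_iff₀ (by linarith [S.p1])]
  linarith [S.αp, S.par.hd]

lemma cont (S : Sol σ d N α p c u) : ContinuousOn u {x | 1 < ‖x‖} := S.adm.smooth.continuousOn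

lemma rhs_nonneg (S : Sol σ d N α p c u) {x : E n} (hx : 1 < ‖x‖) : 0 ≤ Lop N u x := by
  rw [S.eq x hx]
  exact mul_nonneg S.c0.le (mul_nonneg pos! (rpow_nonneg (S.nonneg x hx) _))

lemma rhs_cont (S : Sol σ d N α p c u) : ContinuousOn (Lop N u) {x | 1 < ‖x‖} := by
  have h : ContinuousOn (fun x : E n => c * (‖x‖ ^ α * u x ^ p)) {x | 1 < ‖x‖} := by
    refine continuousOn_const.mul (ContinuousOn.mul ?_ ?_)
    · exact continuous_norm.continuousOn.rpow_const fun x hx => Or.inl (by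
        have : (1 : ℝ) < ‖x‖ := hx
        linarith)
    · exact S.cont.rpow_const fun x hx => Or.inr (by linarith [S.p1])
  exact h.congr fun x hx => S.eq x hx

lemma rhs_bdd (S : Sol σ d N α p c u) {K : Set (E n)} (hK : IsCompact K) (h : K ⊆ {x | 1 < ‖x‖}) :
    ∃ M, ∀ x ∈ K, |Lop N u x| ≤ M :=
  hK.exists_bound_of_continuousOn (S.rhs_cont.mono h)

lemma closedBall_sub {y : E n} {r : ℝ} (h : 1 < ‖y‖ - r) : closedBall y r ⊆ {x | 1 < ‖x‖} := by
  intro x hx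
  rw [mem_closedBall, dist_eq_norm] at hx
  have := norm_sub_norm_le y x
  rw [norm_sub_rev] at this
  change 1 < ‖x‖
  linarith

lemma wt_pos (S : Sol σ d N α p c u) : Wt N (fun x => max (u x) 0) := by
  refine ⟨S.adm.meas.max measurable_const, S.adm.int.mono' ?_ (.of_forall fun x => ?_)⟩
  · exact ((continuous_abs.measurable.comp (S.adm.meas.max measurable_const)).mul
      (by fun_prop)).aestronglyMeasurable
  · rw [norm_of_nonneg pos!]
    refine mul_le_r ?_
    rw [abs_of_nonneg (le_max_right _ _)]
    exact max_le (le_abs_self _) (abs_nonneg _)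

lemma rep_pos (S : Sol σ d N α p c u) : ∃ C > 0, ∀ (y : E n) (r : ℝ), 0 < r → 2 ≤ ‖y‖ → 1 < ‖y‖ - r →
    |kap n d N * u y - (∫ x, max (u x) 0 * gar d N r (x - y)) - ∫ x, Psr d r (x - y) * Lop N u x| ≤
      C * (r ^ (2 * σ) * ‖y‖ ^ (-N)) := by
  have P := S.par
  obtain ⟨_, _, C, hC, hb⟩ := exists_gar_bounds (n := n) P
  have hu1 : IntegrableOn (fun x => |u x|) (closedBall 0 1) := by
    have := integrableOn_of_weighted P.N0 S.adm.meas S.adm.int 2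
    exact (this.mono_set (closedBall_subset_ball num!)).abs
  obtain ⟨U, hU⟩ := named (∫ x in closedBall (0 : E n) 1, |u x|)
  have hU0 := hU ▸ setIntegral_nonneg measurableSet_closedBall fun x _ => abs_nonneg _
  refine ⟨(U + 1) * (C * 2 ^ N), pos!, fun y r hr hy hyr => ?_⟩
  have hsub := closedBall_sub hyr
  obtain ⟨M, hM⟩ := S.rhs_bdd (isCompact_closedBall y r) hsub
  have e := integral_sub (S.adm.wt.mul_gar_integrable P hr y) (S.wt_pos.mul_gar_integrable P hr y)
  have hbd : ‖∫ x, (u x * gar d N r (x - y) - max (u x) 0 * gar d N r (x - y))‖ ≤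
      ∫ x in closedBall (0 : E n) 1, |u x| * (C * 2 ^ N * (r ^ (2 * σ) * ‖y‖ ^ (-N))) := by
    rw [← integral_indicator measurableSet_closedBall]
    have hu2 : IntegrableOn (fun x => |u x| * (C * 2 ^ N * (r ^ (2 * σ) * ‖y‖ ^ (-N))))
      (closedBall 0 1) := Integrable.mul_const hu1 _
    refine norm_integral_le_of_norm_le (hu2.integrable_indicator measurableSet_closedBall)
      (.of_forall fun x => ?_)
    by_cases hx : x ∈ closedBall (0 : E n) 1
    · rw [indicator_of_mem hx, ← sub_mul, norm_mul]
      rw [mem_closedBall_zero_iff] at hx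
      refine mul_le_mul ?_ ?_ (norm_nonneg _) (abs_nonneg _)
      · rw [norm_eq_abs]
        rcases le_total (u x) 0 with h | h
        · rw [max_eq_right h, sub_zero]
        · rw [max_eq_left h, sub_self, abs_zero]; exact abs_nonneg _
      · rw [norm_of_nonneg (gar_pos P hr _).le]
        refine (hb r hr _).2.trans ?_
        have h1 : ‖y‖ / 2 ≤ r + ‖x - y‖ := by
          have := norm_sub_norm_le y x
          rw [norm_sub_rev] at this
          linarith
        have h2 : (r + ‖x - y‖) ^ (-N) ≤ (‖y‖ / 2) ^ (-N) :=
          rpow_anti lin! h1 (by linarith [P.N0])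
        have h3 : (‖y‖ / 2) ^ (-N) = 2 ^ N * ‖y‖ ^ (-N) := by
          rw [div_rpow (norm_nonneg _) zero_le_two, rpow_neg zero_le_two]
          field_simp
        rw [h3] at h2
        calc C * (r ^ (2 * σ) * (r + ‖x - y‖) ^ (-N))
            ≤ C * (r ^ (2 * σ) * (2 ^ N * ‖y‖ ^ (-N))) := by gcongr
          _ = _ := by ring
    · rw [indicator_of_notMem hx]
      rw [mem_closedBall_zero_iff, not_le] at hx
      rw [max_eq_left (S.nonneg x hx), sub_self, norm_zero]
  rw [e, integral_mul_const, ← hU, norm_eq_abs] at hbd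
  rw [representation_ball P S.adm hr hsub hM]
  have h5 : 0 ≤ C * 2 ^ N * (r ^ (2 * σ) * ‖y‖ ^ (-N)) := pos!
  rw [show ∀ a b c : ℝ, a + c - b - c = a - b by intros; ring]
  refine hbd.trans ?_
  nlinarith

lemma exists_doubling (S : Sol σ d N α p c u) {x₀ : E n} (hx₀ : 8 ≤ ‖x₀‖) {K : ℝ} (hK : 1 ≤ K)
    (hu : K * ‖x₀‖ ^ (-((2 * σ + α) / (p - 1))) ≤ u x₀) : ∃ z : E n, ∃ δ > 0, 4 ≤ ‖z‖ ∧ δ ≤ ‖z‖ ∧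
      0 < u z ∧ (∀ x, ‖x - z‖ < δ / 2 → u x ≤ 2 ^ (2 * σ / (p - 1)) * u z) ∧
      1 / 2 * K ^ ((p - 1) / (2 * σ)) * 2 ^ (-|α / (2 * σ)|) ≤
        u z ^ ((p - 1) / (2 * σ)) * ‖z‖ ^ (α / (2 * σ)) * δ ∧
      K * 2 ^ (-d) ≤ u z * ‖z‖ ^ (n : ℝ) := by
  have hσ := S.par.hσ0
  have hp := S.p1
  have hβ0 := S.beta_pos
  have hβ := S.beta_lt
  obtain ⟨β, hβe⟩ := named ((2 * σ + α) / (p - 1))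
  obtain ⟨m, hm⟩ := named ((p - 1) / (2 * σ))
  have hm0 : 0 < m := hm ▸ by apply div_pos <;> linarith
  have hmi : 2 * σ / (p - 1) = m⁻¹ := by rw [hm, inv_div]
  have hβm : β * m = 1 + α / (2 * σ) := by
    rw [hβe, hm]
    have : p - 1 ≠ 0 := lin!
    field_simp
  rw [← hβe] at hu hβ hβ0
  rw [hmi, ← hm]
  obtain ⟨ρ, hρ⟩ := named (‖x₀‖ / 2)
  have hρ0 : 0 < ρ := lin!
  have hsub := closedBall_sub lin!
  have hcont : ContinuousOn (fun x => u x ^ m * (ρ - ‖x - x₀‖)) (closedBall x₀ ρ) :=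
    ((S.cont.mono hsub).rpow_const fun x _ => Or.inr hm0.le).mul (by fun_prop)
  obtain ⟨z, hz, hmax⟩ := (isCompact_closedBall x₀ ρ).exists_isMaxOn
    ⟨x₀, mem_closedBall_self hρ0.le⟩ hcont
  have hx₀p : 0 < ‖x₀‖ := lin!
  have hu0 := lt_of_lt_of_le pos! hu
  have h1 : u x₀ ^ m * ρ ≤ u z ^ m * (ρ - ‖z - x₀‖) := by
    have := hmax (mem_closedBall_self hρ0.le)
    simpa using this
  have hznn := S.nonneg z (hsub hz)
  have hzm : 0 ≤ u z ^ m := rpow_nonneg hznn _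
  have hpos := lt_of_lt_of_le pos! h1
  have hδ : 0 < ρ - ‖z - x₀‖ := by
    by_contra h; push Not at h; nlinarith
  have hzlow : ρ ≤ ‖z‖ := by
    have := norm_sub_norm_le x₀ z
    rw [norm_sub_rev] at this; linarith
  have hzup : ‖z‖ ≤ 3 * ρ := by
    have := norm_sub_norm_le z x₀
    linarith
  have hcmp : u x₀ ^ m ≤ u z ^ m := by
    have : u z ^ m * (ρ - ‖z - x₀‖) ≤ u z ^ m * ρ := by
      refine mul_le_l ?_ hzm; linarith [norm_nonneg (z - x₀)]
    exact le_of_mul_le_mul_right (h1.trans this) hρ0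
  have hcmp' := (rpow_le_rpow_iff hu0.le hznn hm0).1 hcmp
  have hz0 : 0 < ‖z‖ := lin!
  refine ⟨z, ρ - ‖z - x₀‖, hδ, lin!, by linarith [norm_nonneg (z - x₀)], lin!, ?_, ?_, ?_⟩
  · intro x hx
    have hxx : ‖x - x₀‖ ≤ ‖x - z‖ + ‖z - x₀‖ := by
      have : x - x₀ = (x - z) + (z - x₀) := by abel
      rw [this]; exact norm_add_le _ _
    have hxb : x ∈ closedBall x₀ ρ := by
      rw [mem_closedBall, dist_eq_norm]; linarith
    have h2 : u x ^ m * (ρ - ‖x - x₀‖) ≤ u z ^ m * (ρ - ‖z - x₀‖) := hmax hxb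
    have hxnn := S.nonneg x (hsub hxb)
    have h3 : u x ^ m * ((ρ - ‖z - x₀‖) / 2) ≤ u x ^ m * (ρ - ‖x - x₀‖) := by
      refine mul_le_l ?_ (rpow_nonneg hxnn _)
      linarith
    have h4 : u x ^ m ≤ 2 * u z ^ m := by
      refine le_of_mul_le_mul_right (a := (ρ - ‖z - x₀‖) / 2) ?_ lin!
      linarith
    refine (rpow_le_rpow_iff hxnn pos! hm0).1 ?_
    rwa [mul_rpow pos! hznn, ← rpow_mul zero_le_two,
      inv_mul_cancel₀ hm0.ne', rpow_one]
  · have h2 : (K * ‖x₀‖ ^ (-β)) ^ m ≤ u x₀ ^ m := rpow_le_rpow pos! hu hm0.le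
    rw [mul_rpow pos! pos!, ← rpow_mul hx₀p.le, neg_mul, hβm] at h2
    have h3 := (rpow_two_bounds (t := ‖z‖ / ‖x₀‖) (a := α / (2 * σ))
      (by rw [le_div_iff₀ hx₀p]; linarith) (by rw [div_le_iff₀ hx₀p]; linarith)).1
    rw [div_rpow hz0.le hx₀p.le, le_div_iff₀ pos!] at h3
    have h4 : ‖x₀‖ ^ (-(1 + α / (2 * σ))) * ‖x₀‖ ^ (α / (2 * σ)) * ‖x₀‖ = 1 := by
      rw [← rpow_add hx₀p]
      nth_rw 2 [← rpow_one ‖x₀‖]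
      rw [← rpow_add hx₀p, show -(1 + α / (2 * σ)) + α / (2 * σ) + 1 = 0 by ring,
        rpow_zero]
    calc 1 / 2 * K ^ m * 2 ^ (-|α / (2 * σ)|)
        = K ^ m * ‖x₀‖ ^ (-(1 + α / (2 * σ))) * (‖x₀‖ / 2) *
          (2 ^ (-|α / (2 * σ)|) * ‖x₀‖ ^ (α / (2 * σ))) := by
          linear_combination (-(1 / 2 * K ^ m * 2 ^ (-|α / (2 * σ)|))) * h4
      _ ≤ u x₀ ^ m * ρ * ‖z‖ ^ (α / (2 * σ)) := by
          rw [hρ]; gcongr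
      _ ≤ u z ^ m * (ρ - ‖z - x₀‖) * ‖z‖ ^ (α / (2 * σ)) := by gcongr
      _ = _ := by ring
  · have h2 : (2 * ‖z‖) ^ (-β) ≤ ‖x₀‖ ^ (-β) :=
      rpow_anti hx₀p lin!
    have h3 : (2 : ℝ) ^ (-d) ≤ 2 ^ (-β) := rpow_le_rpow_of_exponent_le one_le_two lin!
    have h4 : 1 ≤ ‖z‖ ^ (-β + n) := one_le_rpow lin! (by linarith [S.par.dn])
    calc K * 2 ^ (-d) ≤ K * (2 ^ (-β) * ‖z‖ ^ (-β + n)) := by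
          gcongr
          calc (2 : ℝ) ^ (-d) = 2 ^ (-d) * 1 := (mul_one _).symm
            _ ≤ _ := by gcongr
      _ = K * (2 * ‖z‖) ^ (-β) * ‖z‖ ^ (n : ℝ) := by
          rw [mul_rpow zero_le_two hz0.le, rpow_add hz0]; ring
      _ ≤ K * ‖x₀‖ ^ (-β) * ‖z‖ ^ (n : ℝ) := by gcongr
      _ ≤ u z * ‖z‖ ^ (n : ℝ) := by gcongr; linarith

end Sol

open Real

section
variable {n : ℕ} {σ d N : ℝ}

lemma Psr_smul {μ s : ℝ} (hμ : 0 < μ) (hs : 0 < s) (x : E n) :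
    Psr d (μ * s) (μ • x) = μ ^ (-d) * Psr d s x := by
  rw [Psr, Psr, mul_rpow hμ.le hs.le, smul_smul, mul_inv, mul_comm μ⁻¹, mul_assoc s⁻¹,
    inv_mul_cancel₀ hμ.ne', mul_one, mul_assoc]

lemma Psr_integral_rescale (P : Par n σ d N) {μ s : ℝ} (hμ : 0 < μ) (hs : 0 < s) (z y : E n)
    (g : E n → ℝ) : ∫ x, Psr d (μ * s) (x - (z + μ • y)) * g x =
      μ ^ (2 * σ) * ∫ w, Psr d s (w - y) * g (z + μ • w) := by
  rw [← integral_add_left_eq_self _ z, integral_scale _ hμ, ← integral_const_mul,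
    ← integral_const_mul]
  congr 1; ext w
  rw [add_sub_add_left_eq_sub, ← smul_sub, Psr_smul hμ hs, ← P.nd, rpow_sub hμ,
    rpow_neg hμ.le]
  ring

end

namespace Sol
variable {n : ℕ} {σ d N α p c : ℝ} {u : E n → ℝ}

theorem upper_bound (S : Sol σ d N α p c u) :
    ∃ C > 0, ∀ x, 8 ≤ ‖x‖ → u x ≤ C * ‖x‖ ^ (-((2 * σ + α) / (p - 1))) := by
  have P := S.par
  have hσ := P.hσ0
  have hp := S.p1
  have hd0 := P.d0
  have hc0 := S.c0
  by_contra! hcon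
  have hK : ∀ k : ℕ, ∃ z : E n, ∃ δ > 0, 4 ≤ ‖z‖ ∧ δ ≤ ‖z‖ ∧
      0 < u z ∧ (∀ x, ‖x - z‖ < δ / 2 → u x ≤ 2 ^ (2 * σ / (p - 1)) * u z) ∧
      1 / 2 * ((k : ℝ) + 1) ^ ((p - 1) / (2 * σ)) * 2 ^ (-|α / (2 * σ)|) ≤
        u z ^ ((p - 1) / (2 * σ)) * ‖z‖ ^ (α / (2 * σ)) * δ ∧
      ((k : ℝ) + 1) * 2 ^ (-d) ≤ u z * ‖z‖ ^ (n : ℝ) := fun k => by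
    obtain ⟨x, hx, h⟩ := hcon (k + 1) pos!
    exact S.exists_doubling hx (by linarith [(Nat.cast_nonneg k : (0 : ℝ) ≤ k)]) h.le
  choose z δ hδ hz4 hδz hM hdoub hr hMn using hK
  obtain ⟨C₁, hC₁, hrep⟩ := S.rep_pos
  obtain ⟨m, hm⟩ := named ((p - 1) / (2 * σ))
  have hm0 : 0 < m := hm ▸ by apply div_pos <;> linarith
  simp only [← hm] at hr
  obtain ⟨C, hC⟩ := named ((2 : ℝ) ^ (2 * σ / (p - 1)))
  have hC0 : 0 < C := hC ▸ pos!
  simp only [← hC] at hdoub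
  have hz0 : ∀ k, 0 < ‖z k‖ := fun k => by linarith [hz4 k]
  obtain ⟨q, hq⟩ : ∃ q : ℕ → ℝ, ∀ k, q k = u (z k) ^ m * ‖z k‖ ^ (α / (2 * σ)) := ⟨_, fun k => rfl⟩
  have hq0 : ∀ k, 0 < q k := fun k => by
    have := hM k; have := hz0 k
    rw [hq]; positivity
  obtain ⟨μ, hμ⟩ : ∃ μ : ℕ → ℝ, ∀ k, μ k = (q k)⁻¹ := ⟨_, fun k => rfl⟩
  have hμ0 : ∀ k, 0 < μ k := fun k => by rw [hμ]; exact inv_pos.2 (hq0 k)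
  obtain ⟨r, hrr⟩ : ∃ r : ℕ → ℝ, ∀ k, r k = q k * δ k / 2 := ⟨_, fun k => rfl⟩
  have hr0 : ∀ k, 0 < r k := fun k => by
    have := hq0 k; have := hδ k
    rw [hrr]; positivity
  have hμr : ∀ k, μ k * r k = δ k / 2 := fun k => by
    have := (hq0 k).ne'
    rw [hrr, hμ]; field_simp
  have hμσ : ∀ k, μ k ^ (2 * σ) = (u (z k) ^ (p - 1) * ‖z k‖ ^ α)⁻¹ := fun k => by
    rw [hμ, hq, inv_rpow (by have := hM k; positivity), mul_rpow
      (by have := hM k; positivity) pos!, ← rpow_mul (hM k).le,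
      ← rpow_mul (hz0 k).le, hm, div_mul_cancel₀ _ lin!, div_mul_cancel₀ _ lin!]
  have hball : ∀ k (x : E n), ‖x‖ < r k → ‖μ k • x‖ < δ k / 2 := fun k x hx => by
    rw [norm_smul, norm_of_nonneg (hμ0 k).le, ← hμr]
    exact mul_lt_mul_of_pos_left hx (hμ0 k)
  have hnlow : ∀ k (x : E n), ‖x‖ < r k → ‖z k‖ / 2 ≤ ‖z k + μ k • x‖ := fun k x hx => by
    have h1 := hball k x hx
    have h2 := norm_sub_norm_le (z k) (-(μ k • x))
    rw [sub_neg_eq_add, norm_neg] at h2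
    linarith [hδz k]
  have hnup : ∀ k (x : E n), ‖x‖ < r k → ‖z k + μ k • x‖ ≤ 2 * ‖z k‖ := fun k x hx => by
    have h1 := hball k x hx
    linarith [hδz k, norm_add_le (z k) (μ k • x), hz0 k]
  have hΩ : ∀ k (x : E n), ‖x‖ < r k → 1 < ‖z k + μ k • x‖ := fun k x hx => by
    linarith [hnlow k x hx, hz4 k]
  have hv0 : ∀ k (x : E n), ‖x‖ < r k → 0 ≤ u (z k + μ k • x) / u (z k) := fun k x hx =>
    div_nonneg (S.nonneg _ (hΩ k x hx)) (hM k).le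
  have hvC : ∀ k (x : E n), ‖x‖ < r k → u (z k + μ k • x) / u (z k) ≤ C := fun k x hx => by
    rw [div_le_iff₀ (hM k)]
    exact hdoub k _ (by rw [add_sub_cancel_left]; exact hball k x hx)
  have hratio : ∀ k (x : E n), ‖x‖ < r k → (‖z k + μ k • x‖ / ‖z k‖) ^ α ≤ 2 ^ |α| := fun k x hx =>
    (rpow_two_bounds (by rw [le_div_iff₀ (hz0 k)]; linarith [hnlow k x hx])
      (by rw [div_le_iff₀ (hz0 k)]; exact hnup k x hx)).2
  have hrlim : Tendsto r atTop atTop := by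
    have h1 : Tendsto (fun k : ℕ => ((k : ℝ) + 1) ^ m) atTop atTop :=
      (tendsto_rpow_atTop hm0).comp (tendsto_atTop_add_const_right _ _ tendsto_natCast_atTop_atTop)
    refine tendsto_atTop_mono (fun k => ?_)
      (h1.const_mul_atTop (show (0 : ℝ) < 1 / 4 * 2 ^ (-|α / (2 * σ)|) by positivity))
    have := hr k
    rw [hrr, hq]; linarith
  have hB : Blow σ d N (kap n d N) c C (c * (2 ^ |α| * C ^ p)) p
      (fun k y => u (z k + μ k • y) / u (z k))
      (fun k y => c * ((‖z k + μ k • y‖ / ‖z k‖) ^ α * (u (z k + μ k • y) / u (z k)) ^ p))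
      (fun k s y => (∫ x, max (u x) 0 * gar d N (μ k * s) (x - (z k + μ k • y))) / u (z k)) r
      (fun k => C₁ * 2 ^ N * 2 ^ d * (1 / ((k : ℝ) + 1))) := by
    refine ⟨P, hrlim, ?_, fun k => ?_, fun k => ?_, hv0, hvC, fun k x hx => ?_, fun k x hx => ?_,
      fun x => ?_, fun k s y hs hy => ?_, fun k s y hs => ?_, fun η hη => ?_, kap_pos P, S.c0, S.p1,
      S.dp, hC0.le, ?_⟩
    · have := tendsto_one_div_add_atTop_nhds_zero_nat (𝕜 := ℝ).const_mul (C₁ * 2 ^ N * 2 ^ d)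
      rwa [mul_zero] at this
    · have hm : Measurable (fun y : E n => u (z k + μ k • y)) :=
        S.adm.meas.comp (by fun_prop)
      exact (((by fun_prop : Measurable fun y : E n => ‖z k + μ k • y‖ / ‖z k‖).pow_const α).mul
        ((hm.div_const _).pow_const p)).const_mul c
    · simp [(hM k).ne']
    · have := hv0 k x hx
      positivity
    · have h1 := hv0 k x hx
      have h2 := hvC k x hx
      have h3 := hratio k x hx
      gcongr
    · have hlim : Tendsto (fun k => ‖z k + μ k • x‖ / ‖z k‖) atTop (𝓝 1) := by
        rw [tendsto_iff_norm_sub_tendsto_zero]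
        have h1 : Tendsto (fun k => ‖x‖ / r k) atTop (𝓝 0) := hrlim.const_div_atTop _
        refine squeeze_zero (fun k => norm_nonneg _) (fun k => ?_) h1
        rw [norm_eq_abs, div_sub_one (hz0 k).ne', abs_div, abs_of_pos (hz0 k),
          div_le_div_iff₀ (hz0 k) (hr0 k)]
        have h2 := abs_norm_sub_norm_le (z k + μ k • x) (z k)
        rw [add_sub_cancel_left, norm_smul, norm_of_nonneg (hμ0 k).le] at h2
        calc |‖z k + μ k • x‖ - ‖z k‖| * r k ≤ μ k * ‖x‖ * r k :=
              mul_le_r h2 (hr0 k).le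
          _ = ‖x‖ * (δ k / 2) := by rw [← hμr]; ring
          _ ≤ _ := by gcongr; linarith [hδz k, hδ k]
      have h2 : Tendsto (fun k => c * C ^ p * |(‖z k + μ k • x‖ / ‖z k‖) ^ α - 1|) atTop (𝓝 0) := by
        have h3 := hlim.rpow_const (p := α) (Or.inl one_ne_zero)
        rw [one_rpow] at h3
        simpa using ((h3.sub_const 1).abs).const_mul (c * C ^ p)
      refine squeeze_zero_norm' ?_ h2
      filter_upwards [hrlim.eventually_gt_atTop ‖x‖] with k hk
      have h5 := hv0 k x hk
      have h6 := hvC k x hk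
      rw [show c * ((‖z k + μ k • x‖ / ‖z k‖) ^ α * (u (z k + μ k • x) / u (z k)) ^ p) -
        c * (u (z k + μ k • x) / u (z k)) ^ p = c * (u (z k + μ k • x) / u (z k)) ^ p *
        ((‖z k + μ k • x‖ / ‖z k‖) ^ α - 1) by ring, norm_mul, norm_eq_abs, norm_eq_abs,
        abs_of_nonneg pos!]
      gcongr
    · have hy' : ‖y‖ < r k := lin!
      have hMk := hM k
      have hzk := hz0 k
      have hsk : μ k * s ≤ δ k / 2 - ‖μ k • y‖ := by
        rw [norm_smul, norm_of_nonneg (hμ0 k).le, ← hμr]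
        nlinarith [mul_lt_mul_of_pos_left hy (hμ0 k)]
      have hY := hnlow k y hy'
      have h1 := hrep (z k + μ k • y) (μ k * s) (mul_pos (hμ0 k) hs)
        (by linarith [hz4 k]) (by
          have h2 := norm_sub_norm_le (z k) (-(μ k • y))
          rw [sub_neg_eq_add, norm_neg] at h2
          linarith [hδz k, hz4 k])
      rw [Psr_integral_rescale P (hμ0 k) hs] at h1
      have h2 : ∀ w, Psr d s (w - y) * (c * ((‖z k + μ k • w‖ / ‖z k‖) ^ α *
          (u (z k + μ k • w) / u (z k)) ^ p)) = μ k ^ (2 * σ) / u (z k) *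
          (Psr d s (w - y) * Lop N u (z k + μ k • w)) := by
        intro w
        by_cases hw : s ≤ ‖w - y‖
        · rw [Psr_eq_zero hd0 hs hw]; ring
        · have hw' : ‖w‖ < r k := by
            have := norm_sub_norm_le w y
            linarith
          rw [S.eq _ (hΩ k w hw'), hμσ, div_rpow (norm_nonneg _) hzk.le,
            div_rpow (S.nonneg _ (hΩ k w hw')) hMk.le, rpow_sub hMk, rpow_one]
          field_simp
      simp only [h2]
      rw [integral_const_mul]
      have h3 : ∀ a b e : ℝ, kap n d N * (a / u (z k)) - b / u (z k) - μ k ^ (2 * σ) / u (z k) * e =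
          (kap n d N * a - b - μ k ^ (2 * σ) * e) / u (z k) := fun a b e => by field_simp
      rw [h3, abs_div, abs_of_pos hMk, div_le_iff₀ hMk]
      refine h1.trans ?_
      have h4 : (μ k * s) ^ (2 * σ) ≤ ‖z k‖ ^ (2 * σ) := by
        refine rpow_le_rpow (mul_pos (hμ0 k) hs).le ?_ lin!
        linarith [norm_nonneg (μ k • y), hδz k]
      have h5 : ‖z k + μ k • y‖ ^ (-N) ≤ 2 ^ N * ‖z k‖ ^ (-N) := by
        have h6 : (‖z k‖ / 2) ^ (-N) = 2 ^ N * ‖z k‖ ^ (-N) := by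
          rw [div_rpow (norm_nonneg _) zero_le_two, rpow_neg zero_le_two]
          field_simp
        rw [← h6]
        exact rpow_anti lin! hY (by linarith [P.N0])
      have h7 : ‖z k‖ ^ (2 * σ) * ‖z k‖ ^ (-N) * ‖z k‖ ^ (n : ℝ) = 1 := by
        rw [← rpow_add hzk, ← rpow_add hzk, P.hN,
          show 2 * σ + -((n : ℝ) + 2 * σ) + n = 0 by ring, rpow_zero]
      have h8 : ‖z k‖ ^ (2 * σ) * ‖z k‖ ^ (-N) ≤ 2 ^ d * (1 / ((k : ℝ) + 1)) * u (z k) := by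
        have hk0 : (0 : ℝ) < (k : ℝ) + 1 := pos!
        have h9 := hMn k
        rw [rpow_neg zero_le_two, ← div_eq_mul_inv, div_le_iff₀ pos!] at h9
        rw [mul_one_div, div_mul_eq_mul_div, le_div_iff₀ hk0]
        refine (mul_le_l h9).trans (le_of_eq ?_)
        linear_combination (u (z k) * 2 ^ d) * h7
      calc C₁ * ((μ k * s) ^ (2 * σ) * ‖z k + μ k • y‖ ^ (-N))
          ≤ C₁ * (‖z k‖ ^ (2 * σ) * (2 ^ N * ‖z k‖ ^ (-N))) := by gcongr
        _ = C₁ * 2 ^ N * (‖z k‖ ^ (2 * σ) * ‖z k‖ ^ (-N)) := by ring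
        _ ≤ C₁ * 2 ^ N * (2 ^ d * (1 / ((k : ℝ) + 1)) * u (z k)) := by gcongr
        _ = _ := by ring
    · exact div_nonneg (integral_nonneg fun x => mul_nonneg (le_max_right _ _)
        (gar_pos P (mul_pos (hμ0 k) hs) _).le) (hM k).le
    · obtain ⟨ε, hε, h⟩ := exists_gar_ratio (n := n) P hη
      refine ⟨ε, hε, fun k s y y' hs hyy => ?_⟩
      have hμs := mul_pos (hμ0 k) hs
      rw [← mul_div_assoc]
      refine div_le_div_of_nonneg_right ?_ (hM k).le
      rw [← integral_const_mul]
      refine integral_mono (S.wt_pos.mul_gar_integrable P hμs _)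
        ((S.wt_pos.mul_gar_integrable P hμs _).const_mul _) fun x => ?_
      have h1 := h (μ k * s) hμs (x - (z k + μ k • y)) (x - (z k + μ k • y')) (by
        rw [sub_sub_sub_cancel_left, add_sub_add_left_eq_sub, ← smul_sub, norm_smul,
          norm_of_nonneg (hμ0 k).le, norm_sub_rev]
        calc μ k * ‖y - y'‖ ≤ μ k * (ε * s) := mul_le_l hyy (hμ0 k).le
          _ = _ := by ring)
      have h2 := mul_le_l h1 (le_max_right (u x) 0)
      change max (u x) 0 * _ ≤ (1 + η) * (max (u x) 0 * _)
      linarith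
    · positivity
  exact hB.elim

end Sol

open Real

lemma exists_lipschitz_D2 {V : Type*} [NormedAddCommGroup V] [NormedSpace ℝ V]
    [FiniteDimensional ℝ V] {F : V → ℝ} (hF : ContDiff ℝ 3 F) (hc : HasCompactSupport F) :
    ∃ C, 0 ≤ C ∧ (∀ P, |F P| ≤ C) ∧ (∀ P Q, |F P - F Q| ≤ C * ‖P - Q‖) ∧
      (∀ P Z, |D2 F P Z| ≤ C * ‖Z‖ ^ 2) ∧
      ∀ P Q Z, |D2 F P Z - D2 F Q Z| ≤ C * ‖P - Q‖ * ‖Z‖ ^ 2 := by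
  have hd := hF.differentiable num!
  obtain ⟨C1, h10, h11, h12⟩ := exists_D2_bound_of_hasCompactSupport
    (hF.of_le num! : ContDiff ℝ 2 F) hc
  obtain ⟨C2, h20, h21, h22⟩ := exists_D2_bound_of_hasCompactSupport
    (hF.fderiv_right (m := 2) num!) (hc.fderiv (𝕜 := ℝ))
  have hm1 : C1 ≤ max C1 C2 := le_max_left _ _
  have hm2 : C2 ≤ max C1 C2 := le_max_right _ _
  refine ⟨max C1 C2, h10.trans hm1, fun P => (h11 P).trans hm1, fun P Q => ?_,
    fun P Z => (h12 P Z).trans (by gcongr), fun P Q Z => ?_⟩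
  · have := convex_univ.norm_image_sub_le_of_norm_hasFDerivWithin_le (f := F) (s := univ)
      (fun x _ => (hd x).hasFDerivAt.hasFDerivWithinAt) (fun x _ => h21 x) (mem_univ Q) (mem_univ P)
    exact this.trans (by gcongr)
  · have hD : ∀ x ∈ (univ : Set V), HasFDerivWithinAt (fun x => D2 F x Z) (D2 (fderiv ℝ F) x Z)
        univ x := by
      intro x _
      apply HasFDerivAt.hasFDerivWithinAt
      unfold D2
      refine (((hd x).hasFDerivAt.const_smul (2 : ℝ)).sub ?_).sub ?_
      · simpa [Function.comp_def] using (hd (x + Z)).hasFDerivAt.comp x ((hasFDerivAt_id x).add_const Z)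
      · simpa [Function.comp_def] using (hd (x - Z)).hasFDerivAt.comp x ((hasFDerivAt_id x).sub_const Z)
    have := convex_univ.norm_image_sub_le_of_norm_hasFDerivWithin_le hD
      (fun x _ => h22 x Z) (mem_univ Q) (mem_univ P)
    refine this.trans ?_
    rw [mul_right_comm]
    gcongr

section far
variable {n : ℕ} {σ d N : ℝ} {u : E n → ℝ}

/-- A bump function: `1` on the ball of radius `2`, supported in the ball of radius `3`. -/
def inBump (n : ℕ) : ContDiffBump (0 : E n) := ⟨2, 3, num!, num!⟩

lemma inBump_one {x : E n} (h : ‖x‖ ≤ 2) : inBump n x = 1 :=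
  (inBump n).one_of_mem_closedBall (by rw [mem_closedBall_zero_iff]; exact h)
lemma inBump_zero {x : E n} (h : 3 ≤ ‖x‖) : inBump n x = 0 :=
  (inBump n).zero_of_le_dist (by rw [dist_zero_right]; exact h)
lemma inBump_contDiff {k : ℕ∞} : ContDiff ℝ k (inBump n) := (inBump n).contDiff
lemma inBump_measurable : Measurable (inBump n) := (inBump n).continuous.measurable

/-- The contribution of the unknown interior part of `u` at the point `y`. -/
def far (d N : ℝ) (u : E n → ℝ) (y : E n) : ℝ :=
  ∫ x, u x * Lop N (fun z => inBump n z * Gam d (z - y)) x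

/-- The normalized family of test functions entering in `far`. -/
def farKer (d : ℝ) (Q : E n × E n × ℝ) : ℝ :=
  inBump n Q.1 * inBump n ((2 / 3 : ℝ) • Q.2.1) *
    (⟨1, 2, num!, num!⟩ : ContDiffBump (0 : ℝ)) Q.2.2 *
    Gr d (1 / 8) (Q.2.2 • Q.1 - Q.2.1)

lemma farKer_contDiff (hd : 0 < d) : ContDiff ℝ 3 (farKer (n := n) d) := by
  unfold farKer
  refine ((ContDiff.mul ?_ ?_).mul ?_).mul ?_
  · exact (inBump_contDiff (k := 3)).comp contDiff_fst
  · have h : ContDiff ℝ 3 fun Q : E n × E n × ℝ => (2 / 3 : ℝ) • Q.2.1 := by fun_prop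
    exact (inBump_contDiff (k := 3)).comp h
  · exact (ContDiffBump.contDiff _ (n := 3)).comp (contDiff_snd.comp contDiff_snd)
  · have h : ContDiff ℝ 3 fun Q : E n × E n × ℝ => Q.2.2 • Q.1 - Q.2.1 := by fun_prop
    exact (Gr_contDiff_three hd).comp h

lemma farKer_hasCompactSupport : HasCompactSupport (farKer (n := n) d) := by
  refine HasCompactSupport.intro (K := closedBall (0 : E n × E n × ℝ) 6)
    (isCompact_closedBall _ _) fun Q hQ => ?_
  rw [mem_closedBall_zero_iff, Prod.norm_def, Prod.norm_def] at hQ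
  unfold farKer
  by_cases h1 : 3 ≤ ‖Q.1‖
  · rw [inBump_zero h1]; ring
  by_cases h2 : 3 ≤ ‖(2 / 3 : ℝ) • Q.2.1‖
  · rw [inBump_zero h2]; ring
  by_cases h3 : 2 ≤ ‖Q.2.2‖
  · rw [ContDiffBump.zero_of_le_dist _ (x := Q.2.2) (by rw [dist_zero_right]; exact h3)]; ring
  rw [norm_smul, norm_of_nonneg num!] at h2
  exact absurd (max_le lin! (max_le lin! lin!)) hQ

lemma farKer_eq (hd : 0 < d) {R : ℝ} (hR : 8 ≤ R) {y : E n} (h1 : R / 2 ≤ ‖y‖) (h2 : ‖y‖ ≤ 3 * R)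
    (z : E n) :
    inBump n z * Gam d (z - y) = R ^ (-d) * farKer d (z, R⁻¹ • y, R⁻¹) := by
  have hR0 : 0 < R := lin!
  unfold farKer
  by_cases hz : 3 ≤ ‖z‖
  · simp [inBump_zero hz]
  push Not at hz
  have e1 : inBump n ((2 / 3 : ℝ) • R⁻¹ • y) = 1 := by
    apply inBump_one
    rw [norm_smul, norm_smul, norm_of_nonneg num!,
      norm_of_nonneg pos!]
    have : R⁻¹ * ‖y‖ ≤ 3 := by rw [inv_mul_le_iff₀ hR0]; linarith
    linarith
  have e2 : (⟨1, 2, num!, num!⟩ : ContDiffBump (0 : ℝ)) R⁻¹ = 1 := by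
    apply ContDiffBump.one_of_mem_closedBall
    rw [mem_closedBall_zero_iff, norm_of_nonneg pos!]
    exact inv_le_one_of_one_le₀ lin!
  have e4 : 1 / 8 ≤ ‖R⁻¹ • (z - y)‖ := by
    rw [norm_smul, norm_of_nonneg pos!, ← div_eq_inv_mul, le_div_iff₀ hR0]
    have := norm_sub_norm_le y z
    rw [norm_sub_rev] at this
    linarith
  simp only
  rw [e1, e2,
      (smul_sub _ _ _).symm, Gr_eq hd num! e4, Gam_smul pos!, mul_one, mul_one,
    inv_rpow hR0.le, rpow_neg hR0.le]
  field_simp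

lemma exists_far_bounds (P : Par n σ d N) (hu : Wt N u) :
    ∃ C > 0, ∀ R, 8 ≤ R → ∀ y, R / 2 ≤ ‖y‖ → ‖y‖ ≤ 3 * R → |far d N u y| ≤ C * R ^ (-d) ∧
      ∀ y', R / 2 ≤ ‖y'‖ → ‖y'‖ ≤ 3 * R →
        |far d N u y - far d N u y'| ≤ C * R ^ (-d - 1) * ‖y - y'‖ := by
  obtain ⟨M, hM0, b1, b2, b3, b4⟩ := exists_lipschitz_D2 (farKer_contDiff (n := n) P.d0)
    farKer_hasCompactSupport
  obtain ⟨C, hC, hdec⟩ := exists_Lint_decay (n := n) P 3 num!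
  have hmeas : ∀ a : E n × ℝ, Measurable fun z => farKer d (z, a) := fun a =>
    (((farKer_contDiff P.d0).continuous).comp (Continuous.prodMk_left a)).measurable
  have hD : ∀ (a : E n × ℝ) (x y : E n), D2 (fun z => farKer d (z, a)) x y =
      D2 (farKer d) (x, a) (y, 0) := fun a x y => by simp [D2]
  have hn : ∀ y : E n, ‖((y, 0) : E n × E n × ℝ)‖ = ‖y‖ := fun y => by simp [Prod.norm_def]
  have hz : ∀ (a : E n × ℝ) (x : E n), 3 ≤ ‖x‖ → farKer d (x, a) = 0 := fun a x hx => by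
    simp [farKer, inBump_zero hx]
  have hL : ∀ (a : E n × ℝ) (x : E n), |Lop N (fun z => farKer d (z, a)) x| ≤
      C * M * (1 + ‖x‖) ^ (-N) := fun a x => (norm_Lop_le _ x).trans
    (hdec _ M (hmeas a) hM0 (fun z => b1 _) (fun x y => by
      rw [hD, ← hn y]; exact b3 _ _) (hz a) x)
  have hLi : ∀ (a : E n × ℝ) (x : E n), Integrable (Lint N (fun z => farKer d (z, a)) x) :=
    fun a x => Lint_integrable_test P (hmeas a) hM0 (fun z => b1 _) (fun x y => by
      rw [hD, ← hn y]; exact b3 _ _) x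
  have hL2 : ∀ (a b : E n × ℝ) (x : E n), |Lop N (fun z => farKer d (z, a)) x -
      Lop N (fun z => farKer d (z, b)) x| ≤ C * (M * ‖a - b‖) * (1 + ‖x‖) ^ (-N) := by
    intro a b x
    rw [← Lop_sub (hLi a x) (hLi b x)]
    have hab : ∀ x : E n, ‖((x, a) : E n × E n × ℝ) - (x, b)‖ = ‖a - b‖ := fun x => by
      simp [Prod.norm_def]
    refine (norm_Lop_le _ x).trans (hdec _ (M * ‖a - b‖) ((hmeas a).sub (hmeas b)) pos!
      (fun z => ?_) (fun x y => ?_) (fun x hx => ?_) x)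
    · rw [← hab z]; exact b2 _ _
    · have : D2 (fun z => farKer d (z, a) - farKer d (z, b)) x y =
          D2 (farKer d) (x, a) (y, 0) - D2 (farKer d) (x, b) (y, 0) := by
        simp only [D2, smul_eq_mul, Prod.mk_add_mk, Prod.mk_sub_mk, add_zero, sub_zero]; ring
      change ‖D2 (fun z => farKer d (z, a) - farKer d (z, b)) x y‖ ≤ _
      rw [this, ← hab x, ← hn y]; exact b4 _ _ _
    · change farKer d (x, a) - farKer d (x, b) = 0
      rw [hz a x hx, hz b x hx, sub_zero]
  have hui : ∀ a : E n × ℝ, Integrable fun x => u x * Lop N (fun z => farKer d (z, a)) x :=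
    fun a => hu.mul_decay ((fun a => Lop_measurable (hmeas a)) a) (hL a)
  obtain ⟨I, hI⟩ := named (∫ x : E n, |u x| * (1 + ‖x‖) ^ (-N))
  have hI0 : 0 ≤ I := by rw [hI]; exact integral_nonneg fun x => pos!
  have hfar : ∀ R, 8 ≤ R → ∀ y : E n, R / 2 ≤ ‖y‖ → ‖y‖ ≤ 3 * R → far d N u y =
      R ^ (-d) * ∫ x, u x * Lop N (fun z => farKer d (z, R⁻¹ • y, R⁻¹)) x := by
    intro R hR y h1 h2
    rw [far, ← integral_const_mul]
    congr 1; funext x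
    rw [show (fun z => inBump n z * Gam d (z - y)) =
      fun z => R ^ (-d) * farKer d (z, R⁻¹ • y, R⁻¹) from funext (farKer_eq P.d0 hR h1 h2),
      Lop_const_mul]
    ring
  have key : ∀ (g : E n → ℝ) (B : ℝ), (∀ x, |g x| ≤ B * (1 + ‖x‖) ^ (-N)) →
      |∫ x, u x * g x| ≤ B * I := by
    intro g B hg
    rw [hI, ← integral_const_mul]
    rw [← norm_eq_abs]
    refine norm_integral_le_of_norm_le (hu.2.const_mul B) (.of_forall fun x => ?_)
    rw [norm_mul, norm_eq_abs, norm_eq_abs, mul_left_comm]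
    exact mul_le_l (hg x)
  refine ⟨C * M * I + 1, pos!, fun R hR y h1 h2 => ?_⟩
  have hR0 : 0 < R := lin!
  have hRd : 0 < R ^ (-d) := pos!
  refine ⟨?_, fun y' h1' h2' => ?_⟩
  · rw [hfar R hR y h1 h2, abs_mul, abs_of_pos hRd, mul_comm]
    exact mul_le_r ((key _ _ (hL _)).trans lin!)
  · rw [hfar R hR y h1 h2, hfar R hR y' h1' h2', ← mul_sub, ← integral_sub (hui _) (hui _),
      abs_mul, abs_of_pos hRd]
    have e : ∀ x, u x * Lop N (fun z => farKer d (z, R⁻¹ • y, R⁻¹)) x -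
        u x * Lop N (fun z => farKer d (z, R⁻¹ • y', R⁻¹)) x = u x *
        (Lop N (fun z => farKer d (z, R⁻¹ • y, R⁻¹)) x -
        Lop N (fun z => farKer d (z, R⁻¹ • y', R⁻¹)) x) := fun x => by ring
    simp only [e]
    have hk := key _ _ (hL2 (R⁻¹ • y, R⁻¹) (R⁻¹ • y', R⁻¹))
    have hnm : ‖((R⁻¹ • y, R⁻¹) : E n × ℝ) - (R⁻¹ • y', R⁻¹)‖ = R⁻¹ * ‖y - y'‖ := by
      simp [Prod.norm_def, ← smul_sub, norm_smul, abs_of_pos hR0]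
      positivity
    rw [hnm] at hk
    rw [rpow_sub hR0, rpow_one]
    calc _ ≤ R ^ (-d) * (C * (M * (R⁻¹ * ‖y - y'‖)) * I) := mul_le_l hk
      _ = R ^ (-d) * (C * M * I * (R⁻¹ * ‖y - y'‖)) := by ring
      _ ≤ R ^ (-d) * ((C * M * I + 1) * (R⁻¹ * ‖y - y'‖)) := by gcongr; linarith
      _ = _ := by field_simp

end far

open Real

/-- The source term `Lop u`, cut off near the unit ball. -/
def src {n : ℕ} (N : ℝ) (u : E n → ℝ) (x : E n) : ℝ := (1 - inBump n x) * Lop N u x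

namespace Sol
variable {n : ℕ} {σ d N α p c : ℝ} {u : E n → ℝ}

lemma src_zero {x : E n} (h : ‖x‖ ≤ 2) : src N u x = 0 := by
  rw [src, inBump_one h, sub_self, zero_mul]
lemma src_eq {x : E n} (h : 3 ≤ ‖x‖) : src N u x = Lop N u x := by
  rw [src, inBump_zero h, sub_zero, one_mul]
lemma src_nonneg (S : Sol σ d N α p c u) (x : E n) : 0 ≤ src N u x := by
  rcases le_total ‖x‖ 2 with h | h
  · rw [src_zero h]
  · exact mul_nonneg (by linarith [(inBump n).le_one (x := x)]) (S.rhs_nonneg lin!)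
lemma src_le (S : Sol σ d N α p c u) {x : E n} (h : 1 < ‖x‖) : src N u x ≤ Lop N u x :=
  mul_le_of_le_one_left (S.rhs_nonneg h) (by linarith [(inBump n).nonneg (x := x)])
lemma src_measurable (S : Sol σ d N α p c u) : Measurable (src N u) :=
  (measurable_const.sub inBump_measurable).mul (Lop_measurable S.adm.meas)
lemma wt (S : Sol σ d N α p c u) : Wt N u := ⟨S.adm.meas, S.adm.int⟩

lemma exists_src_le (S : Sol σ d N α p c u) :
    ∃ C > 0, ∀ x, src N u x ≤ C * ‖x‖ ^ (-(2 * σ + (2 * σ + α) / (p - 1))) := by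
  obtain ⟨C, hC, hu⟩ := S.upper_bound
  have hp := S.p1
  have hβ0 := S.beta_pos
  have hβp : (2 * σ + α) / (p - 1) * (p - 1) = 2 * σ + α := div_mul_cancel₀ _ lin!
  generalize (2 * σ + α) / (p - 1) = β at *
  have hσ := S.par.hσ0
  have hc := S.c0
  obtain ⟨M, hM⟩ := S.rhs_bdd (K := closedBall 0 8 \ ball 0 2)
    ((isCompact_closedBall _ _).diff isOpen_ball) fun x hx => by
      have := hx.2
      rw [mem_ball_zero_iff] at this
      change 1 < ‖x‖; linarith
  refine ⟨c * C ^ p + |M| * 8 ^ (2 * σ + β), pos!, fun x => ?_⟩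
  rcases le_or_gt ‖x‖ 2 with h2 | h2
  · rw [src_zero h2]; positivity
  refine (S.src_le lin!).trans ?_
  have hx0 : 0 < ‖x‖ := lin!
  rw [add_mul]
  rcases le_total ‖x‖ 8 with h8 | h8
  · have h1 : Lop N u x ≤ |M| := (le_abs_self _).trans ((hM x ⟨by
      rw [mem_closedBall_zero_iff]; exact h8, by
      rw [mem_ball_zero_iff]; linarith⟩).trans (le_abs_self _))
    have h3 : (8 : ℝ) ^ (-(2 * σ + β)) ≤ ‖x‖ ^ (-(2 * σ + β)) :=
      rpow_anti hx0 h8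
    have h4 : (8 : ℝ) ^ (2 * σ + β) * 8 ^ (-(2 * σ + β)) = 1 := by
      rw [← rpow_add num!, add_neg_cancel, rpow_zero]
    have h5 : 0 ≤ c * C ^ p * ‖x‖ ^ (-(2 * σ + β)) := pos!
    calc _ ≤ |M| := h1
      _ = |M| * ((8 : ℝ) ^ (2 * σ + β) * 8 ^ (-(2 * σ + β))) := by rw [h4, mul_one]
      _ ≤ |M| * ((8 : ℝ) ^ (2 * σ + β) * ‖x‖ ^ (-(2 * σ + β))) := by gcongr
      _ ≤ _ := lin!
  · have h5 : 0 ≤ |M| * 8 ^ (2 * σ + β) * ‖x‖ ^ (-(2 * σ + β)) := pos!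
    have h6 : u x ^ p ≤ C ^ p * ‖x‖ ^ (-(β * p)) := by
      refine (rpow_le_rpow (S.nonneg x lin!) (hu x h8) lin!).trans ?_
      rw [mul_rpow hC.le pos!, ← rpow_mul hx0.le, neg_mul]
    rw [S.eq x lin!]
    calc c * (‖x‖ ^ α * u x ^ p) ≤ c * (‖x‖ ^ α * (C ^ p * ‖x‖ ^ (-(β * p)))) := by gcongr
      _ = c * C ^ p * (‖x‖ ^ α * ‖x‖ ^ (-(β * p))) := by ring
      _ = c * C ^ p * ‖x‖ ^ (-(2 * σ + β)) := by
        rw [← rpow_add hx0]; congr 2; linarith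
      _ ≤ _ := lin!

lemma src_bdd (S : Sol σ d N α p c u) : ∃ M > 0, ∀ x, src N u x ≤ M := by
  obtain ⟨C, hC, h⟩ := S.exists_src_le
  have hβ0 := S.beta_pos
  have hσ := S.par.hσ0
  refine ⟨C, hC, fun x => ?_⟩
  rcases le_or_gt ‖x‖ 2 with h2 | h2
  · rw [src_zero h2]; exact hC.le
  · exact (h x).trans (mul_le_of_le_one_right hC.le
      (rpow_le_one_of_one_le_of_nonpos lin! lin!))

lemma src_integrableOn (S : Sol σ d N α p c u) (R : ℝ) : IntegrableOn (src N u) (ball 0 R) := by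
  obtain ⟨M, hM, h⟩ := S.src_bdd
  refine Measure.integrableOn_of_bounded (M := M) measure_ball_lt_top.ne
    S.src_measurable.aestronglyMeasurable (.of_forall fun x => ?_)
  rw [norm_of_nonneg (S.src_nonneg x)]; exact h x

/-- Integrability at infinity of the source against the fundamental solution. -/
lemma src_tail_integrable (S : Sol σ d N α p c u) {R : ℝ} (hR : 0 < R) :
    IntegrableOn (fun x => ‖x‖ ^ (-d) * src N u x) (ball 0 R)ᶜ := by
  obtain ⟨C, hC, h⟩ := S.exists_src_le
  have hβ0 := S.beta_pos
  have hk : IntegrableOn (fun x : E n => ‖x‖ ^ (-(n + (2 * σ + α) / (p - 1)))) (ball 0 R)ᶜ :=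
    ker_integrable_compl lin! hR
  refine (Integrable.const_mul hk C).mono' (Measurable.aestronglyMeasurable
      ((by fun_prop : Measurable fun x : E n =>
    ‖x‖ ^ (-d)).mul S.src_measurable)) ?_
  refine (ae_restrict_iff' measurableSet_ball.compl).2 (.of_forall fun x hx => ?_)
  rw [mem_compl_iff, mem_ball_zero_iff, not_lt] at hx
  have hx0 : 0 < ‖x‖ := lin!
  rw [norm_of_nonneg (mul_nonneg pos! (S.src_nonneg x))]
  calc _ ≤ ‖x‖ ^ (-d) * (C * ‖x‖ ^ (-(2 * σ + (2 * σ + α) / (p - 1)))) := by gcongr; exact h x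
    _ = C * (‖x‖ ^ (-d) * ‖x‖ ^ (-(2 * σ + (2 * σ + α) / (p - 1)))) := by ring
    _ = _ := by rw [← rpow_add hx0]; congr 2; linarith [S.par.hd]

lemma Gam_mul_src_integrable (S : Sol σ d N α p c u) (y : E n) :
    Integrable (fun x => Gam d (x - y) * src N u x) := by
  obtain ⟨M, hM, h⟩ := S.src_bdd
  obtain ⟨L, hL, hr⟩ := Gam_ratio (n := n) (d := d) one_pos
  obtain ⟨R, hR⟩ := named (L * ‖y‖ + 1)
  have hR0 : 0 < R := by rw [hR]; positivity
  rw [← integrableOn_univ, ← union_compl_self (ball (0 : E n) R)]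
  refine IntegrableOn.union ?_ ?_
  · have := Gam_mul_integrableOn_ball S.par y (R := R) S.src_measurable (M := M) fun z _ => by
      rw [abs_of_nonneg (S.src_nonneg z)]; exact h z
    simpa only [Gam_sub_comm] using this
  · have h2 : IntegrableOn (fun x => 2 * (‖x‖ ^ (-d) * src N u x)) (ball 0 R)ᶜ :=
      Integrable.const_mul (S.src_tail_integrable hR0) 2
    refine h2.mono' ((Gam_measurable.comp
        (measurable_id.sub_const y)).mul S.src_measurable).aestronglyMeasurable ?_
    refine (ae_restrict_iff' measurableSet_ball.compl).2 (.of_forall fun x hx => ?_)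
    rw [mem_compl_iff, mem_ball_zero_iff, not_lt] at hx
    have h3 := hr y x lin! (norm_pos_iff.1 lin!)
    rw [Gam_sub_comm, abs_le] at h3
    rw [norm_of_nonneg (mul_nonneg (Gam_nonneg _) (S.src_nonneg x)), ← mul_assoc]
    refine mul_le_r ?_ (S.src_nonneg x)
    have : Gam d x = ‖x‖ ^ (-d) := rfl
    linarith [h3.2]

/-- The Riesz potential of the source. -/
def pot (d N : ℝ) (u : E n → ℝ) (y : E n) : ℝ := ∫ x, Gam d (x - y) * src N u x

lemma pot_nonneg (S : Sol σ d N α p c u) (y : E n) : 0 ≤ pot d N u y :=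
  integral_nonneg fun x => mul_nonneg (Gam_nonneg _) (S.src_nonneg x)

lemma abs_mul_weight_integrable (S : Sol σ d N α p c u) :
    Integrable (fun x => |u x| * (1 + ‖x‖) ^ (-(n : ℝ))) := by
  obtain ⟨C, hC, h⟩ := S.upper_bound
  have hβ0 := S.beta_pos
  have hn := S.par.n0
  have hm : Measurable fun x => |u x| * (1 + ‖x‖) ^ (-(n : ℝ)) :=
    S.adm.meas.abs.mul (by fun_prop)
  rw [← integrableOn_univ, ← union_compl_self (ball (0 : E n) 8)]
  refine IntegrableOn.union ?_ ?_
  · have h1 : IntegrableOn u (ball 0 8) := integrableOn_of_weighted S.par.N0 S.adm.meas S.adm.int 8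
    refine Integrable.mono' h1.norm hm.aestronglyMeasurable (.of_forall fun x => ?_)
    rw [norm_of_nonneg pos!, norm_eq_abs]
    exact mul_le_of_le_one_right (abs_nonneg _) (rpow_le_one_of_one_le_of_nonpos
      (by linarith [norm_nonneg x]) lin!)
  · have hk : IntegrableOn (fun x : E n => ‖x‖ ^ (-(n + (2 * σ + α) / (p - 1)))) (ball 0 8)ᶜ :=
      ker_integrable_compl lin! num!
    refine (Integrable.const_mul hk C).mono' hm.aestronglyMeasurable ?_
    refine (ae_restrict_iff' measurableSet_ball.compl).2 (.of_forall fun x hx => ?_)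
    rw [mem_compl_iff, mem_ball_zero_iff, not_lt] at hx
    have hx0 : 0 < ‖x‖ := lin!
    rw [norm_of_nonneg pos!, abs_of_nonneg (S.nonneg x lin!)]
    calc _ ≤ (C * ‖x‖ ^ (-((2 * σ + α) / (p - 1)))) * ‖x‖ ^ (-(n : ℝ)) := by
          refine mul_le_mul (h x hx) ?_ pos! pos!
          exact rpow_anti hx0 lin!
      _ = C * (‖x‖ ^ (-((2 * σ + α) / (p - 1))) * ‖x‖ ^ (-(n : ℝ))) := by ring
      _ = _ := by rw [← rpow_add hx0]; congr 2; ring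

lemma tendsto_gar_atTop (S : Sol σ d N α p c u) (y : E n) :
    Tendsto (fun r => ∫ x, u x * gar d N r (x - y)) atTop (𝓝 0) := by
  have P := S.par
  have hσ := P.hσ0
  obtain ⟨_, _, C, hC, hb⟩ := exists_gar_bounds (n := n) P
  have hb' : ∀ r > 0, ∀ z : E n, gar d N r z ≤ C * (r + ‖z‖) ^ (-(n : ℝ)) := by
    intro r hr z
    refine (hb r hr z).2.trans (mul_le_l ?_)
    have h0 : 0 < r + ‖z‖ := pos!
    calc _ ≤ (r + ‖z‖) ^ (2 * σ) * (r + ‖z‖) ^ (-N) := by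
          gcongr; linarith [norm_nonneg z]
      _ = _ := by rw [← rpow_add h0]; congr 1; linarith [P.hN]
  rw [show (0 : ℝ) = ∫ x : E n, 0 by simp]
  refine tendsto_integral_filter_of_dominated_convergence
    (fun x => C * (|u x| * (1 + ‖x‖) ^ (-(n : ℝ)))) ?_ ?_
    (S.abs_mul_weight_integrable.const_mul C) ?_
  · exact .of_forall fun r => (S.adm.meas.mul
      ((gar_continuous P).measurable.comp (measurable_id.sub_const y))).aestronglyMeasurable
  · filter_upwards [eventually_ge_atTop (1 + ‖y‖)] with r hr
    have hr0 : 0 < r := by linarith [norm_nonneg y]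
    refine .of_forall fun x => ?_
    rw [norm_mul, norm_of_nonneg (gar_pos P hr0 _).le, norm_eq_abs, mul_left_comm]
    refine mul_le_l ((hb' r hr0 _).trans (mul_le_l ?_))
    have h1 : ‖x‖ ≤ ‖x - y‖ + ‖y‖ := by simpa using norm_add_le (x - y) y
    exact rpow_anti pos! lin!
  · refine .of_forall fun x => ?_
    rw [← mul_zero (u x)]
    refine Tendsto.const_mul _ ?_
    have h0 : Tendsto (fun r : ℝ => C * r ^ (-(n : ℝ))) atTop (𝓝 0) := by
      have := (tendsto_rpow_neg_atTop P.n0).const_mul C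
      rwa [mul_zero] at this
    refine squeeze_zero' ?_ ?_ h0
    · filter_upwards [eventually_gt_atTop 0] with r hr using (gar_pos P hr _).le
    · filter_upwards [eventually_gt_atTop 0] with r hr
      refine (hb' r hr _).trans (mul_le_l ?_)
      exact rpow_anti hr (by linarith [norm_nonneg (x - y)])

lemma tendsto_Psr_src (S : Sol σ d N α p c u) (y : E n) :
    Tendsto (fun r => ∫ x, Psr d r (x - y) * src N u x) atTop (𝓝 (pot d N u y)) := by
  have P := S.par
  have := P.nontriv
  refine tendsto_integral_filter_of_dominated_convergence
    (fun x => Gam d (x - y) * src N u x) ?_ ?_ (S.Gam_mul_src_integrable y) ?_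
  · exact .of_forall fun r => (((Psr_measurable P.d0).comp
      (measurable_id.sub_const y)).mul S.src_measurable).aestronglyMeasurable
  · filter_upwards [eventually_gt_atTop 0] with r hr
    refine .of_forall fun x => ?_
    rw [norm_of_nonneg (mul_nonneg (Psr_nonneg hr _) (S.src_nonneg x))]
    exact mul_le_r (Psr_le hr _) (S.src_nonneg x)
  · have hae : ∀ᵐ x : E n, x ≠ y := compl_mem_ae_iff.2 (measure_singleton y)
    filter_upwards [hae] with x hx
    refine Tendsto.mul_const _ ?_
    have h0 : Tendsto (fun r : ℝ => Phi 2 * r ^ (-d)) atTop (𝓝 0) := by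
      have := (tendsto_rpow_neg_atTop P.d0).const_mul (Phi 2)
      rwa [mul_zero] at this
    have h1 : Tendsto (fun r : ℝ => Gr d r (x - y)) atTop (𝓝 0) := by
      refine squeeze_zero' ?_ ?_ h0
      · filter_upwards [eventually_gt_atTop 0] with r hr using Gr_nonneg hr _
      · filter_upwards [eventually_gt_atTop 0] with r hr using Gr_le_two hr _
    have h2 := h1.const_sub (Gam d (x - y))
    rw [sub_zero] at h2
    refine h2.congr' ?_
    filter_upwards [eventually_gt_atTop 0] with r hr using (Psr_of_ne hr (sub_ne_zero.2 hx)).symm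

end Sol

open Real

lemma Gr_const {n : ℕ} {d r : ℝ} (hd : 0 < d) (hr : 0 < r) {x : E n}
    (h : (2 : ℝ) ^ (1 / d) * ‖x‖ ≤ r) : Gr d r x = Phi 2 * r ^ (-d) := by
  rw [Gr, mul_comm]
  congr 1
  rcases eq_or_ne x 0 with rfl | hx
  · rw [smul_zero, G1_zero]
  rw [G1_of_ne (smul_ne_zero pos! hx)]
  apply Phi_eq_two
  rw [Gam, norm_smul, norm_of_nonneg pos!, ← div_eq_inv_mul]
  have h1 : ‖x‖ / r ≤ ((2 : ℝ) ^ (1 / d))⁻¹ := by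
    rw [div_le_iff₀ hr, ← div_eq_inv_mul, le_div_iff₀ pos!]; linarith
  have h2 := rpow_anti pos! h1 (lin! : -d ≤ 0)
  rw [inv_rpow pos!, ← rpow_mul num!] at h2
  rwa [show 1 / d * -d = -1 by field_simp, rpow_neg_one, inv_inv] at h2

lemma inBump_mul_Gam_contDiff {n : ℕ} {d : ℝ} (hd : 0 < d) {y : E n} (hy : 4 ≤ ‖y‖) :
    ContDiff ℝ 2 (fun z => inBump n z * Gam d (z - y)) ∧
      HasCompactSupport (fun z => inBump n z * Gam d (z - y)) := by
  constructor
  · have h8 : 8 ≤ max 8 ‖y‖ := le_max_left _ _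
    have e : (fun z => inBump n z * Gam d (z - y)) = fun z => (max 8 ‖y‖) ^ (-d) *
        farKer d (z, (max 8 ‖y‖)⁻¹ • y, (max 8 ‖y‖)⁻¹) := by
      funext z
      refine farKer_eq hd h8 ?_ (by linarith [le_max_right 8 ‖y‖]) z
      rcases max_choice 8 ‖y‖ with h | h <;> rw [h] <;> linarith
    rw [e]
    exact (contDiff_const.mul ((farKer_contDiff hd).comp (by fun_prop))).of_le num!
  · exact (inBump n).hasCompactSupport.mul_right

namespace Sol
variable {n : ℕ} {σ d N α p c : ℝ} {u : E n → ℝ}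

/-- One regularized form of the global representation formula. -/
lemma rep_approx (S : Sol σ d N α p c u) {y : E n} (hy : 4 ≤ ‖y‖) {r : ℝ}
    (hr : (2 : ℝ) ^ (1 / d) * (3 + ‖y‖) ≤ r) :
    kap n d N * u y = (∫ x, u x * gar d N r (x - y)) -
      Phi 2 * r ^ (-d) * (∫ x, u x * Lop N (inBump n) x) + far d N u y +
      ∫ x, Psr d r (x - y) * src N u x := by
  have P := S.par
  have := P.nontriv
  have h21 : (1 : ℝ) ≤ (2 : ℝ) ^ (1 / d) := one_le_rpow num! (by
    have := P.d0; positivity)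
  have hr3 : 3 + ‖y‖ ≤ r := by nlinarith
  have hr0 : 0 < r := lin!
  obtain ⟨hφ, hφc⟩ := inBump_mul_Gam_contDiff P.d0 hy
  obtain ⟨φ, hφe⟩ := named fun (z : E n) => inBump n z * Gam d (z - y)
  rw [← hφe] at hφ hφc
  obtain ⟨k, hk⟩ := named (Phi 2 * r ^ (-d))
  have hG : ContDiff ℝ 2 fun z : E n => Gr d r (z - y) :=
    (Gr_contDiff P.d0).comp (contDiff_id.sub contDiff_const)
  have hθ : ContDiff ℝ 2 (inBump n) := inBump_contDiff (k := 2)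
  obtain ⟨M1, T1⟩ := test_of_contDiff hφ hφc
  obtain ⟨M2, T2⟩ := test_of_contDiff hθ ((inBump n).hasCompactSupport)
  have i2 := fun x => T2.Lint_integrable P x
  have i3 := fun x => (adm_of_bounded P hG (fun x => Gr_abs_le hr0 (x - y))).Lint_integrable P
    (mem_univ x)
  have hLint : ∀ (a : ℝ) (f : E n → ℝ) (x : E n), Integrable (Lint N f x) →
      Integrable (Lint N (fun z => a * f z) x) := by
    intro a f x h
    refine (h.const_mul a).congr (.of_forall fun z => ?_)
    simp only [Lint, D2, smul_eq_mul]; ring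
  have hLint2 : ∀ (f g : E n → ℝ) (x : E n), Integrable (Lint N f x) → Integrable (Lint N g x) →
      Integrable (Lint N (fun z => f z - g z) x) := by
    intro f g x hf hg
    refine (hf.sub hg).congr (.of_forall fun z => ?_)
    simp only [Lint, D2, smul_eq_mul, Pi.sub_apply]; ring
  have hLw : ∀ x, Lop N (fun z => (Gr d r (z - y) - k * inBump n z) - (-1) * φ z) x =
      gar d N r (x - y) - k * Lop N (inBump n) x + Lop N φ x := by
    intro x
    rw [Lop_sub (hLint2 _ _ x (i3 x) (hLint _ _ x (i2 x))) (hLint _ _ x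
        ((fun x => T1.Lint_integrable P x) x)),
      Lop_sub (i3 x) (hLint _ _ x (i2 x)), Lop_const_mul, Lop_const_mul,
      Lop_translate (Gr d r), Lop_Gr P hr0]
    ring
  have hGr3 : ∀ z : E n, inBump n z * Gr d r (z - y) = k * inBump n z := by
    intro z
    rcases le_total 3 ‖z‖ with hz | hz
    · rw [inBump_zero hz]; ring
    · rw [Gr_const P.d0 hr0, mul_comm, hk]
      refine le_trans (mul_le_l ?_) hr
      exact (norm_sub_le _ _).trans lin!
  obtain ⟨Mf, hMf⟩ := S.rhs_bdd (K := closedBall y r \ ball 0 2)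
    ((isCompact_closedBall _ _).diff isOpen_ball) fun x hx => by
      have := hx.2
      rw [mem_ball_zero_iff] at this
      change 1 < ‖x‖; linarith
  have hrep := representation_general P S.adm
    (w := fun z => (Gr d r (z - y) - k * inBump n z) - (-1) * φ z)
    ((hG.sub (contDiff_const.mul hθ)).sub (contDiff_const.mul hφ))
    (M := Phi 2 * r ^ (-d) + |k| * M2 + M1) (fun x => by
      have h1 := Gr_abs_le (d := d) hr0 (x - y)
      have h2 : |k * inBump n x| ≤ |k| * M2 := by
        rw [abs_mul]; exact mul_le_l (T2.bd x)
      have h3 : |(-1) * φ x| ≤ M1 := by rw [neg_one_mul, abs_neg]; exact T1.bd x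
      have h4 := abs_sub (Gr d r (x - y) - k * inBump n x) ((-1) * φ x)
      have h5 := abs_sub (Gr d r (x - y)) (k * inBump n x)
      linarith)
    (K := closedBall y r \ ball 0 2) ((isCompact_closedBall _ _).diff isOpen_ball)
    (fun x hx => by
      have := hx.2
      rw [mem_ball_zero_iff] at this
      change 1 < ‖x‖; linarith) (y := y) (by
      filter_upwards [closedBall_mem_nhds y (show (0 : ℝ) < 1 by norm_num)] with z hz
      rw [mem_closedBall, dist_eq_norm] at hz
      have := norm_sub_norm_le y z
      rw [norm_sub_rev] at this
      refine ⟨?_, ?_⟩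
      · rw [mem_closedBall, dist_eq_norm]; linarith
      · rw [mem_ball_zero_iff]; linarith)
    (fun x hx => by
      rw [← hGr3]
      simp only [hφe]
      rw [Set.mem_sdiff, not_and_or, not_not, mem_closedBall, mem_ball_zero_iff,
        dist_eq_norm, not_le] at hx
      rcases hx with hx | hx
      · rw [Gr_eq P.d0 hr0 hx.le]; ring
      · rw [inBump_one hx.le]; ring) hMf
  have j1 := S.wt.mul_gar_integrable P hr0 y
  have j4 := (T2.mul_Lop_integrable P S.adm.meas S.adm.int).const_mul k
  have j5 : Integrable fun x => u x * gar d N r (x - y) - k * (u x * Lop N (inBump n) x) := j1.sub j4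
  rw [hrep.2.2]
  have e1 : ∫ x, u x * Lop N (fun z => (Gr d r (z - y) - k * inBump n z) - (-1) * φ z) x =
      (∫ x, u x * gar d N r (x - y)) - k * (∫ x, u x * Lop N (inBump n) x) + far d N u y := by
    rw [far, ← hφe, ← integral_const_mul k, ← integral_sub j1 j4, ← integral_add j5
        (T1.mul_Lop_integrable P S.adm.meas S.adm.int)]
    congr 1; funext x
    rw [hLw]; ring
  have e2 : ∫ x, (Gam d (x - y) - ((Gr d r (x - y) - k * inBump n x) - (-1) * φ x)) * Lop N u x =
      ∫ x, Psr d r (x - y) * src N u x := by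
    refine integral_congr_ae ?_
    filter_upwards [compl_mem_ae_iff.2 (measure_singleton y)] with x hx
    rw [← hGr3, hφe, Psr_of_ne hr0 (sub_ne_zero.2 hx), src]
    ring
  rw [e1, e2, hk]

/-- The global representation formula. -/
theorem rep_global (S : Sol σ d N α p c u) {y : E n} (hy : 4 ≤ ‖y‖) :
    kap n d N * u y = pot d N u y + far d N u y := by
  have h0 : Tendsto (fun r : ℝ => Phi 2 * r ^ (-d) * (∫ x, u x * Lop N (inBump n) x)) atTop
      (𝓝 0) := by
    have := ((tendsto_rpow_neg_atTop S.par.d0).const_mul (Phi 2)).mul_const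
      (∫ x, u x * Lop N (inBump n) x)
    rwa [mul_zero, zero_mul] at this
  have h := (((S.tendsto_gar_atTop y).sub h0).add_const (far d N u y)).add (S.tendsto_Psr_src y)
  rw [sub_zero, zero_add, add_comm] at h
  refine tendsto_nhds_unique (tendsto_const_nhds.congr' ?_) h
  filter_upwards [eventually_ge_atTop ((2 : ℝ) ^ (1 / d) * (3 + ‖y‖))] with r hr
  exact S.rep_approx hy hr

end Sol

open Real

lemma le_two_mul_of_le_add_half {X : Type*} {v : X → ℝ} {a b : ℝ} (hb : ∀ x, v x ≤ b)
    (h : ∀ M, (∀ x, v x ≤ M) → ∀ x, v x ≤ a + M / 2) (x : X) : v x ≤ 2 * a := by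
  have : Nonempty X := ⟨x⟩
  have hbd : BddAbove (range v) := ⟨b, by rintro _ ⟨x, rfl⟩; exact hb x⟩
  have h1 := ciSup_le (h _ (le_ciSup hbd))
  linarith [le_ciSup hbd x]

namespace Sol
variable {n : ℕ} {σ d N α p c : ℝ} {u : E n → ℝ}

/-- The size of the potential of the source on the sphere of radius `R`. -/
def SS (d N : ℝ) (u : E n → ℝ) (R : ℝ) : ℝ := ∫ x, max R ‖x‖ ^ (-d) * src N u x
/-- The mass of the source in a ball. -/
def AA (N : ℝ) (u : E n → ℝ) (R : ℝ) : ℝ := ∫ x in ball 0 R, src N u x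
/-- The tail of the potential of the source at the origin. -/
def BB (d N : ℝ) (u : E n → ℝ) (R : ℝ) : ℝ := ∫ x in (ball 0 R)ᶜ, ‖x‖ ^ (-d) * src N u x

lemma SS_aux (S : Sol σ d N α p c u) {R : ℝ} (hR : 0 < R) :
    Integrable (fun x => max R ‖x‖ ^ (-d) * src N u x) ∧
      SS d N u R = R ^ (-d) * AA N u R + BB d N u R := by
  have h1 : IntegrableOn (fun x => R ^ (-d) * src N u x) (ball 0 R) :=
    Integrable.const_mul (S.src_integrableOn R) _
  have e1 : EqOn (fun x => R ^ (-d) * src N u x) (fun x => max R ‖x‖ ^ (-d) * src N u x)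
      (ball 0 R) := fun x hx => by
    rw [mem_ball_zero_iff] at hx
    simp only [max_eq_left hx.le]
  have e2 : EqOn (fun x => ‖x‖ ^ (-d) * src N u x) (fun x => max R ‖x‖ ^ (-d) * src N u x)
      (ball 0 R)ᶜ := fun x hx => by
    rw [mem_compl_iff, mem_ball_zero_iff, not_lt] at hx
    simp only [max_eq_right hx]
  have hi : Integrable (fun x => max R ‖x‖ ^ (-d) * src N u x) := by
    rw [← integrableOn_univ, ← union_compl_self (ball (0 : E n) R)]
    exact (h1.congr_fun e1 measurableSet_ball).union
        ((S.src_tail_integrable hR).congr_fun e2 measurableSet_ball.compl)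
  refine ⟨hi, ?_⟩
  rw [SS, ← integral_add_compl measurableSet_ball hi, AA, BB, ← integral_const_mul,
    setIntegral_congr_fun measurableSet_ball e1, setIntegral_congr_fun measurableSet_ball.compl e2]

lemma SS_eq (S : Sol σ d N α p c u) {R : ℝ} (hR : 0 < R) :
    SS d N u R = R ^ (-d) * AA N u R + BB d N u R := (S.SS_aux hR).2
lemma SS_integrable (S : Sol σ d N α p c u) {R : ℝ} (hR : 0 < R) :
    Integrable (fun x => max R ‖x‖ ^ (-d) * src N u x) := (S.SS_aux hR).1
lemma SS_nonneg (S : Sol σ d N α p c u) {R : ℝ} (hR : 0 < R) : 0 ≤ SS d N u R :=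
  integral_nonneg fun x => mul_nonneg pos! (S.src_nonneg x)
lemma AA_nonneg (S : Sol σ d N α p c u) (R : ℝ) : 0 ≤ AA N u R :=
  setIntegral_nonneg measurableSet_ball fun x _ => S.src_nonneg x
lemma BB_nonneg (S : Sol σ d N α p c u) (R : ℝ) : 0 ≤ BB d N u R :=
  setIntegral_nonneg measurableSet_ball.compl fun x _ =>
    mul_nonneg pos! (S.src_nonneg x)

lemma SS_antitone (S : Sol σ d N α p c u) {R R' : ℝ} (hR : 0 < R) (h : R ≤ R') :
    SS d N u R' ≤ SS d N u R := by
  refine integral_mono (S.SS_integrable (hR.trans_le h)) (S.SS_integrable hR) fun x => ?_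
  refine mul_le_r ?_ (S.src_nonneg x)
  exact rpow_anti (lt_max_of_lt_left hR) (max_le_max_right _ h)
    (by linarith [S.par.d0])

lemma SS_le_scale (S : Sol σ d N α p c u) {R t : ℝ} (hR : 0 < R) (ht : 1 ≤ t) :
    SS d N u R ≤ t ^ d * SS d N u (t * R) := by
  have hd := S.par.d0
  have ht0 : 0 < t := lin!
  rw [SS, SS, ← integral_const_mul]
  refine integral_mono (S.SS_integrable hR) ((S.SS_integrable pos!).const_mul _)
    fun x => ?_
  rw [← mul_assoc]
  refine mul_le_r ?_ (S.src_nonneg x)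
  have h1 : max (t * R) ‖x‖ ≤ t * max R ‖x‖ := by
    refine max_le (by gcongr; exact le_max_left _ _) ?_
    nlinarith [le_max_right R ‖x‖, norm_nonneg x]
  have h2 := rpow_anti (lt_max_of_lt_left pos!) h1
    (lin! : -d ≤ 0)
  rw [mul_rpow ht0.le (lt_max_of_lt_left hR).le] at h2
  have h3 : t ^ d * t ^ (-d) = 1 := by rw [← rpow_add ht0, add_neg_cancel, rpow_zero]
  calc max R ‖x‖ ^ (-d) = t ^ d * (t ^ (-d) * max R ‖x‖ ^ (-d)) := by rw [← mul_assoc, h3, one_mul]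
    _ ≤ _ := mul_le_l h2

lemma pot_lower (S : Sol σ d N α p c u) {y : E n} (hy : 0 < ‖y‖) :
    2 ^ (-d) * SS d N u ‖y‖ ≤ pot d N u y := by
  have := S.par.nontriv
  have hd := S.par.d0
  rw [SS, pot, ← integral_const_mul]
  refine integral_mono_ae ((S.SS_integrable hy).const_mul _) (S.Gam_mul_src_integrable y) ?_
  filter_upwards [compl_mem_ae_iff.2 (measure_singleton y)] with x hx
  rw [← mul_assoc]
  refine mul_le_r ?_ (S.src_nonneg x)
  rw [← mul_rpow num! pos!]
  refine rpow_anti (norm_pos_iff.2 (sub_ne_zero.2 hx)) ?_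
  exact (norm_sub_le _ _).trans (by linarith [le_max_left ‖y‖ ‖x‖, le_max_right ‖y‖ ‖x‖])

/-- Off a ball around `y`, the distance to `y` is comparable with the larger of the norms. -/
lemma max_le_dist {x y : E n} {θ : ℝ} (hθ : 0 < θ) (hθ1 : θ ≤ 1)
    (h : θ * ‖y‖ ≤ ‖x - y‖) : θ / 2 * max ‖y‖ ‖x‖ ≤ ‖x - y‖ := by
  have h1 := norm_sub_norm_le x y
  have h2 := norm_nonneg y
  have h3 := norm_nonneg x
  rcases le_total ‖y‖ ‖x‖ with h4 | h4
  · rw [max_eq_right h4]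
    rcases le_total ‖x‖ (2 * ‖y‖) with h5 | h5 <;> nlinarith
  · rw [max_eq_left h4]; nlinarith

lemma pot_upper (S : Sol σ d N α p c u) {y : E n} (hy : 0 < ‖y‖) {θ G : ℝ} (hθ : 0 < θ)
    (hθ1 : θ ≤ 1) (hG : ∀ x ∈ ball y (θ * ‖y‖), src N u x ≤ G) :
    pot d N u y ≤ (θ / 2) ^ (-d) * SS d N u ‖y‖ +
      G * ((θ * ‖y‖) ^ (2 * σ) * ∫ z in ball (0 : E n) 1, ‖z‖ ^ (-d)) := by
  have P := S.par
  have hd := P.d0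
  have hi := S.Gam_mul_src_integrable y
  rw [pot, ← integral_add_compl (measurableSet_ball (x := y) (ε := θ * ‖y‖)) hi, add_comm]
  obtain ⟨g1, g2⟩ := Gam_ball_integral P y (r := θ * ‖y‖) pos!
  refine add_le_add ?_ ?_
  · rw [SS, ← integral_const_mul]
    have hj : Integrable fun x => (θ / 2) ^ (-d) * (max ‖y‖ ‖x‖ ^ (-d) * src N u x) :=
      (S.SS_integrable hy).const_mul _
    refine (setIntegral_mono_on hi.integrableOn hj.integrableOn measurableSet_ball.compl
      fun x hx => ?_).trans (setIntegral_le_integral hj (.of_forall fun x =>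
        mul_nonneg pos! (mul_nonneg pos! (S.src_nonneg x))))
    rw [mem_compl_iff, mem_ball, dist_eq_norm, not_lt] at hx
    rw [← mul_assoc]
    refine mul_le_r ?_ (S.src_nonneg x)
    rw [← mul_rpow pos! pos!]
    exact rpow_anti (mul_pos pos! (lt_max_of_lt_left hy))
      (max_le_dist hθ hθ1 hx)
  · rw [← g2, ← integral_const_mul]
    refine setIntegral_mono_on hi.integrableOn
        (Integrable.const_mul g1 G) measurableSet_ball fun x hx => ?_
    rw [Gam_sub_comm, mul_comm]
    exact mul_le_r (hG x hx) (Gam_nonneg _)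

lemma exists_far_le (S : Sol σ d N α p c u) :
    ∃ C > 0, ∀ y, 8 ≤ ‖y‖ → |far d N u y| ≤ C * ‖y‖ ^ (-d) := by
  obtain ⟨C, hC, h⟩ := exists_far_bounds S.par S.wt
  exact ⟨C, hC, fun y hy => (h ‖y‖ hy y lin! lin!).1⟩

lemma exists_le_u (S : Sol σ d N α p c u) : ∃ c' > 0, ∃ C > 0, ∀ y, 8 ≤ ‖y‖ →
    c' * SS d N u ‖y‖ - C * ‖y‖ ^ (-d) ≤ u y := by
  obtain ⟨C, hC, h⟩ := S.exists_far_le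
  have hk := kap_pos S.par
  refine ⟨2 ^ (-d) / kap n d N, pos!, C / kap n d N, pos!, fun y hy => ?_⟩
  have h1 := S.rep_global (y := y) lin!
  have h2 := S.pot_lower (y := y) lin!
  have h3 := (abs_le.1 (h y hy)).1
  rw [div_mul_eq_mul_div, div_mul_eq_mul_div, ← sub_div, div_le_iff₀ hk]
  linarith

lemma exists_Lop_le (S : Sol σ d N α p c u) :
    ∃ C > 0, ∀ x, 8 ≤ ‖x‖ → Lop N u x ≤ C * ‖x‖ ^ (-(2 * σ)) * u x := by
  obtain ⟨C, hC, hu⟩ := S.upper_bound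
  have hp := S.p1
  have hβp : (2 * σ + α) / (p - 1) * (p - 1) = 2 * σ + α := div_mul_cancel₀ _ lin!
  generalize (2 * σ + α) / (p - 1) = β at *
  have hc := S.c0
  refine ⟨c * C ^ (p - 1), pos!, fun x hx => ?_⟩
  have hx0 : 0 < ‖x‖ := lin!
  have hu0 := S.nonneg x lin!
  rw [S.eq x lin!]
  have e : u x ^ p = u x ^ (p - 1) * u x := by
    rw [← rpow_add_one' hu0 lin!]; congr 1; ring
  have h6 : u x ^ (p - 1) ≤ C ^ (p - 1) * ‖x‖ ^ (-(β * (p - 1))) := by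
    refine (rpow_le_rpow hu0 (hu x hx) lin!).trans ?_
    rw [mul_rpow hC.le pos!, ← rpow_mul hx0.le, neg_mul]
  rw [e]
  calc c * (‖x‖ ^ α * (u x ^ (p - 1) * u x))
      ≤ c * (‖x‖ ^ α * (C ^ (p - 1) * ‖x‖ ^ (-(β * (p - 1))) * u x)) := by gcongr
    _ = c * C ^ (p - 1) * (‖x‖ ^ α * ‖x‖ ^ (-(β * (p - 1)))) * u x := by ring
    _ = _ := by rw [← rpow_add hx0]; congr 3; linarith

end Sol

open Real

lemma exists_small_rpow {a ε : ℝ} (K : ℝ) (ha : 0 < a) (hε : 0 < ε) :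
    ∃ θ > 0, θ ≤ 1 / 2 ∧ K * θ ^ a ≤ ε := by
  have h := ((continuousAt_rpow_const 0 a (Or.inr ha.le)).tendsto).const_mul K
  rw [zero_rpow ha.ne', mul_zero] at h
  have h2 : ∀ᶠ θ in 𝓝[>] (0 : ℝ), θ ∈ Ioc (0 : ℝ) (1 / 2) := Ioc_mem_nhdsGT num!
  obtain ⟨θ, h3, h4⟩ := (((h.mono_left nhdsWithin_le_nhds).eventually
      (gt_mem_nhds hε)).and h2).exists
  exact ⟨θ, h4.1, h4.2, h3.le⟩

namespace Sol
variable {n : ℕ} {σ d N α p c : ℝ} {u : E n → ℝ}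

lemma exists_u_le (S : Sol σ d N α p c u) :
    ∃ C > 0, ∀ x, 16 ≤ ‖x‖ → u x ≤ C * (SS d N u ‖x‖ + ‖x‖ ^ (-d)) := by
  have P := S.par
  have hd := P.d0
  have hσ := P.hσ0
  have hk := kap_pos P
  obtain ⟨C1, hC1, hu⟩ := S.upper_bound
  have hβ := S.beta_pos
  obtain ⟨CL, hCL, hL⟩ := S.exists_Lop_le
  obtain ⟨Cf, hCf, hf⟩ := S.exists_far_le
  obtain ⟨I, hI⟩ := named (∫ z in ball (0 : E n) 1, ‖z‖ ^ (-d))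
  obtain ⟨θ, hθ, hθ1, hθK⟩ := exists_small_rpow (CL * 2 ^ (2 * σ) * 2 ^ d * 2 ^ d * I)
    (lin! : 0 < 2 * σ) (half_pos hk)
  obtain ⟨a, ha⟩ := named (((θ / 2) ^ (-d) + Cf) / kap n d N + C1 * 32 ^ d)
  have ha1 : ((θ / 2) ^ (-d) + Cf) ≤ a * kap n d N := by
    rw [ha, add_mul, div_mul_cancel₀ _ hk.ne']
    have : 0 ≤ C1 * 32 ^ d * kap n d N := pos!
    linarith
  have ha2 : C1 * 32 ^ d ≤ a := by rw [ha]; linarith [show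
    0 ≤ ((θ / 2) ^ (-d) + Cf) / kap n d N by positivity]
  obtain ⟨W, hW⟩ := named fun (R : ℝ) => SS d N u R + R ^ (-d)
  have hWd : ∀ {R}, 0 < R → R ^ (-d) ≤ W R := fun hR => by
    rw [hW]; simpa using S.SS_nonneg hR
  have hWS : ∀ {R}, 0 < R → SS d N u R ≤ W R := fun hR => by
    rw [hW]; simpa using (rpow_pos_of_pos hR (-d)).le
  have hW0 : ∀ {R}, 0 < R → 0 < W R := fun hR => (rpow_pos_of_pos hR _).trans_le (hWd hR)
  have hW2 : ∀ {R R'}, 0 < R → R / 2 ≤ R' → W R' ≤ 2 ^ d * W R := by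
    intro R R' hR h
    have h1 := S.SS_le_scale (half_pos hR) one_le_two
    have h2 := S.SS_antitone (half_pos hR) h
    have h3 : R' ^ (-d) ≤ 2 ^ d * R ^ (-d) := by
      have := rpow_anti (half_pos hR) h (lin! : -d ≤ 0)
      rwa [div_rpow hR.le two_pos.le, rpow_neg two_pos.le, div_inv_eq_mul,
        mul_comm] at this
    rw [mul_div_cancel₀ R two_ne_zero] at h1
    rw [hW]; simp only; rw [mul_add]; linarith
  have key : ∀ T, 0 < T → ∀ x : {x : E n // 16 ≤ ‖x‖},
      u x / (W ‖(x : E n)‖ * max 1 ((‖(x : E n)‖ / T) ^ d)) ≤ 2 * a := by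
    intro T hT
    have hV0 : ∀ R, 0 < R → 0 < W R * max 1 ((R / T) ^ d) := fun R hR =>
      mul_pos (hW0 hR) (lt_max_of_lt_left one_pos)
    refine le_two_mul_of_le_add_half (b := C1 * T ^ d) ?_ ?_
    · rintro ⟨x, hx⟩
      have hx0 : 0 < ‖x‖ := lin!
      rw [div_le_iff₀ (hV0 _ hx0)]
      have h1 := (hu x lin!).trans (mul_le_of_le_one_right hC1.le
        (rpow_le_one_of_one_le_of_nonpos lin! lin!))
      have h2 : ‖x‖ ^ (-d) * (‖x‖ / T) ^ d ≤ W ‖x‖ * max 1 ((‖x‖ / T) ^ d) :=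
        mul_le_mul (hWd hx0) (le_max_right _ _) pos! (hW0 hx0).le
      calc u x ≤ C1 := h1
        _ = C1 * T ^ d * (‖x‖ ^ (-d) * (‖x‖ / T) ^ d) := by
          rw [div_rpow hx0.le hT.le, rpow_neg hx0.le]; field_simp
        _ ≤ _ := by gcongr
    · rintro M hM ⟨y, hy⟩
      have hy0 : 0 < ‖y‖ := lin!
      have hM0 := le_trans (div_nonneg (S.nonneg y lin!) (hV0 _ hy0).le) (hM ⟨y, hy⟩)
      obtain ⟨v, hv⟩ := named (W ‖y‖ * max 1 ((‖y‖ / T) ^ d))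
      have hv0 := hv ▸ hV0 _ hy0
      have hvW : W ‖y‖ ≤ v := by
        rw [hv]; exact le_mul_of_one_le_right (hW0 hy0).le (le_max_left _ _)
      simp only
      rw [← hv, div_le_iff₀ hv0]
      rcases le_total ‖y‖ 32 with h32 | h32
      · have h1 : u y ≤ C1 := (hu y lin!).trans (mul_le_of_le_one_right hC1.le
          (rpow_le_one_of_one_le_of_nonpos lin! lin!))
        have h2 := (rpow_anti hy0 h32).trans ((hWd hy0).trans hvW)
        calc u y ≤ C1 := h1
          _ = C1 * 32 ^ d * 32 ^ (-d) := by
            rw [mul_assoc, ← rpow_add num!, add_neg_cancel, rpow_zero, mul_one]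
          _ ≤ a * v := mul_le_mul ha2 h2 pos! ((pos! : 0 ≤ C1 * 32 ^ d).trans
            ha2)
          _ ≤ _ := by nlinarith
      have hG : ∀ x ∈ ball y (θ * ‖y‖), src N u x ≤
          CL * (2 ^ (2 * σ) * ‖y‖ ^ (-(2 * σ))) * (M * (2 ^ d * 2 ^ d * v)) := by
        intro x hx
        rw [mem_ball, dist_eq_norm] at hx
        have hd1 := norm_sub_norm_le x y
        have hd2 := norm_sub_norm_le y x
        rw [norm_sub_rev y x] at hd2
        have hx1 : ‖y‖ / 2 ≤ ‖x‖ := by nlinarith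
        have hx2 : ‖x‖ ≤ 2 * ‖y‖ := by nlinarith
        have hx0 : 0 < ‖x‖ := lin!
        refine (S.src_le lin!).trans ((hL x lin!).trans ?_)
        have h1 : ‖x‖ ^ (-(2 * σ)) ≤ 2 ^ (2 * σ) * ‖y‖ ^ (-(2 * σ)) := by
          have := rpow_anti (half_pos hy0) hx1 (lin! : -(2 * σ) ≤ 0)
          rwa [div_rpow hy0.le two_pos.le, rpow_neg two_pos.le, div_inv_eq_mul,
            mul_comm (‖y‖ ^ _)] at this
        have h2 := hM ⟨x, lin!⟩
        simp only at h2
        rw [div_le_iff₀ (hV0 _ hx0)] at h2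
        have h3 : max 1 ((‖x‖ / T) ^ d) ≤ 2 ^ d * max 1 ((‖y‖ / T) ^ d) := by
          refine max_le ?_ ?_
          · have : (1 : ℝ) ≤ 2 ^ d := one_le_rpow one_le_two hd.le
            nlinarith [le_max_left 1 ((‖y‖ / T) ^ d)]
          · calc (‖x‖ / T) ^ d ≤ (2 * (‖y‖ / T)) ^ d := by
                  refine rpow_le_rpow pos! ?_ hd.le
                  rw [← mul_div_assoc]; gcongr
              _ = 2 ^ d * (‖y‖ / T) ^ d := mul_rpow two_pos.le pos!
              _ ≤ _ := by gcongr; exact le_max_right _ _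
        have h4 : u x ≤ M * (2 ^ d * 2 ^ d * v) := by
          refine h2.trans (mul_le_l ?_ hM0)
          calc _ ≤ (2 ^ d * W ‖y‖) * (2 ^ d * max 1 ((‖y‖ / T) ^ d)) :=
                mul_le_mul (hW2 hy0 hx1) h3 pos!
                  (mul_nonneg pos! (hW0 hy0).le)
            _ = _ := by rw [hv]; ring
        have h5 := S.nonneg x lin!
        gcongr
      have h1 := S.pot_upper hy0 hθ lin! hG
      have h2 := S.rep_global (y := y) lin!
      have h3 := (abs_le.1 (hf y lin!)).2
      rw [← hI] at h1
      have e : CL * (2 ^ (2 * σ) * ‖y‖ ^ (-(2 * σ))) * (M * (2 ^ d * 2 ^ d * v)) *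
          ((θ * ‖y‖) ^ (2 * σ) * I) =
          (CL * 2 ^ (2 * σ) * 2 ^ d * 2 ^ d * I * θ ^ (2 * σ)) * (M * v) := by
        rw [mul_rpow hθ.le hy0.le, rpow_neg hy0.le]; field_simp
      rw [e] at h1
      have h4 : (CL * 2 ^ (2 * σ) * 2 ^ d * 2 ^ d * I * θ ^ (2 * σ)) * (M * v) ≤
          kap n d N / 2 * (M * v) := mul_le_r hθK
      have h5 : (θ / 2) ^ (-d) * SS d N u ‖y‖ ≤ (θ / 2) ^ (-d) * v := by
        gcongr; exact (hWS hy0).trans hvW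
      have h6 : Cf * ‖y‖ ^ (-d) ≤ Cf * v := by gcongr; exact (hWd hy0).trans hvW
      have h7 := mul_le_r ha1 hv0.le
      refine le_of_mul_le_mul_left ?_ hk
      rw [h2]
      linarith
  refine ⟨2 * a, by rw [ha]; positivity, fun x hx => ?_⟩
  have hx0 : 0 < ‖x‖ := lin!
  have := key ‖x‖ hx0 ⟨x, hx⟩
  rw [div_self hx0.ne', one_rpow, max_self, mul_one, div_le_iff₀ (hW0 hx0)] at this
  rwa [hW] at this

/-- If the source has finite mass the singularity at infinity is removable. -/
lemma removable_of_integrable (S : Sol σ d N α p c u) (h : Integrable (src N u)) :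
    ∃ C > 0, ∀ x, 16 ≤ ‖x‖ → u x ≤ C * ‖x‖ ^ (-d) := by
  obtain ⟨C, hC, hu⟩ := S.exists_u_le
  have hI : 0 ≤ ∫ x, src N u x := integral_nonneg S.src_nonneg
  refine ⟨C * ((∫ x, src N u x) + 1), pos!, fun x hx => (hu x hx).trans ?_⟩
  have hx0 : 0 < ‖x‖ := lin!
  have h1 : SS d N u ‖x‖ ≤ ‖x‖ ^ (-d) * ∫ x, src N u x := by
    rw [SS, ← integral_const_mul]
    refine integral_mono (S.SS_integrable hx0) (h.const_mul _) fun z => ?_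
    exact mul_le_r (rpow_anti hx0 (le_max_left _ _)
      (by linarith [S.par.d0])) (S.src_nonneg z)
  rw [mul_assoc]
  refine mul_le_l ?_
  linarith

lemma tendsto_AA (S : Sol σ d N α p c u) (h : ¬ Integrable (src N u)) :
    Tendsto (AA N u) atTop atTop := by
  have hmono : Monotone (AA N u) := fun a b hab =>
    setIntegral_mono_set (S.src_integrableOn b) (.of_forall S.src_nonneg)
      (ball_subset_ball hab).eventuallyLE
  refine (tendsto_atTop_of_monotone hmono).resolve_right ?_
  rintro ⟨l, hl⟩
  refine h ((aecover_ball tendsto_id).integrable_of_integral_bounded_of_nonneg_ae l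
    (fun R => S.src_integrableOn R) (.of_forall S.src_nonneg)
    (.of_forall fun R => hmono.ge_of_tendsto hl R))

end Sol

open Real

section euler
variable {n : ℕ}

/-- The divergence of `x ↦ G x • x`. -/
def Eul (G : E n → ℝ) (x : E n) : ℝ := fderiv ℝ G x x + n * G x

variable {G : E n → ℝ}

lemma Eul_continuous (hG : ContDiff ℝ 1 G) : Continuous (Eul G) :=
  ((hG.continuous_fderiv one_ne_zero).clm_apply continuous_id).add
    (continuous_const.mul hG.continuous)

lemma hasDerivAt_dilate (hG : ContDiff ℝ 1 G) (x : E n) (t : ℝ) :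
    HasDerivAt (fun s : ℝ => s ^ n * G (s • x))
      (n * t ^ (n - 1) * G (t • x) + t ^ n * fderiv ℝ G (t • x) x) t := by
  have h1 : HasDerivAt (fun s : ℝ => G (s • x)) (fderiv ℝ G (t • x) x) t := by
    have := ((hG.differentiable one_ne_zero) (t • x)).hasFDerivAt.comp_hasDerivAt t
      ((hasDerivAt_id t).smul_const x)
    simpa [Function.comp_def] using this
  exact (hasDerivAt_pow n t).mul h1

variable {r : ℝ}

lemma Eul_eq_zero (hr : ∀ x, r ≤ ‖x‖ → G x = 0) {x : E n} (hx : r < ‖x‖) : Eul G x = 0 := by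
  have h : G =ᶠ[𝓝 x] fun _ => 0 := by
    filter_upwards [(isOpen_lt continuous_const continuous_norm).mem_nhds hx] with y hy
    exact hr y (le_of_lt hy)
  simp [Eul, h.fderiv_eq, h.eq_of_nhds]

lemma exists_Eul_bound (hG : ContDiff ℝ 1 G)
    (hr : ∀ x, r ≤ ‖x‖ → G x = 0) : ∃ M > 0, ∀ x, |Eul G x| ≤ M := by
  obtain ⟨M, hM⟩ := (isCompact_closedBall (0 : E n) r).exists_bound_of_continuousOn
    (Eul_continuous hG).continuousOn
  refine ⟨max M 1, pos!, fun x => ?_⟩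
  by_cases hx : ‖x‖ ≤ r
  · exact (hM x (by simpa using hx)).trans (le_max_left _ _)
  · rw [Eul_eq_zero hr (not_le.1 hx), abs_zero]; positivity

lemma exists_dilate_bound (hG : ContDiff ℝ 1 G)
    (hr : ∀ x, r ≤ ‖x‖ → G x = 0) : ∃ M > 0, ∀ t ∈ Icc (1 : ℝ) 2, ∀ x,
    |t ^ n * G (t • x) - G x| ≤ (closedBall (0 : E n) r).indicator (fun _ => M) x * (t - 1) := by
  have hc : Continuous fun q : ℝ × E n =>
      n * q.1 ^ (n - 1) * G (q.1 • q.2) + q.1 ^ n * fderiv ℝ G (q.1 • q.2) q.2 := by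
    have h1 : Continuous fun q : ℝ × E n => q.1 • q.2 := continuous_fst.smul continuous_snd
    exact ((continuous_const.mul (continuous_fst.pow _)).mul
        (hG.continuous.comp h1)).add ((continuous_fst.pow _).mul
        (((hG.continuous_fderiv one_ne_zero).comp h1).clm_apply continuous_snd))
  obtain ⟨M, hM⟩ := (isCompact_Icc.prod (isCompact_closedBall (0 : E n) r)).exists_bound_of_continuousOn
    (s := Icc (1 : ℝ) 2 ×ˢ closedBall (0 : E n) r) hc.continuousOn
  refine ⟨max M 1, pos!, fun t ht x => ?_⟩
  by_cases hx : x ∈ closedBall (0 : E n) r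
  · rw [indicator_of_mem hx]
    have := (convex_Icc (1 : ℝ) 2).norm_image_sub_le_of_norm_hasDerivWithin_le
      (fun s _ => (hasDerivAt_dilate hG x s).hasDerivWithinAt)
      (fun s hs => (hM (s, x) ⟨hs, hx⟩).trans (le_max_left M 1))
      (left_mem_Icc.2 one_le_two) ht
    simpa [abs_of_nonneg (sub_nonneg.2 ht.1)] using this
  · rw [indicator_of_notMem hx]
    rw [mem_closedBall_zero_iff, not_le] at hx
    rw [hr x hx.le, hr (t • x), mul_zero, sub_zero, abs_zero, zero_mul]
    rw [norm_smul, norm_eq_abs, abs_of_pos (by linarith [ht.1])]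
    nlinarith [ht.1, norm_nonneg x]

lemma tendsto_dilate (hG : ContDiff ℝ 1 G)
    (hr : ∀ x, r ≤ ‖x‖ → G x = 0) {f : E n → ℝ} (hf : Measurable f) {M : ℝ} (hM : ∀ x, |f x| ≤ M) :
    Tendsto (fun τ : ℝ => ∫ x, f x * (τ⁻¹ * ((1 + τ) ^ n * G ((1 + τ) • x) - G x)))
      (𝓝[>] 0) (𝓝 (∫ x, f x * Eul G x)) := by
  obtain ⟨B, hB, hb⟩ := exists_dilate_bound hG hr
  have hu : ∀ᶠ τ : ℝ in 𝓝[>] 0, 0 < τ ∧ τ < 1 := Ioo_mem_nhdsGT one_pos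
  refine tendsto_integral_filter_of_dominated_convergence
    (fun x => M * (closedBall (0 : E n) r).indicator (fun _ => B) x) ?_ ?_ ?_ ?_
  · refine .of_forall fun τ => (hf.mul (measurable_const.mul ?_)).aestronglyMeasurable
    exact ((measurable_const.mul (hG.continuous.measurable.comp (measurable_const_smul _))).sub
      hG.continuous.measurable)
  · filter_upwards [hu] with τ hτ
    refine .of_forall fun x => ?_
    rw [norm_mul, norm_eq_abs, norm_mul, norm_eq_abs, norm_eq_abs]
    refine mul_le_mul (hM x) ?_ pos! ((abs_nonneg _).trans (hM x))
    have := hb (1 + τ) ⟨lin!, lin!⟩ x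
    rw [add_sub_cancel_left] at this
    rw [abs_inv, abs_of_pos hτ.1, inv_mul_le_iff₀ hτ.1, mul_comm τ]
    exact this
  · exact (((integrable_indicator_iff measurableSet_closedBall).2
      (integrableOn_const measure_closedBall_lt_top.ne)).const_mul M)
  · refine .of_forall fun x => Tendsto.const_mul _ ?_
    have h2 : Eul G x = n * 1 ^ (n - 1) * G ((1 : ℝ) • x) + 1 ^ n * fderiv ℝ G ((1 : ℝ) • x) x := by
      simp [Eul, add_comm]
    rw [h2]
    simpa using (hasDerivAt_iff_tendsto_slope_zero.1 (hasDerivAt_dilate hG x 1)).mono_left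
        (nhdsWithin_mono (t := {0}ᶜ) _ (s := Ioi (0 : ℝ))
      fun τ hτ => (mem_Ioi.1 hτ).ne')

lemma integrable_of_zero (hG : Continuous G) (hr : ∀ x, r < ‖x‖ → G x = 0) : Integrable G :=
  hG.integrable_of_hasCompactSupport
    (.of_support_subset_isCompact (isCompact_closedBall (0 : E n) r) fun x hx => by
      rw [mem_closedBall_zero_iff]; by_contra h; exact hx (hr x (not_le.1 h)))

lemma integral_dilate (hG : ContDiff ℝ 1 G)
    (hr : ∀ x, r ≤ ‖x‖ → G x = 0) {f : E n → ℝ} (hf : Measurable f) {M : ℝ} (hM : ∀ x, |f x| ≤ M) {τ : ℝ}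
    (hτ : 0 < τ) : ∫ x, f x * (τ⁻¹ * ((1 + τ) ^ n * G ((1 + τ) • x) - G x)) =
      ∫ x, τ⁻¹ * (f ((1 + τ)⁻¹ • x) - f x) * G x := by
  have hi := integrable_of_zero hG.continuous fun x hx => hr x hx.le
  have ht : 0 < 1 + τ := lin!
  have h1 := hi.bdd_mul hf.aestronglyMeasurable (.of_forall hM)
  have h2 : Integrable fun x => f ((1 + τ)⁻¹ • x) * G x :=
    hi.bdd_mul (hf.comp (measurable_const_smul _)).aestronglyMeasurable
      (.of_forall fun x => hM _)
  have h3 : Integrable fun x => (1 + τ) ^ n * (f x * G ((1 + τ) • x)) := by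
    have := (h2.comp_smul ht.ne').const_mul ((1 + τ) ^ n)
    simpa [smul_smul, inv_mul_cancel₀ ht.ne'] using this
  have h4 := integral_scale (fun x => f ((1 + τ)⁻¹ • x) * G x) ht
  simp only [smul_smul, inv_mul_cancel₀ ht.ne', one_smul, rpow_natCast] at h4
  have e1 : ∀ x : E n, f x * (τ⁻¹ * ((1 + τ) ^ n * G ((1 + τ) • x) - G x)) =
      τ⁻¹ * ((1 + τ) ^ n * (f x * G ((1 + τ) • x)) - f x * G x) := fun x => by ring
  have e2 : ∀ x : E n, τ⁻¹ * (f ((1 + τ)⁻¹ • x) - f x) * G x =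
      τ⁻¹ * (f ((1 + τ)⁻¹ • x) * G x - f x * G x) := fun x => by ring
  simp only [e1, e2]
  rw [integral_const_mul, integral_const_mul, integral_sub h3 h1, integral_sub h2 h1,
    integral_const_mul, ← h4]

lemma integral_Eul (hG : ContDiff ℝ 1 G)
    (hr : ∀ x, r ≤ ‖x‖ → G x = 0) : ∫ x, Eul G x = 0 := by
  have h := tendsto_dilate hG hr (f := fun _ => 1) measurable_const (M := 1) (by simp)
  simp only [one_mul] at h
  refine tendsto_nhds_unique h (tendsto_const_nhds.congr' ?_)
  filter_upwards [self_mem_nhdsWithin] with τ hτ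
  have := integral_dilate hG hr (f := fun _ => 1) measurable_const (M := 1) (by simp) hτ
  simp only [one_mul, sub_self, mul_zero, zero_mul, integral_zero] at this
  exact this.symm

lemma abs_integral_mul_Eul_le (hG : ContDiff ℝ 1 G)
    (hr : ∀ x, r ≤ ‖x‖ → G x = 0) {f b : E n → ℝ} (hf : Measurable f) {M : ℝ} (hM : ∀ x, |f x| ≤ M)
    (hb : Integrable fun x => b x * |G x|)
    (h : ∀ τ, 0 < τ → τ < 1 → ∀ x, G x ≠ 0 → |f ((1 + τ)⁻¹ • x) - f x| ≤ τ * b x) :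
    |∫ x, f x * Eul G x| ≤ ∫ x, b x * |G x| := by
  refine le_of_tendsto (tendsto_dilate hG hr hf hM).abs ?_
  filter_upwards [Ioo_mem_nhdsGT one_pos] with τ hτ
  rw [integral_dilate hG hr hf hM hτ.1, ← norm_eq_abs]
  refine norm_integral_le_of_norm_le hb (.of_forall fun x => ?_)
  by_cases hx : G x = 0
  · simp [hx]
  rw [norm_mul, norm_mul, norm_eq_abs, norm_eq_abs, norm_eq_abs, abs_inv,
    abs_of_pos hτ.1]
  refine mul_le_r ?_
  rw [inv_mul_le_iff₀ hτ.1]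
  exact h τ hτ.1 hτ.2 x hx

end euler

section cutoff

lemma exists_cutSlope_deriv_bound : ∃ M > 0, ∀ t, |deriv cutSlope t| ≤ M ∧ deriv cutSlope t ≤ 0 ∧
    (t < 1 ∨ 2 < t → deriv cutSlope t = 0) := by
  obtain ⟨M, hM⟩ := (isCompact_Icc (a := (1 : ℝ)) (b := 2)).exists_bound_of_continuousOn
    (cutSlope_contDiff.continuous_deriv num!).continuousOn
  have hz : ∀ t, (t < 1 ∨ 2 < t → deriv cutSlope t = 0) := by
    rintro t (h | h)
    · have : cutSlope =ᶠ[𝓝 t] fun _ => 1 := by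
        filter_upwards [Iio_mem_nhds h] with s hs using cutSlope_eq_one (le_of_lt hs)
      rw [this.deriv_eq, deriv_const]
    · have : cutSlope =ᶠ[𝓝 t] fun _ => 0 := by
        filter_upwards [Ioi_mem_nhds h] with s hs using cutSlope_eq_zero (le_of_lt hs)
      rw [this.deriv_eq, deriv_const]
  refine ⟨max M 1, pos!, fun t => ⟨?_, cutSlope_antitone.deriv_nonpos, hz t⟩⟩
  by_cases ht : t ∈ Icc (1 : ℝ) 2
  · exact (hM t ht).trans (le_max_left _ _)
  · rw [mem_Icc, not_and_or, not_le, not_le] at ht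
    rw [hz t ht, abs_zero]; positivity

lemma exists_cutSlope_sq_bound : ∃ C > 0, ∀ a b : ℝ, 0 ≤ a → 0 ≤ b →
    |cutSlope (a ^ 2) - cutSlope (b ^ 2)| * (a + b) ≤ C * |a - b| := by
  obtain ⟨M, hM0, hM⟩ := exists_cutSlope_deriv_bound
  have hL : ∀ s t, |cutSlope s - cutSlope t| ≤ M * |s - t| := fun s t =>
    convex_univ.norm_image_sub_le_of_norm_deriv_le (fun x _ =>
      (cutSlope_contDiff.differentiable num!) x) (fun x _ => (hM x).1)
      (mem_univ t) (mem_univ s)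
  refine ⟨64 * M + 3, pos!, ?_⟩
  have key : ∀ a b : ℝ, 0 ≤ b → b ≤ a →
      |cutSlope (a ^ 2) - cutSlope (b ^ 2)| * (a + b) ≤ (64 * M + 3) * |a - b| := by
    intro a b hb hab
    rw [abs_of_nonneg (sub_nonneg.2 hab)]
    by_cases h2 : 2 ≤ b
    · rw [cutSlope_eq_zero (by nlinarith), cutSlope_eq_zero (by nlinarith), sub_self, abs_zero,
        zero_mul]
      exact mul_nonneg pos! (sub_nonneg.2 hab)
    by_cases h4 : a ≤ 4
    · have h := hL (a ^ 2) (b ^ 2)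
      rw [abs_of_nonneg (by nlinarith : 0 ≤ a ^ 2 - b ^ 2)] at h
      calc _ ≤ M * (a ^ 2 - b ^ 2) * (a + b) := mul_le_r h lin!
        _ = M * (a - b) * (a + b) ^ 2 := by ring
        _ ≤ M * (a - b) * 64 := by
          refine mul_le_l (by nlinarith) (mul_nonneg hM0.le lin!)
        _ ≤ _ := by nlinarith
    · have h1 : |cutSlope (a ^ 2) - cutSlope (b ^ 2)| ≤ 1 := by
        rw [abs_le]
        have := cutSlope_nonneg (a ^ 2); have := cutSlope_nonneg (b ^ 2)
        have := cutSlope_le_one (a ^ 2); have := cutSlope_le_one (b ^ 2)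
        constructor <;> linarith
      calc _ ≤ 1 * (a + b) := mul_le_r h1 lin!
        _ ≤ 3 * (a - b) := lin!
        _ ≤ _ := mul_le_r lin! lin!
  intro a b ha hb
  rcases le_total b a with h | h
  · exact key a b hb h
  · rw [abs_sub_comm, abs_sub_comm a b, add_comm a b]
    exact key b a ha h

variable {n : ℕ}

/-- A smooth radial step, `0` for `‖x‖ ≤ R` and `1` for `2 * R ≤ ‖x‖`. -/
def chi (R : ℝ) (x : E n) : ℝ := 1 - cutSlope ((‖x‖ / R) ^ 2)

/-- The radial derivative `x · ∇ chi`. -/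
def dchi (R : ℝ) (x : E n) : ℝ := -(2 * (‖x‖ / R) ^ 2 * deriv cutSlope ((‖x‖ / R) ^ 2))

variable {R : ℝ}

lemma chi_contDiff : ContDiff ℝ 1 (chi R : E n → ℝ) := by
  have h : ContDiff ℝ 1 fun x : E n => (‖x‖ / R) ^ 2 := by
    simp only [div_pow]
    exact (contDiff_norm_sq ℝ).div_const _
  exact contDiff_const.sub ((cutSlope_contDiff.of_le num!).comp h)

lemma fderiv_chi (hR : 0 < R) (x : E n) : fderiv ℝ (chi R) x x = dchi R x := by
  have h : HasFDerivAt (fun x : E n => (‖x‖ / R) ^ 2)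
      ((R ^ 2)⁻¹ • ((2 : ℕ) • (innerSL ℝ x))) x := by
    simp only [div_pow]
    simp only [div_eq_inv_mul]
    simpa using ((hasStrictFDerivAt_norm_sq x).hasFDerivAt).const_mul ((R ^ 2)⁻¹)
  have h2 := (((cutSlope_contDiff.differentiable num!) ((‖x‖ / R) ^ 2)).hasDerivAt
    |>.comp_hasFDerivAt x h).const_sub 1
  have h3 : HasFDerivAt (chi R) _ x := h2
  rw [h3.fderiv, dchi]
  simp only [neg_apply, smul_apply, innerSL_apply_apply, real_inner_self_eq_norm_sq, smul_eq_mul,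
    nsmul_eq_mul, Nat.cast_ofNat]
  field_simp

lemma chi_zero (hR : 0 < R) {x : E n} (h : ‖x‖ ≤ R) : chi R x = 0 := by
  rw [chi, cutSlope_eq_one, sub_self]
  exact pow_le_one₀ pos! ((div_le_one hR).2 h)

lemma chi_one (hR : 0 < R) {x : E n} (h : 2 * R ≤ ‖x‖) : chi R x = 1 := by
  have : 2 ≤ ‖x‖ / R := (le_div_iff₀ hR).2 h
  rw [chi, cutSlope_eq_zero, sub_zero]
  nlinarith

lemma chi_nonneg (R : ℝ) (x : E n) : 0 ≤ chi R x := sub_nonneg.2 (cutSlope_le_one _)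
lemma chi_le_one (R : ℝ) (x : E n) : chi R x ≤ 1 := by
  have := cutSlope_nonneg ((‖x‖ / R) ^ 2); unfold chi; linarith

lemma chi_mono (hR : 0 < R) {x y : E n} (h : ‖x‖ ≤ ‖y‖) : chi R x ≤ chi R y :=
  sub_le_sub_left (cutSlope_antitone (pow_le_pow_left₀ pos!
    (div_le_div_of_nonneg_right h hR.le) 2)) 1

lemma dchi_zero (hR : 0 < R) {x : E n} (h : ‖x‖ < R ∨ 2 * R < ‖x‖) : dchi R x = 0 := by
  obtain ⟨M, _, hM⟩ := exists_cutSlope_deriv_bound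
  rw [dchi, (hM _).2.2, mul_zero, neg_zero]
  rcases h with h | h
  · exact Or.inl (pow_lt_one₀ pos! ((div_lt_one hR).2 h) two_ne_zero)
  · have : 2 < ‖x‖ / R := (lt_div_iff₀ hR).2 h
    right; nlinarith

end cutoff

lemma exists_dchi_bound {n : ℕ} : ∃ C > 0, ∀ R, 0 < R → ∀ x : E n, 0 ≤ dchi R x ∧ dchi R x ≤ C := by
  obtain ⟨M, hM0, hM⟩ := exists_cutSlope_deriv_bound
  refine ⟨8 * M, pos!, fun R hR x => ⟨?_, ?_⟩⟩
  · have := mul_nonneg (sq_nonneg (‖x‖ / R)) (neg_nonneg.2 (hM ((‖x‖ / R) ^ 2)).2.1)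
    unfold dchi; nlinarith
  · by_cases h : ‖x‖ ≤ 2 * R
    · have h1 : (‖x‖ / R) ^ 2 ≤ 4 := by
        have h2 := (div_le_iff₀ hR).2 h
        have : 0 ≤ ‖x‖ / R := pos!
        nlinarith
      have h3 := neg_le_of_abs_le (hM ((‖x‖ / R) ^ 2)).1
      unfold dchi
      nlinarith [sq_nonneg (‖x‖ / R)]
    · rw [dchi_zero hR (Or.inr (not_le.1 h))]; positivity

open Real

section kernel
variable {n : ℕ} {d : ℝ}

/-- The symmetric kernel produced by the Pohozaev identity with weight `chi R`. -/
def JK (d R : ℝ) (z : E n × E n) : ℝ :=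
  (chi R z.1 - chi R z.2) * (‖z.1‖ ^ 2 - ‖z.2‖ ^ 2) * ‖z.1 - z.2‖ ^ (-d - 2)

lemma JK_swap (d R : ℝ) (z : E n × E n) : JK d R z.swap = JK d R z := by
  simp only [JK, Prod.fst_swap, Prod.snd_swap]
  rw [norm_sub_rev]; ring

lemma chi_measurable {R : ℝ} : Measurable (chi R : E n → ℝ) :=
  chi_contDiff.continuous.measurable

lemma JK_measurable (d R : ℝ) : Measurable (JK d R : E n × E n → ℝ) := by
  unfold JK
  exact (((chi_measurable.comp measurable_fst).sub
      (chi_measurable.comp measurable_snd)).mul ((measurable_fst.norm.pow_const 2).sub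
      (measurable_snd.norm.pow_const 2))).mul
    ((measurable_fst.sub measurable_snd).norm.pow_const _)

lemma JK_nonneg {R : ℝ} (hR : 0 < R) (z : E n × E n) : 0 ≤ JK d R z := by
  refine mul_nonneg ?_ pos!
  rcases le_total ‖z.1‖ ‖z.2‖ with h | h
  · exact mul_nonneg_of_nonpos_of_nonpos (sub_nonpos.2 (chi_mono hR h))
      (sub_nonpos.2 (pow_le_pow_left₀ (norm_nonneg _) h 2))
  · exact mul_nonneg (sub_nonneg.2 (chi_mono hR h))
      (sub_nonneg.2 (pow_le_pow_left₀ (norm_nonneg _) h 2))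

lemma exists_JK_le : ∃ C > 0, ∀ R, 0 < R → ∀ z : E n × E n, JK d R z ≤ C * Gam d (z.1 - z.2) := by
  obtain ⟨C, hC, h⟩ := exists_cutSlope_sq_bound
  refine ⟨C, hC, fun R hR z => ?_⟩
  by_cases hz : z.1 = z.2
  · have : JK d R z = 0 := by simp [JK, hz]
    rw [this]; exact mul_nonneg hC.le (Gam_nonneg _)
  have h1 := h (‖z.1‖ / R) (‖z.2‖ / R) pos! pos!
  have h2 : |chi R z.1 - chi R z.2| * (‖z.1‖ + ‖z.2‖) ≤ C * |‖z.1‖ - ‖z.2‖| := by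
    rw [← sub_div, ← add_div, abs_div, abs_of_pos hR, ← mul_div_assoc, ← mul_div_assoc,
      div_le_div_iff_of_pos_right hR, abs_sub_comm] at h1
    refine le_trans (le_of_eq ?_) h1
    unfold chi
    congr 2; ring
  have h3 := abs_norm_sub_norm_le z.1 z.2
  have h4 : (chi R z.1 - chi R z.2) * (‖z.1‖ ^ 2 - ‖z.2‖ ^ 2) ≤ C * ‖z.1 - z.2‖ ^ 2 := by
    calc _ ≤ |(chi R z.1 - chi R z.2) * (‖z.1‖ ^ 2 - ‖z.2‖ ^ 2)| := le_abs_self _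
      _ = |chi R z.1 - chi R z.2| * (‖z.1‖ + ‖z.2‖) * |‖z.1‖ - ‖z.2‖| := by
        rw [sq_sub_sq, abs_mul, abs_mul, abs_of_nonneg (pos! : 0 ≤ ‖z.1‖ + ‖z.2‖)]; ring
      _ ≤ C * |‖z.1‖ - ‖z.2‖| * |‖z.1‖ - ‖z.2‖| :=
        mul_le_r h2
      _ ≤ C * ‖z.1 - z.2‖ * ‖z.1 - z.2‖ := by gcongr
      _ = _ := by ring
  calc _ ≤ C * ‖z.1 - z.2‖ ^ 2 * ‖z.1 - z.2‖ ^ (-d - 2) :=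
        mul_le_r h4
    _ = _ := by
      rw [Gam, mul_assoc, ← rpow_natCast, ← rpow_add (norm_pos_iff.2 (sub_ne_zero.2 hz))]
      congr 2; push_cast; ring

lemma JK_eq_zero {R : ℝ} (hR : 0 < R) {z : E n × E n}
    (h : (‖z.1‖ ≤ R ∧ ‖z.2‖ ≤ R) ∨ (2 * R ≤ ‖z.1‖ ∧ 2 * R ≤ ‖z.2‖)) : JK d R z = 0 := by
  rcases h with h | h
  · rw [JK, chi_zero hR h.1, chi_zero hR h.2]; simp
  · rw [JK, chi_one hR h.1, chi_one hR h.2]; simp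

lemma ae_fst_ne_snd (hn : 1 ≤ n) : ∀ᵐ z : E n × E n, z.1 ≠ z.2 := by
  have : Nontrivial (E n) := by
    have : Nonempty (Fin n) := ⟨⟨0, hn⟩⟩
    infer_instance
  rw [ae_iff]
  simp only [not_not]
  rw [Measure.volume_eq_prod, Measure.measure_prod_null
    (measurableSet_eq_fun measurable_fst measurable_snd)]
  refine .of_forall fun x => ?_
  have : Prod.mk x ⁻¹' {z : E n × E n | z.1 = z.2} = {x} := by
    ext y; simp [eq_comm]
  simp only [this, measure_singleton]; rfl

end kernel

namespace Sol
variable {n : ℕ} {σ d N α p c : ℝ} {u : E n → ℝ}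

lemma pot_measurable (S : Sol σ d N α p c u) : Measurable (pot d N u) := by
  have : StronglyMeasurable (Function.uncurry fun (y x : E n) => Gam d (x - y) * src N u x) :=
    ((Gam_measurable.comp (measurable_snd.sub measurable_fst)).mul
      (S.src_measurable.comp measurable_snd)).stronglyMeasurable
  exact this.integral_prod_right.measurable

lemma exists_pot_le (S : Sol σ d N α p c u) : ∃ C > 0, ∀ x, 8 ≤ ‖x‖ → pot d N u x ≤ C := by
  have P := S.par
  have hk := kap_pos P
  obtain ⟨C1, hC1, h1⟩ := S.upper_bound
  obtain ⟨C2, hC2, h2⟩ := S.exists_far_le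
  refine ⟨kap n d N * C1 + C2, pos!, fun x hx => ?_⟩
  have h3 := S.rep_global (y := x) lin!
  have h4 := neg_le_of_abs_le (h2 x hx)
  have h5 := mul_le_l (h1 x hx) hk.le
  have h6 : ‖x‖ ^ (-((2 * σ + α) / (p - 1))) ≤ 1 :=
    rpow_le_one_of_one_le_of_nonpos lin! (by linarith [S.beta_pos])
  have h7 : ‖x‖ ^ (-d) ≤ 1 :=
    rpow_le_one_of_one_le_of_nonpos lin! (by linarith [P.d0])
  have h8 := mul_le_l h7 hC2.le
  have h9 := mul_le_l h6 (mul_pos hk hC1).le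
  nlinarith

lemma integrable_mul_pot (S : Sol σ d N α p c u) {φ : E n → ℝ} (hφ : Measurable φ) {M r : ℝ}
    (hM : ∀ x, |φ x| ≤ M) (h8 : ∀ x, ‖x‖ < 8 → φ x = 0) (hr : ∀ x, r < ‖x‖ → φ x = 0) :
    Integrable fun x => φ x * pot d N u x := by
  obtain ⟨C, hC, h⟩ := S.exists_pot_le
  have hi : Integrable ((closedBall (0 : E n) r).indicator fun _ => M * C) :=
    (integrable_indicator_iff measurableSet_closedBall).2
      (integrableOn_const measure_closedBall_lt_top.ne)
  refine hi.mono' (hφ.mul S.pot_measurable).aestronglyMeasurable (.of_forall fun x => ?_)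
  have hM0 := (abs_nonneg _).trans (hM x)
  by_cases h1 : ‖x‖ < 8
  · rw [h8 x h1, zero_mul, norm_zero]
    exact indicator_nonneg (fun _ _ => pos!) _
  by_cases h2 : r < ‖x‖
  · rw [hr x h2, zero_mul, norm_zero]
    exact indicator_nonneg (fun _ _ => pos!) _
  rw [indicator_of_mem (by simpa using h2), norm_mul, norm_eq_abs, norm_eq_abs,
    abs_of_nonneg (S.pot_nonneg x)]
  exact mul_le_mul (hM x) (h x (not_lt.1 h1)) (S.pot_nonneg x) hM0

lemma prod_pot (S : Sol σ d N α p c u) {φ : E n → ℝ} (hφ : Measurable φ) {M r : ℝ}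
    (hM : ∀ x, |φ x| ≤ M) (h8 : ∀ x, ‖x‖ < 8 → φ x = 0) (hr : ∀ x, r < ‖x‖ → φ x = 0) :
    Integrable (fun z : E n × E n => φ z.1 * (Gam d (z.1 - z.2) * src N u z.2)) ∧
    ∫ z : E n × E n, φ z.1 * (Gam d (z.1 - z.2) * src N u z.2) = ∫ x, φ x * pot d N u x := by
  have e : ∀ x : E n, pot d N u x = ∫ y, Gam d (x - y) * src N u y := fun x => by
    simp only [pot, Gam_sub_comm x]
  have hi : ∀ x : E n, Integrable fun y => Gam d (x - y) * src N u y := fun x => by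
    simpa only [Gam_sub_comm x] using S.Gam_mul_src_integrable x
  have hm : Measurable fun z : E n × E n => φ z.1 * (Gam d (z.1 - z.2) * src N u z.2) :=
    (hφ.comp measurable_fst).mul ((Gam_measurable.comp (measurable_fst.sub measurable_snd)).mul
      (S.src_measurable.comp measurable_snd))
  have h1 : Integrable (fun z : E n × E n => φ z.1 * (Gam d (z.1 - z.2) * src N u z.2)) := by
    rw [Measure.volume_eq_prod, integrable_prod_iff hm.aestronglyMeasurable]
    refine ⟨.of_forall fun x => Integrable.const_mul (hi x) (φ x), ?_⟩
    refine (S.integrable_mul_pot hφ hM h8 hr).norm.congr (.of_forall fun x => ?_)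
    simp only [norm_mul]
    rw [integral_const_mul, e x, norm_of_nonneg (integral_nonneg fun y =>
      mul_nonneg (Gam_nonneg _) (S.src_nonneg y))]
    congr 1
    refine integral_congr_ae (.of_forall fun y => ?_)
    simp only [norm_of_nonneg (Gam_nonneg _), norm_of_nonneg (S.src_nonneg y)]
  refine ⟨h1, ?_⟩
  rw [Measure.volume_eq_prod] at h1 ⊢
  rw [integral_prod _ h1]
  simp only [integral_const_mul, e]

/-- The part of `src` on the annulus `R / 2 ≤ ‖x‖ < 2 * R`. -/
def ann (N : ℝ) (u : E n → ℝ) (R : ℝ) : E n → ℝ :=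
  (ball (0 : E n) (2 * R) \ ball 0 (R / 2)).indicator (src N u)

/-- The energy defect integral. -/
def JJ (d N : ℝ) (u : E n → ℝ) (R : ℝ) : ℝ :=
  ∫ z : E n × E n, JK d R z * (src N u z.1 * src N u z.2)

lemma ann_pot (S : Sol σ d N α p c u) {R : ℝ} (hR : 16 ≤ R) :
    Integrable (fun x => ann N u R x * pot d N u x) ∧
    Integrable (fun z : E n × E n => ann N u R z.1 * (Gam d (z.1 - z.2) * src N u z.2)) ∧
    ∫ z : E n × E n, ann N u R z.1 * (Gam d (z.1 - z.2) * src N u z.2) =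
      ∫ x, ann N u R x * pot d N u x := by
  obtain ⟨M, hM, hb⟩ := S.src_bdd
  have h0 : Measurable (ann N u R) :=
    S.src_measurable.indicator (measurableSet_ball.diff measurableSet_ball)
  have h1 : ∀ x, |ann N u R x| ≤ M := fun x => by
    by_cases hx : x ∈ ball (0 : E n) (2 * R) \ ball 0 (R / 2)
    · rw [ann, indicator_of_mem hx, abs_of_nonneg (S.src_nonneg x)]; exact hb x
    · rw [ann, indicator_of_notMem hx, abs_zero]; exact hM.le
  have h2 : ∀ x : E n, ‖x‖ < 8 → ann N u R x = 0 := fun x hx =>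
    indicator_of_notMem (fun h => h.2 (mem_ball_zero_iff.2 lin!)) _
  have h3 : ∀ x : E n, 2 * R < ‖x‖ → ann N u R x = 0 := fun x hx =>
    indicator_of_notMem (fun h => by have := mem_ball_zero_iff.1 h.1; linarith) _
  exact ⟨S.integrable_mul_pot h0 h1 h2 h3, S.prod_pot h0 h1 h2 h3⟩

lemma exists_JJ_le (S : Sol σ d N α p c u) : ∃ C > 0, ∀ R, 16 ≤ R →
    Integrable (fun z : E n × E n => JK d R z * (src N u z.1 * src N u z.2)) ∧
    JJ d N u R ≤ C * ((∫ x, ann N u R x * pot d N u x) + AA N u (R / 2) * BB d N u R) := by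
  have hd := S.par.d0
  obtain ⟨C, hC, hJ⟩ := exists_JK_le (n := n) (d := d)
  refine ⟨2 * (C * 2 ^ d), pos!, fun R hR => ?_⟩
  have hR0 : 0 < R := lin!
  obtain ⟨-, m1, m2⟩ := S.ann_pot hR
  obtain ⟨f, hf⟩ := named ((ball (0 : E n) (R / 2)).indicator (src N u) : E n → ℝ)
  obtain ⟨g, hg⟩ := named ((ball (0 : E n) R)ᶜ.indicator
    (fun x => ‖x‖ ^ (-d) * src N u x) : E n → ℝ)
  have hfi : Integrable f := by
    rw [hf]; exact (integrable_indicator_iff measurableSet_ball).2 (S.src_integrableOn _)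
  have hgi : Integrable g := by
    rw [hg]
    exact (integrable_indicator_iff measurableSet_ball.compl).2 (S.src_tail_integrable hR0)
  have hfA : ∫ x, f x = AA N u (R / 2) := by rw [hf, integral_indicator measurableSet_ball]; rfl
  have hgB : ∫ x, g x = BB d N u R := by rw [hg, integral_indicator measurableSet_ball.compl]; rfl
  have hfg := hfi.mul_prod hgi
  have hfg2 : ∫ z : E n × E n, f z.1 * g z.2 = AA N u (R / 2) * BB d N u R := by
    rw [Measure.volume_eq_prod, integral_prod_mul, hfA, hgB]
  obtain ⟨m, hm⟩ := named fun (z : E n × E n) =>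
    ann N u R z.1 * (Gam d (z.1 - z.2) * src N u z.2) + f z.1 * g z.2
  have hmi : Integrable m := by rw [hm]; exact m1.add hfg
  have hmv : ∫ z, m z = (∫ x, ann N u R x * pot d N u x) + AA N u (R / 2) * BB d N u R := by
    rw [hm, integral_add m1 hfg, m2, hfg2]
  have hf0 : ∀ x, 0 ≤ f x := fun x => by
    rw [hf]; exact indicator_nonneg (fun x _ => S.src_nonneg x) x
  have hg0 : ∀ x, 0 ≤ g x := fun x => by
    rw [hg]; exact indicator_nonneg (fun x _ => mul_nonneg pos! (S.src_nonneg x)) x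
  have hm0 : ∀ z, 0 ≤ m z := fun z => by
    rw [hm]
    exact add_nonneg (mul_nonneg (indicator_nonneg (fun x _ => S.src_nonneg x) _)
      (mul_nonneg (Gam_nonneg _) (S.src_nonneg _))) (mul_nonneg (hf0 _) (hg0 _))
  have two := one_le_rpow one_le_two hd.le
  have key : ∀ z : E n × E n, ‖z.1‖ ≤ ‖z.2‖ →
      JK d R z * (src N u z.1 * src N u z.2) ≤ C * 2 ^ d * m z := by
    intro z hz
    have hgg := mul_nonneg (S.src_nonneg z.1) (S.src_nonneg z.2)
    have hr0 : 0 ≤ C * 2 ^ d * m z := mul_nonneg pos! (hm0 z)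
    by_cases h1 : 2 * R ≤ ‖z.1‖
    · rwa [JK_eq_zero hR0 (Or.inr ⟨h1, h1.trans hz⟩), zero_mul]
    by_cases h2 : ‖z.2‖ ≤ R
    · rwa [JK_eq_zero hR0 (Or.inl ⟨hz.trans h2, h2⟩), zero_mul]
    rw [not_le] at h1 h2
    refine (mul_le_r (hJ R hR0 z) hgg).trans ?_
    by_cases h4 : ‖z.1‖ < R / 2
    · have e1 : f z.1 = src N u z.1 := by
        rw [hf]; exact indicator_of_mem (mem_ball_zero_iff.2 h4) _
      have e2 : g z.2 = ‖z.2‖ ^ (-d) * src N u z.2 := by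
        rw [hg]
        exact indicator_of_mem (by rw [mem_compl_iff, mem_ball_zero_iff, not_lt]; exact h2.le) _
      have e3 : src N u z.1 * (‖z.2‖ ^ (-d) * src N u z.2) ≤ m z := by
        rw [hm, ← e2, ← e1]
        exact le_add_of_nonneg_left (mul_nonneg (indicator_nonneg (fun x _ => S.src_nonneg x) _)
          (mul_nonneg (Gam_nonneg _) (S.src_nonneg _)))
      have e4 : Gam d (z.1 - z.2) ≤ 2 ^ d * ‖z.2‖ ^ (-d) := by
        have h5 : ‖z.2‖ / 2 ≤ ‖z.1 - z.2‖ := by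
          have := norm_sub_norm_le z.2 z.1
          rw [norm_sub_rev] at this; linarith
        have := rpow_anti (half_pos (hR0.trans h2)) h5 (neg_nonpos.2 hd.le)
        rwa [div_rpow (norm_nonneg _) two_pos.le, rpow_neg two_pos.le, div_inv_eq_mul,
          mul_comm] at this
      calc _ ≤ C * (2 ^ d * ‖z.2‖ ^ (-d)) * (src N u z.1 * src N u z.2) := by gcongr
        _ = C * 2 ^ d * (src N u z.1 * (‖z.2‖ ^ (-d) * src N u z.2)) := by ring
        _ ≤ _ := by gcongr
    · have e1 : ann N u R z.1 = src N u z.1 :=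
        indicator_of_mem (show z.1 ∈ ball (0 : E n) (2 * R) \ ball 0 (R / 2) from
          ⟨mem_ball_zero_iff.2 h1, fun h => h4 (mem_ball_zero_iff.1 h)⟩) _
      have e3 : src N u z.1 * (Gam d (z.1 - z.2) * src N u z.2) ≤ m z := by
        rw [hm, ← e1]
        exact le_add_of_nonneg_right (mul_nonneg (hf0 _) (hg0 _))
      calc _ = C * 1 * (src N u z.1 * (Gam d (z.1 - z.2) * src N u z.2)) := by ring
        _ ≤ C * 2 ^ d * m z := mul_le_mul (by gcongr) e3 (mul_nonneg (S.src_nonneg _)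
          (mul_nonneg (Gam_nonneg _) (S.src_nonneg _))) pos!
  have hmi2 : Integrable fun z : E n × E n => m z.swap := hmi.swap
  have hmv2 : ∫ z : E n × E n, m z.swap = ∫ z, m z := by
    rw [Measure.volume_eq_prod]; exact integral_prod_swap m
  have key2 : ∀ z : E n × E n, JK d R z * (src N u z.1 * src N u z.2) ≤
      C * 2 ^ d * (m z + m z.swap) := by
    intro z
    rcases le_total ‖z.1‖ ‖z.2‖ with h | h
    · refine (key z h).trans (mul_le_l ?_)
      linarith [hm0 z.swap]
    · have := key z.swap h
      rw [JK_swap, mul_comm (src N u z.swap.1)] at this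
      refine this.trans (mul_le_l ?_)
      linarith [hm0 z]
  have hb : Integrable fun z : E n × E n => C * 2 ^ d * (m z + m z.swap) :=
    (hmi.add hmi2).const_mul _
  have hi : Integrable (fun z : E n × E n => JK d R z * (src N u z.1 * src N u z.2)) := by
    refine hb.mono' ((JK_measurable d R).mul ((S.src_measurable.comp measurable_fst).mul
      (S.src_measurable.comp measurable_snd))).aestronglyMeasurable (.of_forall fun z => ?_)
    rw [norm_of_nonneg (mul_nonneg (JK_nonneg hR0 z) (mul_nonneg (S.src_nonneg _)
      (S.src_nonneg _)))]
    exact key2 z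
  refine ⟨hi, (integral_mono hi hb key2).trans (le_of_eq ?_)⟩
  rw [integral_const_mul, integral_add hmi hmi2, hmv2, hmv]
  ring

lemma JJ_nonneg (S : Sol σ d N α p c u) {R : ℝ} (hR : 0 < R) : 0 ≤ JJ d N u R :=
  integral_nonneg fun z => mul_nonneg (JK_nonneg hR z) (mul_nonneg (S.src_nonneg _) (S.src_nonneg _))

end Sol

open Real

section regularization
variable {n : ℕ} {d : ℝ}

lemma reg_le {w ε a : ℝ} (hw : 0 < w) (ha : a ≤ 0) : (w ^ 2 + ε ^ 2) ^ a ≤ w ^ (2 * a) := by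
  rw [rpow_mul hw.le, rpow_two]
  exact rpow_anti pos! (by nlinarith [sq_nonneg ε]) ha

lemma reg_tendsto {w a : ℝ} (hw : 0 < w) :
    Tendsto (fun ε : ℝ => (w ^ 2 + ε ^ 2) ^ a) (𝓝[>] 0) (𝓝 (w ^ (2 * a))) := by
  rw [rpow_mul hw.le, rpow_two]
  have h : ContinuousAt (fun ε : ℝ => (w ^ 2 + ε ^ 2) ^ a) 0 :=
    ContinuousAt.rpow_const (by fun_prop) (Or.inl pos!)
  have := h.tendsto.mono_left (nhdsWithin_le_nhds (s := Ioi 0))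
  simpa using this

/-- The smoothed fundamental solution and its gradient factor. -/
def rg (ε a : ℝ) (x : E n) : ℝ := (‖x‖ ^ 2 + ε ^ 2) ^ a

lemma rg_nonneg (ε a : ℝ) (x : E n) : 0 ≤ rg ε a x := by unfold rg; positivity

lemma rg_measurable (ε a : ℝ) : Measurable (rg ε a : E n → ℝ) :=
  ((measurable_norm.pow_const 2).add_const _).pow_const _

lemma rg_contDiff {ε : ℝ} (hε : 0 < ε) (a : ℝ) : ContDiff ℝ 1 (rg ε a : E n → ℝ) :=
  ((contDiff_norm_sq ℝ).add contDiff_const).rpow_const_of_ne fun x => pos!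

lemma rg_hasFDerivAt {ε : ℝ} (hε : 0 < ε) (a : ℝ) (x y : E n) :
    fderiv ℝ (fun z : E n => rg ε a (z - y)) x x =
      2 * a * (inner ℝ (x - y) x * rg ε (a - 1) (x - y)) := by
  have h1 : HasFDerivAt (fun z : E n => ‖z - y‖ ^ 2 + ε ^ 2) ((2 : ℕ) • innerSL ℝ (x - y)) x := by
    have := (hasStrictFDerivAt_norm_sq (x - y)).hasFDerivAt.comp x
      ((hasFDerivAt_id x).sub_const y)
    simpa [Function.comp_def] using this.add_const (ε ^ 2)
  have h2 := h1.rpow_const (p := a) (Or.inl pos!)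
  have h3 : HasFDerivAt (fun z : E n => rg ε a (z - y)) _ x := h2
  rw [h3.fderiv]
  simp only [smul_apply, innerSL_apply_apply, smul_eq_mul, nsmul_eq_mul, rg]
  push_cast; ring

lemma rg_mul_Eul {ε : ℝ} (hε : 0 < ε) (a : ℝ) {G : E n → ℝ} (hG : ContDiff ℝ 1 G) (x y : E n) :
    Eul (fun z => rg ε a (z - y) * G z) x = rg ε a (x - y) * Eul G x +
      2 * a * (G x * (inner ℝ (x - y) x * rg ε (a - 1) (x - y))) := by
  have h1 : DifferentiableAt ℝ (fun z : E n => rg ε a (z - y)) x :=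
    (((rg_contDiff hε a).comp (contDiff_id.sub contDiff_const)).differentiable one_ne_zero) x
  rw [Eul, fderiv_fun_mul h1 ((hG.differentiable one_ne_zero) x), Eul]
  simp only [add_apply, smul_apply, smul_eq_mul]
  rw [rg_hasFDerivAt hε]
  ring

end regularization

namespace Sol
variable {n : ℕ} {σ d N α p c : ℝ} {u : E n → ℝ}

lemma chi_sub (x : E n) {R₁ R₂ : ℝ} (h1 : 0 < R₁) (h2 : R₁ ≤ R₂) :
    (0 ≤ chi R₁ x - chi R₂ x ∧ chi R₁ x - chi R₂ x ≤ 1) ∧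
    (‖x‖ ≤ R₁ → chi R₁ x - chi R₂ x = 0) ∧ (2 * R₂ ≤ ‖x‖ → chi R₁ x - chi R₂ x = 0) := by
  have a2 := chi_le_one R₁ x
  have a3 := chi_nonneg R₂ x
  have a4 : (chi R₂ x : ℝ) ≤ chi R₁ x := sub_le_sub_left (cutSlope_antitone
    (pow_le_pow_left₀ (div_nonneg (norm_nonneg x) (h1.trans_le h2).le) (div_le_div_of_nonneg_left (norm_nonneg x) h1 h2) 2)) 1
  have hR2 := h1.trans_le h2
  refine ⟨⟨lin!, lin!⟩, fun h => ?_, fun h => ?_⟩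
  · rw [chi_zero h1 h, chi_zero hR2 (h.trans h2), sub_self]
  · rw [chi_one h1 lin!, chi_one hR2 h, sub_self]

lemma integral_pot_Eul (S : Sol σ d N α p c u) {R₁ R₂ : ℝ} (h1 : 16 ≤ R₁) (h2 : R₁ ≤ R₂)
    (hG : ContDiff ℝ 1 fun x => (chi R₁ x - chi R₂ x) * src N u x) :
    ∫ x, Eul (fun x => (chi R₁ x - chi R₂ x) * src N u x) x * pot d N u x =
      d / 2 * (∫ x, (chi R₁ x - chi R₂ x) * src N u x * pot d N u x) +
      d / 4 * (JJ d N u R₁ - JJ d N u R₂) := by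
  have P := S.par
  have hd := P.d0
  have hR1 : 0 < R₁ := lin!
  have hR2 : 0 < R₂ := lin!
  obtain ⟨ζ, hζ⟩ := named fun (x : E n) => chi R₁ x - chi R₂ x
  have hζx : ∀ x, chi R₁ x - chi R₂ x = ζ x := fun x => by rw [hζ]
  have hζm : Measurable ζ := by rw [hζ]; exact chi_measurable.sub chi_measurable
  simp only [hζx] at hG ⊢
  obtain ⟨G, hGd⟩ := named fun (x : E n) => ζ x * src N u x
  have hGx : ∀ x, ζ x * src N u x = G x := fun x => by rw [hGd]
  rw [← hGd] at hG ⊢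
  simp only [hGx]
  obtain ⟨M0, hM0, hb⟩ := S.src_bdd
  have ζ0 (x : E n) := chi_sub x hR1 h2
  simp only [hζx] at ζ0
  have g8 : ∀ x : E n, ‖x‖ ≤ R₁ → G x = 0 := fun x hx => by rw [← hGx, (ζ0 x).2.1 hx, zero_mul]
  have gr : ∀ x : E n, 2 * R₂ ≤ ‖x‖ → G x = 0 := fun x hx => by rw [← hGx, (ζ0 x).2.2 hx, zero_mul]
  have gM : ∀ x, |G x| ≤ M0 := fun x => by
    rw [← hGx, abs_of_nonneg (mul_nonneg (ζ0 x).1.1 (S.src_nonneg x))]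
    nlinarith [hb x, (ζ0 x).1.2, (ζ0 x).1.1, S.src_nonneg x]
  have e8 : ∀ x : E n, ‖x‖ < 8 → Eul G x = 0 := fun x hx => by
    have h : G =ᶠ[𝓝 x] fun _ => 0 := by
      filter_upwards [(isOpen_lt continuous_norm continuous_const).mem_nhds hx] with y hy
      exact g8 y (by linarith [show ‖y‖ < 8 from hy])
    simp [Eul, h.fderiv_eq, h.eq_of_nhds]
  have er : ∀ x : E n, 2 * R₂ < ‖x‖ → Eul G x = 0 := fun x hx => Eul_eq_zero gr hx
  obtain ⟨ME, hME, heb⟩ := exists_Eul_bound hG gr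
  have hEm := (Eul_continuous hG).measurable
  obtain ⟨iE, vE⟩ := S.prod_pot hEm heb e8 er
  obtain ⟨iG, vG⟩ := S.prod_pot hG.continuous.measurable gM (fun x hx => g8 x lin!)
    (fun x hx => gr x hx.le)
  have hne := ae_fst_ne_snd (n := n) P.n1
  have hGa : ∀ w : E n, Gam d w = ‖w‖ ^ (2 * (-d / 2)) := fun w => by rw [Gam]; congr 1; ring
  obtain ⟨g, hg⟩ := named (src N u : E n → ℝ)
  rw [← hg] at iE vE iG vG
  have hg0 : ∀ x, 0 ≤ g x := by rw [hg]; exact S.src_nonneg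
  have hgm : Measurable g := by rw [hg]; exact S.src_measurable
  rw [← hg] at hGx
  -- regularized double integrals
  obtain ⟨F, hF⟩ := named fun (ε : ℝ) (z : E n × E n) =>
    Eul G z.1 * (rg ε (-d / 2) (z.1 - z.2) * g z.2)
  obtain ⟨H, hH⟩ := named fun (ε : ℝ) (z : E n × E n) =>
    G z.1 * (inner ℝ (z.1 - z.2) z.1 * rg ε (-d / 2 - 1) (z.1 - z.2)) * g z.2
  have hw : ∀ z : E n × E n, z.1 ≠ z.2 → 0 < ‖z.1 - z.2‖ := fun z hz =>
    norm_pos_iff.2 (sub_ne_zero.2 hz)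
  have msub : Measurable fun z : E n × E n => z.1 - z.2 := measurable_fst.sub measurable_snd
  have hFm : ∀ ε, Measurable (F ε) := fun ε => by
    rw [hF]
    exact (hEm.comp measurable_fst).mul (((rg_measurable ε _).comp msub).mul
      (hgm.comp measurable_snd))
  have hHm : ∀ ε, Measurable (H ε) := fun ε => by
    rw [hH]
    exact ((hG.continuous.measurable.comp measurable_fst).mul ((msub.inner measurable_fst).mul
      ((rg_measurable ε _).comp msub))).mul (hgm.comp measurable_snd)
  have hFb : ∀ ε, ∀ᵐ z : E n × E n, ‖F ε z‖ ≤ ‖Eul G z.1 * (Gam d (z.1 - z.2) * g z.2)‖ := by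
    intro ε
    filter_upwards [hne] with z hz
    rw [hF, norm_mul, norm_mul, norm_mul, norm_mul]
    gcongr
    rw [norm_of_nonneg (rg_nonneg _ _ _), norm_of_nonneg (Gam_nonneg _), hGa]
    exact reg_le (hw z hz) lin!
  have hHi : ∀ ε, 0 < ε → Integrable (H ε) := by
    intro ε hε
    have hdom : Integrable fun z : E n × E n =>
      2 * R₂ / ε * (G z.1 * (Gam d (z.1 - z.2) * g z.2)) := iG.const_mul _
    refine hdom.mono (hHm ε).aestronglyMeasurable ?_
    filter_upwards [hne] with z hz
    by_cases hx : G z.1 = 0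
    · rw [hH]; simp [hx]
    have e1 : rg ε (-d / 2 - 1) (z.1 - z.2) * ‖z.1 - z.2‖ ≤ ε⁻¹ * Gam d (z.1 - z.2) := by
      have hρ : 0 < ‖z.1 - z.2‖ ^ 2 + ε ^ 2 := pos!
      calc _ ≤ rg ε (-d / 2 - 1) (z.1 - z.2) * (ε⁻¹ * (‖z.1 - z.2‖ ^ 2 + ε ^ 2)) := by
            refine mul_le_l ?_ (rg_nonneg _ _ _)
            rw [le_inv_mul_iff₀ hε]
            nlinarith [sq_nonneg (‖z.1 - z.2‖ - ε), norm_nonneg (z.1 - z.2)]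
        _ = ε⁻¹ * (‖z.1 - z.2‖ ^ 2 + ε ^ 2) ^ (-d / 2) := by
            rw [rg, rpow_sub_one hρ.ne']; field_simp
        _ ≤ _ := by
            rw [hGa]
            exact mul_le_l (reg_le (hw z hz) lin!)
    rw [hH]
    simp only [norm_mul, norm_of_nonneg (rg_nonneg _ _ _), norm_of_nonneg (Gam_nonneg _),
      norm_of_nonneg (hg0 _), norm_of_nonneg (pos! : 0 ≤ 2 * R₂ / ε)]
    have e2 : ‖(inner ℝ (z.1 - z.2) z.1 : ℝ)‖ ≤ ‖z.1 - z.2‖ * (2 * R₂) :=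
      (norm_inner_le_norm _ _).trans (mul_le_l
          (not_lt.1 fun h => hx (gr _ h.le)))
    calc _ ≤ ‖G z.1‖ * (‖z.1 - z.2‖ * (2 * R₂) * rg ε (-d / 2 - 1) (z.1 - z.2)) * g z.2 :=
          mul_le_r (mul_le_l
            (mul_le_r e2 (rg_nonneg _ _ _))) (hg0 _)
      _ = ‖G z.1‖ * (2 * R₂) * g z.2 * (rg ε (-d / 2 - 1) (z.1 - z.2) * ‖z.1 - z.2‖) := by ring
      _ ≤ ‖G z.1‖ * (2 * R₂) * g z.2 * (ε⁻¹ * Gam d (z.1 - z.2)) :=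
          mul_le_l e1 (mul_nonneg pos! (hg0 _))
      _ = _ := by ring
  have hFH : ∀ ε, 0 < ε → ∫ z, F ε z = d * ∫ z, H ε z := by
    intro ε hε
    have i1 := (fun ε => iE.mono (hFm ε).aestronglyMeasurable (hFb ε)) ε
    have i2 := hHi ε hε
    rw [Measure.volume_eq_prod] at i1 i2 ⊢
    rw [integral_prod_symm _ i1, integral_prod_symm _ i2, ← integral_const_mul]
    refine integral_congr_ae (.of_forall fun y => ?_)
    have hr1 : ContDiff ℝ 1 fun x : E n => rg ε (-d / 2) (x - y) :=
      (rg_contDiff hε _).comp (contDiff_id.sub contDiff_const)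
    have h0 := integral_Eul (G := fun x : E n => rg ε (-d / 2) (x - y) * G x) (hr1.mul hG)
      (r := 2 * R₂) (fun x hx => by rw [gr x hx, mul_zero])
    simp only [rg_mul_Eul hε _ hG] at h0
    have j1 : Integrable fun x : E n => rg ε (-d / 2) (x - y) * Eul G x :=
      integrable_of_zero (hr1.continuous.mul (Eul_continuous hG)) (r := 2 * R₂) fun x hx => by simp [er x hx]
    have j2 : Integrable fun x : E n => 2 * (-d / 2) *
        (G x * (inner ℝ (x - y) x * rg ε (-d / 2 - 1) (x - y))) := by
      refine (integrable_of_zero (hG.continuous.mul (((continuous_id.sub continuous_const).inner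
        continuous_id).mul ((rg_contDiff hε _).continuous.comp (continuous_id.sub
        continuous_const)))) (r := 2 * R₂) fun x hx => ?_).const_mul _
      simp [gr x hx.le]
    rw [integral_add j1 j2, integral_const_mul] at h0
    have k1 : ∀ x, F ε (x, y) = rg ε (-d / 2) (x - y) * Eul G x * g y := fun x => by
      rw [hF]; simp only; ring
    simp only [k1, hH]
    rw [integral_mul_const, integral_mul_const]
    linear_combination g y * h0
  -- symmetrization
  obtain ⟨K, hK⟩ := named fun (ε : ℝ) (z : E n × E n) =>
    ((ζ z.1 + ζ z.2) * ‖z.1 - z.2‖ ^ 2 + (ζ z.1 - ζ z.2) * (‖z.1‖ ^ 2 - ‖z.2‖ ^ 2)) *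
      rg ε (-d / 2 - 1) (z.1 - z.2) * (g z.1 * g z.2)
  have hHK : ∀ ε, 0 < ε → ∫ z, H ε z = 1 / 4 * ∫ z, K ε z := by
    intro ε hε
    have i2 := hHi ε hε
    have i3 : Integrable fun z : E n × E n => H ε z.swap := i2.swap
    have e3 : ∫ z : E n × E n, H ε z.swap = ∫ z, H ε z := by
      rw [Measure.volume_eq_prod]; exact integral_prod_swap (H ε)
    have e4 : ∀ z, K ε z = 2 * (H ε z + H ε z.swap) := by
      intro z
      have q1 : rg ε (-d / 2 - 1) (z.2 - z.1) = rg ε (-d / 2 - 1) (z.1 - z.2) := by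
        rw [rg, norm_sub_rev, rg]
      rw [hK, hH]
      simp only [Prod.fst_swap, Prod.snd_swap, q1, ← hGx]
      rw [norm_sub_sq_real z.1 z.2, inner_sub_left, inner_sub_left, real_inner_self_eq_norm_sq,
        real_inner_self_eq_norm_sq, real_inner_comm z.1 z.2]
      ring
    simp only [e4]
    rw [integral_const_mul, integral_add i2 i3, e3]; ring
  have l1 : Tendsto (fun ε => ∫ z, F ε z) (𝓝[>] 0) (𝓝 (∫ x, Eul G x * pot d N u x)) := by
    rw [← vE]
    refine tendsto_integral_filter_of_dominated_convergence _
      (.of_forall fun ε => (hFm ε).aestronglyMeasurable)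
      (.of_forall hFb) iE.norm ?_
    filter_upwards [hne] with z hz
    rw [hF, hGa]
    exact ((reg_tendsto (hw z hz)).mul_const _).const_mul _
  obtain ⟨C1, -, hJ1⟩ := S.exists_JJ_le
  obtain ⟨j1, -⟩ := hJ1 R₁ h1
  obtain ⟨j2, -⟩ := hJ1 R₂ (h1.trans h2)
  rw [← hg] at j1 j2
  obtain ⟨A, hA⟩ := named fun (z : E n × E n) => G z.1 * (Gam d (z.1 - z.2) * g z.2) +
    G z.swap.1 * (Gam d (z.swap.1 - z.swap.2) * g z.swap.2)
  have hAi : Integrable A := by rw [hA]; exact iG.add iG.swap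
  have vA : ∫ z, A z = 2 * ∫ x, G x * pot d N u x := by
    rw [hA, two_mul]
    refine (integral_add iG iG.swap).trans ?_
    rw [vG, ← vG, Measure.volume_eq_prod]
    exact congrArg _ (integral_prod_swap fun z : E n × E n => G z.1 * (Gam d (z.1 - z.2) * g z.2))
  obtain ⟨D, hD⟩ := named fun (z : E n × E n) => JK d R₁ z * (g z.1 * g z.2) -
    JK d R₂ z * (g z.1 * g z.2)
  have hDi : Integrable D := by rw [hD]; exact j1.sub j2
  have hKz : ∀ z : E n × E n, z.1 ≠ z.2 →
      ((ζ z.1 + ζ z.2) * ‖z.1 - z.2‖ ^ 2 + (ζ z.1 - ζ z.2) * (‖z.1‖ ^ 2 - ‖z.2‖ ^ 2)) *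
      ‖z.1 - z.2‖ ^ (2 * (-d / 2 - 1)) * (g z.1 * g z.2) =
      A z + D z := by
    intro z hz
    have q1 : ‖z.1 - z.2‖ ^ 2 * ‖z.1 - z.2‖ ^ (-d - 2) = Gam d (z.1 - z.2) := by
      rw [← rpow_two, ← rpow_add (hw z hz), Gam]; congr 1; ring
    have q2 : 2 * (-d / 2 - 1) = -d - 2 := by ring
    rw [hA, hD, q2]
    simp only [Prod.fst_swap, Prod.snd_swap, Gam_sub_comm z.2 z.1, JK, ← hGx, ← hζx]
    rw [← q1]
    ring
  have hKm : ∀ ε, Measurable (K ε) := fun ε => by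
    rw [hK]
    have a1 : Measurable fun z : E n × E n => ζ z.1 := hζm.comp measurable_fst
    have a2 : Measurable fun z : E n × E n => ζ z.2 := hζm.comp measurable_snd
    exact (((((a1.add a2).mul (msub.norm.pow_const 2)).add ((a1.sub a2).mul
      ((measurable_fst.norm.pow_const 2).sub (measurable_snd.norm.pow_const 2)))).mul
      ((rg_measurable ε _).comp msub)).mul ((hgm.comp measurable_fst).mul
      (hgm.comp measurable_snd)))
  have l2 : Tendsto (fun ε => ∫ z, K ε z) (𝓝[>] 0)
      (𝓝 (∫ z, (A z + D z))) := by
    refine tendsto_integral_filter_of_dominated_convergence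
      (fun z => A z + (JK d R₁ z * (g z.1 * g z.2) + JK d R₂ z * (g z.1 * g z.2)))
      (.of_forall fun ε => (hKm ε).aestronglyMeasurable)
      (.of_forall fun ε => ?_) (hAi.add (j1.add j2)) ?_
    · filter_upwards [hne] with z hz
      have a0 : 0 ≤ A z := by
        rw [hA]
        have : ∀ x, 0 ≤ G x := fun x => by rw [← hGx]; exact mul_nonneg (ζ0 x).1.1 (hg0 x)
        exact add_nonneg (mul_nonneg (this _) (mul_nonneg (Gam_nonneg _) (hg0 _)))
          (mul_nonneg (this _) (mul_nonneg (Gam_nonneg _) (hg0 _)))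
      have b1 := mul_nonneg (JK_nonneg (d := d) hR1 z) (mul_nonneg (hg0 z.1) (hg0 z.2))
      have b2 := mul_nonneg (JK_nonneg (d := d) hR2 z) (mul_nonneg (hg0 z.1) (hg0 z.2))
      calc ‖K ε z‖ ≤ ‖((ζ z.1 + ζ z.2) * ‖z.1 - z.2‖ ^ 2 +
            (ζ z.1 - ζ z.2) * (‖z.1‖ ^ 2 - ‖z.2‖ ^ 2)) *
            ‖z.1 - z.2‖ ^ (2 * (-d / 2 - 1)) * (g z.1 * g z.2)‖ := by
            rw [hK]
            simp only [norm_mul _ (rg _ _ _), norm_mul _ (‖z.1 - z.2‖ ^ (2 * (-d / 2 - 1))),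
              norm_mul _ (g z.1 * g z.2)]
            gcongr
            rw [norm_of_nonneg (rg_nonneg _ _ _), norm_of_nonneg pos!]
            exact reg_le (hw z hz) lin!
        _ = |A z + D z| := by rw [hKz z hz, norm_eq_abs]
        _ ≤ _ := by rw [hD, abs_le]; constructor <;> linarith
    · filter_upwards [hne] with z hz
      rw [← hKz z hz, hK]
      exact ((reg_tendsto (hw z hz)).const_mul _).mul_const _
  have hlim : (∫ x, Eul G x * pot d N u x) = d * (1 / 4 * ∫ z, (A z + D z)) := by
    refine tendsto_nhds_unique l1 (((l2.const_mul (1 / 4)).const_mul d).congr' ?_)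
    filter_upwards [self_mem_nhdsWithin] with ε hε
    rw [hFH ε hε, hHK ε hε]
  rw [hlim, integral_add hAi hDi, vA, hD, integral_sub j1 j2]
  simp only [JJ, ← hg]
  ring

end Sol

open Real

namespace Sol
variable {n : ℕ} {σ d N α p c : ℝ} {u : E n → ℝ}

lemma src_eventuallyEq (S : Sol σ d N α p c u) {x : E n} (hx : 3 < ‖x‖) :
    src N u =ᶠ[𝓝 x] fun y => c * (‖y‖ ^ α * u y ^ p) := by
  filter_upwards [(isOpen_lt continuous_const continuous_norm).mem_nhds hx] with y hy
  rw [src_eq hy.le, S.eq y lin!]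

lemma contDiffAt_u (S : Sol σ d N α p c u) {x : E n} (hx : 3 < ‖x‖) : ContDiffAt ℝ 1 u x :=
  (S.adm.smooth.contDiffAt (S.adm.op.mem_nhds (show 1 < ‖x‖ by linarith))).of_le num!

lemma contDiffAt_src (S : Sol σ d N α p c u) {x : E n} (hx : 3 < ‖x‖) :
    ContDiffAt ℝ 1 (src N u) x :=
  ContDiffAt.congr_of_eventuallyEq (contDiffAt_const.mul (((contDiffAt_norm ℝ
    (norm_pos_iff.1 lin!)).rpow_const_of_ne lin!).mul
    ((S.contDiffAt_u hx).rpow_const_of_le (by exact_mod_cast S.p1.le)))) (S.src_eventuallyEq hx)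

lemma fderiv_src (S : Sol σ d N α p c u) {x : E n} (hx : 3 < ‖x‖) :
    u x * fderiv ℝ (src N u) x x =
      α * (u x * src N u x) + p * (src N u x * fderiv ℝ u x x) := by
  have h0 : 0 < ‖x‖ := lin!
  have hn : DifferentiableAt ℝ (fun y : E n => ‖y‖) x :=
    (contDiffAt_norm ℝ (n := 1) (norm_pos_iff.1 h0)).differentiableAt num!
  have h := ((hn.hasFDerivAt.rpow_const (p := α) (Or.inl h0.ne')).mul
    (((S.contDiffAt_u hx).differentiableAt num!).hasFDerivAt.rpow_const
      (p := p) (Or.inr S.p1.le))).const_mul c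
  have hu0 := S.nonneg x lin!
  have e2 : u x * u x ^ (p - 1) = u x ^ p := by
    rcases hu0.eq_or_lt with h | h
    · rw [← h, zero_mul, zero_rpow (by linarith [S.p1])]
    · rw [rpow_sub_one h.ne']; field_simp
  have e3 : ‖x‖ ^ (α - 1) * ‖x‖ = ‖x‖ ^ α := by rw [rpow_sub_one h0.ne']; field_simp
  rw [(h.congr_of_eventuallyEq (S.src_eventuallyEq hx)).fderiv, (S.src_eventuallyEq hx).eq_of_nhds]
  simp only [add_apply, smul_apply, smul_eq_mul, hn.fderiv_norm_self]
  linear_combination (c * ‖x‖ ^ α * p * fderiv ℝ u x x) * e2 + c * α * u x ^ p * u x * e3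

/-- Radial derivative mass of the energy density on the cutoff region. -/
def WW (N : ℝ) (u : E n → ℝ) (R : ℝ) : ℝ := ∫ x, dchi R x * (u x * src N u x)
/-- The energy between two cutoffs. -/
def TT (N : ℝ) (u : E n → ℝ) (R₁ R₂ : ℝ) : ℝ := ∫ x, (chi R₁ x - chi R₂ x) * (u x * src N u x)

lemma contDiff_of_annulus {R₁ : ℝ} {f : E n → ℝ} (h1 : 3 < R₁) (h0 : ∀ x, ‖x‖ ≤ R₁ → f x = 0)
    (h : ∀ x : E n, 3 < ‖x‖ → ContDiffAt ℝ 1 f x) : ContDiff ℝ 1 f := by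
  refine contDiff_iff_contDiffAt.2 fun x => ?_
  rcases lt_or_ge 3 ‖x‖ with hx | hx
  · exact h x hx
  · refine ContDiffAt.congr_of_eventuallyEq (contDiffAt_const (c := (0 : ℝ))) ?_
    filter_upwards [(isOpen_lt continuous_norm continuous_const).mem_nhds (hx.trans_lt h1)]
      with y hy using h0 y (le_of_lt hy)

/-- The Pohozaev identity on an annulus. -/
theorem exists_pohozaev (S : Sol σ d N α p c u) : ∃ C > 0, ∀ R₁ R₂, 16 ≤ R₁ → R₁ ≤ R₂ →
    Integrable (fun x => (chi R₁ x - chi R₂ x) * (u x * src N u x)) ∧ |kap n d N * ((WW N u R₁ - WW N u R₂) / (p + 1) +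
      ((n + α) / (p + 1) - d / 2) * TT N u R₁ R₂) - d / 4 * (JJ d N u R₁ - JJ d N u R₂)| ≤
    C * BB d N u R₁ := by
  have P := S.par
  have hd := P.d0
  have hp := S.p1
  obtain ⟨Cf, hCf, hfar⟩ := exists_far_bounds P S.wt
  refine ⟨Cf + d / 2 * Cf, pos!, fun R₁ R₂ h1 h2 => ?_⟩
  have hR1 : 0 < R₁ := lin!
  have hR2 : 0 < R₂ := lin!
  obtain ⟨g, hg⟩ := named (src N u : E n → ℝ)
  obtain ⟨G, hG⟩ := named fun (x : E n) => (chi R₁ x - chi R₂ x) * g x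
  have hGx : ∀ x, (chi R₁ x - chi R₂ x) * src N u x = G x := fun x => by rw [hG, hg]
  have g8 : ∀ x : E n, ‖x‖ ≤ R₁ → G x = 0 := fun x hx => by
    rw [← hGx, (chi_sub x hR1 h2).2.1 hx, zero_mul]
  have gr : ∀ x : E n, 2 * R₂ ≤ ‖x‖ → G x = 0 := fun x hx => by
    rw [← hGx, (chi_sub x hR1 h2).2.2 hx, zero_mul]
  have G0 : ∀ x, 0 ≤ G x ∧ G x ≤ src N u x := fun x => by
    have := (chi_sub x hR1 h2).1
    have := S.src_nonneg x
    rw [← hGx]; constructor <;> nlinarith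
  have hζc : ContDiff ℝ 1 fun x : E n => chi R₁ x - chi R₂ x := chi_contDiff.sub chi_contDiff
  have hGc : ContDiff ℝ 1 G := contDiff_of_annulus lin! g8 fun x hx => by
    rw [hG, hg]; exact hζc.contDiffAt.mul (S.contDiffAt_src hx)
  have hUc : ContDiff ℝ 1 fun x => u x * G x :=
    contDiff_of_annulus (R₁ := R₁) lin! (fun x hx => by rw [g8 x hx, mul_zero]) fun x hx =>
      (S.contDiffAt_u hx).mul hGc.contDiffAt
  have ur : ∀ x : E n, 2 * R₂ ≤ ‖x‖ → u x * G x = 0 := fun x hx => by rw [gr x hx, mul_zero]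
  have e8 : ∀ x : E n, ‖x‖ < R₁ → Eul G x = 0 := fun x hx => by
    have h : G =ᶠ[𝓝 x] fun _ => 0 := by
      filter_upwards [(isOpen_lt continuous_norm continuous_const).mem_nhds hx] with y hy
      exact g8 y (le_of_lt hy)
    simp [Eul, h.fderiv_eq, h.eq_of_nhds]
  -- pointwise identity
  have key : ∀ x, (1 + p) * (u x * Eul G x) = (dchi R₁ x - dchi R₂ x) * (u x * g x) +
      (α + n) * ((chi R₁ x - chi R₂ x) * (u x * g x)) + p * Eul (fun x => u x * G x) x := by
    intro x
    rcases lt_or_ge ‖x‖ R₁ with hx | hx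
    · have h : (fun x => u x * G x) =ᶠ[𝓝 x] fun _ => 0 := by
        filter_upwards [(isOpen_lt continuous_norm continuous_const).mem_nhds hx] with y hy
        rw [g8 y (le_of_lt hy), mul_zero]
      rw [e8 x hx, dchi_zero hR1 (Or.inl hx), dchi_zero hR2 (Or.inl lin!),
        (chi_sub x hR1 h2).2.1 hx.le, Eul, h.fderiv_eq, h.eq_of_nhds]
      simp
    · have hx3 : 3 < ‖x‖ := lin!
      have f1 : fderiv ℝ (fun x => u x * G x) x x =
          u x * fderiv ℝ G x x + G x * fderiv ℝ u x x := by
        rw [fderiv_fun_mul ((S.contDiffAt_u hx3).differentiableAt num!)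
            ((hGc.differentiable num!) x)]; simp
      have f3 : fderiv ℝ (fun x : E n => chi R₁ x - chi R₂ x) x x = dchi R₁ x - dchi R₂ x := by
        rw [fderiv_fun_sub (chi_contDiff.differentiable num! x)
          (chi_contDiff.differentiable num! x), sub_apply, fderiv_chi hR1, fderiv_chi hR2]
      have f2 : fderiv ℝ G x x = (chi R₁ x - chi R₂ x) * fderiv ℝ (src N u) x x +
          src N u x * (dchi R₁ x - dchi R₂ x) := by
        rw [hG, hg, fderiv_fun_mul
            ((hζc.differentiable num!) x) ((S.contDiffAt_src hx3).differentiableAt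
            num!), add_apply, smul_apply, smul_apply, f3]; simp
      rw [Eul, Eul, f1, ← hGx, f2, hg]
      linear_combination (chi R₁ x - chi R₂ x) * (S.fderiv_src hx3)
  have cs : ∀ f : E n → ℝ, (∀ x, 3 < ‖x‖ → ContinuousAt f x) →
      (∀ x, ‖x‖ < R₁ ∨ 2 * R₂ < ‖x‖ → f x = 0) → Integrable f := by
    intro f hf h0
    have hi : IntegrableOn f (closedBall 0 (2 * R₂) \ ball 0 R₁) :=
      ContinuousOn.integrableOn_compact ((isCompact_closedBall _ _).diff isOpen_ball) fun x hx =>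
        (hf x (by
          have : ¬ ‖x‖ < R₁ := fun h => hx.2 (mem_ball_zero_iff.2 h)
          linarith)).continuousWithinAt
    refine hi.integrable_of_forall_notMem_eq_zero fun x hx => h0 x ?_
    by_contra h
    push Not at h
    exact hx ⟨mem_closedBall_zero_iff.2 h.2, fun h' => (mem_ball_zero_iff.1 h').not_ge h.1⟩
  have ug : ∀ x : E n, 3 < ‖x‖ → ContinuousAt (fun x => u x * g x) x := fun x hx => by
    rw [hg]; exact (S.contDiffAt_u hx).continuousAt.mul (S.contDiffAt_src hx).continuousAt
  have dc : ∀ R, 0 < R → Continuous (dchi R : E n → ℝ) := fun R hR => by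
    have : (dchi R : E n → ℝ) = fun x => fderiv ℝ (chi R) x x :=
      funext fun x => (fderiv_chi hR x).symm
    rw [this]
    exact (chi_contDiff.continuous_fderiv num!).clm_apply continuous_id
  have i1 : Integrable fun x => dchi R₁ x * (u x * g x) :=
    cs _ (fun x hx => (dc _ hR1).continuousAt.mul (ug x hx)) fun x hx => by
      rw [dchi_zero hR1 (hx.imp id fun h => lin!), zero_mul]
  have i2 : Integrable fun x => dchi R₂ x * (u x * g x) :=
    cs _ (fun x hx => (dc _ hR2).continuousAt.mul (ug x hx)) fun x hx => by
      rw [dchi_zero hR2 (hx.imp (fun h => lin!) id), zero_mul]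
  have i3 : Integrable fun x => (chi R₁ x - chi R₂ x) * (u x * g x) :=
    cs _ (fun x hx => hζc.continuous.continuousAt.mul (ug x hx)) fun x hx => by
      rcases hx with h | h
      · rw [(chi_sub x hR1 h2).2.1 h.le, zero_mul]
      · rw [(chi_sub x hR1 h2).2.2 h.le, zero_mul]
  have i4 : Integrable fun x => p * Eul (fun x => u x * G x) x :=
    (cs _ (fun x _ => (Eul_continuous hUc).continuousAt) fun x hx => by
      rcases hx with h | h
      · have := key x
        rw [e8 x h, dchi_zero hR1 (Or.inl h), dchi_zero hR2 (Or.inl lin!),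
          (chi_sub x hR1 h2).2.1 h.le] at this
        have : p * Eul (fun x => u x * G x) x = 0 := lin!
        exact (mul_eq_zero.1 this).resolve_left lin!
      · exact Eul_eq_zero ur h).const_mul p
  have i5 : Integrable fun x => Eul G x * u x :=
    cs _ (fun x hx => (Eul_continuous hGc).continuousAt.mul (S.contDiffAt_u hx).continuousAt)
      fun x hx => by rw [hx.elim (e8 x) (Eul_eq_zero gr), zero_mul]
  have v1 : (1 + p) * ∫ x, Eul G x * u x =
      WW N u R₁ - WW N u R₂ + (α + n) * TT N u R₁ R₂ := by
    have a1 : Integrable fun x => dchi R₁ x * (u x * g x) - dchi R₂ x * (u x * g x) := i1.sub i2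
    have a2 : Integrable fun x => (α + n) * ((chi R₁ x - chi R₂ x) * (u x * g x)) :=
      i3.const_mul _
    have a3 : Integrable fun x => dchi R₁ x * (u x * g x) - dchi R₂ x * (u x * g x) +
      (α + n) * ((chi R₁ x - chi R₂ x) * (u x * g x)) := a1.add a2
    rw [← integral_const_mul, WW, WW, TT, ← hg, ← integral_sub i1 i2, ← integral_const_mul,
      ← integral_add a1 a2, ← add_zero (∫ x, _ + _), ← mul_zero p, ← integral_Eul hUc ur,
      ← integral_const_mul, ← integral_add a3 i4]
    refine integral_congr_ae (.of_forall fun x => ?_)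
    linear_combination key x
  -- the regular part of the representation
  obtain ⟨f, hf⟩ := named ({x | 8 ≤ ‖x‖}.indicator
    fun x => kap n d N * u x - pot d N u x : E n → ℝ)
  have f8 : ∀ x, 8 ≤ ‖x‖ → f x = kap n d N * u x - pot d N u x := fun x hx => by
    rw [hf, indicator_of_mem (show x ∈ {x : E n | 8 ≤ ‖x‖} from hx)]
  have ff : ∀ x, 8 ≤ ‖x‖ → f x = far d N u x := fun x hx => by
    rw [f8 x hx, S.rep_global lin!]; ring
  have fb : ∀ x, 8 ≤ ‖x‖ → |f x| ≤ Cf * ‖x‖ ^ (-d) := fun x hx => by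
    rw [ff x hx]; exact (hfar ‖x‖ hx x lin! lin!).1
  have fM : ∀ x, |f x| ≤ Cf := fun x => by
    by_cases hx : 8 ≤ ‖x‖
    · exact (fb x hx).trans (mul_le_of_le_one_right hCf.le
        (rpow_le_one_of_one_le_of_nonpos lin! lin!))
    · rw [hf, indicator_of_notMem (show x ∉ {x : E n | 8 ≤ ‖x‖} from hx), abs_zero]; exact hCf.le
  have fm : Measurable f := by
    rw [hf]
    exact ((S.adm.meas.const_mul _).sub S.pot_measurable).indicator
      (measurableSet_le measurable_const measurable_norm)
  have hGR : ∀ x, G x ≠ 0 → R₁ < ‖x‖ := fun x hx => not_le.1 fun h => hx (g8 x h)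
  have ib : Integrable fun x => Cf * ‖x‖ ^ (-d) * |G x| := by
    refine ((integrable_of_zero hGc.continuous fun x hx => gr x hx.le).norm.const_mul Cf).mono' ((((measurable_norm.pow_const _).const_mul
      _).mul hGc.continuous.measurable.norm).aestronglyMeasurable)
      (.of_forall fun x => ?_)
    by_cases hx : G x = 0
    · simp [hx]
    rw [norm_of_nonneg pos!, norm_eq_abs]
    exact mul_le_r (mul_le_of_le_one_right hCf.le
      (rpow_le_one_of_one_le_of_nonpos (by linarith [hGR x hx]) lin!))
  have ibB : ∫ x, Cf * ‖x‖ ^ (-d) * |G x| ≤ Cf * BB d N u R₁ := by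
    rw [BB, ← integral_const_mul, ← integral_indicator measurableSet_ball.compl]
    refine integral_mono ib (((integrable_indicator_iff measurableSet_ball.compl).2
      ((S.src_tail_integrable hR1).const_mul Cf))) fun x => ?_
    by_cases hx : G x = 0
    · simp only [hx, abs_zero, mul_zero]
      exact indicator_nonneg (fun y _ => by have := S.src_nonneg y; positivity) x
    · have hm : x ∈ (ball (0 : E n) R₁)ᶜ := fun h =>
        (mem_ball_zero_iff.1 h).not_gt (hGR x hx)
      rw [indicator_of_mem hm, abs_of_nonneg (G0 x).1, mul_assoc]
      have := (G0 x).2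
      gcongr
  have b1 : |∫ x, f x * Eul G x| ≤ Cf * BB d N u R₁ := by
    refine (abs_integral_mul_Eul_le hGc gr fm fM ib fun τ h0 h1' x hx => ?_).trans ibB
    have hx1 := hGR x hx
    have hx0 : 0 < ‖x‖ := lin!
    have hi : 0 < (1 + τ)⁻¹ := pos!
    have hi1 : (1 + τ)⁻¹ ≤ 1 := inv_le_one_of_one_le₀ lin!
    have hi2 : 1 / 2 ≤ (1 + τ)⁻¹ := by
      rw [one_div]; exact inv_anti₀ lin! lin!
    have hy : ‖(1 + τ)⁻¹ • x‖ = (1 + τ)⁻¹ * ‖x‖ := by rw [norm_smul, norm_of_nonneg hi.le]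
    have hy2 : ‖x‖ / 2 ≤ ‖(1 + τ)⁻¹ • x‖ := by rw [hy]; nlinarith
    have hy3 : ‖(1 + τ)⁻¹ • x‖ ≤ 3 * ‖x‖ := by rw [hy]; nlinarith
    rw [ff _ lin!, ff _ lin!, abs_sub_comm]
    refine ((hfar ‖x‖ lin! x lin! lin!).2 _ hy2 hy3).trans ?_
    have e : ‖x - (1 + τ)⁻¹ • x‖ ≤ τ * ‖x‖ := by
      have e1 : 1 - (1 + τ)⁻¹ ≤ τ := by
        have : (1 + τ) * (1 + τ)⁻¹ = 1 := mul_inv_cancel₀ lin!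
        nlinarith
      nth_rw 1 [← one_smul ℝ x]
      rw [← sub_smul, norm_smul, norm_of_nonneg lin!]
      exact mul_le_r e1
    calc _ ≤ Cf * ‖x‖ ^ (-d - 1) * (τ * ‖x‖) := mul_le_l e
      _ = _ := by rw [rpow_sub_one hx0.ne']; field_simp
  have b2 : |∫ x, f x * G x| ≤ Cf * BB d N u R₁ := by
    rw [← norm_eq_abs]
    refine (norm_integral_le_of_norm_le ib (.of_forall fun x => ?_)).trans ibB
    by_cases hx : G x = 0
    · simp [hx]
    rw [norm_mul, norm_eq_abs, norm_eq_abs]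
    exact mul_le_r (fb x (by linarith [hGR x hx]))
  obtain ⟨ME, -, heb⟩ := exists_Eul_bound hGc gr
  have iV : Integrable fun x => Eul G x * pot d N u x :=
    S.integrable_mul_pot (Eul_continuous hGc).measurable heb (fun x hx => e8 x lin!)
      fun x hx => Eul_eq_zero gr hx
  obtain ⟨M0, -, hb⟩ := S.src_bdd
  have iGV : Integrable fun x => G x * pot d N u x :=
    S.integrable_mul_pot hGc.continuous.measurable
      (fun x => by rw [abs_of_nonneg (G0 x).1]; exact (G0 x).2.trans (hb x))
      (fun x hx => g8 x lin!) fun x hx => gr x hx.le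
  have v2 : ∫ x, f x * Eul G x = kap n d N * (∫ x, Eul G x * u x) -
      ∫ x, Eul G x * pot d N u x := by
    rw [← integral_const_mul, ← integral_sub (i5.const_mul _) iV]
    refine integral_congr_ae (.of_forall fun x => ?_)
    simp only
    rcases lt_or_ge ‖x‖ R₁ with h | h
    · rw [e8 x h]; ring
    · rw [f8 x lin!]; ring
  have v3 : ∫ x, f x * G x = kap n d N * TT N u R₁ R₂ - ∫ x, G x * pot d N u x := by
    rw [TT, ← hg, ← integral_const_mul, ← integral_sub (i3.const_mul _) iGV]
    refine integral_congr_ae (.of_forall fun x => ?_)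
    simp only
    rcases lt_or_ge ‖x‖ R₁ with h | h
    · rw [g8 x h.le, (chi_sub x hR1 h2).2.1 h.le]; ring
    · rw [f8 x lin!, ← hGx, hg]; ring
  have v4 := S.integral_pot_Eul h1 h2 (by simpa only [hGx] using hGc)
  simp only [hGx] at v4
  have v5 : kap n d N * ((WW N u R₁ - WW N u R₂) / (p + 1) +
      ((n + α) / (p + 1) - d / 2) * TT N u R₁ R₂) - d / 4 * (JJ d N u R₁ - JJ d N u R₂) =
      (∫ x, f x * Eul G x) - d / 2 * ∫ x, f x * G x := by
    rw [v2, v3, v4]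
    have : (∫ x, Eul G x * u x) = (WW N u R₁ - WW N u R₂ + (α + n) * TT N u R₁ R₂) / (1 + p) := by
      rw [← v1]; field_simp
    rw [this, add_comm 1 p]
    ring
  rw [v5]
  refine ⟨by simpa only [hg] using i3, ?_⟩
  calc _ ≤ |∫ x, f x * Eul G x| + |d / 2 * ∫ x, f x * G x| := abs_sub _ _
    _ ≤ _ := by
      rw [abs_mul, abs_of_pos (pos! : 0 < d / 2)]
      nlinarith

end Sol

open Real

namespace Sol
variable {n : ℕ} {σ d N α p c : ℝ} {u : E n → ℝ}

lemma exists_comparable (S : Sol σ d N α p c u) (h : ¬ Integrable (src N u)) :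
    ∃ C > 0, ∀ᶠ R in atTop, 64 ≤ R ∧ 1 ≤ AA N u R ∧ 0 < SS d N u R ∧
      ∀ x, R / 2 ≤ ‖x‖ → ‖x‖ ≤ 2 * R → u x ≤ C * SS d N u R ∧ SS d N u R ≤ C * u x ∧
        pot d N u x ≤ C * SS d N u R ∧ src N u x ≤ C * (R ^ α * SS d N u R ^ p) ∧
        R ^ α * SS d N u R ^ p ≤ C * src N u x := by
  have hk := kap_pos S.par
  have hc := S.c0
  obtain ⟨c1, hc1, C1, hC1, lo⟩ := S.exists_le_u
  obtain ⟨C2, hC2, up⟩ := S.exists_u_le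
  obtain ⟨C3, hC3, hf⟩ := S.exists_far_le
  obtain ⟨D, hD⟩ := named ((2 : ℝ) ^ d)
  have hD0 : 0 < D := by rw [hD]; positivity
  obtain ⟨Q1, hQ1⟩ := named (2 * C2 * D)
  obtain ⟨Q2, hQ2⟩ := named (2 / c1 * D)
  have q1 : 0 < Q1 := by rw [hQ1]; positivity
  have q2 : 0 < Q2 := by rw [hQ2]; positivity
  obtain ⟨Q3, hQ3⟩ := named (kap n d N * Q1 + C3 * D)
  obtain ⟨Q4, hQ4⟩ := named (c * 2 ^ |α| * Q1 ^ p)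
  obtain ⟨Q5, hQ5⟩ := named (2 ^ |α| * Q2 ^ p / c)
  have q3 : 0 < Q3 := by rw [hQ3]; positivity
  have q4 : 0 < Q4 := by rw [hQ4]; positivity
  have q5 : 0 < Q5 := by rw [hQ5]; positivity
  refine ⟨Q1 + Q2 + Q3 + Q4 + Q5, pos!, ?_⟩
  obtain ⟨R0, hR0⟩ := (((S.tendsto_AA h).eventually_ge_atTop (1 + 2 * C1 / c1)).and
    (eventually_ge_atTop 64)).exists_forall_of_atTop
  filter_upwards [eventually_ge_atTop (2 * R0), eventually_ge_atTop R0,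
    eventually_ge_atTop 64] with R hR hR' hR64
  have hC : 0 < 2 * C1 / c1 := pos!
  have hRp : 0 < R := lin!
  have main : ∀ r, R0 ≤ r → 0 < SS d N u r ∧ r ^ (-d) ≤ SS d N u r ∧
      C1 * r ^ (-d) ≤ c1 / 2 * SS d N u r := fun r hr => by
    obtain ⟨a1, a2⟩ := hR0 r hr
    have hr0 : 0 < r := lin!
    have e1 : r ^ (-d) * (1 + 2 * C1 / c1) ≤ SS d N u r := by
      rw [S.SS_eq hr0]
      nlinarith [S.BB_nonneg r, rpow_pos_of_pos hr0 (-d)]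
    have := rpow_pos_of_pos hr0 (-d)
    refine ⟨(pos! : 0 < r ^ (-d) * (1 + 2 * C1 / c1)).trans_le e1, by nlinarith, ?_⟩
    calc _ ≤ c1 / 2 * (r ^ (-d) * (1 + 2 * C1 / c1)) := by
          have : c1 / 2 * (r ^ (-d) * (1 + 2 * C1 / c1)) =
            c1 / 2 * r ^ (-d) + C1 * r ^ (-d) := by field_simp
          rw [this]; nlinarith
      _ ≤ _ := by gcongr
  have hs := (main R hR').1
  refine ⟨hR64, by linarith [(hR0 R hR').1], hs, fun x h1 h2 => ?_⟩
  have hx0 : 0 < ‖x‖ := lin!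
  obtain ⟨m1, m2, m3⟩ := main ‖x‖ lin!
  have s1 : SS d N u ‖x‖ ≤ D * SS d N u R := by
    have := S.SS_le_scale (lin! : 0 < R / 2) (t := 2) num!
    rw [← hD, show 2 * (R / 2) = R by ring] at this
    exact (S.SS_antitone lin! h1).trans this
  have s2 : SS d N u R ≤ D * SS d N u ‖x‖ := by
    have := S.SS_le_scale hRp (t := 2) num!
    rw [← hD] at this
    exact this.trans (mul_le_l (S.SS_antitone hx0 h2))
  have u0 := S.nonneg x lin!
  have u1 : u x ≤ Q1 * SS d N u R := by
    refine (up x lin!).trans ?_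
    rw [hQ1]
    nlinarith [mul_le_l m2 hC2.le, mul_le_l s1 hC2.le]
  have u2 : SS d N u R ≤ Q2 * u x := by
    have e : SS d N u ‖x‖ ≤ 2 / c1 * u x := by
      rw [div_mul_eq_mul_div, le_div_iff₀ hc1]
      nlinarith [lo x lin!]
    calc _ ≤ _ := s2
      _ ≤ D * (2 / c1 * u x) := by gcongr
      _ = _ := by rw [hQ2]; ring
  have u3 : pot d N u x ≤ Q3 * SS d N u R := by
    have e1 := S.rep_global (y := x) lin!
    have e2 := (abs_le.1 (hf x lin!)).1
    have e3 := mul_le_l (m2.trans s1) hC3.le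
    have e4 := mul_le_l u1 hk.le
    rw [hQ3]; linarith
  have et : ‖x‖ ^ α = (‖x‖ / R) ^ α * R ^ α := by
    rw [← mul_rpow pos! hRp.le, div_mul_cancel₀ _ hRp.ne']
  obtain ⟨t1, t2⟩ := rpow_two_bounds (t := ‖x‖ / R) (a := α)
    (by rw [le_div_iff₀ hRp]; linarith) (by rw [div_le_iff₀ hRp]; linarith)
  have hp : 0 ≤ p := by linarith [S.p1]
  have es : src N u x = c * (‖x‖ ^ α * u x ^ p) := by
    rw [src_eq lin!, S.eq x lin!]
  have u4 : src N u x ≤ Q4 * (R ^ α * SS d N u R ^ p) := by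
    rw [es, et, hQ4]
    calc _ ≤ c * (2 ^ |α| * R ^ α * (Q1 * SS d N u R) ^ p) := by gcongr
      _ = _ := by rw [mul_rpow q1.le hs.le]; ring
  have u5 : R ^ α * SS d N u R ^ p ≤ Q5 * src N u x := by
    rw [es, et, hQ5]
    have e1 : 1 ≤ 2 ^ |α| * (‖x‖ / R) ^ α := by
      calc (1 : ℝ) = 2 ^ |α| * 2 ^ (-|α|) := by rw [← rpow_add two_pos]; simp
        _ ≤ _ := by gcongr
    calc _ ≤ R ^ α * (Q2 * u x) ^ p * 1 := by rw [mul_one]; gcongr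
      _ ≤ R ^ α * (Q2 * u x) ^ p * (2 ^ |α| * (‖x‖ / R) ^ α) := by gcongr
      _ = _ := by rw [mul_rpow q2.le u0]; field_simp
  have v2 := S.src_nonneg x
  refine ⟨u1.trans ?_, u2.trans ?_, u3.trans ?_, u4.trans ?_, u5.trans ?_⟩ <;> gcongr <;> linarith

end Sol

open Real

lemma le_JK {n : ℕ} {d R : ℝ} (hd : 0 < d) (hR : 0 < R) {z : E n × E n} (h1 : ‖z.1‖ < R)
    (h2 : 2 * R ≤ ‖z.2‖) : ‖z.2‖ ^ (-d) ≤ 2 * 2 ^ (d + 2) * JK d R z := by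
  have hz : 0 < ‖z.2‖ := lin!
  have hw : ‖z.1 - z.2‖ ≤ 2 * ‖z.2‖ := (norm_sub_le _ _).trans lin!
  have hw0 : 0 < ‖z.1 - z.2‖ := by
    have := norm_sub_norm_le z.2 z.1
    rw [norm_sub_rev] at this
    linarith
  have e1 := rpow_anti hw0 hw (lin! : -d - 2 ≤ 0)
  rw [mul_rpow two_pos.le hz.le] at e1
  have e2 : ‖z.2‖ ^ (-d) = ‖z.2‖ ^ (-d - 2) * ‖z.2‖ ^ 2 := by
    rw [← rpow_two, ← rpow_add hz]; congr 1; ring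
  have e3 : (2 : ℝ) ^ (d + 2) * 2 ^ (-d - 2) = 1 := by
    rw [← rpow_add two_pos]; simp
  have e4 : ‖z.2‖ ^ 2 ≤ 2 * (‖z.2‖ ^ 2 - ‖z.1‖ ^ 2) := by nlinarith [norm_nonneg z.1]
  rw [JK, chi_zero hR h1.le, chi_one hR h2, e2]
  calc _ = 2 ^ (d + 2) * (2 ^ (-d - 2) * ‖z.2‖ ^ (-d - 2)) * ‖z.2‖ ^ 2 := by
        rw [← mul_assoc, e3, one_mul]
    _ ≤ 2 ^ (d + 2) * ‖z.1 - z.2‖ ^ (-d - 2) * (2 * (‖z.2‖ ^ 2 - ‖z.1‖ ^ 2)) := by gcongr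
    _ = _ := by ring

namespace Sol
variable {n : ℕ} {σ d N α p c : ℝ} {u : E n → ℝ}

set_option maxHeartbeats 1000000 in
lemma exists_estimates (S : Sol σ d N α p c u) (h : ¬ Integrable (src N u)) :
    ∃ C > 0, ∀ᶠ R in atTop, 64 ≤ R ∧ 1 ≤ AA N u R ∧ 0 < SS d N u R ∧
      (∀ x, R / 2 ≤ ‖x‖ → ‖x‖ ≤ 2 * R → SS d N u R ≤ C * u x) ∧
      AA N u (2 * R) ≤ AA N u R + C * (R ^ n * (R ^ α * SS d N u R ^ p)) ∧
      BB d N u R ≤ BB d N u (2 * R) + C * (R ^ (-d) * (R ^ n * (R ^ α * SS d N u R ^ p))) ∧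
      0 ≤ WW N u R ∧ WW N u R ≤ C * (R ^ n * (R ^ α * SS d N u R ^ p) * SS d N u R) ∧
      JJ d N u R ≤ C * (R ^ d * SS d N u R ^ 2) ∧ AA N u R * BB d N u (2 * R) ≤ C * JJ d N u R ∧
      ∀ R₁ R₂, 16 ≤ R₁ → 2 * R₁ ≤ R → 2 * R ≤ R₂ →
        R ^ n * (R ^ α * SS d N u R ^ p) * SS d N u R ≤ C * TT N u R₁ R₂ := by
  have P := S.par
  have hd := P.d0
  have := P.nontriv
  obtain ⟨C, hC, hcmp⟩ := S.exists_comparable h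
  obtain ⟨Cd, hCd, hdchi⟩ := exists_dchi_bound (n := n)
  obtain ⟨CJ, hCJ, hJ⟩ := S.exists_JJ_le
  obtain ⟨_, _, hpo⟩ := S.exists_pohozaev
  obtain ⟨v, hv⟩ := named (volume.real (ball (0 : E n) 1))
  have hv0 : 0 < v := by
    rw [hv]; exact ENNReal.toReal_pos (measure_ball_pos _ _ one_pos).ne' measure_ball_lt_top.ne
  have vol : ∀ r, 0 < r → volume.real (ball (0 : E n) r) = r ^ n * v := fun r hr => by
    rw [← Measure.addHaar_real_closedBall_eq_addHaar_real_ball,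
      Measure.addHaar_real_closedBall _ _ hr.le, finrank_euclideanSpace_fin, hv]
  obtain ⟨Q1, hQ1⟩ := named (C * (2 ^ n * v))
  obtain ⟨Q2, hQ2⟩ := named (Cd * (C * Q1))
  obtain ⟨Q3, hQ3⟩ := named (CJ * (C * 2 ^ d + 1))
  obtain ⟨Q4, hQ4⟩ := named (2 * (2 : ℝ) ^ (d + 2))
  obtain ⟨Q5, hQ5⟩ := named (C * C / v)
  have q1 : 0 < Q1 := by rw [hQ1]; positivity
  have q2 : 0 < Q2 := by rw [hQ2]; positivity
  have q3 : 0 < Q3 := by rw [hQ3]; positivity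
  have q4 : 0 < Q4 := by rw [hQ4]; positivity
  have q5 : 0 < Q5 := by rw [hQ5]; positivity
  refine ⟨C + Q1 + Q2 + Q3 + Q4 + Q5, pos!, ?_⟩
  filter_upwards [hcmp] with R hR
  obtain ⟨hR64, hA1, hs, hx⟩ := hR
  have hR0 : 0 < R := lin!
  obtain ⟨s, hs'⟩ := named (SS d N u R)
  obtain ⟨Y, hY⟩ := named (R ^ α * s ^ p)
  rw [← hs'] at hs hx ⊢
  rw [← hY] at hx ⊢
  have hY0 : 0 ≤ Y := by rw [hY]; positivity
  have vb : volume.real (ball (0 : E n) (2 * R)) = 2 ^ n * v * R ^ n := by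
    rw [vol _ lin!]; ring
  have hsub : ball (0 : E n) R ⊆ ball 0 (2 * R) := ball_subset_ball lin!
  have ann_fin : volume (ball (0 : E n) (2 * R) \ ball 0 R) < ⊤ :=
    (measure_mono sdiff_subset).trans_lt measure_ball_lt_top
  have hm : ∀ x ∈ ball (0 : E n) (2 * R) \ ball 0 R, R ≤ ‖x‖ ∧ ‖x‖ < 2 * R := fun x hx =>
    ⟨not_lt.1 fun h => hx.2 (mem_ball_zero_iff.2 h), mem_ball_zero_iff.1 hx.1⟩
  have bd : ∀ (f : E n → ℝ) (D : ℝ), 0 ≤ D → (∀ x, R ≤ ‖x‖ → ‖x‖ < 2 * R → |f x| ≤ D) →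
      ∫ x in ball 0 (2 * R) \ ball 0 R, f x ≤ D * (2 ^ n * v * R ^ n) := fun f D hD hf => by
    refine (le_norm_self _).trans ((norm_setIntegral_le_of_norm_le_const ann_fin
      fun x hx => hf x (hm x hx).1 (hm x hx).2).trans ?_)
    rw [← vb]
    exact mul_le_l (measureReal_mono sdiff_subset measure_ball_lt_top.ne) hD
  have hg : ∀ x, R ≤ ‖x‖ → ‖x‖ ≤ 2 * R → src N u x ≤ C * Y ∧ 0 ≤ u x ∧ u x ≤ C * s :=
    fun x h1 h2 => by
      obtain ⟨e1, -, -, e2, -⟩ := hx x lin! h2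
      exact ⟨e2, S.nonneg x lin!, e1⟩
  have g0 := S.src_nonneg
  have eA : AA N u (2 * R) ≤ AA N u R + Q1 * (R ^ n * Y) := by
    have e1 := bd (src N u) (C * Y) pos! fun x h1 h2 => by
      rw [abs_of_nonneg (g0 x)]; exact (hg x h1 h2.le).1
    rw [setIntegral_sdiff measurableSet_ball (S.src_integrableOn _) hsub] at e1
    rw [AA, AA, hQ1]; linarith
  have eB : BB d N u R ≤ BB d N u (2 * R) + Q1 * (R ^ (-d) * (R ^ n * Y)) := by
    have e1 := bd (fun x => ‖x‖ ^ (-d) * src N u x) (R ^ (-d) * (C * Y)) pos!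
      fun x h1 h2 => by
        rw [abs_of_nonneg (mul_nonneg pos! (g0 x))]
        exact mul_le_mul (rpow_anti hR0 h1) (hg x h1 h2.le).1
          (g0 x) pos!
    rw [← compl_sdiff_compl, setIntegral_sdiff measurableSet_ball.compl
      (S.src_tail_integrable hR0) (compl_subset_compl.2 hsub)] at e1
    rw [BB, BB, hQ1]; linarith
  have W0 : ∀ x, 0 ≤ dchi R x * (u x * src N u x) := fun x => by
    by_cases h1 : ‖x‖ < R
    · simp [dchi_zero hR0 (Or.inl h1)]
    · exact mul_nonneg (hdchi R hR0 x).1 (mul_nonneg (S.nonneg x lin!) (g0 x))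
  have eW : WW N u R ≤ Q2 * (R ^ n * Y * s) := by
    calc _ ≤ ∫ x, (ball (0 : E n) (2 * R)).indicator (fun _ => Cd * (C * s * (C * Y))) x := by
          refine integral_mono_of_nonneg (.of_forall W0)
            ((integrable_indicator_iff measurableSet_ball).2
              (integrableOn_const measure_ball_lt_top.ne)) ?_
          filter_upwards [compl_mem_ae_iff.2 (Measure.addHaar_sphere volume (0 : E n) (2 * R))]
            with x hx
          by_cases h1 : x ∈ ball (0 : E n) (2 * R)
          · rw [indicator_of_mem h1]
            have h1 := mem_ball_zero_iff.1 h1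
            by_cases h2 : ‖x‖ < R
            · simp only [dchi_zero hR0 (Or.inl h2), zero_mul]; positivity
            · obtain ⟨k1, k2, k3⟩ := hg x (not_lt.1 h2) h1.le
              exact mul_le_mul (hdchi R hR0 x).2 (mul_le_mul k3 k1 (g0 x) pos!)
                (mul_nonneg k2 (g0 x)) hCd.le
          · rw [indicator_of_notMem h1]
            have : 2 * R < ‖x‖ := lt_of_le_of_ne (not_lt.1 fun h => h1 (mem_ball_zero_iff.2 h))
              fun h => hx (mem_sphere_zero_iff_norm.2 h.symm)
            simp [dchi_zero hR0 (Or.inr this)]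
      _ = _ := by
          rw [integral_indicator_const _ measurableSet_ball, vb, smul_eq_mul, hQ2, hQ1]; ring
  have aS : ∀ r, 0 < r → r ^ d * SS d N u r = AA N u r + r ^ d * BB d N u r := fun r hr => by
    rw [S.SS_eq hr, mul_add, ← mul_assoc, ← rpow_add hr]; simp
  have eA2 : AA N u (2 * R) ≤ 2 ^ d * (R ^ d * s) := by
    have e1 := aS (2 * R) lin!
    have e2 := S.SS_antitone hR0 (lin! : R ≤ 2 * R)
    rw [← hs'] at e2
    rw [← mul_assoc, ← mul_rpow two_pos.le hR0.le]
    have e3 := rpow_pos_of_pos (lin! : 0 < 2 * R) d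
    nlinarith [S.BB_nonneg (2 * R)]
  have eJ : JJ d N u R ≤ Q3 * (R ^ d * s ^ 2) := by
    have e1 : ∫ x, ann N u R x * pot d N u x ≤ C * s * AA N u (2 * R) := by
      rw [AA, ← integral_const_mul, ← integral_indicator measurableSet_ball]
      refine integral_mono (S.ann_pot lin!).1 ((integrable_indicator_iff
        measurableSet_ball).2 ((S.src_integrableOn _).const_mul _)) fun x => ?_
      by_cases h1 : x ∈ ball (0 : E n) (2 * R) \ ball 0 (R / 2)
      · have h2 : R / 2 ≤ ‖x‖ := not_lt.1 fun h => h1.2 (mem_ball_zero_iff.2 h)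
        simp only [ann, indicator_of_mem h1, indicator_of_mem h1.1]
        rw [mul_comm]
        exact mul_le_r (hx x h2 (mem_ball_zero_iff.1 h1.1).le).2.2.1 (g0 x)
      · simp only [ann, indicator_of_notMem h1, zero_mul]
        exact indicator_nonneg (fun y _ => mul_nonneg pos! (g0 y)) x
    have e2 : AA N u (R / 2) ≤ AA N u R := setIntegral_mono_set (S.src_integrableOn _)
      (.of_forall g0) (ball_subset_ball lin!).eventuallyLE
    have e3 := aS R hR0
    rw [← hs'] at e3
    have hRd := rpow_pos_of_pos hR0 d
    have b0 := S.BB_nonneg R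
    have e4 : BB d N u R ≤ s := by nlinarith
    refine (hJ R lin!).2.trans ?_
    calc _ ≤ CJ * (C * s * (2 ^ d * (R ^ d * s)) + R ^ d * s * s) :=
          mul_le_l (add_le_add (e1.trans (by gcongr))
            (mul_le_mul (e2.trans (by nlinarith)) e4 b0 pos!))
      _ = _ := by rw [hQ3]; ring
  have eAB : AA N u R * BB d N u (2 * R) ≤ Q4 * JJ d N u R := by
    rw [AA, BB, ← integral_indicator measurableSet_ball,
      ← integral_indicator measurableSet_ball.compl, ← integral_prod_mul, JJ, ← integral_const_mul]
    refine integral_mono (Integrable.mul_prod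
      ((integrable_indicator_iff measurableSet_ball).2 (S.src_integrableOn _))
      ((integrable_indicator_iff measurableSet_ball.compl).2
        (S.src_tail_integrable lin!))) ((hJ R lin!).1.const_mul _) fun z => ?_
    have k0 : 0 ≤ Q4 * (JK d R z * (src N u z.1 * src N u z.2)) :=
      mul_nonneg q4.le (mul_nonneg (JK_nonneg hR0 z) (mul_nonneg (g0 _) (g0 _)))
    by_cases h1 : z.1 ∈ ball (0 : E n) R
    · by_cases h2 : z.2 ∈ (ball (0 : E n) (2 * R))ᶜ
      · simp only [indicator_of_mem h1, indicator_of_mem h2]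
        have := le_JK hd hR0 (mem_ball_zero_iff.1 h1)
          (not_lt.1 fun h => h2 (mem_ball_zero_iff.2 h))
        calc _ = ‖z.2‖ ^ (-d) * (src N u z.1 * src N u z.2) := by ring
          _ ≤ Q4 * JK d R z * (src N u z.1 * src N u z.2) := by
            rw [hQ4]; exact mul_le_r this (mul_nonneg (g0 _) (g0 _))
          _ = _ := by ring
      · simpa only [indicator_of_notMem h2, mul_zero] using k0
    · simpa only [indicator_of_notMem h1, zero_mul] using k0
  have eT : ∀ R₁ R₂, 16 ≤ R₁ → 2 * R₁ ≤ R → 2 * R ≤ R₂ →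
      R ^ n * Y * s ≤ Q5 * TT N u R₁ R₂ := fun R₁ R₂ h1 h2 h3 => by
    have hi := (hpo R₁ R₂ h1 lin!).1
    have e1 : s / C * (Y / C) * volume.real (ball (0 : E n) (2 * R) \ ball 0 R) ≤ TT N u R₁ R₂ := by
      refine (setIntegral_ge_of_const_le_real (measurableSet_ball.diff measurableSet_ball)
        ann_fin.ne (fun x hx' => ?_) hi.integrableOn).trans
          (setIntegral_le_integral hi (.of_forall fun x => ?_))
      · obtain ⟨k1, k2⟩ := hm x hx'
        obtain ⟨-, k3, -, -, k4⟩ := hx x lin! k2.le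
        rw [chi_one lin! lin!, chi_zero lin! lin!, sub_zero,
          one_mul]
        exact mul_le_mul ((div_le_iff₀' hC).2 k3) ((div_le_iff₀' hC).2 k4) pos!
          (S.nonneg x lin!)
      · obtain ⟨⟨k1, -⟩, k2, -⟩ := chi_sub x (lin! : 0 < R₁) (lin! : R₁ ≤ R₂)
        by_cases k3 : ‖x‖ ≤ R₁
        · simp [k2 k3]
        · exact mul_nonneg k1 (mul_nonneg (S.nonneg x lin!) (g0 x))
    rw [measureReal_sdiff hsub measurableSet_ball measure_ball_lt_top.ne, vb, vol R hR0] at e1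
    have e2 : (2 : ℝ) ≤ 2 ^ n := le_self_pow₀ one_le_two (by have := P.hn; lia)
    have e3 : R ^ n * v ≤ 2 ^ n * v * R ^ n - R ^ n * v := by
      nlinarith [mul_pos (pow_pos hR0 n) hv0]
    calc _ = Q5 * (s / C * (Y / C) * (R ^ n * v)) := by rw [hQ5]; field_simp
      _ ≤ Q5 * (s / C * (Y / C) * (2 ^ n * v * R ^ n - R ^ n * v)) := by gcongr
      _ ≤ _ := by gcongr
  have j0 := S.JJ_nonneg hR0
  refine ⟨hR64, hA1, hs, fun x h1 h2 => (hx x h1 h2).2.1.trans ?_, eA.trans ?_, eB.trans ?_,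
      integral_nonneg W0,
    eW.trans ?_, eJ.trans ?_, eAB.trans ?_, fun R₁ R₂ h1 h2 h3 => (eT R₁ R₂ h1 h2 h3).trans ?_⟩
  · exact mul_le_r lin! (S.nonneg x lin!)
  iterate 2 gcongr; linarith
  iterate 3 gcongr; linarith
  have : 0 ≤ TT N u R₁ R₂ := nonneg_of_mul_nonneg_right
    ((pos! : 0 ≤ R ^ n * Y * s).trans (eT R₁ R₂ h1 h2 h3)) q5
  gcongr; linarith

end Sol

open Real

/-- Inequalities satisfied by the normalised interior and exterior masses at dyadic radii. -/
structure Dy (q r p C M : ℝ) (K : ℕ) (x y s : ℕ → ℝ) : Prop where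
  q0 : 0 < q
  q1 : q < 1
  p1 : 1 < p
  C0 : 0 < C
  x0 : ∀ k, 0 ≤ x k
  y0 : ∀ k, 0 ≤ y k
  sum : ∀ k, s k = x k + y k
  pos : ∀ k, K ≤ k → 0 < s k
  le : ∀ k, K ≤ k → s k ≤ M
  x1 : ∀ k, K ≤ k → x (k + 1) ≤ q * (x k + C * s k ^ p)
  x2 : ∀ k, K ≤ k → q * x k ≤ x (k + 1)
  y1 : ∀ k, K ≤ k → r * (y k - C * s k ^ p) ≤ y (k + 1)
  s1 : ∀ k, K ≤ k → s k ≤ C * s (k + 1)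
  s2 : ∀ k, K ≤ k → s (k + 1) ≤ C * s k
  unb : ∀ D m, ∃ k, m ≤ k ∧ D * q ^ k < x k

namespace Dy
variable {q r p C M θ φ s₀ : ℝ} {K : ℕ} {x y s : ℕ → ℝ}

lemma exists_low (H : Dy q r p C M K x y s) (hθ : q < θ) (hθ1 : θ < 1) (h0 : 0 < φ) (hφ : φ < 1)
    (hr : 1 < r * φ) : ∃ s₀ > 0, ∀ k, K ≤ k → s k < s₀ →
      (x k ≤ y k → y k ≤ φ * y (k + 1) ∧ x (k + 1) ≤ y (k + 1)) ∧
      (y k ≤ x k → x (k + 1) ≤ θ * x k) := by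
  have q0 := H.q0
  have C0 := H.C0
  obtain ⟨η, hη, hη1, hη2⟩ : ∃ η > 0, q * (1 + η) ≤ θ ∧ 1 ≤ (1 - η) * (r * φ) := by
    have h1 : 0 < θ / q - 1 := by rw [sub_pos, lt_div_iff₀ q0]; linarith
    refine ⟨_, lt_min h1 (sub_pos.2 (inv_lt_one_of_one_lt₀ hr)), ?_, ?_⟩
    · rw [← le_div_iff₀' q0]; linarith [min_le_left (θ / q - 1) (1 - (r * φ)⁻¹)]
    · rw [← inv_le_iff_one_le_mul₀ lin!]
      linarith [min_le_right (θ / q - 1) (1 - (r * φ)⁻¹)]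
  have hp : 0 < p - 1 := by linarith [H.p1]
  refine ⟨(η / (2 * C)) ^ (p - 1)⁻¹, pos!, fun k hk hs => ?_⟩
  have s0 := H.pos k hk
  have e1 : C * s k ^ p ≤ η / 2 * s k := by
    have := rpow_le_rpow s0.le hs.le hp.le
    rw [rpow_inv_rpow pos! hp.ne', le_div_iff₀ pos!] at this
    rw [show p = (p - 1) + 1 by ring, rpow_add_one s0.ne', ← mul_assoc]
    gcongr
    linarith
  have x1 := H.x1 k hk
  have y1 := H.y1 k hk
  have x0 := H.x0 k
  have y0 := H.y0 k
  rw [H.sum k] at e1 x1 y1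
  refine ⟨fun h => ?_, fun h => ?_⟩
  · have e2 : C * (x k + y k) ^ p ≤ η * y k := by nlinarith
    have e3 : r * ((1 - η) * y k) ≤ y (k + 1) := by nlinarith
    have e5 : φ * y (k + 1) ≤ y (k + 1) := by nlinarith [H.y0 (k + 1)]
    exact ⟨(by nlinarith), by nlinarith⟩
  · have e2 : C * (x k + y k) ^ p ≤ η * x k := by nlinarith
    nlinarith

lemma y_le (h0 : 0 < φ)
    (hlow : ∀ k, K ≤ k → s k < s₀ → x k ≤ y k → y k ≤ φ * y (k + 1) ∧ x (k + 1) ≤ y (k + 1))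
    {m : ℕ} (hm : K ≤ m) (hxy : x m ≤ y m) (j : ℕ) (hs : ∀ i < j, s (m + i) < s₀) :
    y m ≤ φ ^ j * y (m + j) ∧ x (m + j) ≤ y (m + j) := by
  induction j with
  | zero => simpa using hxy
  | succ j ih =>
    obtain ⟨h1, h2⟩ := ih fun i hi => hs i (by lia)
    obtain ⟨h3, h4⟩ := hlow (m + j) (by lia) (hs j (by lia)) h2
    refine ⟨h1.trans ?_, h4⟩
    rw [pow_succ, mul_assoc]
    gcongr
    exact h3

lemma x_le (hθ : 0 < θ) {m : ℕ} (j : ℕ) (h : ∀ i < j, x (m + i + 1) ≤ θ * x (m + i)) :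
    x (m + j) ≤ θ ^ j * x m := by
  induction j with
  | zero => simp
  | succ j ih =>
    refine (h j (by lia)).trans ?_
    rw [pow_succ', mul_assoc]
    gcongr
    exact ih fun i hi => h i (by lia)

lemma exists_high (H : Dy q r p C M K x y s) (hθ : q < θ) (hθp : θ ^ p < q) (h0 : 0 < φ)
    (hφ : φ < 1) (hlow : ∀ k, K ≤ k → s k < s₀ →
      (x k ≤ y k → y k ≤ φ * y (k + 1) ∧ x (k + 1) ≤ y (k + 1)) ∧
      (y k ≤ x k → x (k + 1) ≤ θ * x k)) {k : ℕ} (hk : K ≤ k) : ∃ m, k ≤ m ∧ s₀ ≤ s m := by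
  by_contra! hs
  have q0 := H.q0
  have θ0 : 0 < θ := q0.trans hθ
  have hM : 0 < M := (H.pos k hk).trans_le (H.le k hk)
  by_cases hxy : ∃ m, k ≤ m ∧ x m ≤ y m
  · obtain ⟨m, hm, h⟩ := hxy
    have h1 : Tendsto (fun j : ℕ => φ ^ j * M) atTop (𝓝 (0 * M)) :=
      (tendsto_pow_atTop_nhds_zero_of_lt_one h0.le hφ).mul_const M
    have h2 := ge_of_tendsto' h1 fun j => (y_le h0 (fun k h1 h2 => (hlow k h1 h2).1) (hk.trans hm)
      h j fun i _ => hs _ (by lia)).1.trans (mul_le_l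
        (by linarith [H.le (m + j) (by lia), H.sum (m + j), H.x0 (m + j)]))
    linarith [H.pos m (hk.trans hm), H.sum m]
  · push Not at hxy
    have e1 : ∀ j, x (k + j) ≤ θ ^ j * M := fun j =>
      (x_le θ0 j fun i _ => (hlow (k + i) (by lia) (hs _ (by lia))).2 (hxy _ (by lia)).le).trans
        (mul_le_l (by linarith [H.le k hk, H.sum k, H.y0 k]))
    obtain ⟨ρ, hρ⟩ := named (θ ^ p / q)
    have ρ1 : ρ < 1 := by rw [hρ]; exact (div_lt_one q0).2 hθp
    have ρ0 : 0 < ρ := by rw [hρ]; positivity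
    have C0 := H.C0
    obtain ⟨D, hD⟩ := named (C * (2 * M) ^ p / (1 - ρ))
    have hD0 : 0 ≤ D := by rw [hD]; have := sub_pos.2 ρ1; positivity
    have hD1 : C * (2 * M) ^ p = D * (1 - ρ) := by
      rw [hD, div_mul_cancel₀ _ (sub_pos.2 ρ1).ne']
    have e2 : ∀ j, x (k + j) ≤ q ^ j * (M + D * (1 - ρ ^ j)) := fun j => by
      induction j with
      | zero => simpa using e1 0
      | succ j ih =>
        have h1 : s (k + j) ≤ 2 * M * θ ^ j := by
          linarith [e1 j, H.sum (k + j), hxy (k + j) (by lia)]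
        have h2 : s (k + j) ^ p ≤ (2 * M) ^ p * (q ^ j * ρ ^ j) := by
          refine (rpow_le_rpow (H.pos _ (by lia)).le h1 (by linarith [H.p1])).trans_eq ?_
          rw [mul_rpow pos! pos!, ← mul_pow, hρ, mul_div_cancel₀ _ q0.ne',
            rpow_pow_comm θ0.le]
        calc _ ≤ _ := H.x1 (k + j) (by lia)
          _ ≤ q * (q ^ j * (M + D * (1 - ρ ^ j)) + C * ((2 * M) ^ p * (q ^ j * ρ ^ j))) := by gcongr
          _ = _ := by rw [← mul_assoc C, hD1]; ring
    obtain ⟨m, hm, h⟩ := H.unb ((M + D) / q ^ k) k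
    obtain ⟨j, rfl⟩ := Nat.exists_eq_add_of_le hm
    have e3 : q ^ j * (M + D * (1 - ρ ^ j)) ≤ q ^ j * (M + D) := by
      gcongr; nlinarith [pow_pos ρ0 j]
    rw [pow_add, ← mul_assoc, div_mul_cancel₀ _ pos!] at h
    linarith [e2 j]

/-- Below the threshold the sequence first decays and then grows at definite rates. -/
lemma exists_valley (H : Dy q r p C M K x y s) (hθ : q < θ) (hθ1 : θ < 1) (hθp : θ ^ p < q)
    (h0 : 0 < φ) (hφ : φ < 1) (hr : 1 < r * φ) : ∃ s₀ > 0, ∃ D > 0, ∀ k', ∃ k'', ∀ k, k'' ≤ k →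
      s k < s₀ → ∃ k₀ i j, k' ≤ k₀ ∧ s₀ ≤ s k₀ ∧ s₀ ≤ s (k₀ + i + j) ∧ s (k₀ + i) ≤ D * s k ∧
        s (k₀ + i) ≤ D * θ ^ i ∧ s (k₀ + i) ≤ D * φ ^ j ∧
        (s₀ ≤ D * s (k₀ + i) ∨ s (k₀ + i) ≤ D * x (k₀ + i) ∧ s (k₀ + i) ≤ D * y (k₀ + i)) := by
  obtain ⟨s₀, hs₀, hlow⟩ := H.exists_low hθ hθ1 h0 hφ hr
  have high := fun k => H.exists_high hθ hθp h0 hφ hlow (k := k)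
  have q0 := H.q0
  have C0 := H.C0
  have θ0 : 0 < θ := q0.trans hθ
  have hM : 0 < M := (H.pos K le_rfl).trans_le (H.le K le_rfl)
  obtain ⟨D, hD⟩ : ∃ D, D = 2 + C + M / θ + 2 * M + 2 * C + 2 * C / q + 2 * C * M / θ ^ 2 :=
    ⟨_, rfl⟩
  refine ⟨s₀, hs₀, D, by rw [hD]; positivity, fun k' => ?_⟩
  obtain ⟨l, hl, hsl⟩ := high (max K k') (le_max_left _ _)
  refine ⟨l, fun k hk hs => ?_⟩
  obtain ⟨k₀, hk₀⟩ := named (Nat.findGreatest (fun i => s₀ ≤ s i) k)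
  have g1 : l ≤ k₀ := by rw [hk₀]; exact Nat.le_findGreatest hk hsl
  have g2 : s₀ ≤ s k₀ := by rw [hk₀]; exact Nat.findGreatest_spec (P := fun i => s₀ ≤ s i) hk hsl
  have g3 : k₀ ≤ k := by rw [hk₀]; exact Nat.findGreatest_le k
  have hk1 := high k (by lia)
  classical
  obtain ⟨k₁, hk₁⟩ := named (Nat.find hk1)
  have g4 : k ≤ k₁ ∧ s₀ ≤ s k₁ := by rw [hk₁]; exact Nat.find_spec hk1
  have g5 : ∀ i, k₀ < i → i < k₁ → s i < s₀ := fun i h1 h2 => by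
    by_cases h3 : i ≤ k
    · exact not_le.1 (Nat.findGreatest_is_greatest (P := fun i => s₀ ≤ s i) (hk₀ ▸ h1) h3)
    · exact not_le.1 fun h => Nat.find_min hk1 (hk₁ ▸ h2) ⟨by lia, h⟩
  have g6 : k₀ < k := lt_of_le_of_ne g3 fun h => by rw [h] at g2; linarith
  have g7 : k < k₁ := lt_of_le_of_ne g4.1 fun h => by rw [h] at hs; linarith
  have hm : ∃ m, k₀ < m ∧ (m = k₁ ∨ x m ≤ y m) := ⟨k₁, by lia, Or.inl rfl⟩
  obtain ⟨m, hm'⟩ := named (Nat.find hm)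
  have m1 : k₀ < m ∧ (m = k₁ ∨ x m ≤ y m) := by rw [hm']; exact Nat.find_spec hm
  have m2 : m ≤ k₁ := by rw [hm']; exact Nat.find_le ⟨by lia, Or.inl rfl⟩
  have m3 : ∀ i, k₀ < i → i < m → y i ≤ x i := fun i h1 h2 =>
    (not_le.1 fun h => Nat.find_min hm (hm' ▸ h2) ⟨h1, Or.inr h⟩).le
  obtain ⟨i, rfl⟩ := Nat.exists_eq_add_of_le m1.1
  obtain ⟨j, rfl⟩ := Nat.exists_eq_add_of_le m2
  have dec : ∀ a b, k₀ < a → a + b < k₀.succ + i → x (a + b) ≤ θ ^ b * x a := fun a b h1 h2 =>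
    x_le θ0 b fun e he => (hlow (a + e) (by lia) (g5 _ (by lia) (by lia))).2 (m3 _ (by lia) (by lia))
  have inc : x (k₀.succ + i) ≤ y (k₀.succ + i) → ∀ e ≤ j,
      y (k₀.succ + i) ≤ φ ^ e * y (k₀.succ + i + e) := fun h e he =>
    (y_le h0 (fun k h1 h2 => (hlow k h1 h2).1) (by lia) h e fun f hf => g5 _ (by lia) (by lia)).1
  have xM : ∀ k, K ≤ k → x k ≤ M ∧ y k ≤ M := fun k hk => by
    constructor <;> linarith [H.le k hk, H.sum k, H.x0 k, H.y0 k]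
  have sx := H.sum
  have x0 := H.x0
  have y0 := H.y0
  have sm := H.pos (k₀.succ + i) (by lia)
  have prev : i ≠ 0 → s (k₀.succ + i) ≤ 2 * C * x (k₀ + i) := fun hi => by
    have e1 := H.s2 (k₀ + i) (by lia)
    have e2 := m3 (k₀ + i) (by lia) (by lia)
    rw [show k₀.succ + i = k₀ + i + 1 by lia]
    nlinarith [sx (k₀ + i)]
  have last : j = 0 ∨ s (k₀.succ + i) ≤ 2 * y (k₀.succ + i) := by
    by_cases hj : j = 0
    · exact Or.inl hj
    · right; linarith [sx (k₀.succ + i), m1.2.resolve_left (by lia)]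
  have up : ∀ {a Q z : ℝ}, a ≤ Q * z → 0 ≤ z → Q ≤ D → a ≤ D * z := fun h1 h2 h3 =>
    h1.trans (mul_le_r h3 h2)
  have p1 : 0 < M / θ := pos!
  have p2 : 0 < 2 * C / q := pos!
  have p3 : 0 < 2 * C * M / θ ^ 2 := pos!
  have ek : k₀ + (i + 1) = k₀.succ + i := by lia
  refine ⟨k₀, i + 1, j, (le_max_right _ _).trans (hl.trans g1), g2, ek ▸ g4.2, ?_, ?_, ?_, ?_⟩ <;>
    rw [ek]
  · by_cases h : k₀.succ + i ≤ k
    · obtain ⟨e, rfl⟩ := Nat.exists_eq_add_of_le h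
      have e1 := inc (m1.2.resolve_left (by lia)) e (by lia)
      have e2 := last.resolve_left (by lia)
      have e3 : φ ^ e ≤ 1 := pow_le_one₀ h0.le hφ.le
      have e4 := y0 (k₀.succ + i + e)
      have e5 := x0 (k₀.succ + i + e)
      exact up (Q := 2) (by nlinarith [sx (k₀.succ + i + e)]) (H.pos _ (by lia)).le lin!
    · obtain ⟨e, he⟩ := Nat.exists_eq_add_of_le (show k ≤ k₀ + i by lia)
      have e1 := prev (by lia)
      have e2 := dec k e (by lia) (by lia)
      rw [he] at e1
      have e3 : θ ^ e ≤ 1 := pow_le_one₀ θ0.le hθ1.le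
      have e4 : x (k + e) ≤ s k := by nlinarith [sx k, x0 k, y0 k]
      exact up (Q := 2 * C) (e1.trans (by gcongr)) (H.pos _ (by lia)).le lin!
  · by_cases hi : i = 0
    · subst hi
      exact up (Q := M / θ) ((H.le _ (by lia)).trans_eq
          (by rw [zero_add, pow_one, div_mul_cancel₀ _ θ0.ne'])) pos!
        lin!
    · obtain ⟨e, rfl⟩ := Nat.exists_eq_succ_of_ne_zero hi
      refine up (Q := 2 * C * M / θ ^ 2) ((prev hi).trans ?_) pos! lin!
      rw [show k₀ + e.succ = k₀ + 1 + e by lia]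
      calc _ ≤ 2 * C * (θ ^ e * M) := by
            gcongr
            exact (dec (k₀ + 1) e (by lia) (by lia)).trans (by gcongr; exact (xM _ (by lia)).1)
        _ = _ := by rw [show e.succ + 1 = e + 2 by lia, pow_add]; field_simp
  · refine up (Q := 2 * M) ?_ pos! lin!
    by_cases hj : j = 0
    · subst hj; have := H.le (k₀.succ + i) (by lia); rw [pow_zero]; linarith
    · have e2 := last.resolve_left hj
      have e1 := (inc (m1.2.resolve_left (by lia)) j le_rfl).trans
        (mul_le_l (xM _ (by lia)).2)
      linarith
  · by_cases hj : j = 0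
    · left
      subst hj
      exact up (Q := 1) (by rw [one_mul]; exact g4.2) sm.le lin!
    by_cases hi : i = 0
    · left
      subst hi
      exact up (Q := C) (g2.trans (H.s1 k₀
          ((le_max_left _ _).trans (hl.trans g1)))) sm.le lin!
    · right
      refine ⟨up (Q := 2 * C / q) ((prev hi).trans ?_) (x0 _) lin!,
        up (last.resolve_left hj) (y0 _) lin!⟩
      have := H.x2 (k₀ + i) (by lia)
      rw [show k₀.succ + i = k₀ + i + 1 by lia, div_mul_eq_mul_div, le_div_iff₀ q0]
      nlinarith

end Dy

open Real

namespace Sol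
variable {n : ℕ} {σ d N α p c : ℝ} {u : E n → ℝ}

lemma exists_dyadic (S : Sol σ d N α p c u) (h : ¬ Integrable (src N u)) {β : ℝ}
    (hβ : β = (2 * σ + α) / (p - 1)) : ∃ C > 0, ∃ M K, ∃ x y s : ℕ → ℝ,
    Dy (2 ^ (β - d)) (2 ^ β) p C M K x y s ∧ ∀ k, K ≤ k → ∀ R : ℝ, R = 2 ^ k →
      16 ≤ R ∧ s k = R ^ β * SS d N u R ∧ (∀ x, R / 2 ≤ ‖x‖ → ‖x‖ ≤ 2 * R → SS d N u R ≤ C * u x) ∧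
      R ^ (d - 2 * β) = (2 ^ (d - 2 * β)) ^ k ∧
      R ^ (d - 2 * β) * (x k * y k) = AA N u R * BB d N u R ∧
      AA N u R * BB d N u R ≤ C * (JJ d N u R + R ^ (d - 2 * β) * s k ^ (p + 1)) ∧
      0 ≤ WW N u R ∧ WW N u R ≤ C * (R ^ (d - 2 * β) * s k ^ (p + 1)) ∧
      JJ d N u R ≤ C * (R ^ (d - 2 * β) * s k ^ 2) ∧ BB d N u R ≤ R ^ (d - 2 * β) * s k ^ 2 ∧
      ∀ R₁ R₂, 16 ≤ R₁ → 2 * R₁ ≤ R → 2 * R ≤ R₂ →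
        R ^ (d - 2 * β) * s k ^ (p + 1) ≤ C * TT N u R₁ R₂ := by
  have P := S.par
  have := P.nontriv
  have hp := S.p1
  have β0 : 0 < β := hβ ▸ S.beta_pos
  have βd : β < d := hβ ▸ S.beta_lt
  have βp : β * p = 2 * σ + α + β := by
    rw [hβ]; field_simp [(lin! : p - 1 ≠ 0)]; ring
  obtain ⟨C, hC, hest⟩ := S.exists_estimates h
  obtain ⟨C₁, hC₁, hup⟩ := S.upper_bound
  rw [← hβ] at hup
  obtain ⟨K, hK⟩ := ((tendsto_pow_atTop_atTop_of_one_lt one_lt_two).eventually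
    hest).exists_forall_of_atTop
  obtain ⟨C', hC'⟩ := named (C + 2 ^ d)
  have d2 : (0 : ℝ) < 2 ^ d := pos!
  have CC : C ≤ C' := lin!
  have C0 : 0 < C' := lin!
  have ht : ∀ (k : ℕ) (a : ℝ), ((2 : ℝ) ^ (k + 1)) ^ a = 2 ^ a * (2 ^ k) ^ a := fun k a => by
    rw [pow_succ', mul_rpow two_pos.le pos!]
  refine ⟨C', C0, C * C₁, K, fun k => ((2 : ℝ) ^ k) ^ (β - d) * AA N u (2 ^ k),
    fun k => ((2 : ℝ) ^ k) ^ β * BB d N u (2 ^ k), fun k => ((2 : ℝ) ^ k) ^ β * SS d N u (2 ^ k),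
    ?_, ?_⟩
  · have key : ∀ k, K ≤ k → (((2 : ℝ) ^ k) ^ β * SS d N u (2 ^ k)) ^ p =
        (2 ^ k) ^ (β - d) * ((2 ^ k) ^ n * ((2 ^ k) ^ α * SS d N u (2 ^ k) ^ p)) := fun k hk => by
      have hR : (0 : ℝ) < 2 ^ k := pos!
      rw [mul_rpow pos! (hK k hk).2.2.1.le, ← rpow_mul hR.le, βp,
        ← rpow_natCast (2 ^ k : ℝ) n, ← mul_assoc, ← mul_assoc, ← rpow_add hR,
        ← rpow_add hR]
      congr 2
      linarith [P.hd]
    have sum : ∀ k, ((2 : ℝ) ^ k) ^ β * SS d N u (2 ^ k) =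
        ((2 : ℝ) ^ k) ^ (β - d) * AA N u (2 ^ k) + ((2 : ℝ) ^ k) ^ β * BB d N u (2 ^ k) :=
      fun k => by
        rw [S.SS_eq pos!, sub_eq_add_neg, rpow_add pos!]; ring
    have nn : ∀ k, K ≤ k → 0 ≤ (((2 : ℝ) ^ k) ^ β * SS d N u (2 ^ k)) ^ p := fun k hk => by
      have := (hK k hk).2.2.1; positivity
    refine ⟨pos!, rpow_lt_one_of_one_lt_of_neg one_lt_two lin!, hp, C0,
      fun k => mul_nonneg pos! (S.AA_nonneg _),
      fun k => mul_nonneg pos! (S.BB_nonneg _), sum,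
      fun k hk => mul_pos pos! (hK k hk).2.2.1, fun k hk => ?_, fun k hk => ?_,
      fun k hk => ?_, fun k hk => ?_, fun k hk => ?_, fun k hk => ?_, fun D m => ?_⟩
    · obtain ⟨R1, -, -, hu, -⟩ := hK k hk
      obtain ⟨z, hz⟩ := exists_norm_eq (E n) (pos! : (0 : ℝ) ≤ 2 ^ k)
      have hR : (0 : ℝ) < 2 ^ k := pos!
      have e1 := hu z lin! lin!
      have e2 := hup z lin!
      rw [hz] at e2
      calc _ ≤ ((2 : ℝ) ^ k) ^ β * (C * (C₁ * (2 ^ k) ^ (-β))) := by gcongr; exact e1.trans (by gcongr)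
        _ = C * C₁ * ((2 ^ k) ^ β * (2 ^ k) ^ (-β)) := by ring
        _ = _ := by rw [← rpow_add hR]; simp
    · have e1 := (hK k hk).2.2.2.2.1
      rw [← pow_succ'] at e1
      rw [ht, mul_assoc]
      refine mul_le_l ?_
      refine (mul_le_l e1).trans ?_
      nlinarith [key k hk, mul_le_r CC (nn k hk)]
    · rw [ht, ← mul_assoc]
      exact mul_le_l (setIntegral_mono_set (S.src_integrableOn _)
        (.of_forall S.src_nonneg) (ball_subset_ball
          (pow_le_pow_right₀ one_le_two (by lia))).eventuallyLE)
    · have e1 := (hK k hk).2.2.2.2.2.1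
      rw [← pow_succ'] at e1
      rw [ht, mul_assoc]
      refine mul_le_l ?_
      have e2 := mul_le_l e1 (pos! : (0 : ℝ) ≤ (2 ^ k) ^ β)
      have e3 := key k hk
      rw [sub_eq_add_neg, rpow_add pos!] at e3
      nlinarith [mul_le_r CC (nn k hk)]
    · have e1 := S.SS_le_scale (pos! : (0 : ℝ) < 2 ^ k) one_le_two
      rw [← pow_succ'] at e1
      have e2 : (1 : ℝ) ≤ 2 ^ β := one_le_rpow one_le_two β0.le
      have e3 := S.SS_nonneg (pos! : (0 : ℝ) < 2 ^ (k + 1))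
      rw [ht]
      calc _ ≤ ((2 : ℝ) ^ k) ^ β * (2 ^ d * 1 * SS d N u (2 ^ (k + 1))) := by rw [mul_one]; gcongr
        _ ≤ ((2 : ℝ) ^ k) ^ β * (C' * 2 ^ β * SS d N u (2 ^ (k + 1))) := by gcongr; linarith
        _ = _ := by ring
    · rw [ht, mul_assoc]
      have e2 : (2 : ℝ) ^ β ≤ 2 ^ d := rpow_le_rpow_of_exponent_le one_le_two βd.le
      have e3 := S.SS_antitone pos! (pow_le_pow_right₀ one_le_two (by lia) :
        (2 : ℝ) ^ k ≤ 2 ^ (k + 1))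
      have e4 := S.SS_nonneg (pos! : (0 : ℝ) < 2 ^ (k + 1))
      gcongr
      linarith
    · obtain ⟨k, hk⟩ := (((S.tendsto_AA h).comp (tendsto_pow_atTop_atTop_of_one_lt
        one_lt_two)).eventually_gt_atTop D).and (eventually_ge_atTop m) |>.exists
      refine ⟨k, hk.2, ?_⟩
      rw [rpow_pow_comm two_pos.le, mul_comm]
      exact mul_lt_mul_of_pos_left hk.1 pos!
  · rintro k hk R hR
    have hK := hK k hk
    simp only [← hR] at hK ⊢
    obtain ⟨R1, A1, s0, hu, -, eB, W0, eW, eJ, eAB, eT⟩ := hK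
    have hR0 : 0 < R := lin!
    obtain ⟨s, hs⟩ := named (R ^ β * SS d N u R)
    obtain ⟨G, hG⟩ := named (R ^ n * (R ^ α * SS d N u R ^ p))
    rw [← hs]
    rw [← hG] at eB eW eT
    have es : R ^ (d - 2 * β) * s ^ 2 = R ^ d * SS d N u R ^ 2 := by
      rw [hs, mul_pow, ← mul_assoc, ← rpow_mul_natCast hR0.le, ← rpow_add hR0]
      congr 2; push_cast; ring
    have eG : R ^ (d - 2 * β) * s ^ (p + 1) = G * SS d N u R := by
      rw [hs, mul_rpow pos! s0.le, ← mul_assoc, ← rpow_mul hR0.le,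
        ← rpow_add hR0, hG, ← rpow_natCast, ← mul_assoc, ← rpow_add hR0,
        rpow_add_one s0.ne', ← mul_assoc]
      congr 3; linarith [P.hd]
    have j0 := S.JJ_nonneg hR0
    have b0 := S.BB_nonneg R
    have G0 : 0 ≤ G := by rw [hG]; positivity
    rw [es, eG]
    have hS := S.SS_eq hR0
    have hA : R ^ (-d) * AA N u R ≤ SS d N u R := lin!
    have hdd : R ^ d * R ^ (-d) = 1 := by rw [← rpow_add hR0]; simp
    have R2 : 1 ≤ R ^ d * SS d N u R := by
      rw [← hdd]; gcongr; nlinarith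
    refine ⟨lin!, trivial, fun x h1 h2 => (hu x h1 h2).trans ?_, ?_, ?_, ?_, W0,
      eW.trans (by gcongr), eJ.trans (by gcongr), ?_, fun R₁ R₂ h1 h2 h3 =>
        (eT R₁ R₂ h1 h2 h3).trans ?_⟩
    · exact mul_le_r CC (S.nonneg x lin!)
    · rw [hR, rpow_pow_comm two_pos.le]
    · have : R ^ (d - 2 * β) * (R ^ (β - d) * R ^ β) = 1 := by
        rw [← rpow_add hR0, ← rpow_add hR0]; ring_nf; simp
      linear_combination (AA N u R * BB d N u R) * this
    · calc _ ≤ AA N u R * (BB d N u (2 * R) + C * (R ^ (-d) * G)) := by gcongr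
        _ = AA N u R * BB d N u (2 * R) + C * (R ^ (-d) * AA N u R * G) := by ring
        _ ≤ C' * JJ d N u R + C' * (SS d N u R * G) := by
          exact add_le_add (eAB.trans (by gcongr)) (by gcongr)
        _ = _ := by ring
    · rw [pow_two, ← mul_assoc]; nlinarith [mul_nonneg
        (rpow_pos_of_pos hR0 (-d)).le (S.AA_nonneg R)]
    · have : 0 ≤ TT N u R₁ R₂ := nonneg_of_mul_nonneg_right ((mul_nonneg G0 s0.le).trans
        (eT R₁ R₂ h1 h2 h3)) hC
      gcongr

end Sol

open Real

lemma exists_lb_of_sq {ρ θ D c : ℝ} (hρ : 0 < ρ) (h : θ ^ 2 < ρ) (hρ1 : ρ ≤ 1) (hc : 0 < c) :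
    ∃ δ > 0, ∀ (L : ℕ) (x : ℝ), 0 ≤ x → x ≤ D * θ ^ L → c * ρ ^ L ≤ x ^ 2 → δ ≤ x := by
  have h1 : Tendsto (fun L : ℕ => D ^ 2 * (θ ^ 2 / ρ) ^ L) atTop (𝓝 (D ^ 2 * 0)) :=
    (tendsto_pow_atTop_nhds_zero_of_lt_one pos! ((div_lt_one hρ).2 h)).const_mul _
  rw [mul_zero] at h1
  obtain ⟨m, hm⟩ := (h1.eventually_lt_const hc).exists_forall_of_atTop
  refine ⟨√(c * ρ ^ m), pos!, fun L x h0 h1 h2 => sqrt_le_iff.2 ⟨h0, ?_⟩⟩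
  by_cases hL : m ≤ L
  · have e1 := hm L hL
    rw [div_pow, mul_div_assoc', div_lt_iff₀ pos!, ← pow_mul, mul_comm 2, pow_mul] at e1
    nlinarith
  · exact (mul_le_l (pow_le_pow_of_le_one hρ.le hρ1 (by lia))).trans h2

namespace Dy
variable {q r p C M ρ ω τ l c : ℝ} {K : ℕ} {x y s A B J W : ℕ → ℝ} {T : ℕ → ℕ → ℝ}

lemma exists_lower (H : Dy q r p C M K x y s) (r1 : 1 < r) (hqr : ρ * (q * r) = 1)
    (hω : 0 < ω) (hl : 0 < l) (hc : 0 < c) (τ0 : ρ < 1 → 0 < τ) (τ1 : ρ = 1 → τ = 0)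
    (τ2 : 1 < ρ → τ < 0) (hA : Tendsto A atTop atTop)
    (hK : ∀ k, K ≤ k → ρ ^ k * (x k * y k) = A k * B k ∧
      A k * B k ≤ C * (J k + ρ ^ k * s k ^ (p + 1)) ∧ 0 ≤ W k ∧
      W k ≤ C * (ρ ^ k * s k ^ (p + 1)) ∧ 0 ≤ J k ∧ J k ≤ C * (ρ ^ k * s k ^ 2) ∧
      0 ≤ B k ∧ B k ≤ ρ ^ k * s k ^ 2)
    (hT : ∀ i j k, K ≤ i → i < j → j < k → ρ ^ j * s j ^ (p + 1) ≤ C * T i k)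
    (po : ∀ i j, K ≤ i → i ≤ j → |ω * (W i - W j) + τ * T i j - l * (J i - J j)| ≤ c * B i) :
    ∃ δ > 0, ∃ m, ∀ k, m ≤ k → δ ≤ s k := by
  have q0 := H.q0
  have q1 := H.q1
  have hp := H.p1
  have hC := H.C0
  have r0 : 0 < r⁻¹ := pos!
  have ρ0 : 0 < ρ := by
    have : 0 < q * r := pos!
    by_contra! h; nlinarith
  have rr : r * r⁻¹ = 1 := mul_inv_cancel₀ pos!
  obtain ⟨θ, ⟨⟨hθ1, hθp⟩, hθ2⟩, hθ⟩ := (((((eventually_lt_nhds q1).and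
    ((continuousAt_rpow_const q p (Or.inl q0.ne')).eventually_lt continuousAt_const
      (by simpa using rpow_lt_rpow_of_exponent_gt q0 q1 hp : q ^ p < q))).and
    ((continuous_pow 2).continuousAt.eventually_lt continuousAt_const
      (by rw [pow_two]; gcongr; linarith : q ^ 2 < q * r))).filter_mono nhdsWithin_le_nhds).and
    (eventually_mem_nhdsWithin (s := Ioi q))).exists
  obtain ⟨φ, ⟨hφ1, hφ2⟩, hφ⟩ := ((((eventually_lt_nhds (inv_lt_one_of_one_lt₀ r1)).and
    ((continuous_pow 2).continuousAt.eventually_lt continuousAt_const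
      (by
        rw [inv_pow, inv_lt_iff_one_lt_mul₀ pos!, ← hqr, pow_two]
        gcongr
        linarith : r⁻¹ ^ 2 < ρ))).filter_mono nhdsWithin_le_nhds).and
    (eventually_mem_nhdsWithin (s := Ioi r⁻¹))).exists
  have φ0 : 0 < φ := r0.trans hφ
  obtain ⟨s₀, hs₀, D, hD, hval⟩ := H.exists_valley hθ hθ1 hθp φ0 hφ1
    (by rw [← rr]; exact mul_lt_mul_of_pos_left hφ lin!)
  by_contra! hlow
  suffices hm : ∃ δ > 0, ∃ k', K ≤ k' ∧ ∀ k₀ i j, k' ≤ k₀ → s₀ ≤ s k₀ → s₀ ≤ s (k₀ + i + j) →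
      s (k₀ + i) ≤ D * θ ^ i → s (k₀ + i) ≤ D * φ ^ j → (s₀ ≤ D * s (k₀ + i) ∨
        s (k₀ + i) ≤ D * x (k₀ + i) ∧ s (k₀ + i) ≤ D * y (k₀ + i)) → δ ≤ s (k₀ + i) by
    obtain ⟨δ, hδ, k', -, hm⟩ := hm
    obtain ⟨k'', hk''⟩ := hval k'
    obtain ⟨k, hk, hs⟩ := hlow (min s₀ (δ / D)) pos! k''
    obtain ⟨k₀, i, j, v1, v2, v3, v4, v5, v6, v7⟩ := hk'' k hk (hs.trans_le (min_le_left _ _))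
    have e1 := hs.trans_le (min_le_right _ _)
    rw [lt_div_iff₀' hD] at e1
    linarith [hm k₀ i j v1 v2 v3 v5 v6 v7]
  have pw : ∀ k, s₀ ≤ s k → s₀ ^ (p + 1) ≤ s k ^ (p + 1) := fun k h1 => by gcongr
  rcases lt_trichotomy ρ 1 with ρ1 | ρ1 | ρ1
  · have τ0 := τ0 ρ1
    obtain ⟨δ, hδ, hf⟩ := exists_lb_of_sq (D := D) (c := τ * s₀ ^ (p + 1) /
      (C * (c + l * C))) ρ0 hφ2 ρ1.le pos!
    refine ⟨min δ s₀, pos!, K, le_rfl, fun k₀ i j h1 _ h3 _ h5 _ => ?_⟩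
    by_cases hj : j = 0
    · subst hj; exact (min_le_right _ _).trans h3
    refine (min_le_left _ _).trans (hf j _ (H.pos _ (by lia)).le h5 ?_)
    obtain ⟨-, -, a3, -, -, a4, -, a5⟩ := hK (k₀ + i) (by lia)
    have e1 : ∀ m, τ * (ρ ^ (k₀ + i + j) * s (k₀ + i + j) ^ (p + 1)) / C ≤
        c * B (k₀ + i) + l * J (k₀ + i) +
          ω * (C * (ρ ^ (m + (k₀ + i + j + 1)) * M ^ (p + 1))) := fun m => by
      obtain ⟨-, -, -, c3, c6, -⟩ := hK (m + (k₀ + i + j + 1)) (by lia)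
      have c4 := hT (k₀ + i) (k₀ + i + j) (m + (k₀ + i + j + 1)) (by lia) (by lia) (by lia)
      have c5 := (abs_le.1 (po (k₀ + i) (m + (k₀ + i + j + 1)) (by lia) (by lia))).2
      have c8 : s (m + (k₀ + i + j + 1)) ^ (p + 1) ≤ M ^ (p + 1) := by
        have := (H.pos (m + (k₀ + i + j + 1)) (by lia)).le
        gcongr; exact H.le _ (by lia)
      have c9 : ω * W (m + (k₀ + i + j + 1)) ≤
          ω * (C * (ρ ^ (m + (k₀ + i + j + 1)) * M ^ (p + 1))) := by
        gcongr; exact c3.trans (by gcongr)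
      have c10 : τ * (ρ ^ (k₀ + i + j) * s (k₀ + i + j) ^ (p + 1)) / C ≤
          τ * T (k₀ + i) (m + (k₀ + i + j + 1)) := by
        rw [div_le_iff₀ hC, mul_assoc, mul_comm _ C]; gcongr
      have c11 := mul_nonneg hω.le a3
      have c12 := mul_nonneg hl.le c6
      linarith
    have e2 := ge_of_tendsto' (((((tendsto_pow_atTop_nhds_zero_of_lt_one ρ0.le ρ1).comp
      (tendsto_add_atTop_nat (k₀ + i + j + 1))).mul_const (M ^ (p + 1))).const_mul C
        |>.const_mul ω).const_add (c * B (k₀ + i) + l * J (k₀ + i))) e1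
    have e3 : τ * (ρ ^ (k₀ + i) * (ρ ^ j * s₀ ^ (p + 1))) / C ≤
        (ρ ^ (k₀ + i) * s (k₀ + i) ^ 2) * (c + l * C) := by
      have b1 := mul_le_l a4 hl.le
      have b2 := mul_le_l a5 hc.le
      have b3 : τ * (ρ ^ (k₀ + i) * (ρ ^ j * s₀ ^ (p + 1))) / C ≤
          τ * (ρ ^ (k₀ + i + j) * s (k₀ + i + j) ^ (p + 1)) / C := by
        rw [pow_add _ _ j, mul_assoc (ρ ^ (k₀ + i))]
        gcongr
      linarith
    rw [div_mul_eq_mul_div, div_le_iff₀ pos!]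
    rw [div_le_iff₀ hC] at e3
    refine le_of_mul_le_mul_left ?_ (pow_pos ρ0 (k₀ + i))
    linarith
  · subst ρ1
    obtain ⟨k', hk'⟩ := (hA.eventually_ge_atTop (2 * (C * c / l))).exists_forall_of_atTop
    obtain ⟨Q, hQ⟩ := named (D ^ 2 * (2 * (C * (ω * C / l + 1))))
    have Q0 : 0 < Q := by rw [hQ]; positivity
    have hJ : ∀ k, K ≤ k → l * J k ≤ ω * W k + c * B k := fun k hk => by
      refine le_of_forall_pos_le_add fun ε hε => ?_
      obtain ⟨m, hm, hs⟩ := hlow (√(ε / (l * C))) pos! k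
      obtain ⟨-, -, a1, -, -, a2, -⟩ := hK m (by lia)
      have a3 := (abs_le.1 (po k m hk hm)).1
      rw [τ1 rfl] at a3
      have a4 : s m ^ 2 ≤ ε / (l * C) :=
        (pow_le_pow_left₀ (H.pos m (by lia)).le hs.le 2).trans_eq (sq_sqrt pos!)
      rw [le_div_iff₀ pos!] at a4
      rw [one_pow, one_mul] at a2
      have a5 := mul_le_l a2 hl.le
      have a6 := mul_nonneg hω.le a1
      linarith
    refine ⟨min (s₀ / D) ((Q⁻¹) ^ (p - 1)⁻¹), pos!, max K k', le_max_left _ _,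
      fun k₀ i j h1 _ _ _ _ h6 => ?_⟩
    rw [min_le_iff]
    refine h6.imp (fun h => (div_le_iff₀' hD).2 h) fun ⟨h6, h7⟩ => ?_
    obtain ⟨a1, a2, -, a3, -, -, a4, -⟩ := hK (k₀ + i) (by lia)
    have a5 := hJ (k₀ + i) (by lia)
    have a6 := mul_le_r (hk' (k₀ + i) (by lia)) a4
    have a7 := H.pos (k₀ + i) (by lia)
    generalize k₀ + i = m at *
    rw [one_pow, one_mul] at a1 a2 a3
    obtain ⟨X, hX⟩ := named (s m ^ (p + 1))
    rw [← hX] at a2 a3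
    have b1 : C * J m ≤ C * (ω * C / l * X + c / l * B m) := by
      gcongr
      refine le_of_mul_le_mul_left ?_ hl
      have : l * (ω * C / l * X + c / l * B m) = ω * (C * X) + c * B m := by field_simp
      rw [this]
      exact a5.trans (by gcongr)
    have b2 : s m ^ 2 ≤ Q * X := by
      have e1 : A m * B m ≤ 2 * (C * (ω * C / l + 1)) * X := by
        have : C * (c / l * B m) = C * c / l * B m := by ring
        linarith
      calc s m ^ 2 = s m * s m := pow_two _
        _ ≤ D * x m * (D * y m) := by gcongr; exact a7.le.trans h6
        _ = D ^ 2 * (x m * y m) := by ring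
        _ ≤ D ^ 2 * (2 * (C * (ω * C / l + 1)) * X) := by rw [a1]; gcongr
        _ = _ := by rw [hQ]; ring
    rw [rpow_inv_le_iff_of_pos pos! a7.le lin!, inv_le_iff_one_le_mul₀ Q0]
    have b3 : X = s m ^ 2 * s m ^ (p - 1) := by
      rw [hX, ← rpow_natCast, ← rpow_add a7]; congr 1; push_cast; ring
    refine le_of_mul_le_mul_left ?_ (pow_pos a7 2)
    rw [b3] at b2
    linarith
  · have τ0 := neg_pos.2 (τ2 ρ1)
    have er : ρ⁻¹ = q * r := DivisionMonoid.inv_eq_of_mul _ _ hqr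
    obtain ⟨δ, hδ, hf⟩ := exists_lb_of_sq (D := D) (c := -τ * s₀ ^ (p + 1) / (2 * C * (l * C)))
      (ρ := ρ⁻¹) pos! (er ▸ hθ2) (inv_le_one_of_one_le₀ ρ1.le) pos!
    obtain ⟨k', hk'⟩ := ((tendsto_pow_atTop_atTop_of_one_lt ρ1).eventually_ge_atTop
      ((c * B K + ω * W K) * (2 * C) / (-τ * s₀ ^ (p + 1)))).exists_forall_of_atTop
    refine ⟨min δ s₀, pos!, max (K + 1) k', by lia, fun k₀ i j h1 h2 _ h4 _ _ => ?_⟩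
    by_cases hi : i = 0
    · subst hi; exact (min_le_right _ _).trans h2
    refine (min_le_left _ _).trans (hf i _ (H.pos _ (by lia)).le h4 ?_)
    have e1 := hk' k₀ (by lia)
    rw [div_le_iff₀ pos!] at e1
    obtain ⟨-, -, a1, -, -, a2, -⟩ := hK (k₀ + i) (by lia)
    obtain ⟨-, -, -, -, b1, -⟩ := hK K le_rfl
    have e2 := (abs_le.1 (po K (k₀ + i) le_rfl (by lia))).1
    have e3 := hT K k₀ (k₀ + i) le_rfl (by lia) (by lia)
    have e4 := mul_le_l (((mul_le_l (pw k₀ h2)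
      (pow_pos ρ0 k₀).le)).trans e3) τ0.le
    have e5 := mul_le_l a2 (mul_pos hl hC).le
    have e6 : -τ * (ρ ^ k₀ * s₀ ^ (p + 1)) ≤ ρ ^ (k₀ + i) * s (k₀ + i) ^ 2 * (2 * C * (l * C)) := by
      have := mul_le_l e2 hC.le
      have := mul_nonneg hC.le (mul_nonneg hω.le a1)
      have := mul_nonneg hC.le (mul_nonneg hl.le b1)
      linarith
    rw [div_mul_eq_mul_div, div_le_iff₀ pos!, inv_pow, mul_inv_le_iff₀ pos!]
    refine le_of_mul_le_mul_left ?_ (pow_pos ρ0 k₀)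
    rw [pow_add] at e6
    linarith

end Dy

namespace Sol
variable {n : ℕ} {σ d N α p c : ℝ} {u : E n → ℝ}

lemma exists_lower (S : Sol σ d N α p c u) (h : ¬ Integrable (src N u)) :
    ∃ C > 0, ∃ R, ∀ x, R < ‖x‖ → C * ‖x‖ ^ (-((2 * σ + α) / (p - 1))) ≤ u x := by
  obtain ⟨β, hβ⟩ := named ((2 * σ + α) / (p - 1))
  rw [← hβ]
  have hd := S.par.d0
  have hp := S.p1
  have β0 : 0 < β := hβ ▸ S.beta_pos
  have hκ := kap_pos S.par
  obtain ⟨C, hC, M, K, x, y, s, H, hK⟩ := S.exists_dyadic h hβ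
  obtain ⟨Cp, hCp, hpo⟩ := S.exists_pohozaev
  have hτ : ((n + α) / (p + 1) - d / 2) = (2 * β - d) * ((p - 1) / (2 * (p + 1))) := by
    have : β * (p - 1) = 2 * σ + α := by rw [hβ, div_mul_cancel₀]; linarith
    have e : (n : ℝ) = d + 2 * σ := by linarith [S.par.hd]
    rw [e]; field_simp; linear_combination -2 * this
  rw [hτ] at hpo
  have p0 : 0 < (p - 1) / (2 * (p + 1)) := div_pos lin! lin!
  have mono : ∀ {a b : ℕ}, a ≤ b → (2 : ℝ) ^ a ≤ 2 ^ b := pow_le_pow_right₀ one_le_two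
  obtain ⟨δ, hδ, m, hm⟩ := H.exists_lower (ρ := 2 ^ (d - 2 * β)) (ω := kap n d N / (p + 1))
    (l := d / 4) (c := Cp) (τ := kap n d N * ((2 * β - d) * ((p - 1) / (2 * (p + 1)))))
    (A := fun k => AA N u (2 ^ k)) (B := fun k => BB d N u (2 ^ k))
    (W := fun k => WW N u (2 ^ k)) (J := fun k => JJ d N u (2 ^ k))
    (T := fun i j => TT N u (2 ^ i) (2 ^ j))
    (one_lt_rpow one_lt_two β0)
    (by rw [← rpow_add two_pos, ← rpow_add two_pos]; ring_nf; simp)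
    pos! pos! hCp
    (fun h => by
      have := (rpow_lt_one_iff_of_pos two_pos).1 h
      have : 0 < 2 * β - d := by grind
      positivity)
    (fun h => by
      have := congrArg log h
      rw [log_rpow two_pos, log_one, mul_eq_zero_iff_right pos!] at this
      rw [(lin! : 2 * β - d = 0)]; ring)
    (fun h => by
      have := (one_lt_rpow_iff_of_pos two_pos).1 h
      have : 2 * β - d < 0 := by grind
      exact mul_neg_of_pos_of_neg hκ (mul_neg_of_neg_of_pos this p0))
    ((S.tendsto_AA h).comp (tendsto_pow_atTop_atTop_of_one_lt one_lt_two))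
    (fun k hk => by
      obtain ⟨h1, -, -, h2, h3, h4, h5, h6, h7, h8, -⟩ := hK k hk _ rfl
      rw [h2] at h3 h4 h6 h7 h8
      exact ⟨h3, h4, h5, h6, S.JJ_nonneg pos!, h7, S.BB_nonneg _, h8⟩)
    (fun i j k h1 h2 h3 => by
      obtain ⟨-, -, -, e2, -, -, -, -, -, -, e3⟩ := hK j (by lia) _ rfl
      rw [← e2]
      exact e3 _ _ (hK i h1 _ rfl).1 (by rw [← pow_succ']; exact mono h2)
        (by rw [← pow_succ']; exact mono h3))
    (fun i j h1 h2 => by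
      convert (hpo _ _ (hK i h1 _ rfl).1 (mono h2)).2 using 3
      ring)
  refine ⟨δ / C, pos!, 2 ^ max m K, fun z hz => ?_⟩
  obtain ⟨k, hk, hk'⟩ := exists_nat_pow_near
    ((one_le_pow₀ one_le_two).trans hz.le) (one_lt_two (α := ℝ))
  have hk1 : max m K < k + 1 := (pow_lt_pow_iff_right₀ one_lt_two).1 (hz.trans hk')
  obtain ⟨R1, es, hu, -⟩ := hK k (by lia) _ rfl
  have e1 := hm k (by lia)
  have hR : (0 : ℝ) < 2 ^ k := pos!
  have e2 := hu z lin! (by rw [← pow_succ']; exact hk'.le)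
  have e3 := rpow_anti hR hk (lin! : -β ≤ 0)
  rw [div_mul_eq_mul_div, div_le_iff₀' hC]
  refine le_trans ?_ e2
  calc _ ≤ s k * (2 ^ k) ^ (-β) := mul_le_mul e1 e3 pos! (hδ.le.trans e1)
    _ = (2 ^ k) ^ β * (2 ^ k) ^ (-β) * SS d N u (2 ^ k) := by rw [es]; ring
    _ = _ := by rw [← rpow_add hR]; simp

end Sol

open Real

lemma Adm.tail_integrable {n : ℕ} {σ d N : ℝ} (P : Par n σ d N) {u : E n → ℝ} {U : Set (E n)}
    (hu : Adm N u U) (x : E n) {ε : ℝ} (hε : 0 < ε) :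
    Integrable ({y | ε < ‖y‖}.indicator fun y => (u x - u (x - y)) * ‖y‖ ^ (-N)) := by
  have hA : MeasurableSet {y : E n | ε < ‖y‖} := measurableSet_lt measurable_const measurable_norm
  have hN := P.N0
  obtain ⟨D, hD⟩ := named ((1 + ‖x‖) / ε + 1)
  have D0 : 0 < D := by rw [hD]; positivity
  have h1 : ∀ y ∈ {y : E n | ε < ‖y‖}, 1 + ‖x - y‖ ≤ D * ‖y‖ := fun y hy => by
    have e1 := norm_sub_le x y
    have e2 : (1 + ‖x‖) / ε * ε ≤ (1 + ‖x‖) / ε * ‖y‖ := by gcongr; exact hy.le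
    rw [div_mul_cancel₀ _ hε.ne'] at e2
    rw [hD]
    linarith
  have h2 : ∀ y ∈ {y : E n | ε < ‖y‖}, ‖y‖ ^ (-N) ≤ D ^ N * (1 + ‖x - y‖) ^ (-N) := fun y hy => by
    have := rpow_anti pos! (h1 y hy) (lin! : -N ≤ 0)
    rw [mul_rpow D0.le (hε.trans hy).le, rpow_neg D0.le, inv_mul_le_iff₀ pos!] at this
    exact this
  rw [integrable_indicator_iff hA]
  have h4 : IntegrableOn (fun y => u (x - y) * ‖y‖ ^ (-N)) {y | ε < ‖y‖} := by
    refine ((hu.int.comp_sub_left x).const_mul (D ^ N)).integrableOn.mono'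
      ((hu.meas.comp (measurable_const.sub measurable_id)).mul
          (ker_measurable _)).aestronglyMeasurable ?_
    filter_upwards [ae_restrict_mem hA] with y hy
    rw [norm_mul, norm_eq_abs, norm_of_nonneg pos!, mul_left_comm]
    gcongr
    exact h2 y hy
  exact ((((ker_integrable_compl P.nN hε).mono_set fun y hy => by simpa using hy.le).const_mul
      (u x)).sub h4).congr (.of_forall fun y => by simp [sub_mul])

lemma Adm.tendsto_Lop {n : ℕ} {σ d N : ℝ} (P : Par n σ d N) {u : E n → ℝ} {U : Set (E n)}
    (hu : Adm N u U) {x : E n} (hx : x ∈ U) :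
    Tendsto (fun ε : ℝ => ∫ ξ in {ξ : E n | ε < dist x ξ}, (u x - u ξ) / dist x ξ ^ N)
      (𝓝[>] 0) (𝓝 (Lop N u x / 2)) := by
  have hA : ∀ ε : ℝ, MeasurableSet {y : E n | ε < ‖y‖} := fun ε =>
    measurableSet_lt measurable_const measurable_norm
  have key : ∀ ε : ℝ, 0 < ε → ∫ ξ in {ξ : E n | ε < dist x ξ}, (u x - u ξ) / dist x ξ ^ N =
      (∫ y, {y | ε < ‖y‖}.indicator (Lint N u x) y) / 2 := fun ε hε => by
    obtain ⟨g, hg⟩ := named ({y | ε < ‖y‖}.indicator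
      fun y => (u x - u (x - y)) * ‖y‖ ^ (-N))
    have gi : Integrable g := hg ▸ hu.tail_integrable P x hε
    have e1 : ∫ ξ in {ξ : E n | ε < dist x ξ}, (u x - u ξ) / dist x ξ ^ N = ∫ y, g y := by
      have : MeasurableSet {ξ : E n | ε < dist x ξ} :=
        measurableSet_lt measurable_const (measurable_const.dist measurable_id)
      rw [← integral_sub_left_eq_self g volume x, ← integral_indicator this]
      congr 1 with ξ
      simp only [hg, indicator, mem_ofPred_eq, dist_eq_norm, sub_sub_cancel,
        rpow_neg (norm_nonneg _), div_eq_mul_inv]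
    have e2 : ∫ y, {y | ε < ‖y‖}.indicator (Lint N u x) y = (∫ y, g y) + ∫ y, g (-y) := by
      rw [← integral_add gi gi.comp_neg]
      congr 1 with y
      simp only [hg, indicator, mem_ofPred_eq, norm_neg, sub_neg_eq_add, Lint, D2, smul_eq_mul]
      split_ifs <;> ring
    rw [e1, e2, integral_neg_eq_self]; ring
  have hL := hu.Lint_integrable P hx
  refine ((tendsto_integral_filter_of_dominated_convergence (fun y => ‖Lint N u x y‖)
    (.of_forall fun ε => hL.1.indicator (hA ε))
    (.of_forall fun ε => .of_forall fun y => norm_indicator_le_norm_self _ _)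
    hL.norm (.of_forall fun y => ?_)).div_const 2).congr' ?_
  · refine tendsto_const_nhds.congr' ?_
    by_cases hy : y = 0
    · exact .of_forall fun ε => by simp [hy, indicator, Lint, D2, two_mul]
    · filter_upwards [mem_nhdsWithin_of_mem_nhds (Iio_mem_nhds (norm_pos_iff.2 hy))] with ε hε
      exact (indicator_of_mem (s := {y : E n | ε < ‖y‖}) hε _).symm
  · filter_upwards [self_mem_nhdsWithin] with ε hε using (key ε hε).symm

end

/-- **Theorem 1.3(2)**: classification of isolated singularities at infinity. -/
theorem exterior_classification
    (n : ℕ) (σ α p : ℝ) (hn : 2 ≤ n) (hσ : σ ∈ Set.Ioo (0 : ℝ) 1)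
    (hα : -(2 * σ) < α)
    (hp₁ : ((n : ℝ) + α) / ((n : ℝ) - 2 * σ) < p)
    (hp₂ : p < ((n : ℝ) + 2 * σ) / ((n : ℝ) - 2 * σ))
    (u : EuclideanSpace ℝ (Fin n) → ℝ)
    (hu : ContDiffOn ℝ 2 u {x : EuclideanSpace ℝ (Fin n) | 1 < ‖x‖})
    (hL : MemLsigma n σ u)
    (hnonneg : ∀ x : EuclideanSpace ℝ (Fin n), 1 < ‖x‖ → 0 ≤ u x)
    (heq : FracLapEq n σ u {x : EuclideanSpace ℝ (Fin n) | 1 < ‖x‖}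
      (fun x => ‖x‖ ^ α * u x ^ p)) :
    (∃ C > (0 : ℝ), ∃ R > (1 : ℝ), ∀ x : EuclideanSpace ℝ (Fin n), R < ‖x‖ →
        u x ≤ C * ‖x‖ ^ (-((n : ℝ) - 2 * σ))) ∨
      (∃ C₁ > (0 : ℝ), ∃ C₂ > (0 : ℝ), ∃ R > (1 : ℝ),
        ∀ x : EuclideanSpace ℝ (Fin n), R < ‖x‖ →
          C₁ * ‖x‖ ^ (-((2 * σ + α) / (p - 1))) ≤ u x ∧
          u x ≤ C₂ * ‖x‖ ^ (-((2 * σ + α) / (p - 1)))) := by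
  have P : Par n σ (n - 2 * σ) (n + 2 * σ) := ⟨hn, hσ.1, hσ.2, rfl, rfl⟩
  have hd := P.d0
  have hΩ : IsOpen {x : E n | 1 < ‖x‖} := isOpen_lt continuous_const continuous_norm
  obtain ⟨v, vm, hv, hva⟩ : ∃ v : E n → ℝ, Measurable v ∧ (∀ x, 1 < ‖x‖ → v x = u x) ∧
      v =ᵐ[volume] u := by
    classical
    obtain ⟨w, wm, hw⟩ := hL.1.aestronglyMeasurable.aemeasurable
    have h1 := hu.continuousOn.measurable_piecewise (g := fun _ => (0 : ℝ)) continuousOn_const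
      hΩ.measurableSet
    refine ⟨{x : E n | 1 < ‖x‖}.piecewise ({x : E n | 1 < ‖x‖}.piecewise u fun _ => 0) w,
      h1.piecewise hΩ.measurableSet wm, fun x hx => by simp [piecewise, hx], ?_⟩
    filter_upwards [hw] with x hx
    by_cases h : 1 < ‖x‖ <;> simp [piecewise, h, hx]
  have hadm : Adm (n + 2 * σ) v {x : E n | 1 < ‖x‖} := by
    refine ⟨vm, hL.2.congr ?_, hΩ, hu.congr hv⟩
    filter_upwards [hva] with x hx
    rw [hx, Real.rpow_neg pos!, div_eq_mul_inv]
  have hc : 0 < cns n σ := by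
    have h1 := hσ.1
    have h2 := Real.Gamma_pos_of_pos (sub_pos.2 hσ.2)
    unfold cns
    positivity
  rw [div_lt_iff₀' hd] at hp₁
  rw [lt_div_iff₀' hd] at hp₂
  have S : Sol σ (n - 2 * σ) (n + 2 * σ) α p (2 / cns n σ) v := by
    refine ⟨P, hadm, fun x hx => (hnonneg x hx).trans_eq (hv x hx).symm, fun x hx => ?_,
      pos!, hα, hp₂, hp₁⟩
    have h2 := tendsto_nhds_unique (((hadm.tendsto_Lop P (x := x) hx).const_mul
        (cns n σ)).congr fun ε => ?_) (heq x hx)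
    · beta_reduce at h2
      rw [hv x hx, ← h2]; field_simp
    · congr 1
      refine setIntegral_congr_ae (measurableSet_lt measurable_const
        (measurable_const.dist measurable_id)) ?_
      filter_upwards [hva] with ξ hξ _
      rw [hv x hx, hξ]
  by_cases h : Integrable (src (n + 2 * σ) v)
  · obtain ⟨C, hC, hb⟩ := S.removable_of_integrable h
    refine Or.inl ⟨C, hC, 16, num!, fun x hx => ?_⟩
    rw [← hv x lin!]
    exact hb x hx.le
  · obtain ⟨C₁, h₁, R, hl⟩ := S.exists_lower h
    obtain ⟨C₂, h₂, hb⟩ := S.upper_bound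
    refine Or.inr ⟨C₁, h₁, C₂, h₂, max R 8, by simp, fun x hx => ?_⟩
    rw [max_lt_iff] at hx
    rw [← hv x lin!]
    exact ⟨hl x hx.1, hb x hx.2.le⟩

end
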